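/- Fix a real number T > 0 and integers n, k ≥ 1. For 1 ≤ i ≤ n let a_i : ℂ^k × [0,T] → ℂ be a finite sum a_i(w,x) = Σ_β c_{i,β}(x) w^β over monomials w^β, where each coefficient c_{i,β} is an admissible function of x, and suppose that for each fixed x the polynomial w ↦ a_i(w,x) is homogeneous. Set A(w) := (a_1(w,·),…,a_n(w,·)), 𝒰_A := {w ∈ ℂ^k : I_{i_1,…,i_m}(A(w)) = 0 for every m ≥ 1 and all indices}, and 𝒞_A := {w ∈ ℂ^k : the equation E(A(w)) determines a center}. Let V ⊆ ℂ^k be the common zero set of a family of polynomials such that V ∩ 𝒰_A = ∅ and such that for every sequence (w_j) in V with ‖w_j‖ → ∞ and w_j/‖w_j‖ → v one has v ∉ 𝒰_A. Then there exist N ≥ 1, finitely many moments m_1,…,m_N (functions of the form w ↦ m^{n_1,…,n_j}_{i_1,…,i_{j+1}}(A(w))) and holomorphic polynomials p_1,…,p_N on ℂ^N such that 𝒞_A ∩ V = {w ∈ V : p_j(m_1(w),…,m_N(w)) = 0 for all 1 ≤ j ≤ N}. -/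

import Mathlib

open MeasureTheory Set Filter Topology

noncomputable section

/-- Iterated integral over the simplex `0 ≤ s₁ ≤ … ≤ s_m ≤ x`; the head of the
list is attached to the outermost (largest) variable. -/
def simplexInt : List (ℝ → ℂ) → ℝ → ℂ
  | [] => fun _ => 1
  | f :: fs => fun x => ∫ s in (0:ℝ)..x, f s * simplexInt fs s

/-- The basic iterated integral `I_{i₁,…,i_m}(a)`. -/
def iterInt (T : ℝ) {n : ℕ} (a : Fin n → ℝ → ℂ) (l : List (Fin n)) : ℂ :=
  simplexInt ((l.map a).reverse) T

/-- `ã(x) = ∫_0^x a(s) ds`. -/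
def primitive (a : ℝ → ℂ) (x : ℝ) : ℂ := ∫ s in (0:ℝ)..x, a s

/-- The moment `m^{n₁,…,n_j}_{i₁,…,i_{j+1}}(a)`, encoded by the list
`ps = [(i₁,n₁),…,(i_j,n_j)]` of index/exponent pairs and the final index `i`. -/
def moment (T : ℝ) {n : ℕ} (a : Fin n → ℝ → ℂ) (ps : List (Fin n × ℕ)) (i : Fin n) : ℂ :=
  ∫ s in (0:ℝ)..T, (ps.map fun q => primitive (a q.1) s ^ q.2).prod * a i s

/-- A function is admissible if on `[0,T]` it is a polynomial in `x`
or a finite linear combination of the exponentials `e^{2πijx/T}`, `j ∈ ℤ`. -/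
def Admissible (T : ℝ) (f : ℝ → ℂ) : Prop :=
  (∃ p : Polynomial ℂ, ∀ x ∈ Icc (0:ℝ) T, f x = p.eval (x : ℂ)) ∨
  (∃ (s : Finset ℤ) (c : ℤ → ℂ), ∀ x ∈ Icc (0:ℝ) T,
    f x = ∑ j ∈ s, c j * Complex.exp (2 * (Real.pi : ℂ) * Complex.I * (j : ℂ) * (x : ℂ) / (T : ℂ)))

/-- The equation `dv/dx = Σ_{i=1}^n a_i(x) v^{i+1}` determines a center. -/
def DeterminesCenter (T : ℝ) {n : ℕ} (a : Fin n → ℝ → ℂ) : Prop :=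
  ∃ ε > (0:ℝ), ∀ v : ℝ → ℂ,
    (∀ x ∈ Icc (0:ℝ) T, v x = v 0 + ∫ s in (0:ℝ)..x, ∑ i, a i s * v s ^ ((i : ℕ) + 2)) →
    ‖v 0‖ < ε → v T = v 0


section FileA1
open MeasureTheory Set Filter Topology
noncomputable section

lemma exists_log_germ {h : ℂ → ℂ} {c : ℂ} (hh : AnalyticAt ℂ h c) (h0 : h c ≠ 0) :
    ∃ G : ℂ → ℂ, AnalyticAt ℂ G c ∧ ∀ᶠ u in 𝓝 c, Complex.exp (G u) = h u := by
  refine ⟨fun u => Complex.log (h u / h c) + Complex.log (h c), ?_, ?_⟩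
  · refine AnalyticAt.add (AnalyticAt.clog (hh.div analyticAt_const h0) ?_) analyticAt_const
    rw [div_self h0]; simp
  · filter_upwards [hh.continuousAt.eventually_ne h0] with u hu
    rw [Complex.exp_add, Complex.exp_log (div_ne_zero hu h0), Complex.exp_log h0]
    field_simp

lemma local_root {s : ℂ → ℂ} {c : ℂ} (hs : AnalyticAt ℂ s c)
    (hnc : ¬ ∀ᶠ x in 𝓝 c, s x = s c) :
    ∃ (m : ℕ) (φ : ℂ → ℂ), 1 ≤ m ∧ AnalyticAt ℂ φ c ∧ φ c = 0 ∧ deriv φ c ≠ 0 ∧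
      ∀ᶠ x in 𝓝 c, s x = s c + φ x ^ m := by
  have h1 : AnalyticAt ℂ (fun x => s x - s c) c := hs.sub analyticAt_const
  have h2 := (h1.exists_eventuallyEq_pow_smul_nonzero_iff).2 (by
    intro h; apply hnc; filter_upwards [h] with x hx; exact sub_eq_zero.1 hx)
  obtain ⟨m, U, hU, hU0, hm⟩ := h2
  obtain ⟨G, hG, hGe⟩ := exists_log_germ hU hU0
  have hm1 : 1 ≤ m := by
    rcases Nat.eq_zero_or_pos m with h | h
    · subst h
      have := hm.self_of_nhds
      simp at this; exact absurd this.symm hU0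
    · exact h
  have hm0 : (m : ℂ) ≠ 0 := by exact_mod_cast (by omega : m ≠ 0)
  have hE : AnalyticAt ℂ (fun x => Complex.exp (G x / m)) c :=
    (hG.div analyticAt_const hm0).cexp
  refine ⟨m, fun x => (x - c) * Complex.exp (G x / m), hm1, ?_, by simp, ?_, ?_⟩
  · exact (analyticAt_id.sub analyticAt_const).mul hE
  · have : HasDerivAt (fun x => (x - c) * Complex.exp (G x / m)) _ c :=
      ((hasDerivAt_id c).sub_const c).mul hE.differentiableAt.hasDerivAt
    rw [this.deriv]; simp [Complex.exp_ne_zero]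
  · filter_upwards [hm, hGe] with x hx hg
    have e : s x = s c + (x - c) ^ m * U x := by
      rw [smul_eq_mul] at hx; rw [← hx]; ring
    rw [e, mul_pow, ← Complex.exp_nat_mul, mul_div_cancel₀ _ hm0, hg]

lemma local_branch {s : ℂ → ℂ} {c : ℂ} {T : ℂ} (hT : T ≠ 0) (hs : AnalyticAt ℂ s c)
    (hnc : ¬ ∀ᶠ x in 𝓝 c, s x = s c) :
    ∃ (m : ℕ) (φ k G : ℂ → ℂ), 1 ≤ m ∧ AnalyticAt ℂ φ c ∧ φ c = 0 ∧ AnalyticAt ℂ k 0 ∧ k 0 = c ∧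
      AnalyticAt ℂ G 0 ∧
      (∀ᶠ x in 𝓝 c, s x = s c + φ x ^ m ∧ k (φ x) = x) ∧
      (∀ᶠ u in 𝓝 0, s (k u) = s c + u ^ m ∧ φ (k u) = u) ∧
      (∀ᶠ u in 𝓝[≠] 0, k u ≠ 0 ∧ k u ≠ T ∧ 
        Complex.exp (G u) * u ^ ((if c = T then (1:ℤ) else 0) - (if c = 0 then (1:ℤ) else 0))
          = (k u - T) / k u) := by
  obtain ⟨m, φ, hm, hφ, hφ0, hφ', he⟩ := local_root hs hnc
  let k := hφ.hasStrictDerivAt.localInverse _ _ _ hφ'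
  have hk : AnalyticAt ℂ k (φ c) := hφ.analyticAt_localInverse hφ'
  have hkc : k (φ c) = c := HasStrictFDerivAt.localInverse_apply_image ..
  have hleft : ∀ᶠ x in 𝓝 c, k (φ x) = x := HasStrictFDerivAt.eventually_left_inverse ..
  have hright : ∀ᶠ u in 𝓝 (φ c), φ (k u) = u := HasStrictDerivAt.eventually_right_inverse ..
  rw [hφ0] at hk hkc hright
  have hkcont : Tendsto k (𝓝 0) (𝓝 c) := by
    have := hk.continuousAt; rwa [ContinuousAt, hkc] at this
  have hk' : deriv k 0 ≠ 0 := by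
    intro h0
    have h1 : HasDerivAt (fun u => φ (k u)) (deriv φ c * deriv k 0) 0 := by
      have hd : HasDerivAt φ (deriv φ c) (k 0) := by
        rw [hkc]; exact hφ.differentiableAt.hasDerivAt
      exact hd.comp 0 hk.differentiableAt.hasDerivAt
    have h2 : HasDerivAt (fun u => φ (k u)) 1 0 :=
      (hasDerivAt_id (0:ℂ)).congr_of_eventuallyEq hright
    have := h1.unique h2
    rw [h0] at this; simp at this
  have hkne : ∀ᶠ u in 𝓝[≠] (0:ℂ), k u ≠ c := by
    have h3 : ∀ᶠ u in 𝓝[≠] (0:ℂ), φ (k u) = u := hright.filter_mono nhdsWithin_le_nhds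
    filter_upwards [h3, self_mem_nhdsWithin] with u hu hu0 h
    rw [h, hφ0] at hu; exact hu0 hu.symm
  -- factorization of k - p
  have hfac : ∀ p : ℂ, ∃ H : ℂ → ℂ, AnalyticAt ℂ H 0 ∧ H 0 ≠ 0 ∧
      (∀ u, k u - p = H u * u ^ (if c = p then 1 else 0 : ℕ)) := by
    intro p
    by_cases hp : c = p
    · refine ⟨dslope k 0, ?_, by rwa [dslope_same], ?_⟩
      · obtain ⟨r, hr, hr'⟩ := Metric.eventually_nhds_iff_ball.1 hk.eventually_analyticAt
        have := (Complex.differentiableOn_dslope (Metric.ball_mem_nhds (0:ℂ) hr)).2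
          (fun u hu => (hr' u hu).differentiableAt.differentiableWithinAt)
        exact this.analyticAt (Metric.ball_mem_nhds (0:ℂ) hr)
      · intro u
        have := sub_smul_dslope k 0 u
        simp only [sub_zero, smul_eq_mul, hkc, hp] at this
        simp [hp, ← this, mul_comm]
    · refine ⟨fun u => k u - p, hk.sub analyticAt_const, by show k 0 - p ≠ 0; rw [hkc]; exact sub_ne_zero.2 hp, ?_⟩
      intro u; simp [hp]
  obtain ⟨H1, hH1, hH10, hH1e⟩ := hfac T
  obtain ⟨H2, hH2, hH20, hH2e⟩ := hfac 0
  obtain ⟨G, hG, hGe⟩ := exists_log_germ (hH1.div hH2 hH20) (div_ne_zero hH10 hH20)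
  refine ⟨m, φ, k, G, hm, hφ, hφ0, hk, hkc, hG, he.and hleft, ?_, ?_⟩
  · filter_upwards [hright, hkcont.eventually he] with u h1 h2
    rw [h2, h1]; exact ⟨rfl, rfl⟩
  · have a1 : ∀ᶠ u in 𝓝[≠] (0:ℂ), H1 u ≠ 0 :=
      (hH1.continuousAt.eventually_ne hH10).filter_mono nhdsWithin_le_nhds
    have a2 : ∀ᶠ u in 𝓝[≠] (0:ℂ), H2 u ≠ 0 :=
      (hH2.continuousAt.eventually_ne hH20).filter_mono nhdsWithin_le_nhds
    have a3 := hGe.filter_mono (nhdsWithin_le_nhds (s := {(0:ℂ)}ᶜ))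
    filter_upwards [a1, a2, a3, self_mem_nhdsWithin] with u h1 h2 h3 h4
    have h4' : u ≠ 0 := h4
    have e1 := hH1e u
    have e2 := hH2e u
    rw [sub_zero] at e2
    have e3 : k u ≠ 0 := by rw [e2]; exact mul_ne_zero h2 (pow_ne_zero _ h4')
    have e4 : k u - T ≠ 0 := by rw [e1]; exact mul_ne_zero h1 (pow_ne_zero _ h4')
    refine ⟨e3, sub_ne_zero.1 e4, ?_⟩
    rw [h3, e1, e2, zpow_sub₀ h4', Pi.div_apply]
    split_ifs <;> simp <;> field_simp

end
end FileA1

section FileA2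
open MeasureTheory Set Filter Topology
noncomputable section

structure LocData (s : ℂ → ℂ) (T : ℝ) (z0 : ℂ) where
  ρ : ℝ
  hρ : T / 2 < ρ
  hsph : ∀ ζ ∈ Metric.sphere ((T:ℂ)/2) ρ, s ζ ≠ z0
  R0 : ℝ
  B : Type
  inst : Fintype B
  x : B → ℂ → ℂ
  W : B → ℂ → ℂ
  c : B → ℂ
  ν : B → ℤ
  L : ℕ
  hL : 0 < L
  hxd : ∀ b, ∀ ξ : ℂ, ξ.re < R0 → DifferentiableAt ℂ (x b) ξ
  hWd : ∀ b, ∀ ξ : ℂ, ξ.re < R0 → DifferentiableAt ℂ (W b) ξ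
  hinj : ∀ ξ : ℂ, ξ.re < R0 → Function.Injective (fun b => x b ξ)
  hball : ∀ b, ∀ ξ : ℂ, ξ.re < R0 → x b ξ ∈ Metric.ball ((T:ℂ)/2) ρ
  hs : ∀ b, ∀ ξ : ℂ, ξ.re < R0 → s (x b ξ) = z0 + Complex.exp ξ
  hall : ∀ ξ : ℂ, ξ.re < R0 → ∀ p ∈ Metric.closedBall ((T:ℂ)/2) ρ, 
    s p = z0 + Complex.exp ξ → ∃ b, p = x b ξ
  hne : ∀ b, ∀ ξ : ℂ, ξ.re < R0 → x b ξ ≠ 0 ∧ x b ξ ≠ T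
  hW : ∀ b, ∀ ξ : ℂ, ξ.re < R0 → Complex.exp (W b ξ) = (x b ξ - T) / x b ξ
  hxL : ∀ b, ∀ ξ : ℂ, x b (ξ + 2 * Real.pi * Complex.I * L) = x b ξ
  hWL : ∀ b, ∀ ξ : ℂ, W b (ξ + 2 * Real.pi * Complex.I * L) 
    = W b ξ + 2 * Real.pi * Complex.I * ν b
  hlim : ∀ b, Tendsto (x b) (comap Complex.re atBot) (𝓝 (c b))
  hsc : ∀ b, s (c b) = z0
  hν0 : ∀ b, c b = 0 → ν b < 0
  hνT : ∀ b, c b = T → 0 < ν b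
  hν : ∀ b, c b ≠ 0 → c b ≠ T → ν b = 0
  hex : ∀ p ∈ Metric.closedBall ((T:ℂ)/2) ρ, s p = z0 → ∃ b, c b = p

lemma root_exp {m : ℕ} (hm : 1 ≤ m) {y ξ : ℂ} (h : y ^ m = Complex.exp ξ) :
    ∃ i : Fin m, y = Complex.exp ((ξ + 2 * Real.pi * Complex.I * (i : ℕ)) / m) := by
  have hm0 : (m : ℂ) ≠ 0 := by exact_mod_cast (by omega : m ≠ 0)
  have hy : y ≠ 0 := by
    rintro rfl
    rw [zero_pow (by omega)] at h
    exact Complex.exp_ne_zero _ h.symm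
  have h1 : Complex.exp (m * Complex.log y) = Complex.exp ξ := by
    rw [Complex.exp_nat_mul, Complex.exp_log hy, h]
  obtain ⟨N, hN⟩ := Complex.exp_eq_exp_iff_exists_int.1 h1
  have hmz : (m : ℤ) ≠ 0 := by exact_mod_cast (by omega : m ≠ 0)
  have h3 : 0 ≤ N % m := Int.emod_nonneg _ hmz
  have h4 : N % m < m := Int.emod_lt_of_pos _ (by omega)
  refine ⟨⟨(N % m).toNat, by omega⟩, ?_⟩
  have h5 : (((N % m).toNat : ℕ) : ℂ) = ((N % m : ℤ) : ℂ) := by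
    have : (((N % m).toNat : ℕ) : ℤ) = N % m := Int.toNat_of_nonneg h3
    exact_mod_cast congrArg (Int.cast : ℤ → ℂ) this
  have h6 : (N : ℂ) = (N % m : ℤ) + m * (N / m : ℤ) := by
    exact_mod_cast (Int.emod_add_mul_ediv N m).symm
  conv_lhs => rw [← Complex.exp_log hy]
  apply Complex.exp_eq_exp_iff_exists_int.2
  refine ⟨N / m, ?_⟩
  simp only [h5]
  field_simp
  rw [mul_comm, hN, h6]; ring

lemma exp_div_inj {m : ℕ} {ξ : ℂ} {i j : Fin m}
    (h : Complex.exp ((ξ + 2 * Real.pi * Complex.I * (i : ℕ)) / m) =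
      Complex.exp ((ξ + 2 * Real.pi * Complex.I * (j : ℕ)) / m)) : i = j := by
  have hm : 0 < m := i.pos
  have hm0 : (m : ℂ) ≠ 0 := by exact_mod_cast (by omega : m ≠ 0)
  obtain ⟨N, hN⟩ := Complex.exp_eq_exp_iff_exists_int.1 h
  have hpi : (2 * Real.pi * Complex.I : ℂ) ≠ 0 := by simp [Real.pi_ne_zero]
  have h1 : ((i : ℕ) : ℂ) = (j : ℕ) + m * N := by
    field_simp at hN
    apply mul_left_cancel₀ hpi
    linear_combination hN
  have h2 : ((i : ℕ) : ℤ) = (j : ℕ) + m * N := by exact_mod_cast h1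
  have hi := i.isLt
  have hj := j.isLt
  have h3 : N = 0 := by
    by_contra hN0
    rcases lt_or_gt_of_ne hN0 with h | h
    · have : (m:ℤ) * N ≤ m * (-1) := mul_le_mul_of_nonneg_left (by omega) (by omega)
      omega
    · have : (m:ℤ) * 1 ≤ m * N := mul_le_mul_of_nonneg_left (by omega) (by omega)
      omega
  subst h3
  ext; simpa using h2

lemma finite_level {s : ℂ → ℂ} (hs : Differentiable ℂ s) (hnc : ∃ x y, s x ≠ s y) (z0 : ℂ)
    (K : Set ℂ) (hK : IsCompact K) : (K ∩ {x | s x = z0}).Finite := by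
  by_contra hinf
  have hinf : (K ∩ {x | s x = z0}).Infinite := hinf
  obtain ⟨c, hc, hacc⟩ := hinf.exists_accPt_of_subset_isCompact hK inter_subset_left
  have ha : AnalyticOnNhd ℂ s univ := fun x _ => hs.analyticAt x
  have hfr : ∃ᶠ x in 𝓝[≠] c, s x = z0 := by
    have := accPt_iff_frequently_nhdsNE.1 hacc
    exact this.mono (fun x hx => hx.2)
  have := ha.eqOn_of_preconnected_of_frequently_eq (analyticOnNhd_const (v := z0)) isPreconnected_univ 
    (mem_univ c) hfr
  obtain ⟨x, y, hxy⟩ := hnc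
  exact hxy ((this (mem_univ x)).trans (this (mem_univ y)).symm)

lemma exists_radius {s : ℂ → ℂ} (hs : Differentiable ℂ s) (hnc : ∃ x y, s x ≠ s y) (z0 : ℂ)
    {T : ℝ} (hT : 0 < T) : ∃ ρ, T / 2 < ρ ∧ ∀ ζ ∈ Metric.sphere ((T:ℂ)/2) ρ, s ζ ≠ z0 := by
  have hfin := finite_level hs hnc z0 _ (isCompact_closedBall ((T:ℂ)/2) T)
  have hfin2 := hfin.image (fun x => dist x ((T:ℂ)/2))
  obtain ⟨ρ, hρ, hρn⟩ := (Set.Ioo_infinite (show T/2 < T by linarith)).exists_notMem_finite hfin2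
  refine ⟨ρ, hρ.1, fun ζ hζ h => hρn ⟨ζ, ⟨?_, h⟩, hζ⟩⟩
  rw [Metric.mem_closedBall]; rw [Metric.mem_sphere] at hζ; rw [hζ]; exact hρ.2.le

end
end FileA2

section FileA3
open MeasureTheory Set Filter Topology
noncomputable section

/-- a good radius at one zero -/
lemma local_branch_ball {s : ℂ → ℂ} {c : ℂ} {T : ℂ} (hT : T ≠ 0) (hs : Differentiable ℂ s)
    (hnc : ∃ x y, s x ≠ s y) {N : Set ℂ} (hN : N ∈ 𝓝 c) :
    ∃ (m : ℕ) (φ k G : ℂ → ℂ) (r : ℝ) (V : Set ℂ), 1 ≤ m ∧ 0 < r ∧ V ∈ 𝓝 c ∧ k 0 = c ∧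
      (∀ x ∈ V, s x = s c + φ x ^ m ∧ k (φ x) = x) ∧
      (∀ u ∈ Metric.ball (0:ℂ) r, DifferentiableAt ℂ k u ∧ DifferentiableAt ℂ G u ∧ k u ∈ N ∧
        s (k u) = s c + u ^ m ∧ φ (k u) = u) ∧
      (∀ u ∈ Metric.ball (0:ℂ) r, u ≠ 0 → k u ≠ 0 ∧ k u ≠ T ∧ 
        Complex.exp (G u) * u ^ ((if c = T then (1:ℤ) else 0) - (if c = 0 then (1:ℤ) else 0))
          = (k u - T) / k u) := by
  have hnc' : ¬ ∀ᶠ x in 𝓝 c, s x = s c := by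
    intro h
    have ha : AnalyticOnNhd ℂ s univ := fun x _ => hs.analyticAt x
    have := ha.eqOn_of_preconnected_of_eventuallyEq (analyticOnNhd_const (v := s c))
      isPreconnected_univ (mem_univ c) h
    obtain ⟨x, y, hxy⟩ := hnc
    exact hxy ((this (mem_univ x)).trans (this (mem_univ y)).symm)
  obtain ⟨m, φ, k, G, hm, hφ, hφ0, hk, hkc, hG, h1, h2, h3⟩ := local_branch hT (hs.analyticAt c) hnc'
  have hkN : ∀ᶠ u in 𝓝 (0:ℂ), k u ∈ N := by
    have := hk.continuousAt; rw [ContinuousAt, hkc] at this; exact this hN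
  have h3' := eventually_nhdsWithin_iff.1 h3
  have hall := (hk.eventually_analyticAt.and (hG.eventually_analyticAt.and (hkN.and (h2.and h3'))))
  obtain ⟨r, hr, hr'⟩ := Metric.eventually_nhds_iff_ball.1 hall
  refine ⟨m, φ, k, G, r, _, hm, hr, h1, hkc, fun x hx => hx, ?_, ?_⟩
  · intro u hu
    obtain ⟨a, b, c, d, e⟩ := hr' u hu
    exact ⟨a.differentiableAt, b.differentiableAt, c, d⟩
  · intro u hu h0
    exact (hr' u hu).2.2.2.2 h0

theorem exists_locData {s : ℂ → ℂ} (hs : Differentiable ℂ s) (hnc : ∃ x y, s x ≠ s y) (z0 : ℂ)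
    {T : ℝ} (hT : 0 < T) : Nonempty (LocData s T z0) := by
  classical
  have hT0 : (T : ℂ) ≠ 0 := by exact_mod_cast hT.ne'
  obtain ⟨ρ, hρ, hsph⟩ := exists_radius hs hnc z0 hT
  have hfin := finite_level hs hnc z0 _ (isCompact_closedBall ((T:ℂ)/2) ρ)
  set Zs := (Metric.closedBall ((T:ℂ)/2) ρ ∩ {x | s x = z0}) with hZs
  let Z : Finset ℂ := hfin.toFinset
  have hZ : ∀ c, c ∈ Z ↔ c ∈ Metric.closedBall ((T:ℂ)/2) ρ ∧ s c = z0 := by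
    intro c; simp [Z, hZs]
  have hZball : ∀ c ∈ Z, c ∈ Metric.ball ((T:ℂ)/2) ρ := by
    intro c hc
    obtain ⟨h1, h2⟩ := (hZ c).1 hc
    rw [Metric.mem_closedBall] at h1
    rw [Metric.mem_ball]
    exact lt_of_le_of_ne h1 (fun h => hsph c h h2)
  -- disjoint neighbourhoods
  obtain ⟨Nn, hNn, hdisj⟩ : ∃ Nn : ℂ → Set ℂ, (∀ c ∈ Z, c ∈ Nn c ∧ IsOpen (Nn c)) ∧ 
      (Z : Set ℂ).PairwiseDisjoint Nn := by
    obtain ⟨U, hU, hd⟩ := Z.finite_toSet.t2_separation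
    exact ⟨U, fun c hc => hU c, hd⟩
  have key : ∀ c : Z, ∃ (m : ℕ) (φ k G : ℂ → ℂ) (r : ℝ) (V : Set ℂ), 1 ≤ m ∧ 0 < r ∧ V ∈ 𝓝 (c:ℂ) ∧ 
      k 0 = c ∧
      (∀ x ∈ V, s x = s c + φ x ^ m ∧ k (φ x) = x) ∧
      (∀ u ∈ Metric.ball (0:ℂ) r, DifferentiableAt ℂ k u ∧ DifferentiableAt ℂ G u ∧ 
        k u ∈ Nn c ∩ Metric.ball ((T:ℂ)/2) ρ ∧ s (k u) = s c + u ^ m ∧ φ (k u) = u) ∧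
      (∀ u ∈ Metric.ball (0:ℂ) r, u ≠ 0 → k u ≠ 0 ∧ k u ≠ T ∧ 
        Complex.exp (G u) * u ^ ((if (c:ℂ) = T then (1:ℤ) else 0) - (if (c:ℂ) = 0 then (1:ℤ) else 0))
          = (k u - T) / k u) := by
    intro c
    apply local_branch_ball hT0 hs hnc
    exact inter_mem ((hNn c c.2).2.mem_nhds (hNn c c.2).1) (Metric.isOpen_ball.mem_nhds (hZball c c.2))
  choose m φ k G r V hm hr hV hk0 hVs hball hexp using key
  have hsc : ∀ c : Z, s c = z0 := fun c => ((hZ c).1 c.2).2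
  -- compactness
  obtain ⟨δ, hδ, hδ'⟩ : ∃ δ > 0, ∀ p ∈ Metric.closedBall ((T:ℂ)/2) ρ, ‖s p - z0‖ < δ → 
      ∃ c : Z, p ∈ V c := by
    let K : Set ℂ := Metric.closedBall ((T:ℂ)/2) ρ \ ⋃ c : Z, interior (V c)
    have hK : IsCompact K := (isCompact_closedBall _ _).diff (isOpen_iUnion fun c => isOpen_interior)
    rcases K.eq_empty_or_nonempty with hKe | hKn
    · refine ⟨1, one_pos, fun p hp _ => ?_⟩
      have : p ∈ ⋃ c : Z, interior (V c) := by
        by_contra h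
        exact (hKe ▸ (show p ∈ K from ⟨hp, h⟩) : p ∈ (∅ : Set ℂ))
      obtain ⟨c, hc⟩ := mem_iUnion.1 this
      exact ⟨c, interior_subset hc⟩
    · obtain ⟨p0, hp0, hmin⟩ := hK.exists_isMinOn hKn 
        ((hs.continuous.sub continuous_const).norm.continuousOn (s := K) (f := fun p => ‖s p - z0‖))
      have hpos : 0 < ‖s p0 - z0‖ := by
        rw [norm_pos_iff, sub_ne_zero]
        intro h
        apply hp0.2
        have : p0 ∈ Z := (hZ p0).2 ⟨hp0.1, h⟩
        exact mem_iUnion.2 ⟨⟨p0, this⟩, mem_interior_iff_mem_nhds.2 (hV ⟨p0, this⟩)⟩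
      refine ⟨_, hpos, fun p hp hlt => ?_⟩
      by_contra hcon
      push Not at hcon
      have : p ∈ K := ⟨hp, fun h => by
        obtain ⟨c, hc⟩ := mem_iUnion.1 h
        exact hcon c (interior_subset hc)⟩
      exact absurd (hmin this) (not_le.2 hlt)
  have hm0 : ∀ c, (m c : ℂ) ≠ 0 := fun c => by exact_mod_cast (by have := hm c; omega : m c ≠ 0)
  let e : (Σ c : Z, Fin (m c)) → ℂ → ℂ := fun b ξ => 
    (ξ + 2 * Real.pi * Complex.I * ((b.2 : ℕ) : ℂ)) / m b.1
  have hee : ∀ b ξ, e b ξ = (ξ + 2 * Real.pi * Complex.I * ((b.2 : ℕ) : ℂ)) / m b.1 := fun b ξ => rfl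
  have hed : ∀ b, Differentiable ℂ (e b) := by
    intro b; exact (differentiable_id.add_const _).div_const _
  have hre : ∀ b ξ, (e b ξ).re = ξ.re / m b.1 := by
    intro b ξ
    rw [hee, Complex.div_natCast_re, Complex.add_re]
    simp
  obtain ⟨R0, hR0, hR0'⟩ : ∃ R0 : ℝ, (∀ ξ : ℂ, ξ.re < R0 → ‖Complex.exp ξ‖ < δ) ∧ 
      ∀ b, ∀ ξ : ℂ, ξ.re < R0 → Complex.exp (e b ξ) ∈ Metric.ball (0:ℂ) (r b.1) := by
    have h1 : ∀ᶠ R in (atBot : Filter ℝ), R ≤ Real.log δ := eventually_le_atBot _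
    have h2 : ∀ᶠ R in (atBot : Filter ℝ), ∀ b : (Σ c : Z, Fin (m c)), R ≤ m b.1 * Real.log (r b.1) :=
      eventually_all.2 (fun b => eventually_le_atBot _)
    obtain ⟨R, hR1, hR2⟩ := (h1.and h2).exists
    refine ⟨R, fun ξ hξ => ?_, fun b ξ hξ => ?_⟩
    · rw [Complex.norm_exp, ← Real.lt_log_iff_exp_lt hδ]; linarith
    · rw [mem_ball_zero_iff, Complex.norm_exp, ← Real.lt_log_iff_exp_lt (hr b.1), hre, 
        div_lt_iff₀ (by exact_mod_cast hm b.1), mul_comm]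
      exact hξ.trans_le (hR2 b)
  let L : ℕ := ∏ c : Z, m c
  have hdvd : ∀ c, m c ∣ L := fun c => Finset.dvd_prod_of_mem _ (Finset.mem_univ c)
  have hLpos : 0 < L := Finset.prod_pos (fun c _ => hm c)
  let τ : Z → ℤ := fun c => (if (c:ℂ) = T then (1:ℤ) else 0) - (if (c:ℂ) = 0 then (1:ℤ) else 0)
  have hLm : ∀ c, 0 < L / m c := fun c => Nat.div_pos (Nat.le_of_dvd hLpos (hdvd c)) (hm c)
  have hshift : ∀ b ξ, e b (ξ + 2 * Real.pi * Complex.I * L) 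
      = e b ξ + 2 * Real.pi * Complex.I * ((L / m b.1 : ℕ) : ℂ) := by
    intro b ξ
    rw [hee, hee, Nat.cast_div (hdvd _) (hm0 _)]
    field_simp
    ring
  have hshiftexp : ∀ b ξ, Complex.exp (e b (ξ + 2 * Real.pi * Complex.I * L)) = Complex.exp (e b ξ) := by
    intro b ξ
    rw [hshift, Complex.exp_eq_exp_iff_exists_int]
    exact ⟨(L / m b.1 : ℕ), by rw [Int.cast_natCast]; ring⟩
  refine ⟨{ ρ := ρ, hρ := hρ, hsph := hsph, R0 := R0, B := Σ c : Z, Fin (m c), inst := inferInstance,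
            x := fun b ξ => k b.1 (Complex.exp (e b ξ)),
            W := fun b ξ => G b.1 (Complex.exp (e b ξ)) + τ b.1 * e b ξ,
            c := fun b => b.1, ν := fun b => τ b.1 * ((L / m b.1 : ℕ) : ℤ), L := L, hL := hLpos,
            hxd := ?_, hWd := ?_, hinj := ?_, hball := ?_, hs := ?_, hall := ?_, hne := ?_, hW := ?_,
            hxL := ?_, hWL := ?_, hlim := ?_, hsc := ?_, hν0 := ?_, hνT := ?_, hν := ?_, hex := ?_ }⟩
  · intro b ξ hξ
    exact (hball b.1 _ (hR0' b ξ hξ)).1.comp ξ ((hed b).cexp ξ)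
  · intro b ξ hξ
    exact ((hball b.1 _ (hR0' b ξ hξ)).2.1.comp ξ ((hed b).cexp ξ)).add ((hed b ξ).const_mul _)
  · intro ξ hξ b b' h
    have h1 := (hball b.1 _ (hR0' b ξ hξ))
    have h2 := (hball b'.1 _ (hR0' b' ξ hξ))
    have h : k b.1 (Complex.exp (e b ξ)) = k b'.1 (Complex.exp (e b' ξ)) := h
    have hc : b.1 = b'.1 := by
      by_contra hne
      have := hdisj b.1.2 b'.1.2 (fun h => hne (Subtype.ext h))
      exact Set.disjoint_left.1 this h1.2.2.1.1 (h ▸ h2.2.2.1.1)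
    obtain ⟨c, i⟩ := b
    obtain ⟨c', i'⟩ := b'
    simp only at hc
    subst hc
    have h3 := h1.2.2.2.2
    have h4 := h2.2.2.2.2
    simp only at h h3 h4
    rw [h, h4] at h3
    have := exp_div_inj h3
    simp only at this
    rw [this]
  · intro b ξ hξ
    exact (hball b.1 _ (hR0' b ξ hξ)).2.2.1.2
  · intro b ξ hξ
    rw [(hball b.1 _ (hR0' b ξ hξ)).2.2.2.1, hsc, ← Complex.exp_nat_mul, hee, mul_div_cancel₀ _ (hm0 _),
      Complex.exp_add]
    have : Complex.exp (2 * Real.pi * Complex.I * ((b.2 : ℕ) : ℂ)) = 1 := by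
      rw [mul_comm]; exact Complex.exp_nat_mul_two_pi_mul_I _
    rw [this, mul_one]
  · intro ξ hξ p hp hsp
    obtain ⟨c, hc⟩ := hδ' p hp (by rw [hsp, add_sub_cancel_left]; exact hR0 ξ hξ)
    obtain ⟨h1, h2⟩ := hVs c p hc
    rw [hsp, hsc] at h1
    obtain ⟨i, hi⟩ := root_exp (hm c) (add_left_cancel h1).symm
    refine ⟨⟨c, i⟩, ?_⟩
    show p = k c (Complex.exp _)
    rw [← hi, h2]
  · intro b ξ hξ
    obtain ⟨h1, h2, h3⟩ := hexp b.1 _ (hR0' b ξ hξ) (Complex.exp_ne_zero _)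
    exact ⟨h1, h2⟩
  · intro b ξ hξ
    obtain ⟨h1, h2, h3⟩ := hexp b.1 _ (hR0' b ξ hξ) (Complex.exp_ne_zero _)
    rw [← h3, Complex.exp_add, ← Complex.exp_int_mul]
  · intro b ξ
    show k b.1 (Complex.exp _) = k b.1 (Complex.exp _)
    rw [hshiftexp]
  · intro b ξ
    show G b.1 (Complex.exp _) + _ = G b.1 (Complex.exp _) + _ + _
    rw [hshiftexp, hshift, Int.cast_mul, Int.cast_natCast]
    ring
  · intro b
    have h0 : Tendsto (fun ξ : ℂ => Complex.exp (e b ξ)) (comap Complex.re atBot) (𝓝 0) := by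
      rw [tendsto_zero_iff_norm_tendsto_zero]
      simp only [Complex.norm_exp, hre]
      apply Real.tendsto_exp_atBot.comp
      have : Tendsto (fun ξ : ℂ => ξ.re) (comap Complex.re atBot) atBot := tendsto_comap
      exact this.atBot_div_const (by exact_mod_cast hm b.1)
    have hkc : ContinuousAt (k b.1) 0 := (hball b.1 0 (Metric.mem_ball_self (hr b.1))).1.continuousAt
    rw [ContinuousAt, hk0] at hkc
    exact hkc.comp h0
  · intro b; exact hsc b.1
  · intro b hb
    have hb : (b.1 : ℂ) = 0 := hb
    have : τ b.1 = -1 := by simp [τ, hb, hT0.symm]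
    show τ b.1 * _ < 0
    rw [this]
    have := hLm b.1
    omega
  · intro b hb
    have hb : (b.1 : ℂ) = T := hb
    have : τ b.1 = 1 := by simp only [τ, hb, hT0]; simp
    show 0 < τ b.1 * _
    rw [this]
    have := hLm b.1
    omega
  · intro b hb hb'
    have : τ b.1 = 0 := by simp only [τ, if_neg hb, if_neg hb']; simp
    show τ b.1 * _ = 0
    rw [this, zero_mul]
  · intro p hp hsp
    exact ⟨⟨⟨p, (hZ p).2 ⟨hp, hsp⟩⟩, ⟨0, hm _⟩⟩, rfl⟩

end
end FileA3

section FileA4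
open MeasureTheory Set Filter Topology
open scoped Interval
noncomputable section

lemma param_diff {Φ : ℂ → ℝ → ℂ} {U : Set ℂ} (hU : IsOpen U) {a b : ℝ}
    (hc : ContinuousOn (fun p : ℂ × ℝ => Φ p.1 p.2) (U ×ˢ uIcc a b))
    (hd : ∀ t ∈ uIcc a b, DifferentiableOn ℂ (fun z => Φ z t) U) :
    DifferentiableOn ℂ (fun z => ∫ t in a..b, Φ z t) U := by
  intro z0 hz0
  obtain ⟨r, hr, hrU⟩ := Metric.isOpen_iff.1 hU z0 hz0
  have hK : IsCompact (Metric.closedBall z0 (r/2) ×ˢ uIcc a b) := 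
    (isCompact_closedBall _ _).prod isCompact_uIcc
  have hsub : Metric.closedBall z0 (r/2) ⊆ U := 
    (Metric.closedBall_subset_ball (by linarith)).trans hrU
  obtain ⟨C, hC⟩ := hK.exists_bound_of_continuousOn (hc.mono (prod_mono hsub le_rfl))
  have hcz : ∀ z ∈ U, ContinuousOn (Φ z) (uIcc a b) := fun z hz => 
    hc.comp (f := fun t : ℝ => (z, t)) (by fun_prop) (fun t ht => ⟨hz, ht⟩)
  have hmeas : ∀ z ∈ U, AEStronglyMeasurable (Φ z) (volume.restrict (Ι a b)) := fun z hz =>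
    ((hcz z hz).mono uIoc_subset_uIcc).aestronglyMeasurable measurableSet_uIoc
  have hder : ∀ t ∈ uIcc a b, ∀ z ∈ U, HasDerivAt (fun z => Φ z t) (deriv (fun z => Φ z t) z) z :=
    fun t ht z hz => ((hd t ht).differentiableAt (hU.mem_nhds hz)).hasDerivAt
  have main := intervalIntegral.hasDerivAt_integral_of_dominated_loc_of_deriv_le (μ := volume)
    (F := Φ) (F' := fun z t => deriv (fun z => Φ z t) z) (x₀ := z0) (s := Metric.ball z0 (r/4))
    (a := a) (b := b) (bound := fun _ => C / (r/4)) (Metric.ball_mem_nhds _ (by linarith))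
    (by filter_upwards [hU.mem_nhds hz0] with z hz using hmeas z hz)
    ((hcz z0 hz0).intervalIntegrable) ?_ ?_ (by simp) ?_
  · exact main.2.differentiableAt.differentiableWithinAt
  · -- measurability by difference quotients
    let w : ℕ → ℂ := fun n => ((r/2) / (n+1) : ℝ)
    have hw0 : ∀ n, w n ≠ 0 := fun n => by
      simp only [w]; exact_mod_cast (by positivity : (r/2)/((n:ℝ)+1) ≠ 0)
    have hwt : Tendsto w atTop (𝓝 0) := by
      have h1 : Tendsto (fun n : ℕ => (r/2) * (1 / ((n:ℝ)+1))) atTop (𝓝 ((r/2) * 0)) :=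
        tendsto_one_div_add_atTop_nhds_zero_nat.const_mul _
      rw [mul_zero] at h1
      have := (Complex.continuous_ofReal.tendsto 0).comp h1
      refine (this.congr ?_)
      intro n; simp only [w, Function.comp]; congr 1; ring
    have hwU : ∀ n, z0 + w n ∈ U := fun n => hsub (by
      rw [Metric.mem_closedBall, dist_eq_norm, add_sub_cancel_left]
      simp only [w, Complex.norm_real, Real.norm_eq_abs]
      rw [abs_of_pos (by positivity)]
      apply div_le_self (by linarith)
      have : (0:ℝ) ≤ n := Nat.cast_nonneg n
      linarith)
    apply aestronglyMeasurable_of_tendsto_ae (u := atTop) 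
      (f := fun (n : ℕ) t => (w n)⁻¹ * (Φ (z0 + w n) t - Φ z0 t))
    · intro n
      exact ((hmeas _ (hwU n)).sub (hmeas _ hz0)).const_mul _
    · filter_upwards [ae_restrict_mem measurableSet_uIoc] with t ht
      have h1 := (hder t (uIoc_subset_uIcc ht) z0 hz0).tendsto_slope_zero
      have h2 : Tendsto w atTop (𝓝[≠] 0) := tendsto_nhdsWithin_iff.2 ⟨hwt, Eventually.of_forall hw0⟩
      have := h1.comp h2
      refine this.congr ?_
      intro n; simp
  · refine Eventually.of_forall fun t ht z hz => ?_
    have ht' := uIoc_subset_uIcc ht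
    apply Complex.norm_deriv_le_of_forall_mem_sphere_norm_le (by linarith)
    · apply DifferentiableOn.diffContOnCl
      rw [closure_ball _ (by linarith)]
      refine (hd t ht').mono (fun p hp => hsub ?_)
      rw [Metric.mem_closedBall] at *; rw [Metric.mem_ball] at hz
      have := dist_triangle p z z0; linarith
    · intro p hp
      apply hC (p, t)
      refine ⟨?_, ht'⟩
      rw [Metric.mem_sphere] at hp; rw [Metric.mem_ball] at hz
      rw [Metric.mem_closedBall]
      have := dist_triangle p z z0; simp only; linarith
  · refine Eventually.of_forall fun t ht z hz => ?_
    apply hder t (uIoc_subset_uIcc ht) z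
    apply hsub
    rw [Metric.mem_ball] at hz; rw [Metric.mem_closedBall]; linarith

/-- finite factorization of an entire function -/
lemma entire_factor {φ : ℂ → ℂ} (hφ : Differentiable ℂ φ) (X : Finset ℂ) (hX : ∀ b ∈ X, φ b = 0) :
    ∃ u : ℂ → ℂ, Differentiable ℂ u ∧ ∀ x, φ x = (∏ b ∈ X, (x - b)) * u x := by
  classical
  induction X using Finset.induction_on with
  | empty => exact ⟨φ, hφ, fun x => by simp⟩
  | insert b X hb ih =>
    obtain ⟨u, hu, hue⟩ := ih (fun c hc => hX c (Finset.mem_insert_of_mem hc))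
    have hub : u b = 0 := by
      have := hX b (Finset.mem_insert_self _ _)
      rw [hue, mul_eq_zero] at this
      rcases this with h | h
      · exfalso
        obtain ⟨c, hc, hc'⟩ := Finset.prod_eq_zero_iff.1 h
        rw [sub_eq_zero.1 hc'] at hb; exact hb hc
      · exact h
    refine ⟨dslope u b, ?_, fun x => ?_⟩
    · have := (Complex.differentiableOn_dslope (s := univ) (c := b) univ_mem).2 hu.differentiableOn
      exact differentiableOn_univ.1 this
    · rw [Finset.prod_insert hb, hue]
      have := sub_smul_dslope u b x
      rw [hub, sub_zero, smul_eq_mul] at this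
      rw [← this]; ring

lemma differentiableAt_dslope_aux {g : ℂ → ℂ} {a : ℂ} {ρ : ℝ} 
    (hg : ∀ p ∈ Metric.closedBall a ρ, DifferentiableAt ℂ g p) {b : ℂ} (hb : b ∈ Metric.ball a ρ) :
    ∀ p ∈ Metric.closedBall a ρ, DifferentiableAt ℂ (dslope g b) p := by
  intro p hp
  by_cases h : p = b
  · subst h
    have hn : Metric.ball a ρ ∈ 𝓝 p := Metric.isOpen_ball.mem_nhds hb
    have := (Complex.differentiableOn_dslope hn).2 (fun q hq => 
      (hg q (Metric.ball_subset_closedBall hq)).differentiableWithinAt)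
    exact this.differentiableAt hn
  · exact (differentiableAt_dslope_of_ne h).2 (hg p hp)

def wInt (T : ℝ) (p : ℂ) : ℂ := ∫ x in (0:ℝ)..T, ((x:ℂ) - p)⁻¹

def Fk (s g : ℂ → ℂ) (T ρ : ℝ) (z : ℂ) (x : ℝ) : ℂ := 
  (2 * Real.pi * Complex.I : ℂ)⁻¹ * 
    ∮ ζ in C((T:ℂ)/2, ρ), (ζ - x)⁻¹ * (g ζ * deriv s ζ / (s ζ - z))

lemma mem_ball_of_Icc {T ρ : ℝ} (hρ : T / 2 < ρ) {x : ℝ} (hx : x ∈ Icc 0 T) : 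
    (x:ℂ) ∈ Metric.ball ((T:ℂ)/2) ρ := by
  rw [Metric.mem_ball, Complex.dist_eq]
  have : (x:ℂ) - (T:ℂ)/2 = ((x - T/2 : ℝ) : ℂ) := by push_cast; ring
  rw [this, Complex.norm_real, Real.norm_eq_abs, abs_lt]
  constructor <;> linarith [hx.1, hx.2]

lemma cauchy_formula {s g : ℂ → ℂ} {T ρ : ℝ} (hT : 0 < T) (hρ : T / 2 < ρ) (hs : Differentiable ℂ s) 
    (hg : ∀ p ∈ Metric.closedBall ((T:ℂ)/2) ρ, DifferentiableAt ℂ g p) {z : ℂ} {X : Finset ℂ}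
    (hXb : ∀ b ∈ X, b ∈ Metric.ball ((T:ℂ)/2) ρ)
    (hX : ∀ p ∈ Metric.closedBall ((T:ℂ)/2) ρ, s p = z ↔ p ∈ X)
    (hX' : ∀ b ∈ X, deriv s b ≠ 0) (hXT : ∀ x ∈ Icc 0 T, (x:ℂ) ∉ X) :
    ∫ x in (0:ℝ)..T, g x * deriv s x / (s x - z) = 
      (∫ x in (0:ℝ)..T, Fk s g T ρ z x) + ∑ b ∈ X, g b * wInt T b := by
  classical
  have hρ0 : 0 < ρ := by linarith
  set a : ℂ := (T:ℂ)/2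
  obtain ⟨u, hu, hue⟩ := entire_factor (φ := fun p => s p - z) (hs.sub_const z) X 
    (fun b hb => sub_eq_zero.2 ((hX b (Metric.ball_subset_closedBall (hXb b hb))).2 hb))
  have hder : ∀ p, deriv s p = (∑ b ∈ X, ∏ c ∈ X.erase b, (p - c)) * u p + (∏ b ∈ X, (p - b)) * deriv u p := by
    intro p
    have h1 : HasDerivAt (fun p => (∏ b ∈ X, (p - b)) * u p) 
        ((∑ b ∈ X, ∏ c ∈ X.erase b, (p - c)) * u p + (∏ b ∈ X, (p - b)) * deriv u p) p := by
      refine HasDerivAt.mul ?_ (hu p).hasDerivAt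
      have := HasDerivAt.fun_finset_prod (u := X) (f := fun b p => p - b) (f' := fun _ => (1:ℂ)) (x := p)
        (fun b _ => (hasDerivAt_id p).sub_const b)
      simpa using this
    have h2 : HasDerivAt (fun p => s p - z) (deriv s p) p := ((hs p).hasDerivAt).sub_const z
    have h3 : (fun p => s p - z) = fun p => (∏ b ∈ X, (p - b)) * u p := funext hue
    rw [h3] at h2
    exact h2.unique h1
  have hu0 : ∀ p ∈ Metric.closedBall a ρ, u p ≠ 0 := by
    intro p hp h
    have h1 : s p = z := by have := hue p; rw [h, mul_zero] at this; exact sub_eq_zero.1 this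
    have h2 := (hX p hp).1 h1
    apply hX' p h2
    rw [hder, h, mul_zero, zero_add, Finset.prod_eq_zero h2 (sub_self p), zero_mul]
  let h : ℂ → ℂ := fun p => (∑ b ∈ X, dslope g b p) + g p * deriv u p / u p
  have hud : Differentiable ℂ (deriv u) := fun p => (hu.analyticAt p).deriv.differentiableAt
  have hh : ∀ p ∈ Metric.closedBall a ρ, DifferentiableAt ℂ h p := by
    intro p hp
    refine DifferentiableAt.add ?_ (((hg p hp).mul (hud p)).div (hu p) (hu0 p hp))
    exact DifferentiableAt.fun_sum (fun b hb => differentiableAt_dslope_aux hg (hXb b hb) p hp)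
  have hdecomp : ∀ p ∈ Metric.closedBall a ρ, p ∉ X → 
      g p * deriv s p / (s p - z) = h p + ∑ b ∈ X, g b * (p - b)⁻¹ := by
    intro p hp hpX
    have hne : ∀ b ∈ X, p - b ≠ 0 := fun b hb => sub_ne_zero.2 (fun h => hpX (h ▸ hb))
    have hprod : ∏ b ∈ X, (p - b) ≠ 0 := Finset.prod_ne_zero_iff.2 hne
    have e1 : deriv s p / (s p - z) = (∑ b ∈ X, (p - b)⁻¹) + deriv u p / u p := by
      have : (s p - z) = (∏ b ∈ X, (p - b)) * u p := hue p
      rw [this, hder, add_div, mul_div_mul_right _ _ (hu0 p hp), mul_div_mul_left _ _ hprod, Finset.sum_div]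
      congr 1
      refine Finset.sum_congr rfl fun b hb => ?_
      rw [← Finset.mul_prod_erase X _ hb]
      have : ∏ c ∈ X.erase b, (p - c) ≠ 0 := 
        Finset.prod_ne_zero_iff.2 (fun c hc => hne c (Finset.mem_of_mem_erase hc))
      field_simp [hne b hb]
    rw [mul_div_assoc, e1]
    simp only [h]
    rw [mul_add, Finset.mul_sum, ← mul_div_assoc, add_right_comm, ← Finset.sum_add_distrib]
    congr 1
    refine Finset.sum_congr rfl fun b hb => ?_
    have hpb : p ≠ b := sub_ne_zero.1 (hne b hb)
    rw [dslope_of_ne _ hpb, slope_def_field]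
    field_simp [hne b hb]
    ring
  have hsphX : ∀ ζ ∈ Metric.sphere a ρ, ζ ∉ X := by
    intro ζ hζ hX
    have := hXb ζ hX
    rw [Metric.mem_ball] at this; rw [Metric.mem_sphere] at hζ; linarith
  have hFk : ∀ x ∈ Icc 0 T, Fk s g T ρ z x = h x := by
    intro x hx
    have hxb := mem_ball_of_Icc hρ hx
    have hC := DifferentiableOn.circleIntegral_sub_inv_smul (f := h) (c := a) (R := ρ) (w := x)
      (fun p hp => (hh p hp).differentiableWithinAt) hxb
    have hpi : (2 * Real.pi * Complex.I : ℂ) ≠ 0 := by simp [Real.pi_ne_zero]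
    have hzero : ∀ b ∈ X, (∮ ζ in C(a, ρ), (ζ - x)⁻¹ * (ζ - b)⁻¹) = 0 := by
      intro b hb
      have hxb' : (x:ℂ) - b ≠ 0 := sub_ne_zero.2 (fun h => hXT x hx (h ▸ hb))
      have e : ∀ ζ ∈ Metric.sphere a ρ, (ζ - x)⁻¹ * (ζ - b)⁻¹ = (x - b)⁻¹ * ((ζ - x)⁻¹ - (ζ - b)⁻¹) := by
        intro ζ hζ
        have h1 : ζ - x ≠ 0 := sub_ne_zero.2 (fun h => by
          rw [h, Metric.mem_sphere] at hζ; rw [Metric.mem_ball] at hxb; linarith)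
        have h2 : ζ - b ≠ 0 := sub_ne_zero.2 (fun h => hsphX ζ hζ (h ▸ hb))
        field_simp
        ring
      have hci : ∀ q ∈ Metric.ball a ρ, CircleIntegrable (fun ζ => (ζ - q)⁻¹) a ρ := by
        intro q hq
        rw [circleIntegrable_sub_inv_iff]
        right
        intro h
        rw [abs_of_pos hρ0, Metric.mem_sphere] at h; rw [Metric.mem_ball] at hq; linarith
      rw [circleIntegral.integral_congr hρ0.le e, circleIntegral.integral_const_mul, 
        circleIntegral.integral_sub (hci _ hxb) (hci _ (hXb b hb)), 
        circleIntegral.integral_sub_inv_of_mem_ball hxb, 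
        circleIntegral.integral_sub_inv_of_mem_ball (hXb b hb), sub_self, mul_zero]
    unfold Fk
    have e2 : (∮ ζ in C(a, ρ), (ζ - x)⁻¹ * (g ζ * deriv s ζ / (s ζ - z))) 
        = ∮ ζ in C(a, ρ), ((ζ - x)⁻¹ • h ζ + ∑ b ∈ X, g b * ((ζ - x)⁻¹ * (ζ - b)⁻¹)) := by
      apply circleIntegral.integral_congr hρ0.le
      intro ζ hζ
      simp only
      rw [hdecomp ζ (Metric.sphere_subset_closedBall hζ) (hsphX ζ hζ), mul_add, smul_eq_mul, Finset.mul_sum]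
      congr 1
      refine Finset.sum_congr rfl fun b _ => ?_
      ring
    have hcx : ContinuousOn (fun ζ : ℂ => (ζ - x)⁻¹) (Metric.sphere a ρ) := by
      apply ContinuousOn.inv₀ (by fun_prop)
      intro ζ hζ
      refine sub_ne_zero.2 (fun h => by
          rw [h, Metric.mem_sphere] at hζ; rw [Metric.mem_ball] at hxb; linarith)
    have hcb : ∀ b ∈ X, ContinuousOn (fun ζ : ℂ => g b * ((ζ - x)⁻¹ * (ζ - b)⁻¹)) (Metric.sphere a ρ) := by
      intro b hb
      apply ContinuousOn.mul continuousOn_const (hcx.mul _)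
      apply ContinuousOn.inv₀ (by fun_prop)
      intro ζ hζ
      exact sub_ne_zero.2 (fun h => hsphX ζ hζ (h ▸ hb))
    rw [e2, circleIntegral.integral_add, hC, circleIntegral.integral_fun_sum, Finset.sum_eq_zero, add_zero,
      smul_eq_mul, ← mul_assoc, inv_mul_cancel₀ hpi, one_mul]
    · intro b hb
      rw [circleIntegral.integral_const_mul, hzero b hb, mul_zero]
    · intro b hb
      exact (hcb b hb).circleIntegrable hρ0.le
    · apply ContinuousOn.circleIntegrable hρ0.le
      exact hcx.smul (fun p hp => (hh p (Metric.sphere_subset_closedBall hp)).continuousAt.continuousWithinAt)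
    · apply ContinuousOn.circleIntegrable hρ0.le
      exact continuousOn_finset_sum _ hcb
  have huI : uIcc (0:ℝ) T = Icc 0 T := uIcc_of_le hT.le
  have e3 : ∫ x in (0:ℝ)..T, g x * deriv s x / (s x - z) 
      = ∫ x in (0:ℝ)..T, (h x + ∑ b ∈ X, g b * ((x:ℂ) - b)⁻¹) := by
    apply intervalIntegral.integral_congr
    intro x hx
    rw [huI] at hx
    exact hdecomp x (Metric.ball_subset_closedBall (mem_ball_of_Icc hρ hx)) (hXT x hx)
  have e4 : ∫ x in (0:ℝ)..T, Fk s g T ρ z x = ∫ x in (0:ℝ)..T, h x := by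
    apply intervalIntegral.integral_congr
    intro x hx
    rw [huI] at hx
    exact hFk x hx
  have hcb : ∀ b ∈ X, IntervalIntegrable (fun x : ℝ => g b * ((x:ℂ) - b)⁻¹) volume 0 T := by
    intro b hb
    apply ContinuousOn.intervalIntegrable
    apply ContinuousOn.mul continuousOn_const
    apply ContinuousOn.inv₀ (by fun_prop)
    intro x hx
    rw [huI] at hx
    exact sub_ne_zero.2 (fun h => hXT x hx (h ▸ hb))
  rw [e3, e4, intervalIntegral.integral_add, intervalIntegral.integral_finset_sum hcb]
  · congr 1
    refine Finset.sum_congr rfl fun b hb => ?_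
    rw [intervalIntegral.integral_const_mul, wInt]
  · apply ContinuousOn.intervalIntegrable
    intro x hx
    rw [huI] at hx
    exact ((hh x (Metric.ball_subset_closedBall (mem_ball_of_Icc hρ hx))).continuousAt.comp
      (f := fun x : ℝ => (x:ℂ)) Complex.continuous_ofReal.continuousAt).continuousWithinAt
  · exact IntervalIntegrable.sum (f := fun b (x:ℝ) => g b * ((x:ℂ) - b)⁻¹) X hcb |>.congr_ae (by 
      refine Eventually.of_forall fun x => ?_
      simp)

end
end FileA4

section FileA5
open MeasureTheory Set Filter Topology
noncomputable section

def Uset (s : ℂ → ℂ) (T ρ : ℝ) : Set ℂ := {z | ∀ ζ ∈ Metric.sphere ((T:ℂ)/2) ρ, s ζ ≠ z}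

lemma isOpen_Uset {s : ℂ → ℂ} {T ρ : ℝ} (hs : Differentiable ℂ s) : IsOpen (Uset s T ρ) := by
  have : Uset s T ρ = (s '' Metric.sphere ((T:ℂ)/2) ρ)ᶜ := by
    ext z; simp [Uset]
  rw [this]
  exact ((isCompact_sphere _ _).image hs.continuous).isClosed.isOpen_compl

lemma Fint_diff {s g : ℂ → ℂ} {T ρ : ℝ} (hT : 0 < T) (hρ : T / 2 < ρ) (hs : Differentiable ℂ s)
    (hg : Differentiable ℂ g) :
    DifferentiableOn ℂ (fun z => ∫ x in (0:ℝ)..T, Fk s g T ρ z x) (Uset s T ρ) := by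
  have hρ0 : 0 < ρ := by linarith
  have hsd : Differentiable ℂ (deriv s) := fun p => (hs.analyticAt p).deriv.differentiableAt
  have hgc := hg.continuous
  have hsdc := hsd.continuous
  have hsc := hs.continuous
  have hcm : ∀ θ, circleMap ((T:ℂ)/2) ρ θ ∈ Metric.sphere ((T:ℂ)/2) ρ := 
    fun θ => circleMap_mem_sphere _ hρ0.le θ
  have hne1 : ∀ z ∈ Uset s T ρ, ∀ θ, s (circleMap ((T:ℂ)/2) ρ θ) - z ≠ 0 := fun z hz θ =>
    sub_ne_zero.2 (hz _ (hcm θ))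
  have hne2 : ∀ x ∈ Icc 0 T, ∀ θ, circleMap ((T:ℂ)/2) ρ θ - (x:ℝ) ≠ 0 := fun x hx θ =>
    sub_ne_zero.2 (fun h => by
      have h1 := hcm θ
      have h2 := mem_ball_of_Icc hρ hx
      rw [h, Metric.mem_sphere] at h1; rw [Metric.mem_ball] at h2; linarith)
  let Ψ : ℂ × ℝ → ℝ → ℂ := fun p θ => deriv (circleMap ((T:ℂ)/2) ρ) θ * 
    ((circleMap ((T:ℂ)/2) ρ θ - p.2)⁻¹ * (g (circleMap ((T:ℂ)/2) ρ θ) * 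
      deriv s (circleMap ((T:ℂ)/2) ρ θ) / (s (circleMap ((T:ℂ)/2) ρ θ) - p.1)))
  have hFk : ∀ z (x:ℝ), Fk s g T ρ z x = (2 * Real.pi * Complex.I : ℂ)⁻¹ * 
      ∫ θ in (0:ℝ)..2 * Real.pi, Ψ (z, x) θ := by
    intro z x
    simp only [Fk, circleIntegral, smul_eq_mul, Ψ]
  have hcmc : Continuous (circleMap ((T:ℂ)/2) ρ) := continuous_circleMap _ _
  have hdc : Continuous (deriv (circleMap ((T:ℂ)/2) ρ)) := by
    have : deriv (circleMap ((T:ℂ)/2) ρ) = fun θ => circleMap 0 ρ θ * Complex.I := by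
      ext θ; simp
    rw [this]; exact (continuous_circleMap _ _).mul continuous_const
  apply param_diff (isOpen_Uset hs)
  · rw [uIcc_of_le hT.le]
    simp only [hFk]
    apply ContinuousOn.mul continuousOn_const
    rw [continuousOn_iff_continuous_restrict]
    apply intervalIntegral.continuous_parametric_intervalIntegral_of_continuous'
      (f := fun (p : ↥(Uset s T ρ ×ˢ Icc 0 T)) θ => Ψ p.1 θ)
    simp only [Function.uncurry_def, Ψ]
    refine Continuous.mul (by fun_prop) (Continuous.mul (Continuous.inv₀ (by fun_prop) ?_) 
      (Continuous.div (by fun_prop) (by fun_prop) ?_))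
    · rintro ⟨⟨p, hp⟩, θ⟩; exact hne2 _ hp.2 θ
    · rintro ⟨⟨p, hp⟩, θ⟩; exact hne1 _ hp.1 θ
  · intro x hx
    rw [uIcc_of_le hT.le] at hx
    simp only [hFk]
    refine DifferentiableOn.const_mul ?_ _
    apply param_diff (isOpen_Uset hs)
    · simp only [Ψ]
      refine ContinuousOn.mul (by fun_prop) (ContinuousOn.mul (ContinuousOn.inv₀ (by fun_prop) ?_) 
        (ContinuousOn.div (by fun_prop) (by fun_prop) ?_))
      · rintro ⟨p, θ⟩ _; exact hne2 _ hx θ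
      · rintro ⟨p, θ⟩ hp; exact hne1 _ hp.1 θ
    · intro θ _ z hz
      simp only [Ψ]
      refine DifferentiableAt.differentiableWithinAt ?_
      refine DifferentiableAt.const_mul (DifferentiableAt.const_mul ?_ _) _
      exact DifferentiableAt.div (by fun_prop) (by fun_prop) (hne1 z hz θ)

lemma exp_wInt {T : ℝ} (hT : 0 < T) {p : ℂ} (hp : ∀ x ∈ Icc 0 T, (x:ℂ) ≠ p) : 
    Complex.exp (wInt T p) = (p - T) / p := by
  have hp0 : p ≠ 0 := fun h => hp 0 ⟨le_rfl, hT.le⟩ (by simp [h])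
  -- derivative of ψ(x) = exp(∫_0^x) / (p - x)
  have hcont : ContinuousOn (fun x : ℝ => ((x:ℂ) - p)⁻¹) (Icc 0 T) := by
    apply ContinuousOn.inv₀ (by fun_prop)
    intro x hx; exact sub_ne_zero.2 (hp x hx)
  have hint : ∀ x ∈ Icc 0 T, HasDerivWithinAt (fun y : ℝ => ∫ t in (0:ℝ)..y, ((t:ℂ) - p)⁻¹) (((x:ℂ) - p)⁻¹) (Icc 0 T) x := by
    intro x hx
    haveI : Fact (x ∈ Icc 0 T) := ⟨hx⟩
    apply intervalIntegral.integral_hasDerivWithinAt_right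
    · apply ContinuousOn.intervalIntegrable
      rw [uIcc_of_le hx.1]; exact hcont.mono (Icc_subset_Icc le_rfl hx.2)
    · exact hcont.stronglyMeasurableAtFilter_nhdsWithin measurableSet_Icc x
    · exact hcont x hx
  have hder : ∀ x ∈ Icc 0 T, HasDerivWithinAt (fun y : ℝ => Complex.exp (∫ t in (0:ℝ)..y, ((t:ℂ) - p)⁻¹) * ((y:ℂ) - p)⁻¹) 0 (Icc 0 T) x := by
    intro x hx
    have h0 := sub_ne_zero.2 (hp x hx)
    have h1 := (hint x hx).cexp
    have h2 : HasDerivWithinAt (fun y : ℝ => ((y:ℂ) - p)⁻¹) (-1 / ((x:ℂ)-p)^2) (Icc 0 T) x := by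
      have : HasDerivAt (fun y : ℝ => ((y:ℂ) - p)) 1 x := 
        (Complex.ofRealCLM.hasDerivAt.sub_const p)
      exact (this.inv h0).hasDerivWithinAt
    have h3 := h1.mul h2
    have e : Complex.exp (∫ t in (0:ℝ)..x, ((t:ℂ) - p)⁻¹) * (↑x - p)⁻¹ * (↑x - p)⁻¹ + 
        Complex.exp (∫ t in (0:ℝ)..x, ((t:ℂ) - p)⁻¹) * (-1 / (↑x - p) ^ 2) = 0 := by
      field_simp
      ring
    rw [e] at h3
    exact h3
  have := constant_of_derivWithin_zero (f := (fun y : ℝ => Complex.exp (∫ t in (0:ℝ)..y, ((t:ℂ) - p)⁻¹) * ((y:ℂ) - p)⁻¹)) 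
    (a := 0) (b := T) (fun x hx => (hder x hx).differentiableWithinAt) (fun x hx => 
      (hder x ⟨hx.1, hx.2.le⟩).derivWithin (uniqueDiffOn_Icc hT x ⟨hx.1, hx.2.le⟩)) T ⟨hT.le, le_rfl⟩
  simp only [intervalIntegral.integral_same, Complex.exp_zero, one_mul, Complex.ofReal_zero, zero_sub] at this
  unfold wInt
  have h0 := sub_ne_zero.2 (hp T ⟨hT.le, le_rfl⟩)
  rw [mul_inv_eq_iff_eq_mul₀ h0] at this
  rw [this]
  field_simp
  ring

end
end FileA5

section FileA6
open MeasureTheory Set Filter Topology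
noncomputable section

lemma countable_zeros {f : ℂ → ℂ} {H : Set ℂ} (hH : IsOpen H) (hHc : IsPreconnected H) 
    (hf : DifferentiableOn ℂ f H) {z1 : ℂ} (hz1 : z1 ∈ H) (h1 : f z1 ≠ 0) : 
    {z ∈ H | f z = 0}.Countable := by
  have ha : AnalyticOnNhd ℂ f H := hf.analyticOnNhd hH
  have : DiscreteTopology {z ∈ H | f z = 0} := by
    rw [discreteTopology_subtype_iff]
    rintro x ⟨hxH, hx⟩
    rcases (ha x hxH).eventually_eq_zero_or_eventually_ne_zero with h | h
    · exact absurd (ha.eqOn_zero_of_preconnected_of_eventuallyEq_zero hHc hxH h hz1) h1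
    · rw [← _root_.disjoint_iff, Filter.disjoint_principal_right]
      filter_upwards [h] with z hz hz'
      exact hz hz'.2
  have : Countable {z ∈ H | f z = 0} := countable_of_Lindelof_of_discrete
  exact this

def pc (h : ℕ → ℂ) : ℕ → ℂ
  | 0 => 1
  | m + 1 => (∑ i : Fin (m+1), pc h i * h (m - i)) / (m + 1)
decreasing_by exact i.2

open PowerSeries in
def psE (h : PowerSeries ℂ) : PowerSeries ℂ := PowerSeries.mk (pc (fun j => coeff j h))

open PowerSeries in
lemma psE_zero_coeff (h : PowerSeries ℂ) : constantCoeff (psE h) = 1 := by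
  rw [← coeff_zero_eq_constantCoeff_apply, psE, coeff_mk, pc]

open PowerSeries in
lemma psE_deriv (h : PowerSeries ℂ) : d⁄dX ℂ (psE h) = psE h * h := by
  ext m
  rw [coeff_derivative, coeff_mul, psE, coeff_mk, pc, Finset.Nat.sum_antidiagonal_eq_sum_range_succ_mk]
  have : (m:ℂ) + 1 ≠ 0 := by exact_mod_cast Nat.succ_ne_zero m
  rw [div_mul_cancel₀ _ this, ← Fin.sum_univ_eq_sum_range (fun i => 
    (coeff i) (mk (pc fun j => coeff j h)) * (coeff (m - i)) h)]
  simp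

open PowerSeries in
lemma psE_unique {h φ : PowerSeries ℂ} (h0 : constantCoeff φ = 1) (h1 : d⁄dX ℂ φ = φ * h) : φ = psE h := by
  ext m
  induction m using Nat.strong_induction_on with
  | _ m ih =>
    cases m with
    | zero => rw [coeff_zero_eq_constantCoeff_apply, coeff_zero_eq_constantCoeff_apply, h0, psE_zero_coeff]
    | succ m =>
      have e1 := congrArg (coeff m) h1
      have e2 := congrArg (coeff m) (psE_deriv h)
      rw [coeff_derivative, coeff_mul] at e1 e2
      have : (m:ℂ) + 1 ≠ 0 := by exact_mod_cast Nat.succ_ne_zero m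
      apply mul_right_cancel₀ this
      rw [e1, e2]
      refine Finset.sum_congr rfl fun p hp => ?_
      rw [ih p.1 (by have := Finset.HasAntidiagonal.mem_antidiagonal.1 hp; omega)]

open PowerSeries in
lemma psE_add (h k : PowerSeries ℂ) : psE (h + k) = psE h * psE k := by
  symm
  apply psE_unique
  · simp [psE_zero_coeff]
  · rw [Derivation.leibniz, psE_deriv, psE_deriv]; simp only [smul_eq_mul]; ring

open PowerSeries in
lemma psE_zero : psE 0 = 1 := by
  symm; apply psE_unique <;> simp

/-- geometric series Σ q^{j+1} η^j -/
def geo (q : ℂ) : PowerSeries ℂ := PowerSeries.mk (fun j => q ^ (j+1))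

open PowerSeries in
lemma geo_mul (q : ℂ) : (1 - C q * X) * geo q = C q := by
  ext m
  rw [sub_mul, one_mul, map_sub, mul_assoc, coeff_C_mul, coeff_C]
  cases m with
  | zero => simp [geo]
  | succ m => rw [coeff_succ_X_mul]; simp [geo]; ring

open PowerSeries in
lemma psE_geo (q : ℂ) : psE (-geo q) = 1 - C q * X := by
  symm
  apply psE_unique
  · simp
  · rw [mul_neg, geo_mul]
    simp [Derivation.leibniz]

open PowerSeries in
lemma psE_geo_nat (q : ℂ) (k : ℕ) : psE (-((k:ℂ) • geo q)) = (1 - C q * X) ^ k := by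
  induction k with
  | zero => simp [psE_zero]
  | succ k ih => 
    rw [pow_succ, ← ih, ← psE_geo, ← psE_add]
    congr 1
    push_cast
    rw [add_smul, one_smul, neg_add]

open PowerSeries in
lemma psE_neg (h : PowerSeries ℂ) : psE h * psE (-h) = 1 := by
  rw [← psE_add, add_neg_cancel, psE_zero]

def Pr (r : ℕ) (φ : PowerSeries ℂ) : Prop := 
  ∃ a b : Polynomial ℂ, a.natDegree ≤ r ∧ b.natDegree ≤ r ∧ b ≠ 0 ∧ (b : PowerSeries ℂ) * φ = a

lemma Pr.mono {r r' : ℕ} (h : r ≤ r') {φ : PowerSeries ℂ} (hp : Pr r φ) : Pr r' φ := by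
  obtain ⟨a, b, h1, h2, h3, h4⟩ := hp
  exact ⟨a, b, h1.trans h, h2.trans h, h3, h4⟩

lemma Pr_one : Pr 0 1 := ⟨1, 1, by simp, by simp, one_ne_zero, by simp⟩

open Polynomial in
lemma lin_ne (q : ℂ) : (1 - C q * X : Polynomial ℂ) ≠ 0 := by
  intro h; have := congrArg (eval 0) h; simp at this

open Polynomial in
lemma Pr_geo (q : ℂ) (k : ℤ) : Pr k.natAbs (psE (-((k:ℂ) • geo q))) := by
  have hd : ((1 - C q * X : Polynomial ℂ) ^ k.natAbs).natDegree ≤ k.natAbs := by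
    refine natDegree_pow_le.trans ?_
    have : (1 - C q * X : Polynomial ℂ).natDegree ≤ 1 := by
      compute_degree
    exact (Nat.mul_le_mul_left _ this).trans (by simp)
  rcases le_or_gt 0 k with h | h
  · refine ⟨(1 - C q * X) ^ k.natAbs, 1, hd, by simp, one_ne_zero, ?_⟩
    have : (k:ℂ) = (k.natAbs : ℂ) := by
      have : k = (k.natAbs : ℤ) := by omega
      have h2 := congrArg (Int.cast : ℤ → ℂ) this
      rwa [Int.cast_natCast] at h2
    rw [this, psE_geo_nat]; simp
  · refine ⟨1, (1 - C q * X) ^ k.natAbs, by simp, hd, pow_ne_zero _ (lin_ne q), ?_⟩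
    have : (k:ℂ) = -(k.natAbs : ℂ) := by
      have : k = -(k.natAbs : ℤ) := by omega
      have h2 := congrArg (Int.cast : ℤ → ℂ) this
      rwa [Int.cast_neg, Int.cast_natCast] at h2
    have h2 : ((((1 - C q * X) ^ k.natAbs : Polynomial ℂ)) : PowerSeries ℂ) = psE (-((k.natAbs:ℂ) • geo q)) := by
      rw [psE_geo_nat]; simp
    rw [this, h2, neg_smul, psE_neg]; simp

lemma Pr.mul {r r' : ℕ} {φ φ' : PowerSeries ℂ} (h : Pr r φ) (h' : Pr r' φ') : Pr (r + r') (φ * φ') := by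
  obtain ⟨a, b, h1, h2, h3, h4⟩ := h
  obtain ⟨a', b', h1', h2', h3', h4'⟩ := h'
  refine ⟨a * a', b * b', Polynomial.natDegree_mul_le.trans (by omega), 
    Polynomial.natDegree_mul_le.trans (by omega), mul_ne_zero h3 h3', ?_⟩
  push_cast
  rw [← h4, ← h4']; ring

lemma Pr_prod {ι : Type*} (S : Finset ι) (q : ι → ℂ) (k : ι → ℤ) : 
    ∃ r, Pr r (psE (-∑ i ∈ S, (k i : ℂ) • geo (q i))) := by
  classical
  induction S using Finset.induction_on with
  | empty => exact ⟨0, by simpa [psE_zero] using Pr_one⟩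
  | insert i S hi ih =>
    obtain ⟨r, hr⟩ := ih
    refine ⟨_, (?_ : Pr ((k i).natAbs + r) _)⟩
    rw [Finset.sum_insert hi, neg_add, psE_add]
    exact (Pr_geo _ _).mul hr

/-- identity theorem propagation -/
lemma Pr_propagate {H : Set ℂ} (hH : IsOpen H) (hHc : IsPreconnected H) (φ : ℂ → PowerSeries ℂ)
    (hφ : ∀ m, DifferentiableOn ℂ (fun ξ => PowerSeries.coeff m (φ ξ)) H) (r : ℕ) 
    (hunc : ¬ {ξ ∈ H | Pr r (φ ξ)}.Countable) : ∀ ξ ∈ H, Pr r (φ ξ) := by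
  intro ξ1 hξ1
  by_contra hno
  let v : ℂ → ℕ → (Fin (r+1) → ℂ) := fun ξ m i => PowerSeries.coeff (m + r + 1 - i) (φ ξ)
  -- key equivalence
  have key : ∀ ξ (b : Fin (r+1) → ℂ), b ≠ 0 → (∀ m, ∑ i, b i * v ξ m i = 0) → Pr r (φ ξ) := by
    intro ξ b hb hz
    let B : Polynomial ℂ := ∑ i : Fin (r+1), Polynomial.monomial i (b i)
    have hBc : ∀ j : ℕ, B.coeff j = if h : j < r + 1 then b ⟨j, h⟩ else 0 := by
      intro j
      simp only [B, Polynomial.finset_sum_coeff, Polynomial.coeff_monomial]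
      split_ifs with h
      · rw [Finset.sum_eq_single ⟨j, h⟩]
        · simp
        · intro i _ hi; rw [if_neg]; intro h'; apply hi; ext; exact h'
        · simp
      · apply Finset.sum_eq_zero; intro i _; rw [if_neg]; have := i.2; omega
    have hBd : B.natDegree ≤ r := by
      rw [Polynomial.natDegree_le_iff_coeff_eq_zero]
      intro N hN; rw [hBc, dif_neg (by omega)]
    have hB0 : B ≠ 0 := by
      intro h; apply hb; ext i
      have := hBc i; rw [h, dif_pos i.2] at this; simpa using this.symm
    have hzero : ∀ m, PowerSeries.coeff (m + r + 1) ((B : PowerSeries ℂ) * φ ξ) = 0 := by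
      intro m
      rw [PowerSeries.coeff_mul, Finset.Nat.sum_antidiagonal_eq_sum_range_succ_mk, 
        ← Finset.sum_subset (s₁ := Finset.range (r+1)) (by intro x; simp; omega), 
        ← hz m, ← Fin.sum_univ_eq_sum_range (fun i => PowerSeries.coeff i (B : PowerSeries ℂ) * PowerSeries.coeff (m + r + 1 - i) (φ ξ))]
      · refine Finset.sum_congr rfl fun i _ => ?_
        rw [Polynomial.coeff_coe, hBc, dif_pos i.2]
      · intro x _ hx
        rw [Polynomial.coeff_coe, hBc, dif_neg (by simpa using hx), zero_mul]
    refine ⟨PowerSeries.trunc (r+1) ((B : PowerSeries ℂ) * φ ξ), B, ?_, hBd, hB0, ?_⟩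
    · have := PowerSeries.natDegree_trunc_lt ((B : PowerSeries ℂ) * φ ξ) r
      omega
    · ext j
      rw [Polynomial.coeff_coe, PowerSeries.coeff_trunc]
      split_ifs with h
      · rfl
      · have := hzero (j - (r+1)); rwa [show j - (r+1) + r + 1 = j by omega] at this
  have key2 : ∀ ξ, Pr r (φ ξ) → ∃ b : Fin (r+1) → ℂ, b ≠ 0 ∧ (∀ m, ∑ i, b i * v ξ m i = 0) := by
    rintro ξ ⟨a, B, ha, hB, hB0, he⟩
    refine ⟨fun i => B.coeff i, ?_, ?_⟩
    · intro h; apply hB0; ext j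
      by_cases hj : j < r + 1
      · exact congrFun h ⟨j, hj⟩
      · rw [Polynomial.coeff_eq_zero_of_natDegree_lt (by omega)]; simp
    · intro m
      have := congrArg (PowerSeries.coeff (m + r + 1)) he
      rw [Polynomial.coeff_coe, Polynomial.coeff_eq_zero_of_natDegree_lt (by omega), PowerSeries.coeff_mul, 
        Finset.Nat.sum_antidiagonal_eq_sum_range_succ_mk, 
        ← Finset.sum_subset (s₁ := Finset.range (r+1)) (by intro x; simp; omega), 
        ← Fin.sum_univ_eq_sum_range (fun i => PowerSeries.coeff i (B : PowerSeries ℂ) * PowerSeries.coeff (m + r + 1 - i) (φ ξ))] at this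
      · simpa [v] using this
      · intro x _ hx
        rw [Polynomial.coeff_coe, Polynomial.coeff_eq_zero_of_natDegree_lt (by simp at hx; omega), zero_mul]
  have hspan : Submodule.span ℂ (range (v ξ1)) = ⊤ := by
    by_contra hne
    obtain ⟨f, hf0, hf⟩ := Submodule.exists_le_ker_of_lt_top _ (lt_top_iff_ne_top.2 hne)
    apply hno
    have hfe : ∀ w : Fin (r+1) → ℂ, f w = ∑ i, f (Pi.single i 1) * w i := by
      intro w
      conv_lhs => rw [← Finset.univ_sum_single w]
      rw [map_sum]
      refine Finset.sum_congr rfl fun i _ => ?_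
      rw [show (Pi.single i (w i) : Fin (r+1) → ℂ) = w i • Pi.single i 1 by
        rw [← Pi.single_smul]; simp, map_smul, smul_eq_mul, mul_comm]
    apply key ξ1 (fun i => f (Pi.single i 1))
    · intro h; apply hf0; ext w
      have := congrFun h w; simpa using this
    · intro m
      rw [← hfe]
      exact hf (Submodule.subset_span ⟨m, rfl⟩)
  have hfr : Module.finrank ℂ (Submodule.span ℂ (range (v ξ1))) = r + 1 := by
    rw [hspan, finrank_top]; simp
  obtain ⟨w, hw1, hw2, hw3⟩ := Submodule.exists_fun_fin_finrank_span_eq ℂ (range (v ξ1))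
  let w' : Fin (r+1) → (Fin (r+1) → ℂ) := fun i => w (Fin.cast hfr.symm i)
  have hw'li : LinearIndependent ℂ w' := hw3.comp _ (Fin.cast_injective _)
  have hw'm : ∀ i, ∃ m, v ξ1 m = w' i := fun i => hw1 _
  choose M hM using hw'm
  let Mat : ℂ → Matrix (Fin (r+1)) (Fin (r+1)) ℂ := fun ξ => Matrix.of (fun i => v ξ (M i))
  have hdet1 : (Mat ξ1).det ≠ 0 := by
    have : LinearIndependent ℂ (Mat ξ1).row := by
      convert hw'li using 1
      funext i; exact hM i
    have := Matrix.linearIndependent_rows_iff_isUnit.1 this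
    exact ((Matrix.isUnit_iff_isUnit_det _).1 this).ne_zero
  apply hunc
  refine (countable_zeros hH hHc (f := fun ξ => (Mat ξ).det) ?_ hξ1 hdet1).mono ?_
  · simp only [Matrix.det_apply]
    refine DifferentiableOn.fun_sum fun σ _ => ?_
    refine DifferentiableOn.const_smul ?_ _
    refine DifferentiableOn.fun_finset_prod fun i _ => hφ _
  · rintro ξ ⟨hξ, hP⟩
    refine ⟨hξ, ?_⟩
    obtain ⟨b, hb, hz⟩ := key2 ξ hP
    apply Matrix.exists_mulVec_eq_zero_iff.1
    refine ⟨b, hb, ?_⟩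
    funext i
    simp only [Matrix.mulVec, dotProduct, Mat, Matrix.of_apply, Pi.zero_apply]
    rw [← hz (M i)]
    exact Finset.sum_congr rfl fun j _ => mul_comm _ _

lemma differentiableOn_psE {H : Set ℂ} (h : ℂ → PowerSeries ℂ) 
    (hh : ∀ m, DifferentiableOn ℂ (fun ξ => PowerSeries.coeff m (h ξ)) H) (m : ℕ) : 
    DifferentiableOn ℂ (fun ξ => PowerSeries.coeff m (psE (h ξ))) H := by
  simp only [psE, PowerSeries.coeff_mk]
  induction m using Nat.strong_induction_on with
  | _ m ih =>
    cases m with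
    | zero => simp only [pc]; fun_prop
    | succ m =>
      simp only [pc]
      refine DifferentiableOn.div_const ?_ _
      refine DifferentiableOn.fun_sum fun i _ => ?_
      exact (ih i i.2).mul (hh _)

end
end FileA6

section FileA7
open MeasureTheory Set Filter Topology
noncomputable section

open Polynomial in
lemma lin_deg (k : ℕ) : ((1 - C 1 * X : Polynomial ℂ) ^ k).natDegree = k := by
  rw [natDegree_pow]
  have : (1 - C 1 * X : Polynomial ℂ).natDegree = 1 := by
    rw [show (1 - C 1 * X : Polynomial ℂ) = -(X - C 1) by simp, natDegree_neg, natDegree_X_sub_C]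
  rw [this, mul_one]

open Polynomial in
lemma order_aux {a b : Polynomial ℂ} {r K : ℕ} (hb : b ≠ 0) (hbr : b.natDegree ≤ 2 * r) 
    (hK : 2 * r < K) (h : a * (1 - C 1 * X) ^ K = b) : False := by
  have ha : a ≠ 0 := by rintro rfl; simp at h; exact hb h.symm
  have := congrArg natDegree h
  rw [natDegree_mul ha (pow_ne_zero _ (lin_ne 1)), lin_deg] at this
  omega

lemma order_arg {h : PowerSeries ℂ} {r : ℕ} {N : ℤ} 
    (hP : ∀ k : ℕ, Pr r (psE h * psE (-(((k * N : ℤ) : ℂ) • geo 1)))) : N = 0 := by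
  by_contra hN
  have hh : psE h ≠ 0 := by
    intro h0; have := psE_zero_coeff h; rw [h0] at this; simp at this
  obtain ⟨a0, b0, ha0, hb0, hb00, he0⟩ := hP 0
  obtain ⟨a1, b1, ha1, hb1, hb10, he1⟩ := hP (2*r+1)
  simp only [Nat.cast_zero, zero_mul, Int.cast_zero, zero_smul, neg_zero, psE_zero, mul_one] at he0
  have hpsne : ∀ g, psE g ≠ 0 := by
    intro g h0; have := psE_zero_coeff g; rw [h0] at this; simp at this
  have ha00 : a0 ≠ 0 := by
    rintro rfl
    simp at he0
    rcases he0 with h | h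
    · exact hb00 h
    · exact hh h
  have ha10 : a1 ≠ 0 := by
    rintro rfl
    simp only [Polynomial.coe_zero] at he1
    exact (mul_ne_zero (by simpa using hb10) (mul_ne_zero hh (hpsne _))) he1
  set K : ℕ := ((((2*r+1 : ℕ) : ℤ)) * N).natAbs with hKdef
  have hK : 2 * r < K := by
    rw [hKdef, Int.natAbs_mul, Int.natAbs_natCast]
    have : 1 ≤ N.natAbs := Int.natAbs_pos.2 hN
    nlinarith
  rcases lt_or_gt_of_ne hN with h1 | h1
  · have e : ((((2*r+1 : ℕ) : ℤ) * N : ℤ) : ℂ) = -(K:ℂ) := by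
      have : (((2*r+1 : ℕ) : ℤ)) * N = -(K:ℤ) := by
        have : (((2*r+1 : ℕ) : ℤ)) * N ≤ 0 := mul_nonpos_of_nonneg_of_nonpos (by positivity) h1.le
        omega
      rw [this]; simp
    rw [e, neg_smul] at he1
    have h2 := psE_neg (-((K:ℂ) • geo 1))
    rw [psE_geo_nat] at h2
    refine order_aux (r := r) (K := K) (a := b0 * a1) (b := b1 * a0) (mul_ne_zero hb10 ha00) 
      (Polynomial.natDegree_mul_le.trans (by omega)) hK ?_
    apply Polynomial.coe_injective
    push_cast
    rw [← he0, ← he1]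
    linear_combination (b0:PowerSeries ℂ) * b1 * psE h * h2
  · have e : ((((2*r+1 : ℕ) : ℤ) * N : ℤ) : ℂ) = (K:ℂ) := by
      have : (((2*r+1 : ℕ) : ℤ)) * N = (K:ℤ) := by
        have : 0 ≤ (((2*r+1 : ℕ) : ℤ)) * N := mul_nonneg (by positivity) h1.le
        omega
      rw [this]; simp
    rw [e, psE_geo_nat] at he1
    refine order_aux (r := r) (K := K) (a := b1 * a0) (b := b0 * a1) (mul_ne_zero hb00 ha10) 
      (Polynomial.natDegree_mul_le.trans (by omega)) hK ?_
    apply Polynomial.coe_injective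
    push_cast
    rw [← he0, ← he1]
    ring

end
end FileA7

section FileA8
open MeasureTheory Set Filter Topology
noncomputable section

structure Cfg (ι : Type) [Fintype ι] where
  s : ι → ℂ → ℂ
  ε : ι → ℤ
  T : ℝ
  hT : 0 < T
  hs : ∀ e, Differentiable ℂ (s e)
  hnc : ∀ e, ∃ x y, s e x ≠ s e y

namespace Cfg
variable {ι : Type} [Fintype ι] (c : Cfg ι)

def D (z0 : ℂ) (e : ι) : LocData (c.s e) c.T z0 := (exists_locData (c.hs e) (c.hnc e) z0 c.hT).some

instance (z0 : ℂ) (e : ι) : Fintype (c.D z0 e).B := (c.D z0 e).inst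

def σ : Set ℂ := ⋃ e, (fun x : ℝ => c.s e x) '' Icc 0 c.T

def tpi : ℂ := 2 * Real.pi * Complex.I

lemma tpi_ne : tpi ≠ 0 := by simp [tpi, Real.pi_ne_zero]

def Λ (g : ι → ℂ → ℂ) (z : ℂ) : ℂ := 
  tpi⁻¹ * ∑ e, (c.ε e : ℂ) * ∫ x in (0:ℝ)..c.T, g e x * deriv (c.s e) x / (c.s e x - z)

def G (z0 : ℂ) (g : ι → ℂ → ℂ) (ξ : ℂ) : ℂ := 
  tpi⁻¹ * ∑ e, (c.ε e : ℂ) * ((∫ x in (0:ℝ)..c.T, Fk (c.s e) (g e) c.T (c.D z0 e).ρ (z0 + Complex.exp ξ) x) + 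
    ∑ b, g e ((c.D z0 e).x b ξ) * (c.D z0 e).W b ξ)

lemma exists_R (z0 : ℂ) : ∃ R : ℝ, (∀ e, R ≤ (c.D z0 e).R0) ∧ 
    ∀ ξ : ℂ, ξ.re < R → ∀ e, z0 + Complex.exp ξ ∈ Uset (c.s e) c.T (c.D z0 e).ρ := by
  have h1 : ∀ᶠ z in 𝓝 z0, ∀ e, z ∈ Uset (c.s e) c.T (c.D z0 e).ρ := by
    rw [eventually_all]
    intro e
    exact (isOpen_Uset (c.hs e)).mem_nhds (c.D z0 e).hsph
  obtain ⟨δ, hδ, hball⟩ := Metric.eventually_nhds_iff.1 h1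
  obtain ⟨R1, hR1⟩ : ∃ R1 : ℝ, ∀ e, R1 ≤ (c.D z0 e).R0 := by
    obtain ⟨M, hM⟩ := (Set.finite_range (fun e => (c.D z0 e).R0)).bddBelow
    exact ⟨M, fun e => hM ⟨e, rfl⟩⟩
  refine ⟨min R1 (Real.log δ), fun e => (min_le_left _ _).trans (hR1 e), fun ξ hξ => hball ?_⟩
  rw [dist_eq_norm, add_sub_cancel_left, Complex.norm_exp, ← Real.lt_log_iff_exp_lt hδ]
  exact hξ.trans_le (min_le_right _ _)

def R (z0 : ℂ) : ℝ := (c.exists_R z0).choose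
lemma hR0 (z0 : ℂ) (e : ι) : c.R z0 ≤ (c.D z0 e).R0 := (c.exists_R z0).choose_spec.1 e
lemma hRU {z0 : ℂ} {ξ : ℂ} (h : ξ.re < c.R z0) (e : ι) : 
    z0 + Complex.exp ξ ∈ Uset (c.s e) c.T (c.D z0 e).ρ := (c.exists_R z0).choose_spec.2 ξ h e

def H (z0 : ℂ) : Set ℂ := {ξ | ξ.re < c.R z0}

lemma isOpen_H (z0 : ℂ) : IsOpen (c.H z0) := isOpen_lt Complex.continuous_re continuous_const
lemma conn_H (z0 : ℂ) : IsPreconnected (c.H z0) := (convex_halfSpace_re_lt _).isPreconnected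

lemma G_diff (z0 : ℂ) {g : ι → ℂ → ℂ} (hg : ∀ e, Differentiable ℂ (g e)) : 
    DifferentiableOn ℂ (c.G z0 g) (c.H z0) := by
  unfold G
  refine DifferentiableOn.const_mul ?_ _
  refine DifferentiableOn.fun_sum fun e _ => ?_
  refine DifferentiableOn.const_mul (DifferentiableOn.add ?_ ?_) _
  · exact (Fint_diff c.hT (c.D z0 e).hρ (c.hs e) (hg e)).comp (f := fun ξ => z0 + Complex.exp ξ) 
      (by fun_prop) (fun ξ hξ => c.hRU hξ e)
  · refine DifferentiableOn.fun_sum fun b _ => ?_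
    intro ξ hξ
    have h0 : ξ.re < (c.D z0 e).R0 := lt_of_lt_of_le hξ (c.hR0 z0 e)
    exact (((hg e _).comp ξ ((c.D z0 e).hxd b ξ h0)).mul ((c.D z0 e).hWd b ξ h0)).differentiableWithinAt

lemma Λ_eq (z0 : ℂ) {ξ : ℂ} (hξ : ξ ∈ c.H z0) (hσ : z0 + Complex.exp ξ ∉ c.σ) : 
    ∃ k : (Σ e, (c.D z0 e).B) → ℤ, ∀ g : ι → ℂ → ℂ, (∀ e, Differentiable ℂ (g e)) → 
      c.Λ g (z0 + Complex.exp ξ) = c.G z0 g ξ + ∑ p, (k p : ℂ) * g p.1 ((c.D z0 p.1).x p.2 ξ) := by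
  classical
  have h0 : ∀ e, ξ.re < (c.D z0 e).R0 := fun e => lt_of_lt_of_le hξ (c.hR0 z0 e)
  have hns : ∀ e (b : (c.D z0 e).B), ∀ x ∈ Icc 0 c.T, (x:ℂ) ≠ (c.D z0 e).x b ξ := by
    intro e b x hx h
    apply hσ
    refine mem_iUnion.2 ⟨e, x, hx, ?_⟩
    simp only
    rw [h, (c.D z0 e).hs b ξ (h0 e)]
  have hk : ∀ p : (Σ e, (c.D z0 e).B), ∃ k : ℤ, wInt c.T ((c.D z0 p.1).x p.2 ξ) = (c.D z0 p.1).W p.2 ξ + k * tpi := by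
    intro p
    have := exp_wInt c.hT (hns p.1 p.2)
    rw [← (c.D z0 p.1).hW p.2 ξ (h0 _)] at this
    exact Complex.exp_eq_exp_iff_exists_int.1 this
  choose k hk using hk
  refine ⟨fun p => c.ε p.1 * k p, fun g hg => ?_⟩
  have hcf : ∀ e, ∫ x in (0:ℝ)..c.T, g e x * deriv (c.s e) x / (c.s e x - (z0 + Complex.exp ξ)) = 
      (∫ x in (0:ℝ)..c.T, Fk (c.s e) (g e) c.T (c.D z0 e).ρ (z0 + Complex.exp ξ) x) + 
      ∑ b, g e ((c.D z0 e).x b ξ) * wInt c.T ((c.D z0 e).x b ξ) := by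
    intro e
    set d := c.D z0 e
    have := cauchy_formula (X := Finset.univ.image (fun b => d.x b ξ)) c.hT d.hρ (c.hs e) 
      (fun p _ => hg e p) (z := z0 + Complex.exp ξ) ?_ ?_ ?_ ?_
    · rw [this, Finset.sum_image]
      exact fun b _ b' _ h => d.hinj ξ (h0 e) h
    · intro p hp
      obtain ⟨b, _, rfl⟩ := Finset.mem_image.1 hp
      exact d.hball b ξ (h0 e)
    · intro p hp
      constructor
      · intro h
        obtain ⟨b, hb⟩ := d.hall ξ (h0 e) p hp h
        exact Finset.mem_image.2 ⟨b, Finset.mem_univ _, hb.symm⟩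
      · intro h
        obtain ⟨b, _, rfl⟩ := Finset.mem_image.1 h
        exact d.hs b ξ (h0 e)
    · intro p hp
      obtain ⟨b, _, rfl⟩ := Finset.mem_image.1 hp
      intro hd0
      have h1 := (c.hs e (d.x b ξ)).hasDerivAt.comp ξ (d.hxd b ξ (h0 e)).hasDerivAt
      rw [hd0, zero_mul] at h1
      have h2 : HasDerivAt (fun ξ => z0 + Complex.exp ξ) (Complex.exp ξ) ξ := (Complex.hasDerivAt_exp ξ).const_add z0
      have h3 : (c.s e ∘ d.x b) =ᶠ[𝓝 ξ] (fun ξ => z0 + Complex.exp ξ) := by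
        filter_upwards [(isOpen_lt Complex.continuous_re continuous_const).mem_nhds (h0 e)] with ξ' h'
        exact d.hs b ξ' h'
      exact Complex.exp_ne_zero ξ ((h2.congr_of_eventuallyEq h3).unique h1)
    · intro x hx hmem
      obtain ⟨b, _, hb⟩ := Finset.mem_image.1 hmem
      exact hns e b x hx hb.symm
  unfold Λ G
  simp only [hcf]
  rw [← Finset.univ_sigma_univ, Finset.sum_sigma, Finset.mul_sum, Finset.mul_sum, ← Finset.sum_add_distrib]
  refine Finset.sum_congr rfl fun e _ => ?_
  have : ∑ b, g e ((c.D z0 e).x b ξ) * wInt c.T ((c.D z0 e).x b ξ) = 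
      (∑ b, g e ((c.D z0 e).x b ξ) * (c.D z0 e).W b ξ) + tpi * ∑ b, (k ⟨e, b⟩ : ℂ) * g e ((c.D z0 e).x b ξ) := by
    rw [Finset.mul_sum, ← Finset.sum_add_distrib]
    refine Finset.sum_congr rfl fun b _ => ?_
    rw [hk ⟨e, b⟩]; ring
  rw [this]
  have e2 : ∑ b, ((c.ε e * k ⟨e, b⟩ : ℤ) : ℂ) * g e ((c.D z0 e).x b ξ) = 
      (c.ε e : ℂ) * ∑ b, (k ⟨e, b⟩ : ℂ) * g e ((c.D z0 e).x b ξ) := by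
    rw [Finset.mul_sum]
    refine Finset.sum_congr rfl fun b _ => ?_
    push_cast; ring
  simp only [e2]
  field_simp [tpi_ne]
  ring

/-- series at z -/
def hz (q : ι → ℂ → ℂ) (z : ℂ) : PowerSeries ℂ := 
  PowerSeries.mk fun j => -c.Λ (fun e x => q e x ^ (j+1)) z

def hG (z0 : ℂ) (q : ι → ℂ → ℂ) (ξ : ℂ) : PowerSeries ℂ := 
  PowerSeries.mk fun j => -c.G z0 (fun e x => q e x ^ (j+1)) ξ

lemma hz_eq (z0 : ℂ) {ξ : ℂ} (hξ : ξ ∈ c.H z0) (hσ : z0 + Complex.exp ξ ∉ c.σ) {q : ι → ℂ → ℂ} 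
    (hq : ∀ e, Differentiable ℂ (q e)) : 
    ∃ k : (Σ e, (c.D z0 e).B) → ℤ, c.hz q (z0 + Complex.exp ξ) = c.hG z0 q ξ + 
      -∑ p, (k p : ℂ) • geo (q p.1 ((c.D z0 p.1).x p.2 ξ)) := by
  obtain ⟨k, hk⟩ := c.Λ_eq z0 hξ hσ
  refine ⟨k, ?_⟩
  ext j
  have := hk (fun e x => q e x ^ (j+1)) (fun e => (hq e).pow _)
  simp only [hz, hG, geo, map_add, map_neg, map_sum, PowerSeries.coeff_mk, PowerSeries.coeff_smul, smul_eq_mul] at this ⊢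
  rw [this]; ring

def FT (q : ι → ℂ → ℂ) (z : ℂ) : Prop := ∃ r, Pr r (psE (c.hz q z))

lemma FT_iff (z0 : ℂ) {ξ : ℂ} (hξ : ξ ∈ c.H z0) (hσ : z0 + Complex.exp ξ ∉ c.σ) {q : ι → ℂ → ℂ} 
    (hq : ∀ e, Differentiable ℂ (q e)) : 
    c.FT q (z0 + Complex.exp ξ) ↔ ∃ r, Pr r (psE (c.hG z0 q ξ)) := by
  obtain ⟨k, hk⟩ := c.hz_eq z0 hξ hσ hq
  constructor
  · rintro ⟨r, hr⟩
    obtain ⟨r', hr'⟩ := Pr_prod Finset.univ (fun p : (Σ e, (c.D z0 e).B) => (q p.1 ((c.D z0 p.1).x p.2 ξ))) (fun p => -k p)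
    refine ⟨r + r', ?_⟩
    have := hr.mul hr'
    rwa [← psE_add, hk, add_assoc, ← neg_add, ← Finset.sum_add_distrib, Finset.sum_eq_zero, neg_zero, add_zero] at this
    intro p _
    push_cast; rw [neg_smul, add_neg_cancel]
  · rintro ⟨r, hr⟩
    obtain ⟨r', hr'⟩ := Pr_prod Finset.univ (fun p : (Σ e, (c.D z0 e).B) => (q p.1 ((c.D z0 p.1).x p.2 ξ))) k
    refine ⟨r + r', ?_⟩
    rw [hk, psE_add]
    exact hr.mul hr'

lemma local_dich (z0 : ℂ) {q : ι → ℂ → ℂ} (hq : ∀ e, Differentiable ℂ (q e)) : 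
    (∃ r, ∀ ξ ∈ c.H z0, Pr r (psE (c.hG z0 q ξ))) ∨ {ξ ∈ c.H z0 | ∃ r, Pr r (psE (c.hG z0 q ξ))}.Countable := by
  by_cases h : ∃ r, ¬ {ξ ∈ c.H z0 | Pr r (psE (c.hG z0 q ξ))}.Countable
  · left
    obtain ⟨r, hr⟩ := h
    refine ⟨r, Pr_propagate (c.isOpen_H z0) (c.conn_H z0) _ ?_ r hr⟩
    apply differentiableOn_psE
    intro m
    simp only [hG, PowerSeries.coeff_mk]
    exact (c.G_diff z0 (fun e => (hq e).pow _)).neg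
  · right
    push Not at h
    refine (countable_iUnion h).mono ?_
    rintro ξ ⟨h1, r, hr⟩
    exact mem_iUnion.2 ⟨r, h1, hr⟩

lemma dense_aux {C : Set ℂ} (hC : C.Countable) : Dense (c.σ ∪ C)ᶜ := by
  apply dense_compl_of_dimH_lt_finrank
  rw [dimH_union, dimH_countable hC, Complex.finrank_real_complex]
  have h2 : ∀ e, dimH ((fun x : ℝ => c.s e x) '' Icc 0 c.T) ≤ 1 := by
    intro e
    have hcd : ContDiff ℝ 1 (fun x : ℝ => c.s e x) := by
      have : ContDiff ℝ 1 (c.s e) := (c.hs e).contDiff.restrict_scalars ℝ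
      exact this.comp Complex.ofRealCLM.contDiff
    refine (dimH_mono (image_subset_range _ _)).trans ?_
    have := hcd.dimH_range_le
    simpa using this
  rw [max_lt_iff]
  refine ⟨?_, by simp⟩
  unfold σ
  rw [dimH_iUnion]
  refine lt_of_le_of_lt (iSup_le h2) (by norm_num)

lemma ball_param {z0 z : ℂ} (h : z ≠ z0) (hz : dist z z0 < Real.exp (c.R z0)) : 
    ∃ ξ ∈ c.H z0, z0 + Complex.exp ξ = z := by
  refine ⟨Complex.log (z - z0), ?_, ?_⟩
  · show (Complex.log (z - z0)).re < c.R z0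
    rw [Complex.log_re, ← dist_eq_norm, Real.log_lt_iff_lt_exp (dist_pos.2 h)]
    exact hz
  · rw [Complex.exp_log (sub_ne_zero.2 h)]; ring

lemma FT_all {q : ι → ℂ → ℂ} (hq : ∀ e, Differentiable ℂ (q e)) (z1 : ℂ) 
    (hz1 : ∀ᶠ z in 𝓝[≠] z1, z ∉ c.σ → c.FT q z) (z0 : ℂ) : 
    ∃ r, ∀ ξ ∈ c.H z0, Pr r (psE (c.hG z0 q ξ)) := by
  let A : Set ℂ := {z0 | ∀ᶠ z in 𝓝[≠] z0, z ∉ c.σ → c.FT q z}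
  have hcount : ∀ z0, ¬ (∃ r, ∀ ξ ∈ c.H z0, Pr r (psE (c.hG z0 q ξ))) → 
      ∀ z2 ∈ Metric.ball z0 (Real.exp (c.R z0)), z2 ∉ A := by
    intro z0 hno z2 hz2 hA
    have hC := ((c.local_dich z0 hq).resolve_left hno).image (fun ξ => z0 + Complex.exp ξ)
    obtain ⟨N, hN, hNo, hNz⟩ := eventually_nhds_iff.1 (eventually_nhdsWithin_iff.1 hA)
    have hd := c.dense_aux (hC.union (Set.countable_insert.2 (Set.countable_singleton z2) : ({z0, z2} : Set ℂ).Countable))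
    obtain ⟨w, hw, hwc⟩ := hd.inter_open_nonempty _ (hNo.inter Metric.isOpen_ball) ⟨z2, hNz, hz2⟩
    simp only [mem_compl_iff, mem_union, mem_insert_iff, mem_singleton_iff, not_or] at hwc
    obtain ⟨hwσ, hwC, hw0, hw2⟩ := hwc
    obtain ⟨ξ, hξ, rfl⟩ := c.ball_param hw0 hw.2
    exact hwC ⟨ξ, ⟨hξ, (c.FT_iff z0 hξ hwσ hq).1 (hN _ hw.1 hw2 hwσ)⟩, rfl⟩
  have hopen : IsOpen A := by
    rw [isOpen_iff_mem_nhds]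
    intro z hz
    have := eventually_nhds_iff.1 (eventually_nhdsWithin_iff.1 hz)
    obtain ⟨N, hN, hNo, hNz⟩ := this
    filter_upwards [hNo.mem_nhds hNz] with w hw
    show ∀ᶠ y in 𝓝[≠] w, _
    by_cases hwz : w = z
    · subst hwz; exact hz
    · filter_upwards [mem_nhdsWithin_of_mem_nhds (hNo.mem_nhds hw), mem_nhdsWithin_of_mem_nhds (isOpen_ne.mem_nhds hwz)] with y hy hyz
      exact hN y hy hyz
  have himp : ∀ z0, (∃ r, ∀ ξ ∈ c.H z0, Pr r (psE (c.hG z0 q ξ))) → z0 ∈ A := by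
    rintro z0 ⟨r, hr⟩
    show ∀ᶠ y in 𝓝[≠] z0, _
    filter_upwards [mem_nhdsWithin_of_mem_nhds (Metric.ball_mem_nhds z0 (Real.exp_pos (c.R z0))), self_mem_nhdsWithin] with y hy hyz hyσ
    obtain ⟨ξ, hξ, rfl⟩ := c.ball_param hyz hy
    exact (c.FT_iff z0 hξ hyσ hq).2 ⟨r, hr ξ hξ⟩
  have hclosed : IsOpen Aᶜ := by
    rw [isOpen_iff_mem_nhds]
    intro z hz
    have hno : ¬ (∃ r, ∀ ξ ∈ c.H z, Pr r (psE (c.hG z q ξ))) := fun h => hz (himp z h)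
    filter_upwards [Metric.ball_mem_nhds z (Real.exp_pos (c.R z))] with w hw
    exact hcount z hno w hw
  have huniv : A = univ := IsClopen.eq_univ ⟨⟨hclosed⟩, hopen⟩ ⟨z1, hz1⟩
  by_contra hno
  exact hcount z0 hno z0 (Metric.mem_ball_self (Real.exp_pos _)) (huniv ▸ mem_univ _)

end Cfg
end
end FileA8

section FileA9
open MeasureTheory Set Filter Topology
noncomputable section

lemma indicator_poly {n : ℕ} (S : Finset (Fin n → ℂ)) (p0 : Fin n → ℂ) : 
    ∃ P : MvPolynomial (Fin n) ℂ, MvPolynomial.eval p0 P = 1 ∧ ∀ p ∈ S, p ≠ p0 → MvPolynomial.eval p P = 0 := by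
  classical
  have h : ∀ p : Fin n → ℂ, ∃ Q : MvPolynomial (Fin n) ℂ, MvPolynomial.eval p0 Q = 1 ∧ 
      (p ≠ p0 → MvPolynomial.eval p Q = 0) := by
    intro p
    by_cases hp : p = p0
    · exact ⟨1, by simp, fun h => absurd hp h⟩
    · obtain ⟨i, hi⟩ := Function.ne_iff.1 hp
      refine ⟨MvPolynomial.C ((p0 i - p i)⁻¹) * (MvPolynomial.X i - MvPolynomial.C (p i)), ?_, ?_⟩
      · simp [inv_mul_cancel₀ (sub_ne_zero.2 (Ne.symm hi))]
      · simp
  choose Q hQ1 hQ2 using h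
  refine ⟨∏ p ∈ S, Q p, ?_, ?_⟩
  · rw [map_prod]; exact Finset.prod_eq_one fun p _ => hQ1 p
  · intro p hp hne
    rw [map_prod]; exact Finset.prod_eq_zero hp (hQ2 p hne)

namespace Cfg
variable {ι : Type} [Fintype ι] (c : Cfg ι)

lemma Λ_zero {g : ι → ℂ → ℂ} (hg : ∀ e, Continuous (g e)) 
    (hmom : ∀ k : ℕ, ∑ e, (c.ε e : ℂ) * ∫ x in (0:ℝ)..c.T, g e x * c.s e x ^ k * deriv (c.s e) x = 0)
    {M : ℝ} (hM : ∀ e, ∀ x ∈ Icc 0 c.T, ‖c.s e (x:ℝ)‖ ≤ M) {z : ℂ} (hz : M < ‖z‖) : c.Λ g z = 0 := by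
  rcases isEmpty_or_nonempty ι with hι | ⟨⟨e0⟩⟩
  · simp [Λ]
  have hM0 : 0 ≤ M := (norm_nonneg _).trans (hM e0 0 ⟨le_rfl, c.hT.le⟩)
  have hz0 : z ≠ 0 := by rintro rfl; simp at hz; linarith
  have hne : ∀ e, ∀ x ∈ Icc 0 c.T, c.s e (x:ℝ) - z ≠ 0 := by
    intro e x hx h
    have := hM e x hx
    rw [sub_eq_zero.1 h] at this; linarith
  have hsc : ∀ e, Continuous (c.s e) := fun e => (c.hs e).continuous
  have hdc : ∀ e, Continuous (deriv (c.s e)) := fun e => by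
    have : Differentiable ℂ (deriv (c.s e)) := fun p => ((c.hs e).analyticAt p).deriv.differentiableAt
    exact this.continuous
  have hcont : ∀ e (K : ℕ), ContinuousOn (fun x : ℝ => g e x * deriv (c.s e) x * (c.s e x / z)^K / (c.s e x - z)) (uIcc 0 c.T) := by
    intro e K
    rw [uIcc_of_le c.hT.le]
    have := hg e
    have := hsc e
    have := hdc e
    exact ContinuousOn.div (by fun_prop) (by fun_prop) (hne e)
  have hrec : ∀ K : ℕ, ∑ e, (c.ε e : ℂ) * ∫ x in (0:ℝ)..c.T, g e x * deriv (c.s e) x / (c.s e x - z) = 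
      ∑ e, (c.ε e : ℂ) * ∫ x in (0:ℝ)..c.T, g e x * deriv (c.s e) x * (c.s e x / z)^K / (c.s e x - z) := by
    intro K
    induction K with
    | zero => simp
    | succ K ih =>
      rw [ih, ← sub_eq_zero, ← Finset.sum_sub_distrib]
      have h1 : ∀ e, (c.ε e : ℂ) * (∫ x in (0:ℝ)..c.T, g e x * deriv (c.s e) x * (c.s e x / z)^K / (c.s e x - z)) - 
          (c.ε e : ℂ) * (∫ x in (0:ℝ)..c.T, g e x * deriv (c.s e) x * (c.s e x / z)^(K+1) / (c.s e x - z)) = 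
          -(z⁻¹)^(K+1) * ((c.ε e : ℂ) * ∫ x in (0:ℝ)..c.T, g e x * c.s e x ^ K * deriv (c.s e) x) := by
        intro e
        rw [← mul_sub, ← intervalIntegral.integral_sub (hcont e K).intervalIntegrable (hcont e (K+1)).intervalIntegrable, 
          mul_left_comm (-(z⁻¹)^(K+1)), ← intervalIntegral.integral_const_mul (-(z⁻¹)^(K+1))]
        congr 1
        apply intervalIntegral.integral_congr
        intro x hx
        rw [uIcc_of_le c.hT.le] at hx
        have := hne e x hx
        simp only
        rw [div_pow, div_pow, pow_succ, pow_succ, pow_succ, inv_pow]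
        field_simp
        ring
      simp only [h1]
      rw [← Finset.mul_sum, hmom K, mul_zero]
  have hlim : Tendsto (fun K : ℕ => ∑ e, (c.ε e : ℂ) * ∫ x in (0:ℝ)..c.T, g e x * deriv (c.s e) x * (c.s e x / z)^K / (c.s e x - z)) atTop (𝓝 (∑ e : ι, (c.ε e : ℂ) * 0)) := by
    refine tendsto_finset_sum _ fun e _ => Tendsto.const_mul _ ?_
    obtain ⟨C, hC⟩ := (isCompact_uIcc (a := (0:ℝ)) (b := c.T)).exists_bound_of_continuousOn (hcont e 0)
    have hθ : M / ‖z‖ < 1 := (div_lt_one (norm_pos_iff.2 hz0)).2 hz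
    apply squeeze_zero_norm (a := fun K : ℕ => (C * (M / ‖z‖)^K) * |c.T - 0|)
    · intro K
      apply intervalIntegral.norm_integral_le_of_norm_le_const
      intro x hx
      have hx' := uIoc_subset_uIcc hx
      have h1 := hC x hx'
      rw [uIcc_of_le c.hT.le] at hx'
      rw [show g e x * deriv (c.s e) x * (c.s e x / z)^K / (c.s e x - z) = 
        (g e x * deriv (c.s e) x * (c.s e x / z)^0 / (c.s e x - z)) * (c.s e x / z)^K by ring, norm_mul]
      refine mul_le_mul h1 ?_ (norm_nonneg _) ((norm_nonneg _).trans h1)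
      rw [norm_pow, norm_div]
      exact pow_le_pow_left₀ (by positivity) (div_le_div_of_nonneg_right (hM e x hx') (norm_nonneg _)) K
    · have := ((tendsto_pow_atTop_nhds_zero_of_lt_one (div_nonneg hM0 (norm_nonneg z)) hθ).const_mul C).mul_const |c.T - 0|
      simpa using this
  have := tendsto_nhds_unique (tendsto_const_nhds.congr hrec) hlim
  unfold Λ
  rw [this]; simp

lemma FT_large {q : ι → ℂ → ℂ} (hq : ∀ e, Differentiable ℂ (q e)) 
    (hmom : ∀ j k : ℕ, ∑ e, (c.ε e : ℂ) * ∫ x in (0:ℝ)..c.T, q e x ^ (j+1) * c.s e x ^ k * deriv (c.s e) x = 0) :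
    ∃ z1, ∀ᶠ z in 𝓝[≠] z1, z ∉ c.σ → c.FT q z := by
  have hb : ∀ e, ∃ M, ∀ x ∈ Icc 0 c.T, ‖c.s e (x:ℝ)‖ ≤ M := by
    intro e
    apply (isCompact_Icc (a := (0:ℝ)) (b := c.T)).exists_bound_of_continuousOn
    have := (c.hs e).continuous
    fun_prop
  choose M hM using hb
  obtain ⟨M0, hM0⟩ := (Set.finite_range M).bddAbove
  have hM' : ∀ e, ∀ x ∈ Icc 0 c.T, ‖c.s e (x:ℝ)‖ ≤ M0 := fun e x hx => (hM e x hx).trans (hM0 ⟨e, rfl⟩)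
  refine ⟨((|M0| + 1 : ℝ) : ℂ), ?_⟩
  apply mem_nhdsWithin_of_mem_nhds
  have : {z : ℂ | M0 < ‖z‖} ∈ 𝓝 (((|M0| + 1 : ℝ) : ℂ)) := by
    apply (isOpen_lt continuous_const continuous_norm).mem_nhds
    show M0 < _
    rw [Complex.norm_real, Real.norm_eq_abs, abs_of_pos (by positivity)]
    linarith [le_abs_self M0]
  filter_upwards [this] with z hz _
  refine ⟨0, ?_⟩
  have : c.hz q z = 0 := by
    ext j
    simp only [Cfg.hz, PowerSeries.coeff_mk, map_zero]
    rw [c.Λ_zero (g := fun e x => q e x ^ (j+1)) (fun e => ((hq e).pow _).continuous) (hmom j) hM' hz, neg_zero]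
  rw [this, psE_zero]; exact Pr_one

def LL (z0 : ℂ) : ℕ := ∏ e, (c.D z0 e).L

lemma exists_mm (z0 : ℂ) (e : ι) : ∃ m : ℕ, 0 < m ∧ c.LL z0 = m * (c.D z0 e).L := by
  have hpos : 0 < c.LL z0 := Finset.prod_pos fun e _ => (c.D z0 e).hL
  obtain ⟨m, hm⟩ := Finset.dvd_prod_of_mem (fun e => (c.D z0 e).L) (Finset.mem_univ e)
  refine ⟨m, ?_, by rw [mul_comm]; exact hm⟩
  rcases Nat.eq_zero_or_pos m with h | h
  · rw [LL, hm, h] at hpos; simp at hpos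
  · exact h

def mm (z0 : ℂ) (e : ι) : ℕ := (c.exists_mm z0 e).choose

lemma shift_x (z0 : ℂ) (e : ι) (b : (c.D z0 e).B) (ξ : ℂ) (k : ℕ) : 
    (c.D z0 e).x b (ξ + 2 * Real.pi * Complex.I * (c.D z0 e).L * k) = (c.D z0 e).x b ξ := by
  induction k with
  | zero => simp
  | succ k ih => 
    rw [show ξ + 2 * Real.pi * Complex.I * (c.D z0 e).L * ((k+1:ℕ):ℂ) = 
      ξ + 2 * Real.pi * Complex.I * (c.D z0 e).L * k + 2 * Real.pi * Complex.I * (c.D z0 e).L by push_cast; ring, 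
      (c.D z0 e).hxL, ih]

lemma shift_W (z0 : ℂ) (e : ι) (b : (c.D z0 e).B) (ξ : ℂ) (k : ℕ) : 
    (c.D z0 e).W b (ξ + 2 * Real.pi * Complex.I * (c.D z0 e).L * k) = (c.D z0 e).W b ξ + tpi * (k * (c.D z0 e).ν b) := by
  induction k with
  | zero => simp
  | succ k ih => 
    have := (c.D z0 e).hWL b (ξ + 2 * Real.pi * Complex.I * (c.D z0 e).L * k)
    rw [ih] at this
    rw [show ξ + 2 * Real.pi * Complex.I * (c.D z0 e).L * ((k+1:ℕ):ℂ) = 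
      ξ + 2 * Real.pi * Complex.I * (c.D z0 e).L * k + 2 * Real.pi * Complex.I * (c.D z0 e).L by push_cast; ring, this, tpi]
    push_cast; ring

lemma shift_G (z0 : ℂ) (g : ι → ℂ → ℂ) (ξ : ℂ) (k : ℕ) : 
    c.G z0 g (ξ + 2 * Real.pi * Complex.I * c.LL z0 * k) = c.G z0 g ξ + 
      ∑ p : (Σ e, (c.D z0 e).B), ((k * (c.ε p.1 * (c.mm z0 p.1 * (c.D z0 p.1).ν p.2)) : ℤ) : ℂ) * g p.1 ((c.D z0 p.1).x p.2 ξ) := by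
  unfold G
  have hexp : Complex.exp (ξ + 2 * Real.pi * Complex.I * c.LL z0 * k) = Complex.exp ξ := by
    apply Complex.exp_eq_exp_iff_exists_int.2
    refine ⟨c.LL z0 * k, ?_⟩
    push_cast; ring
  rw [hexp, ← Finset.univ_sigma_univ, Finset.sum_sigma, Finset.mul_sum, Finset.mul_sum, ← Finset.sum_add_distrib]
  refine Finset.sum_congr rfl fun e _ => ?_
  have hm : (c.LL z0 : ℂ) = c.mm z0 e * (c.D z0 e).L := by exact_mod_cast (c.exists_mm z0 e).choose_spec.2
  have harg : ξ + 2 * Real.pi * Complex.I * c.LL z0 * k = ξ + 2 * Real.pi * Complex.I * (c.D z0 e).L * ((c.mm z0 e * k : ℕ) : ℂ) := by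
    rw [hm]; push_cast; ring
  simp only [harg, c.shift_x, c.shift_W]
  have : ∑ b, g e ((c.D z0 e).x b ξ) * ((c.D z0 e).W b ξ + tpi * (((c.mm z0 e * k : ℕ):ℂ) * (c.D z0 e).ν b)) = 
    (∑ b, g e ((c.D z0 e).x b ξ) * (c.D z0 e).W b ξ) + tpi * ∑ b, (k * (c.mm z0 e * (c.D z0 e).ν b) : ℂ) * g e ((c.D z0 e).x b ξ) := by
    rw [Finset.mul_sum, ← Finset.sum_add_distrib]
    refine Finset.sum_congr rfl fun b _ => ?_
    push_cast; ring
  rw [this]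
  have e2 : ∑ b, ((k * (c.ε e * (c.mm z0 e * (c.D z0 e).ν b)) : ℤ) : ℂ) * g e ((c.D z0 e).x b ξ) = 
      (c.ε e : ℂ) * ∑ b, (k * (c.mm z0 e * (c.D z0 e).ν b) : ℂ) * g e ((c.D z0 e).x b ξ) := by
    rw [Finset.mul_sum]
    refine Finset.sum_congr rfl fun b _ => ?_
    push_cast; ring
  rw [e2]
  field_simp [tpi_ne]
  ring

theorem endpoint {n : ℕ} (f : ι → Fin n → ℂ → ℂ) (hf : ∀ e i, Differentiable ℂ (f e i)) 
    (S : MvPolynomial (Fin n) ℂ) (hS : ∀ e x, c.s e x = MvPolynomial.eval (fun i => f e i x) S)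
    (hmom : ∀ P : MvPolynomial (Fin n) ℂ, ∑ e, (c.ε e : ℂ) * 
      ∫ x in (0:ℝ)..c.T, MvPolynomial.eval (fun i => f e i x) P * deriv (c.s e) x = 0)
    (z0 : ℂ) (p0 : Σ e, (c.D z0 e).B) (hp0 : c.ε p0.1 * (c.D z0 p0.1).ν p0.2 ≠ 0) : 
    ∃ p1 : (Σ e, (c.D z0 e).B), (c.ε p0.1 * (c.D z0 p0.1).ν p0.2) * (c.ε p1.1 * (c.D z0 p1.1).ν p1.2) < 0 ∧
      ∀ ξ ∈ c.H z0, ∀ i, f p0.1 i ((c.D z0 p0.1).x p0.2 ξ) = f p1.1 i ((c.D z0 p1.1).x p1.2 ξ) := by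
  classical
  have hpd : ∀ (P : MvPolynomial (Fin n) ℂ) e, Differentiable ℂ (fun x => MvPolynomial.eval (fun i => f e i x) P) := by
    intro P e
    induction P using MvPolynomial.induction_on with
    | C a => simp
    | add p q hp hq => simp only [map_add]; exact hp.add hq
    | mul_X p i hp => simp only [map_mul, MvPolynomial.eval_X]; exact hp.mul (hf e i)
  let pt : (Σ e, (c.D z0 e).B) → ℂ → (Fin n → ℂ) := fun p ξ i => f p.1 i ((c.D z0 p.1).x p.2 ξ)
  have hpt : ∀ ξ ∈ c.H z0, ∃ p1 : (Σ e, (c.D z0 e).B), (c.ε p0.1 * (c.D z0 p0.1).ν p0.2) * (c.ε p1.1 * (c.D z0 p1.1).ν p1.2) < 0 ∧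
      pt p0 ξ = pt p1 ξ := by
    intro ξ hξ
    obtain ⟨P, hP1, hP2⟩ := indicator_poly (Finset.univ.image (fun p => pt p ξ)) (pt p0 ξ)
    let q : ι → ℂ → ℂ := fun e x => MvPolynomial.eval (fun i => f e i x) P
    obtain ⟨z1, hz1⟩ := c.FT_large (q := q) (hpd P) (by
      intro j k
      have := hmom (P^(j+1) * S^k)
      simpa [q, hS] using this)
    obtain ⟨r, hr⟩ := c.FT_all (q := q) (hpd P) z1 hz1 z0
    let w : (Σ e, (c.D z0 e).B) → ℤ := fun p => c.ε p.1 * (c.mm z0 p.1 * (c.D z0 p.1).ν p.2)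
    let N : ℤ := ∑ p ∈ Finset.univ.filter (fun p => pt p ξ = pt p0 ξ), w p
    have hq : ∀ p : (Σ e, (c.D z0 e).B), q p.1 ((c.D z0 p.1).x p.2 ξ) = if pt p ξ = pt p0 ξ then 1 else 0 := by
      intro p
      show MvPolynomial.eval (pt p ξ) P = _
      split_ifs with h
      · rw [h, hP1]
      · exact hP2 _ (Finset.mem_image.2 ⟨p, Finset.mem_univ _, rfl⟩) h
    have hN : N = 0 := by
      apply order_arg (h := c.hG z0 q ξ) (r := r)
      intro k
      have h1 := hr (ξ + 2 * Real.pi * Complex.I * c.LL z0 * k) (by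
        show (_ : ℂ).re < _
        have : ξ.re < c.R z0 := hξ
        simpa using this)
      convert h1 using 1
      rw [← psE_add]
      congr 1
      ext j
      simp only [hG, map_add, PowerSeries.coeff_mk, map_neg, c.shift_G, PowerSeries.coeff_smul, geo, smul_eq_mul, hq]
      rw [neg_add]
      congr 2
      simp only [N]
      rw [Finset.mul_sum, Int.cast_sum, Finset.sum_mul, Finset.sum_filter]
      refine Finset.sum_congr rfl fun p _ => ?_
      split_ifs with h
      · simp [w]
      · simp
    by_contra hno
    push Not at hno
    have hpos : ∀ p : (Σ e, (c.D z0 e).B), (0:ℤ) < c.mm z0 p.1 := fun p => by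
      exact_mod_cast (c.exists_mm z0 p.1).choose_spec.1
    have hlt : 0 < (c.ε p0.1 * (c.D z0 p0.1).ν p0.2) * N := by
      simp only [N]
      rw [Finset.mul_sum]
      apply Finset.sum_pos'
      · intro p hp
        have h1 := (Finset.mem_filter.1 hp).2
        have h2 : ¬ ((c.ε p0.1 * (c.D z0 p0.1).ν p0.2) * (c.ε p.1 * (c.D z0 p.1).ν p.2) < 0) := fun h => hno p h h1.symm
        have := mul_nonneg (hpos p).le (not_lt.1 h2)
        simp only [w]; linarith
      · refine ⟨p0, by simp, ?_⟩
        have := mul_pos (hpos p0) (mul_self_pos.2 hp0)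
        simp only [w]; linarith
    rw [hN] at hlt; simp at hlt
  by_contra hno
  push Not at hno
  let Q : Set (Σ e, (c.D z0 e).B) := {p1 | (c.ε p0.1 * (c.D z0 p0.1).ν p0.2) * (c.ε p1.1 * (c.D z0 p1.1).ν p1.2) < 0}
  have hcov : (⋃ p ∈ Q, {ξ ∈ c.H z0 | pt p0 ξ = pt p ξ}).Countable := by
    refine (Set.toFinite Q).countable.biUnion fun p hp => ?_
    obtain ⟨ξ1, hξ1, i, hi⟩ := hno p hp
    refine (countable_zeros (c.isOpen_H z0) (c.conn_H z0) (f := fun ξ => pt p0 ξ i - pt p ξ i) ?_ hξ1 (sub_ne_zero.2 hi)).mono ?_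
    · intro ξ hξ
      have h0 : ∀ e, ξ.re < (c.D z0 e).R0 := fun e => lt_of_lt_of_le hξ (c.hR0 z0 e)
      exact (((hf _ i _).comp ξ ((c.D z0 _).hxd _ ξ (h0 _))).sub ((hf _ i _).comp ξ ((c.D z0 _).hxd _ ξ (h0 _)))).differentiableWithinAt
    · rintro ξ ⟨h1, h2⟩
      exact ⟨h1, sub_eq_zero.2 (congrFun h2 i)⟩
  have hd : Dense (⋃ p ∈ Q, {ξ ∈ c.H z0 | pt p0 ξ = pt p ξ})ᶜ := by
    apply dense_compl_of_dimH_lt_finrank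
    rw [dimH_countable hcov, Complex.finrank_real_complex]; norm_num
  obtain ⟨ξ, hξ, hξ'⟩ := hd.inter_open_nonempty _ (c.isOpen_H z0) ⟨((c.R z0 - 1 : ℝ) : ℂ), by
    show (_ : ℂ).re < _
    rw [Complex.ofReal_re]; linarith⟩
  obtain ⟨p1, h1, h2⟩ := hpt ξ hξ
  exact hξ' (mem_biUnion (show p1 ∈ Q from h1) ⟨hξ, h2⟩)

end Cfg
end
end FileA9

section FileB1
open MeasureTheory Set Filter Topology
noncomputable section

def HP (R : ℝ) : Set ℂ := {ξ | ξ.re < R}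
lemma isOpen_HP (R : ℝ) : IsOpen (HP R) := isOpen_lt Complex.continuous_re continuous_const
lemma conn_HP (R : ℝ) : IsPreconnected (HP R) := (convex_halfSpace_re_lt _).isPreconnected

/-- nonconstant holomorphic curve on a half plane tending to c -/
structure Cur (R : ℝ) (α : ℂ → ℂ) (c : ℂ) : Prop where
  hd : DifferentiableOn ℂ α (HP R)
  hn : ∃ ξ ∈ HP R, ∃ ξ' ∈ HP R, α ξ ≠ α ξ'
  hl : Tendsto α (comap Complex.re atBot) (𝓝 c)

def PRel {n : ℕ} (f g : Fin n → ℂ → ℂ) (c c' : ℂ) : Prop :=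
  ∃ R α β, Cur R α c ∧ Cur R β c' ∧ ∀ ξ ∈ HP R, ∀ i, f i (α ξ) = g i (β ξ)

lemma PRel.symm {n : ℕ} {f g : Fin n → ℂ → ℂ} {c c' : ℂ} (h : PRel f g c c') : PRel g f c' c := by
  obtain ⟨R, α, β, h1, h2, h3⟩ := h
  exact ⟨R, β, α, h2, h1, fun ξ hξ i => (h3 ξ hξ i).symm⟩

lemma Cur.ident {R : ℝ} {α : ℂ → ℂ} {c : ℂ} (hα : Cur R α c) {h : ℂ → ℂ} (hh : Differentiable ℂ h)
    (h0 : ∀ ξ ∈ HP R, h (α ξ) = 0) : ∀ x, h x = 0 := by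
  obtain ⟨ξ, hξ, ξ', hξ', hne⟩ := hα.hn
  have hop : IsOpen (α '' HP R) := by
    rcases (hα.hd.analyticOnNhd (isOpen_HP R)).is_constant_or_isOpen (conn_HP R) with ⟨w, hw⟩ | h
    · exact absurd ((hw ξ hξ).trans (hw ξ' hξ').symm) hne
    · exact h _ subset_rfl (isOpen_HP R)
  have h1 : h =ᶠ[𝓝 (α ξ)] 0 := by
    filter_upwards [hop.mem_nhds ⟨ξ, hξ, rfl⟩] with x hx
    obtain ⟨η, hη, rfl⟩ := hx
    exact h0 η hη
  have ha : AnalyticOnNhd ℂ h univ := fun x _ => hh.analyticAt x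
  have := ha.eqOn_of_preconnected_of_eventuallyEq (analyticOnNhd_const (v := (0:ℂ))) isPreconnected_univ (mem_univ (α ξ)) h1
  exact fun x => this (mem_univ x)

structure IsJ {n : ℕ} (f : Fin n → ℂ → ℂ) (J : List (Fin n) → ℂ → ℂ) : Prop where
  hd : ∀ l, Differentiable ℂ (J l)
  nil : J [] = fun _ => 1
  der : ∀ i l x, deriv (J (i :: l)) x = deriv (f i) x * J l x
  zero : ∀ i l, J (i :: l) 0 = 0

lemma exists_J {n : ℕ} {f : Fin n → ℂ → ℂ} (hf : ∀ i, Differentiable ℂ (f i)) : ∃ J, IsJ f J := by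
  have hprim : ∀ g : ℂ → ℂ, ∃ G : ℂ → ℂ, Differentiable ℂ g → (∀ x, HasDerivAt G (g x) x) ∧ G 0 = 0 := by
    intro g
    by_cases hg : Differentiable ℂ g
    · obtain ⟨G, h1, h2⟩ := hg.isExactOn_univ.with_val_at 0 0
      exact ⟨G, fun _ => ⟨fun x => h2 x (mem_univ x), h1⟩⟩
    · exact ⟨0, fun h => absurd h hg⟩
  choose P hP using hprim
  let J : List (Fin n) → ℂ → ℂ := fun l => List.rec (fun _ => 1) (fun i _ r => P (fun x => deriv (f i) x * r x)) l
  have hdf : ∀ i, Differentiable ℂ (deriv (f i)) := fun i p => ((hf i).analyticAt p).deriv.differentiableAt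
  have hd : ∀ l, Differentiable ℂ (J l) := by
    intro l
    induction l with
    | nil => exact differentiable_const _
    | cons i l ih => exact fun x => ((hP _ ((hdf i).mul ih)).1 x).differentiableAt
  refine ⟨J, hd, rfl, fun i l x => ((hP _ ((hdf i).mul (hd l))).1 x).deriv, fun i l => (hP _ ((hdf i).mul (hd l))).2⟩

/-- J is algebraic over the functions f -/
def AlgOver {n : ℕ} (f : Fin n → ℂ → ℂ) (J : ℂ → ℂ) : Prop :=
  ∃ Q : Polynomial (MvPolynomial (Fin n) ℂ), 
    (∀ x, (Q.map (MvPolynomial.eval (fun i => f i x))).eval (J x) = 0) ∧ 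
    ∃ x, Q.map (MvPolynomial.eval (fun i => f i x)) ≠ 0

def Alg {n : ℕ} (f : Fin n → ℂ → ℂ) : Prop := ∀ J, IsJ f J → ∀ l, AlgOver f (J l)

lemma diff_evalMv {n : ℕ} {f : Fin n → ℂ → ℂ} (hf : ∀ i, Differentiable ℂ (f i)) (P : MvPolynomial (Fin n) ℂ) :
    Differentiable ℂ (fun x => MvPolynomial.eval (fun i => f i x) P) := by
  induction P using MvPolynomial.induction_on with
  | C a => simp
  | add p q hp hq => simp only [map_add]; exact hp.add hq
  | mul_X p i hp => simp only [map_mul, MvPolynomial.eval_X]; exact hp.mul (hf i)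

lemma diff_evalQ {n : ℕ} {f : Fin n → ℂ → ℂ} (hf : ∀ i, Differentiable ℂ (f i)) {J : ℂ → ℂ} (hJ : Differentiable ℂ J)
    (Q : Polynomial (MvPolynomial (Fin n) ℂ)) :
    Differentiable ℂ (fun x => (Q.map (MvPolynomial.eval (fun i => f i x))).eval (J x)) := by
  induction Q using Polynomial.induction_on' with
  | add p q hp hq => simp only [Polynomial.map_add, Polynomial.eval_add]; exact hp.add hq
  | monomial m a => 
    simp only [Polynomial.map_monomial, Polynomial.eval_monomial]
    exact (diff_evalMv hf a).mul (hJ.pow m)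

lemma PRel.transport {n : ℕ} {f g : Fin n → ℂ → ℂ} (hg : ∀ i, Differentiable ℂ (g i)) {R : ℝ} {α β : ℂ → ℂ} {c' : ℂ}
    (hβ : Cur R β c') (hfg : ∀ ξ ∈ HP R, ∀ i, f i (α ξ) = g i (β ξ)) {J K : ℂ → ℂ} (hK : Differentiable ℂ K)
    (hJK : ∀ ξ ∈ HP R, J (α ξ) = K (β ξ)) (Q : Polynomial (MvPolynomial (Fin n) ℂ))
    (hQ : ∀ x, (Q.map (MvPolynomial.eval (fun i => f i x))).eval (J x) = 0) : 
    ∀ x, (Q.map (MvPolynomial.eval (fun i => g i x))).eval (K x) = 0 := by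
  apply hβ.ident (diff_evalQ hg hK Q)
  intro ξ hξ
  have := hQ (α ξ)
  simp only [hfg ξ hξ, hJK ξ hξ] at this
  exact this

/-- the finite set of constants argument -/
lemma kappa_zero {n : ℕ} {f : Fin n → ℂ → ℂ} {J : ℂ → ℂ} {Q : Polynomial (MvPolynomial (Fin n) ℂ)}
    (hQ : ∀ x, (Q.map (MvPolynomial.eval (fun i => f i x))).eval (J x) = 0)
    (hQ' : ∃ x, Q.map (MvPolynomial.eval (fun i => f i x)) ≠ 0) {κ : ℂ}
    (h : ∀ c : ℂ, (∀ x, (Q.map (MvPolynomial.eval (fun i => f i x))).eval (J x + c) = 0) → 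
      (∀ x, (Q.map (MvPolynomial.eval (fun i => f i x))).eval (J x + (c + κ)) = 0)) : κ = 0 := by
  by_contra hκ
  obtain ⟨x, hx⟩ := hQ'
  have hall : ∀ k : ℕ, ∀ x, (Q.map (MvPolynomial.eval (fun i => f i x))).eval (J x + k * κ) = 0 := by
    intro k
    induction k with
    | zero => simpa using hQ
    | succ k ih => 
      have := h _ ih
      intro x
      rw [← this x]; congr 1; push_cast; ring
  have hfin := Polynomial.finite_setOf_isRoot hx
  have : Set.Infinite (Set.range (fun k : ℕ => J x + k * κ)) := by
    apply Set.infinite_range_of_injective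
    intro a b hab
    simpa [hκ] using hab
  exact this (hfin.subset (by rintro _ ⟨k, rfl⟩; exact hall k x))

lemma J_const {n : ℕ} {f g : Fin n → ℂ → ℂ} (hf : ∀ i, Differentiable ℂ (f i)) (hg : ∀ i, Differentiable ℂ (g i)) 
    {J K : List (Fin n) → ℂ → ℂ} (hJ : IsJ f J) (hK : IsJ g K) {R : ℝ} {α β : ℂ → ℂ} {c c' : ℂ}
    (hα : Cur R α c) (hβ : Cur R β c') (hfg : ∀ ξ ∈ HP R, ∀ i, f i (α ξ) = g i (β ξ)) {l : List (Fin n)} 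
    (hl : ∀ ξ ∈ HP R, J l (α ξ) = K l (β ξ)) (i : Fin n) : 
    ∀ ξ ∈ HP R, J (i :: l) (α ξ) = K (i :: l) (β ξ) + (J (i :: l) c - K (i :: l) c') := by
  have hder : ∀ ξ ∈ HP R, HasDerivAt (fun ξ => J (i::l) (α ξ) - K (i::l) (β ξ)) 0 ξ := by
    intro ξ hξ
    have ha := (hα.hd.differentiableAt ((isOpen_HP R).mem_nhds hξ)).hasDerivAt
    have hb := (hβ.hd.differentiableAt ((isOpen_HP R).mem_nhds hξ)).hasDerivAt
    have h1 := (hJ.hd (i::l) (α ξ)).hasDerivAt.comp ξ ha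
    have h2 := (hK.hd (i::l) (β ξ)).hasDerivAt.comp ξ hb
    have h3 := (hf i (α ξ)).hasDerivAt.comp ξ ha
    have h4 := (hg i (β ξ)).hasDerivAt.comp ξ hb
    have h5 : (f i ∘ α) =ᶠ[𝓝 ξ] (g i ∘ β) := by
      filter_upwards [(isOpen_HP R).mem_nhds hξ] with η hη using hfg η hη i
    have h6 := (h4.congr_of_eventuallyEq h5).unique h3
    have h7 : HasDerivAt (fun ξ => J (i::l) (α ξ) - K (i::l) (β ξ)) _ ξ := h1.sub h2
    have h8 : deriv (J (i :: l)) (α ξ) * deriv α ξ - deriv (K (i :: l)) (β ξ) * deriv β ξ = 0 := by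
      rw [hJ.der, hK.der, hl ξ hξ]
      linear_combination -K l (β ξ) * h6
    rwa [h8] at h7
  have hconst : ∀ ξ ∈ HP R, ∀ η ∈ HP R, (fun ξ => J (i::l) (α ξ) - K (i::l) (β ξ)) ξ = (fun ξ => J (i::l) (α ξ) - K (i::l) (β ξ)) η := by
    intro ξ hξ η hη
    exact (isOpen_HP R).is_const_of_deriv_eq_zero (𝕜 := ℂ) (f := fun ξ => J (i::l) (α ξ) - K (i::l) (β ξ)) (conn_HP R) 
      (fun x hx => (hder x hx).differentiableAt.differentiableWithinAt) (fun x hx => (hder x hx).deriv) hξ hη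
  intro ξ hξ
  have hlim : Tendsto (fun ξ => J (i::l) (α ξ) - K (i::l) (β ξ)) (comap Complex.re atBot) (𝓝 (J (i :: l) c - K (i :: l) c')) :=
    (((hJ.hd _).continuous.tendsto _).comp hα.hl).sub (((hK.hd _).continuous.tendsto _).comp hβ.hl)
  have hmem : ∀ᶠ η in comap Complex.re atBot, η ∈ HP R := 
    (eventually_lt_atBot R).comap Complex.re
  have hlim2 : Tendsto (fun ξ => J (i::l) (α ξ) - K (i::l) (β ξ)) (comap Complex.re atBot) (𝓝 (J (i :: l) (α ξ) - K (i :: l) (β ξ))) := by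
    apply tendsto_const_nhds.congr'
    filter_upwards [hmem] with η hη
    exact hconst ξ hξ η hη
  have hnb : (comap Complex.re atBot).NeBot := by
    apply comap_neBot_iff.2
    intro t ht
    obtain ⟨a, ha⟩ := mem_atBot_sets.1 ht
    exact ⟨(a:ℂ), ha _ (by simp)⟩
  have := tendsto_nhds_unique hlim hlim2
  rw [this]; ring

theorem caseB {n : ℕ} {f : Fin n → ℂ → ℂ} (hf : ∀ i, Differentiable ℂ (f i)) (hA : Alg f) {T : ℂ}
    (hr : PRel f f 0 T) {J : List (Fin n) → ℂ → ℂ} (hJ : IsJ f J) : ∀ i l, J (i :: l) T = 0 := by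
  obtain ⟨R, α, β, hα, hβ, hfg⟩ := hr
  suffices h : ∀ l, (∀ ξ ∈ HP R, J l (α ξ) = J l (β ξ)) ∧ J l 0 = J l T by
    intro i l
    rw [← (h (i::l)).2, hJ.zero]
  intro l
  induction l with
  | nil => simp [hJ.nil]
  | cons i l ih => 
    have h1 := J_const hf hf hJ hJ hα hβ hfg ih.1 i
    obtain ⟨Q, hQ, hQ'⟩ := hA J hJ (i :: l)
    have hκ : J (i :: l) 0 - J (i :: l) T = 0 := by
      apply kappa_zero hQ hQ'
      intro c hc
      exact PRel.transport (J := fun x => J (i::l) x + c) (K := fun x => J (i::l) x + (c + (J (i :: l) 0 - J (i :: l) T)))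
        hf hβ hfg ((hJ.hd _).add_const _) (fun ξ hξ => by rw [h1 ξ hξ]; ring) Q hc
    refine ⟨fun ξ hξ => by rw [h1 ξ hξ, hκ, add_zero], sub_eq_zero.1 hκ⟩

theorem caseA {n : ℕ} {f g : Fin n → ℂ → ℂ} (hf : ∀ i, Differentiable ℂ (f i)) (hg : ∀ i, Differentiable ℂ (g i)) 
    (hA : Alg f) {T : ℂ}
    (hr : PRel f g 0 0) (hr' : PRel f g T T) {J K : List (Fin n) → ℂ → ℂ} (hJ : IsJ f J) (hK : IsJ g K) : 
    ∀ l, J l T = K l T := by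
  obtain ⟨R, α, β, hα, hβ, hfg⟩ := hr
  obtain ⟨R', α', β', hα', hβ', hfg'⟩ := hr'
  suffices h : ∀ l, (∀ ξ ∈ HP R, J l (α ξ) = K l (β ξ)) ∧ (∀ ξ ∈ HP R', J l (α' ξ) = K l (β' ξ)) ∧ J l T = K l T by
    exact fun l => (h l).2.2
  intro l
  induction l with
  | nil => simp [hJ.nil, hK.nil]
  | cons i l ih => 
    have h1 := J_const hf hg hJ hK hα hβ hfg ih.1 i
    rw [hJ.zero, hK.zero] at h1
    simp only [sub_zero, add_zero] at h1
    have h2 := J_const hf hg hJ hK hα' hβ' hfg' ih.2.1 i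
    obtain ⟨Q, hQ, hQ'⟩ := hA J hJ (i :: l)
    have hκ : J (i :: l) T - K (i :: l) T = 0 := by
      apply kappa_zero hQ hQ'
      intro c hc
      have h3 := PRel.transport (J := fun x => J (i::l) x + c) (K := fun x => K (i::l) x + (c + (J (i :: l) T - K (i :: l) T)))
        hg hβ' hfg' ((hK.hd _).add_const _) (fun ξ hξ => by rw [h2 ξ hξ]; ring) Q hc
      exact PRel.transport (J := fun x => K (i::l) x + (c + (J (i :: l) T - K (i :: l) T))) (K := fun x => J (i::l) x + (c + (J (i :: l) T - K (i :: l) T)))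
        hf hα (fun ξ hξ i => (hfg ξ hξ i).symm) ((hJ.hd _).add_const _) (fun ξ hξ => by rw [h1 ξ hξ]) Q h3
    refine ⟨h1, fun ξ hξ => by rw [h2 ξ hξ, hκ, add_zero], sub_eq_zero.1 hκ⟩
end
end FileB1

section FileB2
open MeasureTheory Set Filter Topology
noncomputable section

lemma exists_lam {ι : Type} [Fintype ι] {n : ℕ} (d : ι → Fin n → ℂ) (hd : ∀ e, d e ≠ 0) : 
    ∃ lam : Fin n → ℂ, ∀ e, ∑ i, lam i * d e i ≠ 0 := by
  classical
  let p : ι → Polynomial ℂ := fun e => ∑ i : Fin n, Polynomial.monomial (i:ℕ) (d e i)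
  have hp : ∀ e, p e ≠ 0 := by
    intro e h0
    apply hd e
    funext i
    have := congrArg (fun q => Polynomial.coeff q (i:ℕ)) h0
    simpa [p, Polynomial.finset_sum_coeff, Polynomial.coeff_monomial, Fin.val_inj] using this
  have hprod : ∏ e, p e ≠ 0 := Finset.prod_ne_zero_iff.2 fun e _ => hp e
  obtain ⟨κ, hκ⟩ : ∃ κ, (∏ e, p e).eval κ ≠ 0 := by
    by_contra h
    push Not at h
    exact hprod (Polynomial.funext (by simpa using h))
  refine ⟨fun i => κ ^ (i:ℕ), fun e he => ?_⟩
  rw [Polynomial.eval_prod, Finset.prod_ne_zero_iff] at hκ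
  apply hκ e (Finset.mem_univ e)
  rw [← he]
  simp only [p, Polynomial.eval_finset_sum, Polynomial.eval_monomial]
  exact Finset.sum_congr rfl fun i _ => mul_comm _ _

def endp (T : ℝ) (t : Bool) : ℂ := if t then (T:ℂ) else 0
def sgn (t : Bool) : ℤ := if t then 1 else -1

theorem moments_rel {ι : Type} [Fintype ι] {T : ℝ} (hT : 0 < T) {n : ℕ} (f : ι → Fin n → ℂ → ℂ) (ε : ι → ℤ)
    (hf : ∀ e i, Differentiable ℂ (f e i)) (hnc : ∀ e, ∃ i x y, f e i x ≠ f e i y)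
    (hmom : ∀ (P : MvPolynomial (Fin n) ℂ) (i : Fin n), ∑ e, (ε e : ℂ) * 
      ∫ x in (0:ℝ)..T, MvPolynomial.eval (fun i => f e i x) P * deriv (f e i) x = 0)
    (e0 : ι) (he0 : ε e0 ≠ 0) (t0 : Bool) : 
    ∃ e1 t1, PRel (f e0) (f e1) (endp T t0) (endp T t1) ∧ (ε e0 * sgn t0) * (ε e1 * sgn t1) < 0 := by
  choose i0 x0 y0 hxy using hnc
  obtain ⟨lam, hlam⟩ := exists_lam (fun e i => f e i (x0 e) - f e i (y0 e)) (by
    intro e h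
    exact sub_ne_zero.2 (hxy e) (congrFun h (i0 e)))
  let S : MvPolynomial (Fin n) ℂ := ∑ i, MvPolynomial.C (lam i) * MvPolynomial.X i
  have hS : ∀ v : Fin n → ℂ, MvPolynomial.eval v S = ∑ i, lam i * v i := by
    intro v; simp [S, map_sum]
  let c : Cfg ι := { 
    s := fun e x => MvPolynomial.eval (fun i => f e i x) S
    ε := ε
    T := T
    hT := hT
    hs := fun e => diff_evalMv (hf e) S
    hnc := fun e => ⟨x0 e, y0 e, by
      rw [hS, hS]
      intro h
      apply hlam e
      simp only [mul_sub, Finset.sum_sub_distrib]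
      rw [h, sub_self]⟩ }
  have hdc : ∀ e i, Continuous (deriv (f e i)) := fun e i => by
    have : Differentiable ℂ (deriv (f e i)) := fun p => ((hf e i).analyticAt p).deriv.differentiableAt
    exact this.continuous
  have hmom' : ∀ P : MvPolynomial (Fin n) ℂ, ∑ e, (c.ε e : ℂ) * 
      ∫ x in (0:ℝ)..c.T, MvPolynomial.eval (fun i => f e i x) P * deriv (c.s e) x = 0 := by
    intro P
    have h1 : ∀ e, ∫ x in (0:ℝ)..T, MvPolynomial.eval (fun i => f e i x) P * deriv (c.s e) x = 
        ∑ i, lam i * ∫ x in (0:ℝ)..T, MvPolynomial.eval (fun i => f e i x) P * deriv (f e i) x := by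
      intro e
      have hder : ∀ x, deriv (c.s e) x = ∑ i, lam i * deriv (f e i) x := by
        intro x
        have : c.s e = fun x => ∑ i, lam i * f e i x := by funext x; exact hS _
        rw [this, deriv_fun_sum (fun i _ => ((hf e i x).const_mul _))]
        refine Finset.sum_congr rfl fun i _ => ?_
        rw [deriv_const_mul _ (hf e i x)]
      simp only [hder, ← intervalIntegral.integral_const_mul]
      rw [← intervalIntegral.integral_finset_sum]
      · refine intervalIntegral.integral_congr fun x _ => ?_
        rw [Finset.mul_sum]
        exact Finset.sum_congr rfl fun i _ => by ring
      · intro i _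
        apply Continuous.intervalIntegrable
        have h1 := (diff_evalMv (hf e) P).continuous
        exact continuous_const.mul ((h1.comp Complex.continuous_ofReal).mul ((hdc e i).comp Complex.continuous_ofReal))
    show ∑ e, (ε e : ℂ) * ∫ x in (0:ℝ)..T, MvPolynomial.eval (fun i => f e i x) P * deriv (c.s e) x = 0
    simp only [h1, Finset.mul_sum]
    rw [Finset.sum_comm]
    apply Finset.sum_eq_zero
    intro i _
    have := hmom P i
    rw [← mul_zero (lam i), ← this, Finset.mul_sum]
    exact Finset.sum_congr rfl fun e _ => by ring
  set z0 : ℂ := c.s e0 (endp T t0) with hz0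
  have hTC : (T:ℂ) ≠ 0 := by exact_mod_cast hT.ne'
  have hmem : endp T t0 ∈ Metric.closedBall ((T:ℂ)/2) (c.D z0 e0).ρ := by
    have hρ : T / 2 < (c.D z0 e0).ρ := (c.D z0 e0).hρ
    have : endp T t0 = ((if t0 then T else 0 : ℝ) : ℂ) := by
      unfold endp; split_ifs <;> simp
    rw [this]
    apply Metric.ball_subset_closedBall
    apply mem_ball_of_Icc hρ
    split_ifs <;> simp [hT.le]
  obtain ⟨b, hb⟩ := (c.D z0 e0).hex _ hmem rfl
  have hsg : ∀ e (b : (c.D z0 e).B), (c.D z0 e).ν b ≠ 0 → ∃ t, (c.D z0 e).c b = endp T t ∧ 0 < (c.D z0 e).ν b * sgn t := by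
    intro e b hν
    by_cases h1 : (c.D z0 e).c b = 0
    · refine ⟨false, by simp [endp, h1], ?_⟩
      have := (c.D z0 e).hν0 b h1
      simp only [sgn]; simp; linarith
    · by_cases h2 : (c.D z0 e).c b = T
      · refine ⟨true, by simp [endp, h2], ?_⟩
        have := (c.D z0 e).hνT b h2
        simpa [sgn] using this
      · exact absurd ((c.D z0 e).hν b h1 h2) hν
  have hν0 : 0 < (c.D z0 e0).ν b * sgn t0 := by
    cases t0 with
    | false => 
      have := (c.D z0 e0).hν0 b (by rw [hb]; simp [endp])
      simp only [sgn]; simp; linarith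
    | true => 
      have := (c.D z0 e0).hνT b (by rw [hb]; simp [endp]; rfl)
      simpa [sgn] using this
  have hν0' : (c.D z0 e0).ν b ≠ 0 := by rintro h; rw [h] at hν0; simp at hν0
  obtain ⟨p1, hp1, hrel⟩ := c.endpoint f hf S (fun e x => rfl) hmom' z0 ⟨e0, b⟩ (mul_ne_zero he0 hν0')
  have hν1 : (c.D z0 p1.1).ν p1.2 ≠ 0 := by rintro h; rw [h] at hp1; simp at hp1
  obtain ⟨t1, ht1, ht1'⟩ := hsg p1.1 p1.2 hν1
  have hcur : ∀ e (b : (c.D z0 e).B), Cur (c.R z0) ((c.D z0 e).x b) ((c.D z0 e).c b) := by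
    intro e b
    refine ⟨fun ξ hξ => ((c.D z0 e).hxd b ξ (lt_of_lt_of_le hξ (c.hR0 z0 e))).differentiableWithinAt, ?_, (c.D z0 e).hlim b⟩
    have hR : ∀ r : ℝ, r < c.R z0 → (r:ℂ) ∈ HP (c.R z0) := fun r hr => by simpa [HP] using hr
    refine ⟨_, hR (c.R z0 - 1) (by linarith), _, hR (c.R z0 - 2) (by linarith), fun h => ?_⟩
    have e1 := (c.D z0 e).hs b _ (lt_of_lt_of_le (hR (c.R z0 - 1) (by linarith)) (c.hR0 z0 e))
    have e2 := (c.D z0 e).hs b _ (lt_of_lt_of_le (hR (c.R z0 - 2) (by linarith)) (c.hR0 z0 e))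
    rw [h, e2, add_right_inj, ← Complex.ofReal_exp, ← Complex.ofReal_exp, Complex.ofReal_inj] at e1
    have := Real.exp_injective e1
    linarith
  refine ⟨p1.1, t1, ⟨c.R z0, _, _, hb ▸ hcur e0 b, ht1 ▸ hcur p1.1 p1.2, fun ξ hξ i => hrel ξ hξ i⟩, ?_⟩
  simp only at hp1
  have hp1' : (ε e0 * (c.D z0 e0).ν b) * (ε p1.1 * (c.D z0 p1.1).ν p1.2) < 0 := hp1
  set u := (c.D z0 e0).ν b
  set v := (c.D z0 p1.1).ν p1.2
  by_contra hcon
  push Not at hcon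
  have h1 : 0 < (u * sgn t0) * (v * sgn t1) := mul_pos hν0 ht1'
  have h2 : (ε e0 * u) * (ε p1.1 * v) * ((ε e0 * sgn t0) * (ε p1.1 * sgn t1)) = (ε e0 * ε p1.1)^2 * ((u * sgn t0) * (v * sgn t1)) := by ring
  have hne : ε e0 * ε p1.1 ≠ 0 := by
    intro h
    have : (ε e0 * u) * (ε p1.1 * v) = (ε e0 * ε p1.1) * (u * v) := by ring
    rw [this, h] at hp1'; simp at hp1'
  have h3 : 0 < (ε e0 * ε p1.1)^2 * ((u * sgn t0) * (v * sgn t1)) := mul_pos (by positivity) h1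
  have h4 := mul_nonneg_of_nonpos_of_nonpos hp1'.le (neg_nonpos.2 hcon)
  rw [mul_neg, h2] at h4
  linarith
end
end FileB2

section FileB3
open MeasureTheory Set Filter Topology
noncomputable section

/-- entire functions -/
def EntS : Subalgebra ℂ (ℂ → ℂ) where
  carrier := {f | Differentiable ℂ f}
  mul_mem' := fun ha hb => Differentiable.mul ha hb
  add_mem' := fun ha hb => Differentiable.add ha hb
  algebraMap_mem' := fun r => differentiable_const r

def Ent : Type := EntS
instance : CommRing Ent := inferInstanceAs (CommRing EntS)
instance : Algebra ℂ Ent := inferInstanceAs (Algebra ℂ EntS)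
def Ent.fn (f : Ent) : ℂ → ℂ := Subtype.val (show EntS from f)
instance : CoeOut Ent (ℂ → ℂ) := ⟨Ent.fn⟩
def Ent.mk (f : ℂ → ℂ) (h : Differentiable ℂ f) : Ent := (⟨f, h⟩ : EntS)
lemma Ent.ext' {f g : Ent} (h : ∀ x, f.fn x = g.fn x) : f = g := Subtype.ext (funext h)
lemma fn_mk (f : ℂ → ℂ) (h : Differentiable ℂ f) : (Ent.mk f h).fn = f := rfl
lemma fn_add (f g : Ent) (x : ℂ) : (f + g).fn x = f.fn x + g.fn x := rfl
lemma fn_sub (f g : Ent) (x : ℂ) : (f - g).fn x = f.fn x - g.fn x := rfl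
lemma fn_mul (f g : Ent) (x : ℂ) : (f * g).fn x = f.fn x * g.fn x := rfl
lemma fn_pow (f : Ent) (k : ℕ) (x : ℂ) : (f ^ k).fn x = f.fn x ^ k := rfl
lemma fn_zero (x : ℂ) : (0 : Ent).fn x = 0 := rfl
lemma fn_one (x : ℂ) : (1 : Ent).fn x = 1 := rfl
lemma fn_smul (c : ℂ) (f : Ent) (x : ℂ) : (c • f).fn x = c * f.fn x := rfl
lemma fn_alg (c : ℂ) (x : ℂ) : (algebraMap ℂ Ent c).fn x = c := rfl

lemma entD (f : Ent) : Differentiable ℂ (f : ℂ → ℂ) := Subtype.prop (show EntS from f)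
lemma fn_congr {f g : Ent} (h : f = g) (x : ℂ) : f.fn x = g.fn x := by rw [h]

instance : IsDomain Ent :=
  haveI : NoZeroDivisors Ent := ⟨fun {f g} h => by
    have h1 := AnalyticOnNhd.eq_zero_or_eq_zero_of_mul_eq_zero (U := univ)
      (fun x _ => (entD f).analyticAt x) (fun x _ => (entD g).analyticAt x)
      (fun z _ => fn_congr h z) isPreconnected_univ
    exact h1.imp (fun h => Ent.ext' (fun z => h z (mem_univ z)))
      (fun h => Ent.ext' (fun z => h z (mem_univ z)))⟩
  haveI : Nontrivial Ent := ⟨0, 1, fun h => zero_ne_one (α := ℂ) (fn_congr h 0)⟩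
  NoZeroDivisors.to_isDomain _

instance : CharZero Ent := charZero_of_injective_algebraMap (algebraMap ℂ Ent).injective

lemma entDeriv (f : Ent) : Differentiable ℂ (deriv (f : ℂ → ℂ)) :=
  fun p => ((entD f).analyticAt p).deriv.differentiableAt

def dE : Derivation ℂ Ent Ent :=
  Derivation.mk' 
    { toFun := fun f => Ent.mk (deriv f) (entDeriv f)
      map_add' := fun f g => Ent.ext' (fun x => deriv_add ((entD f) x) ((entD g) x))
      map_smul' := fun c f => Ent.ext' (fun x => deriv_const_smul c ((entD f) x)) }
    (fun f g => Ent.ext' (fun x => by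
      change deriv ((f : ℂ → ℂ) * (g : ℂ → ℂ)) x = f.fn x * deriv g.fn x + g.fn x * deriv f.fn x
      rw [deriv_mul ((entD f) x) ((entD g) x)]; ring))

lemma dE_apply (f : Ent) (x : ℂ) : (dE f : ℂ → ℂ) x = deriv (f : ℂ → ℂ) x := rfl

lemma dE_surj (f : Ent) (z c : ℂ) : ∃ g : Ent, dE g = f ∧ (g : ℂ → ℂ) z = c := by
  obtain ⟨G, h1, h2⟩ := (entD f).isExactOn_univ.with_val_at z c
  exact ⟨Ent.mk G fun x => (h2 x (mem_univ x)).differentiableAt, Ent.ext' (fun x => (h2 x (mem_univ x)).deriv), h1⟩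

lemma dE_eq_zero {f : Ent} (h : dE f = 0) : ∃ c : ℂ, f = algebraMap ℂ Ent c := by
  refine ⟨(f : ℂ → ℂ) 0, Ent.ext' (fun x => ?_)⟩
  exact is_const_of_deriv_eq_zero (entD f) (fun y => fn_congr h y) x 0

def idE : Ent := Ent.mk id differentiable_id
lemma dE_id : dE idE = 1 := Ent.ext' (fun x => deriv_id x)

/-- evaluation at a point -/
def evE (z : ℂ) : Ent →ₐ[ℂ] ℂ := (Pi.evalAlgHom ℂ (fun _ => ℂ) z).comp EntS.val
lemma evE_apply (z : ℂ) (f : Ent) : evE z f = (f : ℂ → ℂ) z := rfl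

lemma evE_eq_zero {z : ℂ} {f : Ent} (h : evE z f = 0) : (idE - algebraMap ℂ Ent z) ∣ f := by
  have hd : Differentiable ℂ (dslope (f : ℂ → ℂ) z) := by
    have := (Complex.differentiableOn_dslope (s := univ) (c := z) (f := (f : ℂ → ℂ)) Filter.univ_mem).2 (entD f).differentiableOn
    exact differentiableOn_univ.1 this
  refine ⟨Ent.mk _ hd, Ent.ext' (fun x => ?_)⟩
  have := sub_smul_dslope (f : ℂ → ℂ) z x
  rw [show (f : ℂ → ℂ) z = 0 from h, sub_zero, smul_eq_mul] at this
  exact this.symm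

lemma eq_zero_of_pow_dvd {z : ℂ} {f : Ent} (h : ∀ k : ℕ, (idE - algebraMap ℂ Ent z) ^ k ∣ f) : f = 0 := by
  have ha : AnalyticAt ℂ (f : ℂ → ℂ) z := (entD f).analyticAt z
  have ht : analyticOrderAt (f : ℂ → ℂ) z = ⊤ := by
    refine ENat.eq_top_iff_forall_ge.2 fun k => ?_
    rw [natCast_le_analyticOrderAt ha]
    obtain ⟨g, hg⟩ := h k
    refine ⟨g, (entD g).analyticAt z, Eventually.of_forall fun x => ?_⟩
    have := fn_congr hg x
    exact this
  rw [analyticOrderAt_eq_top] at ht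
  have := (show AnalyticOnNhd ℂ (f : ℂ → ℂ) univ from fun x _ => (entD f).analyticAt x).eqOn_of_preconnected_of_eventuallyEq (analyticOnNhd_const (v := (0:ℂ))) isPreconnected_univ (mem_univ z) ht
  exact Ent.ext' (fun x => this (mem_univ x))

/-! polynomials in x with entire coefficients in t -/
open Polynomial in
def pt : Derivation ℂ Ent[X] Ent[X] := PolynomialModule.equivPolynomialSelf.compDer dE.mapCoeffs
open Polynomial in
def px : Derivation ℂ Ent[X] Ent[X] := (derivative' (R := Ent)).restrictScalars ℂ

open Polynomial

lemma pt_coeff (p : Ent[X]) (i : ℕ) : (pt p).coeff i = dE (p.coeff i) := rfl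
lemma px_apply (p : Ent[X]) : px p = derivative p := rfl
lemma pt_C (a : Ent) : pt (C a) = C (dE a) := by
  ext1 i; rw [pt_coeff, coeff_C, coeff_C]; split_ifs <;> simp
lemma pt_X : pt (X : Ent[X]) = 0 := by
  ext1 i; rw [pt_coeff, coeff_X]; split_ifs <;> simp
lemma pt_px (p : Ent[X]) : pt (px p) = px (pt p) := by
  ext1 i; rw [pt_coeff, px_apply, px_apply, coeff_derivative, coeff_derivative, pt_coeff]; simp; ring

def dg : Ent[X] →ₐ[ℂ] Ent := (aeval (R := Ent) idE).restrictScalars ℂ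
lemma dg_apply (p : Ent[X]) : dg p = p.eval idE := by simp [dg, aeval_def, eval₂_eq_eval_map]

lemma dE_dg (p : Ent[X]) : dE (dg p) = dg (px p) + dg (pt p) := by
  induction p using Polynomial.induction_on with
  | C a => rw [pt_C, px_apply, dg_apply, dg_apply, dg_apply]; simp
  | add p q hp hq => simp only [map_add, hp, hq]; ring
  | monomial m a h => 
    rw [pow_succ, ← mul_assoc]
    simp only [map_mul, Derivation.leibniz, map_add, smul_eq_mul] at h ⊢
    have : dg X = idE := by rw [dg_apply]; simp
    have h2 : dg (px X) = 1 := by rw [px_apply, dg_apply]; simp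
    have h3 : dg (pt X) = 0 := by rw [pt_X]; simp
    simp only [this, dE_id, h2, h3]
    linear_combination idE * h

/-- Poisson bracket derivation -/
def br (f : Ent[X]) : Derivation ℂ Ent[X] Ent[X] := (pt f) • px + (-px f) • pt
lemma br_apply (f p : Ent[X]) : br f p = pt f * px p - px f * pt p := by
  change pt f * px p + -px f * pt p = _; ring
end
end FileB3

section FileB4
open MeasureTheory Set Filter Topology
noncomputable section
open Polynomial

abbrev LL := LaurentPolynomial ℂ

lemma trdeg_LL : Algebra.trdeg ℂ LL ≤ 1 := by
  haveI : FaithfulSMul ℂ[X] LL := (faithfulSMul_iff_algebraMap_injective ℂ[X] LL).2 Polynomial.toLaurent_injective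
  haveI : IsScalarTower ℂ ℂ[X] LL := IsScalarTower.of_algebraMap_eq fun c => by
    simp [LaurentPolynomial.algebraMap_eq_toLaurent]
  have h := trdeg_add_eq ℂ ℂ[X] (A := LL)
  have h0 : Algebra.trdeg ℂ[X] LL = 0 := by
    haveI : Algebra.IsAlgebraic ℂ[X] LL := IsLocalization.isAlgebraic LL (Submonoid.powers (X : ℂ[X]))
    exact trdeg_eq_zero
  rw [← h, h0, Polynomial.trdeg_of_isDomain]; simp

lemma trdeg_LLX : Algebra.trdeg ℂ LL[X] ≤ 2 := by
  rw [← trdeg_add_eq ℂ LL (A := LL[X]), Polynomial.trdeg_of_isDomain]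
  calc _ ≤ (1 : Cardinal) + 1 := by gcongr; exact trdeg_LL
    _ = 2 := by norm_num

lemma alg_one {f : LL} (hf : Transcendental ℂ f) (g : LL) : IsAlgebraic (Algebra.adjoin ℂ {f}) g := by
  have hi : AlgebraicIndependent ℂ (fun _ : Unit => f) := algebraicIndependent_unique_type_iff.2 hf
  have hb := AlgebraicIndependent.isTranscendenceBasis_of_trdeg_le_of_finite hi (by simpa using trdeg_LL)
  have := hb.isAlgebraic
  rw [range_const] at this
  exact this.isAlgebraic g

lemma alg_two {f g : LL[X]} (hg : Transcendental ℂ g) (hf : Transcendental (Algebra.adjoin ℂ {g}) f) (h : LL[X]) :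
    IsAlgebraic (Algebra.adjoin ℂ {f, g}) h := by
  have hi : AlgebraicIndependent ℂ (fun _ : Unit => g) := algebraicIndependent_unique_type_iff.2 hg
  have hi2 := (hi.option_iff_transcendental f).2 (by rw [range_const]; exact hf)
  have hb := AlgebraicIndependent.isTranscendenceBasis_of_trdeg_le_of_finite hi2 (by 
    refine trdeg_LLX.trans (le_of_eq ?_); simp)
  have := hb.isAlgebraic
  have hr : range (fun o : Option Unit => o.elim f (fun _ => g)) = {f, g} := by
    ext x; simp [Option.exists, eq_comm]
  rw [hr] at this
  exact this.isAlgebraic h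

/-- a derivation kills nothing transcendental -/
lemma transc_of_der {A : Type*} [CommRing A] [IsDomain A] [Algebra ℂ A] (δ : Derivation ℂ A A) (S : Subalgebra ℂ A)
    (hS : ∀ s ∈ S, δ s = 0) {f : A} (hf : δ f ≠ 0) : Transcendental S f := by
  haveI : CharZero A := charZero_of_injective_algebraMap (algebraMap ℂ A).injective
  have hd : ∀ P : S[X], δ (aeval f P) = aeval f (derivative P) * δ f := by
    intro P
    induction P using Polynomial.induction_on' with
    | add p q hp hq => simp [hp, hq, add_mul]
    | monomial m a =>
      have h1 : δ (algebraMap S A a) = 0 := hS a a.2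
      simp only [aeval_monomial, Derivation.leibniz, h1, Derivation.leibniz_pow, derivative_monomial, smul_eq_mul, mul_zero, add_zero, map_mul, map_natCast, nsmul_eq_mul]; ring
  have key : ∀ (N : ℕ) (P : S[X]), P.natDegree ≤ N → aeval f P = 0 → P = 0 := by
    intro N
    have hC : ∀ P : S[X], P.natDegree = 0 → aeval f P = 0 → P = 0 := by
      intro P hP h0
      rw [eq_C_of_natDegree_eq_zero hP] at h0 ⊢
      rw [aeval_C] at h0
      rw [show P.coeff 0 = 0 from Subtype.ext h0, C_0]
    induction N with
    | zero => intro P hP; exact hC P (by omega)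
    | succ N ih =>
      intro P hP h0
      have h1 : aeval f (derivative P) = 0 := by
        have := hd P
        rw [h0, map_zero, eq_comm, mul_eq_zero] at this
        exact this.resolve_right hf
      have h2 := ih _ ((natDegree_derivative_le P).trans (by omega)) h1
      exact hC P (natDegree_eq_zero_of_derivative_eq_zero h2) h0
  exact (transcendental_iff).2 fun P hP => key _ P le_rfl hP

lemma transc_of_der' {A : Type*} [CommRing A] [IsDomain A] [Algebra ℂ A] (δ : Derivation ℂ A A) {f : A} (hf : δ f ≠ 0) :
    Transcendental ℂ f := by
  have := transc_of_der δ ⊥ (fun s hs => by obtain ⟨c, rfl⟩ := Algebra.mem_bot.1 hs; simp) hf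
  intro h
  exact this (IsAlgebraic.extendScalars (R := ℂ) (S := (⊥ : Subalgebra ℂ A)) (algebraMap ℂ (⊥ : Subalgebra ℂ A)).injective h)

lemma algOver_of {n : ℕ} {A : Type*} [CommRing A] [Algebra ℂ A] (Φ : A →ₐ[ℂ] Ent) (hΦ : Function.Injective Φ)
    (F : Fin n → A) (G : A) (h : IsAlgebraic (Algebra.adjoin ℂ (range F)) G) :
    AlgOver (fun i => (Φ (F i) : ℂ → ℂ)) (Φ G : ℂ → ℂ) := by
  obtain ⟨q, hq0, hq⟩ := h
  let π : MvPolynomial (Fin n) ℂ →ₐ[ℂ] Algebra.adjoin ℂ (range F) :=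
    (MvPolynomial.aeval F).codRestrict _ (fun P => by
      rw [Algebra.adjoin_range_eq_range_aeval]; exact ⟨P, rfl⟩)
  have hπ : Function.Surjective π := by
    rintro ⟨y, hy⟩
    rw [Algebra.adjoin_range_eq_range_aeval] at hy
    obtain ⟨P, hP⟩ := hy
    exact ⟨P, Subtype.ext hP⟩
  obtain ⟨Q, rfl⟩ := Polynomial.map_surjective π.toRingHom hπ q
  have hev : ∀ x, MvPolynomial.eval (fun i => (Φ (F i) : ℂ → ℂ) x) = 
      (((evE x).comp Φ).toRingHom.comp (algebraMap (Algebra.adjoin ℂ (range F)) A)).comp π.toRingHom := by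
    intro x
    apply MvPolynomial.ringHom_ext
    · intro r; simp [evE_apply, MvPolynomial.algebraMap_eq]
    · intro i; simp [evE_apply]
      have : (π (MvPolynomial.X i) : A) = F i := by simp [π]
      rw [this]
  refine ⟨Q, fun x => ?_, ?_⟩
  · have h2 : evE x (Φ (aeval G (Q.map π.toRingHom))) = 0 := by rw [hq]; simp
    rw [hev x, ← Polynomial.map_map]
    rw [aeval_def, eval₂_eq_eval_map] at h2
    rw [← h2, ← Polynomial.map_map]
    exact (Polynomial.eval_map_apply (f := ((evE x).comp Φ).toRingHom) (p := map (algebraMap _ A) (Q.map π.toRingHom)) G)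
  · by_contra! hc
    apply hq0
    ext1 m
    have h1 : ∀ x, evE x (Φ ((Q.map π.toRingHom).coeff m : A)) = 0 := by
      intro x
      have := congrArg (fun p => p.coeff m) (hc x)
      simp only [coeff_map, coeff_zero] at this ⊢
      rw [hev x] at this
      exact this
    have h2 : Φ ((Q.map π.toRingHom).coeff m : A) = 0 := Ent.ext' h1
    exact Subtype.ext (hΦ (h2.trans (map_zero Φ).symm))
end
end FileB4

section FileB5
open MeasureTheory Set Filter Topology
noncomputable section
open Polynomial

def om (T : ℝ) : ℂ := 2 * Real.pi * Complex.I / T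
lemma om_ne {T : ℝ} (hT : 0 < T) : om T ≠ 0 := by
  have := Complex.two_pi_I_ne_zero
  exact div_ne_zero this (by exact_mod_cast hT.ne')
lemma om_T {T : ℝ} (hT : 0 < T) : om T * T = 2 * Real.pi * Complex.I := by
  have : (T : ℂ) ≠ 0 := by exact_mod_cast hT.ne'
  unfold om; field_simp

def exE (c : ℂ) : Ent := Ent.mk (fun x => Complex.exp (c * x)) (by fun_prop)
lemma exE_mul (c d : ℂ) : exE c * exE d = exE (c + d) :=
  Ent.ext' (fun x => by change Complex.exp _ * Complex.exp _ = Complex.exp _; rw [← Complex.exp_add]; ring_nf)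
lemma exE_zero : exE 0 = 1 := Ent.ext' (fun x => by change Complex.exp _ = 1; simp)
lemma dE_exE (c : ℂ) : dE (exE c) = c • exE c := by
  refine Ent.ext' (fun x => ?_)
  change deriv (fun x => Complex.exp (c * x)) x = c * Complex.exp (c * x)
  have := (((hasDerivAt_id x).const_mul c).cexp).deriv
  simp only [id, mul_one] at this; rw [this, mul_comm]

def uE (T : ℝ) : Entˣ := ⟨exE (om T), exE (-om T), by rw [exE_mul]; simp [exE_zero], by rw [exE_mul]; simp [exE_zero]⟩

def lE (T : ℝ) : LL →ₐ[ℂ] Ent :=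
  { LaurentPolynomial.eval₂ (algebraMap ℂ Ent) (uE T) with
    commutes' := fun r => LaurentPolynomial.eval₂_C _ _ r }

lemma lE_T (T : ℝ) (j : ℤ) : lE T (LaurentPolynomial.T j) = exE (j * om T) := by
  have h : lE T (LaurentPolynomial.T j) = ((uE T ^ j : Entˣ) : Ent) := LaurentPolynomial.eval₂_T _ _ j
  rw [h]
  refine Ent.ext' (fun x => ?_)
  have h2 : Units.map (evE x : Ent →* ℂ) (uE T ^ j) = (Units.map (evE x : Ent →* ℂ) (uE T)) ^ j := map_zpow _ _ _
  have h3 := congrArg Units.val h2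
  rw [Units.val_zpow_eq_zpow_val] at h3
  change ((uE T ^ j : Entˣ) : Ent).fn x = (Complex.exp (om T * x)) ^ j at h3
  rw [h3, ← Complex.exp_int_mul]
  change _ = Complex.exp _; ring_nf

lemma LL_smul (a : ℂ) (j : ℤ) : (LaurentPolynomial.C a * LaurentPolynomial.T j : LL) = a • LaurentPolynomial.T j := by
  rw [LaurentPolynomial.smul_eq_C_mul]

lemma lE_inj {T : ℝ} (hT : 0 < T) : Function.Injective (lE T) := by
  rw [injective_iff_map_eq_zero]
  intro f hf
  obtain ⟨m, q, hq⟩ := f.exists_T_pow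
  have h1 : lE T (toLaurent q) = 0 := by rw [hq, map_mul, hf, zero_mul]
  have h2 : ∀ z : ℂ, z ≠ 0 → q.eval z = 0 := by
    intro z hz
    have h3 := congrArg (evE (Complex.log z / om T)) (show lE T (toLaurent q) = aeval (exE (om T)) q from LaurentPolynomial.eval₂_toLaurent _ _ q)
    rw [h1, map_zero, ← aeval_algHom_apply] at h3
    rw [← coe_aeval_eq_eval, h3]
    change aeval z q = aeval (Complex.exp (om T * (Complex.log z / om T))) q
    rw [mul_div_cancel₀ _ (om_ne hT), Complex.exp_log hz]
  have h3 : q = 0 := by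
    refine Polynomial.eq_zero_of_infinite_isRoot q (Set.Infinite.mono (s := {z : ℂ | z ≠ 0}) (fun z hz => h2 z hz) ?_)
    exact (Set.finite_singleton (0:ℂ)).infinite_compl
  rw [h3, map_zero] at hq
  exact (mul_eq_zero.1 hq.symm).resolve_right (LaurentPolynomial.isUnit_T _).ne_zero

lemma lE_per {T : ℝ} (hT : 0 < T) (f : LL) (x : ℂ) : (lE T f : ℂ → ℂ) (x + T) = (lE T f : ℂ → ℂ) x := by
  induction f using LaurentPolynomial.induction_on' with
  | add p q hp hq => rw [map_add, fn_add, fn_add, hp, hq]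
  | C_mul_T j a =>
    rw [LL_smul, map_smul, lE_T]
    change a * Complex.exp _ = a * Complex.exp _
    rw [mul_add, Complex.exp_add, mul_assoc (j:ℂ), mul_assoc (j:ℂ), om_T hT, Complex.exp_int_mul_two_pi_mul_I, mul_one]

def pE (T : ℝ) : LL[X] →ₐ[ℂ] Ent[X] := Polynomial.mapAlgHom (lE T)
def PT (T : ℝ) : LL[X] →ₐ[ℂ] Ent := dg.comp (pE T)

lemma pE_inj {T : ℝ} (hT : 0 < T) : Function.Injective (pE T) := Polynomial.map_injective (lE T).toRingHom (lE_inj hT)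

lemma PT_C (T : ℝ) (a : LL) : PT T (C a) = lE T a := by
  change dg (map (lE T).toRingHom (C a)) = _
  rw [map_C, dg_apply, eval_C]; rfl
lemma PT_X (T : ℝ) : PT T X = idE := by
  change dg (map (lE T).toRingHom X) = _
  rw [map_X, dg_apply, eval_X]

lemma evE_PT (T : ℝ) (F : LL[X]) (x : ℂ) : evE x (PT T F) = (F.map ((evE x).comp (lE T)).toRingHom).eval x := by
  change evE x (dg (map (lE T).toRingHom F)) = _
  rw [dg_apply]
  exact (Polynomial.eval_map_apply (f := (evE x).toRingHom) (p := map (lE T).toRingHom F) idE).symm.trans (by rw [Polynomial.map_map]; rfl)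

lemma PT_inj {T : ℝ} (hT : 0 < T) : Function.Injective (PT T) := by
  rw [injective_iff_map_eq_zero]
  intro F hF
  have key : ∀ z, F.map ((evE z).comp (lE T)).toRingHom = 0 := by
    intro z
    have hp : ∀ N : ℕ, ((evE (z + N * T)).comp (lE T)).toRingHom = ((evE z).comp (lE T)).toRingHom := by
      intro N
      refine RingHom.ext fun f => ?_
      change (lE T f : ℂ → ℂ) _ = (lE T f : ℂ → ℂ) _
      induction N with
      | zero => simp
      | succ N ih => rw [← ih, ← lE_per hT f (z + N * T)]; push_cast; ring_nf
    refine Polynomial.eq_zero_of_infinite_isRoot _ (Set.Infinite.mono (s := range fun N : ℕ => z + N * (T:ℂ)) ?_ (Set.infinite_range_of_injective fun a b h => ?_))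
    · rintro _ ⟨N, rfl⟩
      have := evE_PT T F (z + N * T)
      rw [hp N, hF, map_zero] at this
      exact this.symm
    · have hT' : (T : ℂ) ≠ 0 := by exact_mod_cast hT.ne'
      simpa [hT'] using h
  ext1 m
  refine lE_inj hT (Ent.ext' (fun z => ?_))
  have := congrArg (fun p => p.coeff m) (key z)
  simpa [evE_apply, fn_zero] using this

lemma LLX_ind {M : LL[X] → Prop} (hadd : ∀ p q, M p → M q → M (p + q))
    (hm : ∀ (m : ℕ) (j : ℤ) (a : ℂ), M (a • (C (LaurentPolynomial.T j) * X ^ m))) (F : LL[X]) : M F := by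
  induction F using Polynomial.induction_on' with
  | add p q hp hq => exact hadd p q hp hq
  | monomial m a =>
    induction a using LaurentPolynomial.induction_on' with
    | add p q hp hq => rw [map_add]; exact hadd _ _ hp hq
    | C_mul_T j a => 
      have := hm m j a
      rwa [← C_mul_X_pow_eq_monomial, LL_smul, ← smul_C, smul_mul_assoc]

lemma PT_mon (T : ℝ) (j : ℤ) (m : ℕ) : PT T (C (LaurentPolynomial.T j) * X ^ m) = exE (j * om T) * idE ^ m := by
  rw [map_mul, map_pow, PT_C, PT_X, lE_T]

lemma PT_der (T : ℝ) (F : LL[X]) : ∃ G, dE (PT T F) = PT T G := by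
  induction F using LLX_ind with
  | hadd p q hp hq => 
    obtain ⟨G, hG⟩ := hp; obtain ⟨H, hH⟩ := hq
    exact ⟨G + H, by simp [hG, hH]⟩
  | hm m j a =>
    refine ⟨a • ((j * om T) • (C (LaurentPolynomial.T j) * X ^ m) + (m : ℂ) • (C (LaurentPolynomial.T j) * X ^ (m-1))), ?_⟩
    simp only [map_smul, map_add, PT_mon, Derivation.map_smul, Derivation.leibniz, Derivation.leibniz_pow, dE_exE, dE_id, smul_eq_mul]
    congr 1
    simp only [Algebra.smul_def, nsmul_eq_mul, map_mul, map_natCast, eq_natCast]; ring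

lemma PT_prim {T : ℝ} (hT : 0 < T) (F : LL[X]) : ∃ G, dE (PT T G) = PT T F := by
  induction F using LLX_ind with
  | hadd p q hp hq => 
    obtain ⟨G, hG⟩ := hp; obtain ⟨H, hH⟩ := hq
    exact ⟨G + H, by simp [hG, hH]⟩
  | hm m j a =>
    suffices h : ∃ G, dE (PT T G) = PT T (C (LaurentPolynomial.T j) * X ^ m) by
      obtain ⟨G, hG⟩ := h
      exact ⟨a • G, by simp only [map_smul, Derivation.map_smul, hG]⟩
    by_cases hj : j = 0
    · subst hj
      refine ⟨((m + 1 : ℂ)⁻¹) • X ^ (m+1), ?_⟩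
      have : (m + 1 : ℂ) ≠ 0 := by exact_mod_cast m.succ_ne_zero
      rw [PT_mon, map_smul, map_pow, PT_X, Derivation.map_smul, Derivation.leibniz_pow, dE_id]
      simp only [Int.cast_zero, zero_mul, exE_zero, one_mul, add_tsub_cancel_right, smul_eq_mul, mul_one]
      rw [← Nat.cast_smul_eq_nsmul ℂ, smul_smul]; push_cast; rw [inv_mul_cancel₀ this, one_smul]
    · have hj' : (j * om T : ℂ) ≠ 0 := mul_ne_zero (by exact_mod_cast hj) (om_ne hT)
      induction m with
      | zero => 
        refine ⟨(j * om T : ℂ)⁻¹ • (C (LaurentPolynomial.T j) * X ^ 0), ?_⟩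
        rw [map_smul, PT_mon, pow_zero, mul_one, Derivation.map_smul, dE_exE, smul_smul, inv_mul_cancel₀ hj', one_smul]
      | succ m ih =>
        obtain ⟨G, hG⟩ := ih
        refine ⟨(j * om T : ℂ)⁻¹ • (C (LaurentPolynomial.T j) * X ^ (m+1) - (m+1 : ℂ) • G), ?_⟩
        simp only [map_smul, map_sub, PT_mon, Derivation.map_smul, Derivation.leibniz, Derivation.leibniz_pow, dE_exE, dE_id, smul_eq_mul, hG]
        rw [inv_smul_eq_iff₀ hj']
        simp only [Algebra.smul_def]; simp; ring

lemma J_mem_PT {n : ℕ} {T : ℝ} (hT : 0 < T) (F : Fin n → LL[X]) {J : List (Fin n) → ℂ → ℂ} 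
    (hJ : IsJ (fun i => (PT T (F i) : ℂ → ℂ)) J) (l : List (Fin n)) : ∃ G, J l = (PT T G : ℂ → ℂ) := by
  induction l with
  | nil => exact ⟨1, by rw [hJ.nil, map_one]; rfl⟩
  | cons i l ih =>
    obtain ⟨H, hH⟩ := ih
    obtain ⟨K, hK⟩ := PT_der T (F i)
    obtain ⟨G, hG⟩ := PT_prim hT (K * H)
    obtain ⟨c, hc⟩ := dE_eq_zero (f := Ent.mk (J (i :: l)) (hJ.hd _) - PT T G) (by
      rw [map_sub, hG, map_mul, ← hK, sub_eq_zero]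
      refine Ent.ext' (fun x => ?_)
      change deriv (J (i :: l)) x = deriv (PT T (F i)) x * (PT T H : ℂ → ℂ) x
      rw [hJ.der, hH])
    refine ⟨G + algebraMap ℂ _ c, ?_⟩
    rw [map_add, AlgHom.commutes, ← hc]; simp [fn_mk]

/-- case I -/
lemma alg_caseI {n : ℕ} {T : ℝ} (hT : 0 < T) (F : Fin n → LL[X]) (i j : Fin n) (h : br (pE T (F i)) (pE T (F j)) ≠ 0) :
    Alg (fun i => (PT T (F i) : ℂ → ℂ)) := by
  intro J hJ l
  obtain ⟨G, hG⟩ := J_mem_PT hT F hJ l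
  rw [hG]
  have h1 : Transcendental ℂ (F i) := by
    have : br (pE T (F j)) (pE T (F i)) ≠ 0 := by
      rw [br_apply] at h ⊢; intro h0; apply h; linear_combination -h0
    intro ha
    exact transc_of_der' _ this (ha.algHom (pE T))
  have h2 : Transcendental (Algebra.adjoin ℂ {F i}) (F j) := by
    intro ha
    have h3 := transc_of_der (br (pE T (F i))) (Algebra.adjoin ℂ {pE T (F i)}) (fun s hs => by
      refine Algebra.adjoin_induction (p := fun s _ => br (pE T (F i)) s = 0) ?_ ?_ ?_ ?_ hs
      · rintro x rfl; rw [br_apply]; ring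
      · intro r; exact Derivation.map_algebraMap _ r
      · intro x y _ _ hx hy; rw [map_add, hx, hy, add_zero]
      · intro x y _ _ hx hy; rw [Derivation.leibniz, hx, hy]; simp) h
    apply h3
    have hmem : ∀ y : Algebra.adjoin ℂ {F i}, pE T y ∈ Algebra.adjoin ℂ {pE T (F i)} := fun y => by
      have := (AlgHom.map_adjoin (pE T) {F i}) ▸ (Subalgebra.mem_map.2 ⟨y.1, y.2, rfl⟩ : pE T y ∈ (Algebra.adjoin ℂ {F i}).map (pE T))
      rwa [image_singleton] at this
    let ρ : Algebra.adjoin ℂ {F i} →+* Algebra.adjoin ℂ {pE T (F i)} :=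
      (((pE T).comp (Algebra.adjoin ℂ {F i}).val).codRestrict _ hmem).toRingHom
    have hρ : Function.Injective ρ := fun a b hab => Subtype.ext (pE_inj hT (congrArg Subtype.val hab))
    exact IsAlgebraic.ringHom_of_comp_eq ρ (pE T).toRingHom (a := F j) ha hρ (RingHom.ext fun _ => rfl)
  have := alg_two h1 h2 G
  refine algOver_of (PT T) (PT_inj hT) F G ?_
  have hle : Algebra.adjoin ℂ {F j, F i} ≤ Algebra.adjoin ℂ (range F) := Algebra.adjoin_mono (by
    rintro x (rfl | rfl) <;> exact mem_range_self _)
  exact IsAlgebraic.ringHom_of_comp_eq (Subalgebra.inclusion hle).toRingHom (RingHom.id _) (a := G) this (Subalgebra.inclusion_injective hle) (RingHom.ext fun _ => rfl)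
end
end FileB5

section FileB6
open MeasureTheory Set Filter Topology
noncomputable section
open Polynomial

lemma alg_one' {A : Type} [CommRing A] [IsDomain A] [Algebra ℂ A] (hA : Algebra.trdeg ℂ A ≤ 1) {f : A} (hf : Transcendental ℂ f) (g : A) :
    IsAlgebraic (Algebra.adjoin ℂ {f}) g := by
  have hi : AlgebraicIndependent ℂ (fun _ : Unit => f) := algebraicIndependent_unique_type_iff.2 hf
  have hb := AlgebraicIndependent.isTranscendenceBasis_of_trdeg_le_of_finite hi (by simpa using hA)
  have := hb.isAlgebraic
  rw [range_const] at this
  exact this.isAlgebraic g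

lemma exists_Q {A : Type*} [CommRing A] [Algebra ℂ A] {a b : A} (h : IsAlgebraic (Algebra.adjoin ℂ {a}) b) :
    ∃ Q : ℂ[X][X], Q ≠ 0 ∧ (Q.map (aeval a).toRingHom).eval b = 0 := by
  obtain ⟨q, hq0, hq⟩ := h
  let π : ℂ[X] →ₐ[ℂ] Algebra.adjoin ℂ {a} :=
    (aeval a).codRestrict _ (fun P => by rw [Algebra.adjoin_singleton_eq_range_aeval]; exact ⟨P, rfl⟩)
  have hπ : Function.Surjective π := by
    rintro ⟨y, hy⟩
    rw [Algebra.adjoin_singleton_eq_range_aeval] at hy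
    obtain ⟨P, hP⟩ := hy
    exact ⟨P, Subtype.ext hP⟩
  obtain ⟨Q, rfl⟩ := Polynomial.map_surjective π.toRingHom hπ q
  refine ⟨Q, fun h => hq0 (by rw [h, Polynomial.map_zero]), ?_⟩
  rw [aeval_def, eval₂_eq_eval_map, Polynomial.map_map] at hq
  exact hq

lemma of_Q {A : Type*} [CommRing A] [Algebra ℂ A] {a b : A} (ha : Transcendental ℂ a) (S : Subalgebra ℂ A) (haS : a ∈ S)
    {Q : ℂ[X][X]} (hQ : Q ≠ 0) (h : (Q.map (aeval a).toRingHom).eval b = 0) : IsAlgebraic S b := by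
  refine ⟨Q.map (aeval (⟨a, haS⟩ : S)).toRingHom, ?_, ?_⟩
  · refine (Polynomial.map_ne_zero_iff ?_).2 hQ
    refine (injective_iff_map_eq_zero _).2 fun P hP => ?_
    refine (transcendental_iff.1 ha) P ?_
    have := congrArg S.val hP
    change S.val (aeval _ P) = S.val 0 at this
    rw [← aeval_algHom_apply, map_zero] at this
    exact this
  · rw [aeval_def, eval₂_eq_eval_map, Polynomial.map_map]
    convert! h
    refine Polynomial.ringHom_ext (fun r => ?_) ?_
    · simp
    · simp

lemma der_surj (p : Ent[X]) : ∃ q, px q = p := by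
  induction p using Polynomial.induction_on' with
  | add p q hp hq => 
    obtain ⟨a, ha⟩ := hp; obtain ⟨b, hb⟩ := hq
    exact ⟨a + b, by rw [map_add, ha, hb]⟩
  | monomial m a =>
    refine ⟨monomial (m+1) (((m:ℂ)+1)⁻¹ • a), ?_⟩
    have : (m + 1 : ℂ) ≠ 0 := by exact_mod_cast m.succ_ne_zero
    rw [px_apply, derivative_monomial]
    congr 1
    rw [smul_mul_assoc, inv_smul_eq_iff₀ this, Algebra.smul_def, mul_comm]; simp

/-- order argument -/
lemma order_br {f G : Ent[X]} (z : ℂ) (hf : (px f).map (evE z).toRingHom ≠ 0) (hb : br f G = 0)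
    (hG : G.map (evE z).toRingHom = 0) : G = 0 := by
  set τ : Ent := idE - algebraMap ℂ Ent z with hτ
  have hdτ : dE τ = 1 := by rw [hτ, map_sub, dE_id]; simp
  have hdvd : ∀ p : Ent[X], C τ ∣ p ↔ p.map (evE z).toRingHom = 0 := by
    intro p
    constructor
    · rintro ⟨q, rfl⟩
      have : (evE z).toRingHom τ = 0 := by
        change idE.fn z - z = 0
        exact sub_self z
      rw [Polynomial.map_mul, map_C, this]; simp
    · intro h
      rw [C_dvd_iff_dvd_coeff]
      intro i
      have := congrArg (fun p => p.coeff i) h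
      simp only [coeff_map, coeff_zero] at this
      exact evE_eq_zero this
  have hτ0 : (C τ : Ent[X]) ≠ 0 := by
    intro h
    rw [C_eq_zero] at h; rw [h, map_zero] at hdτ; exact zero_ne_one hdτ
  have key : ∀ k : ℕ, C τ ^ k ∣ G := by
    intro k
    induction k with
    | zero => simp
    | succ k ih =>
      rcases Nat.eq_zero_or_pos k with rfl | hk
      · simpa using (hdvd G).2 hG
      obtain ⟨G', rfl⟩ := ih
      rw [pow_succ]
      refine mul_dvd_mul_left _ ?_
      have e1 : br f (C τ ^ k) = - (px f * ((k : Ent[X]) * C τ ^ (k-1))) := by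
        rw [Derivation.leibniz_pow, br_apply, px_apply (C τ), derivative_C, pt_C, hdτ, C_1]
        simp only [smul_eq_mul, nsmul_eq_mul]; ring
      rw [Derivation.leibniz, e1] at hb
      obtain ⟨k, rfl⟩ : ∃ k', k = k' + 1 := ⟨k - 1, by omega⟩
      simp only [add_tsub_cancel_right, smul_eq_mul] at hb
      have h2 : C τ * br f G' = ((k + 1 : ℕ) : Ent[X]) * (px f * G') := by
        refine mul_left_cancel₀ (pow_ne_zero k hτ0) ?_
        linear_combination hb
      have h3 := (hdvd _).1 ⟨_, h2.symm⟩
      rw [Polynomial.map_mul, Polynomial.map_mul, Polynomial.map_natCast, mul_eq_zero, mul_eq_zero] at h3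
      rcases h3 with h | h | h
      · exact absurd h (Nat.cast_ne_zero.2 k.succ_ne_zero)
      · exact absurd h hf
      · exact (hdvd _).2 h
  ext1 i
  refine eq_zero_of_pow_dvd (z := z) fun k => ?_
  have := key k
  rw [← C_pow, C_dvd_iff_dvd_coeff] at this
  exact this i

lemma J_tilde {n : ℕ} (p : Fin n → Ent[X]) (hbr : ∀ i j, br (p i) (p j) = 0) {J : List (Fin n) → ℂ → ℂ} 
    (hJ : IsJ (fun i => (dg (p i) : ℂ → ℂ)) J) (l : List (Fin n)) :
    ∃ H : Ent[X], J l = (dg H : ℂ → ℂ) ∧ ∀ j, br (p j) H = 0 := by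
  induction l with
  | nil => exact ⟨1, by rw [hJ.nil, map_one]; rfl, fun j => Derivation.map_one_eq_zero _⟩
  | cons i l ih =>
    obtain ⟨H, hH, hb⟩ := ih
    obtain ⟨K0, hK0⟩ := der_surj (H * px (p i))
    have h1 : px (pt K0 - H * pt (p i)) = 0 := by
      rw [map_sub, ← pt_px, hK0, Derivation.leibniz, Derivation.leibniz, pt_px]
      have := hb i
      rw [br_apply] at this
      simp only [smul_eq_mul]; linear_combination -this
    obtain ⟨a, ha⟩ : ∃ a, pt K0 - H * pt (p i) = C a :=
      ⟨_, eq_C_of_natDegree_eq_zero (natDegree_eq_zero_of_derivative_eq_zero h1)⟩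
    obtain ⟨b, hb1, -⟩ := dE_surj a 0 0
    have hx : ∀ c, px (K0 - C b + algebraMap ℂ _ c) = H * px (p i) := fun c => by
      rw [map_add, map_sub, hK0, Derivation.map_algebraMap, px_apply (C b), derivative_C]; ring
    have ht : ∀ c, pt (K0 - C b + algebraMap ℂ _ c) = H * pt (p i) := fun c => by
      rw [map_add, map_sub, Derivation.map_algebraMap, pt_C, hb1, ← ha]; ring
    obtain ⟨c, hc⟩ := dE_eq_zero (f := Ent.mk (J (i :: l)) (hJ.hd _) - dg (K0 - C b + algebraMap ℂ _ 0)) (by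
      rw [map_sub, dE_dg, hx, ht, map_mul, map_mul, sub_eq_zero, ← mul_add, ← dE_dg]
      refine Ent.ext' fun x => ?_
      change deriv (J (i :: l)) x = (dg H).fn x * deriv (dg (p i)).fn x
      rw [hJ.der, hH, mul_comm])
    refine ⟨K0 - C b + algebraMap ℂ _ c, ?_, fun j => ?_⟩
    · rw [map_add, AlgHom.commutes, ← hc]; simp [fn_mk]
    · rw [br_apply, hx, ht]
      have := hbr j i
      rw [br_apply] at this
      linear_combination H * this

lemma alg_caseIIa {n : ℕ} (p : Fin n → Ent[X]) (hbr : ∀ i j, br (p i) (p j) = 0) (i : Fin n) (hi : px (p i) ≠ 0)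
    (ht : Transcendental ℂ (dg (p i))) : Alg (fun i => (dg (p i) : ℂ → ℂ)) := by
  intro J hJ l
  obtain ⟨H, hH, hb⟩ := J_tilde p hbr hJ l
  rw [hH]
  obtain ⟨z, hz⟩ : ∃ z, (px (p i)).map (evE z).toRingHom ≠ 0 := by
    by_contra! h
    apply hi
    ext1 m
    refine Ent.ext' fun z => ?_
    have := congrArg (fun p => p.coeff m) (h z)
    simpa [fn_zero, evE_apply] using this
  have htr : Transcendental ℂ ((p i).map (evE z).toRingHom) := by
    refine transc_of_der' (A := ℂ[X]) derivative' ?_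
    change derivative _ ≠ 0
    rwa [derivative_map]
  have halg := alg_one' (A := ℂ[X]) (by rw [Polynomial.trdeg_of_isDomain]) htr (H.map (evE z).toRingHom)
  obtain ⟨Q, hQ0, hQ⟩ := exists_Q halg
  have hG : (Q.map (aeval (p i)).toRingHom).eval H = 0 := by
    refine order_br z hz ?_ ?_
    · clear hQ hQ0
      induction Q using Polynomial.induction_on' with
      | add a b ha hb => rw [Polynomial.map_add, eval_add, map_add, ha, hb, add_zero]
      | monomial m a =>
        rw [map_monomial, eval_monomial, Derivation.leibniz, Derivation.leibniz_pow, hb i]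
        have : br (p i) ((aeval (p i)).toRingHom a) = 0 := by
          change br (p i) (aeval (p i) a) = 0
          rw [Derivation.map_aeval, br_apply]; simp [mul_comm]
        rw [this]; simp
    · rw [← hQ, ← coe_mapRingHom, ← Polynomial.eval_map_apply, Polynomial.map_map]
      congr 2
      refine Polynomial.ringHom_ext (fun r => ?_) ?_
      · simp
      · simp
  refine algOver_of (AlgHom.id ℂ Ent) (fun a b h => h) (fun i => dg (p i)) (dg H) ?_
  refine of_Q ht _ (Algebra.subset_adjoin (mem_range_self i)) hQ0 ?_
  have := congrArg dg hG
  rw [map_zero] at this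
  rw [← this]
  change _ = dg.toRingHom _
  rw [← Polynomial.eval_map_apply, Polynomial.map_map]
  congr 2
  refine Polynomial.ringHom_ext (fun r => ?_) ?_
  · simp; rw [dg_apply, eval_C]
  · simp
end
end FileB6

section FileB7
open MeasureTheory Set Filter Topology
noncomputable section
open Polynomial

def evU {A : Type*} [CommRing A] [Algebra ℂ A] (u : Aˣ) : LL →ₐ[ℂ] A :=
  { LaurentPolynomial.eval₂ (algebraMap ℂ A) u with
    commutes' := fun r => LaurentPolynomial.eval₂_C _ _ r }

lemma evU_T {A : Type*} [CommRing A] [Algebra ℂ A] (u : Aˣ) (j : ℤ) : evU u (LaurentPolynomial.T j) = ((u ^ j : Aˣ) : A) :=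
  LaurentPolynomial.eval₂_T _ _ j

lemma evU_toLaurent {A : Type*} [CommRing A] [Algebra ℂ A] (u : Aˣ) (q : ℂ[X]) : evU u (toLaurent q) = aeval (u : A) q :=
  LaurentPolynomial.eval₂_toLaurent _ _ q

lemma evU_inj {A : Type*} [CommRing A] [IsDomain A] [Algebra ℂ A] (u : Aˣ) (hu : Transcendental ℂ (u : A)) :
    Function.Injective (evU u) := by
  rw [injective_iff_map_eq_zero]
  intro f hf
  obtain ⟨m, q, hq⟩ := f.exists_T_pow
  have h1 : evU u (toLaurent q) = 0 := by rw [hq, map_mul, hf, zero_mul]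
  rw [evU_toLaurent] at h1
  have := (transcendental_iff.1 hu) q h1
  rw [this, map_zero] at hq
  exact (mul_eq_zero.1 hq.symm).resolve_right (LaurentPolynomial.isUnit_T _).ne_zero

abbrev RF := RatFunc ℂ
def toR : LL →ₐ[ℂ] RF := evU (Units.mk0 RatFunc.X RatFunc.X_ne_zero)

lemma aeval_X_RF (q : ℂ[X]) : aeval (RatFunc.X : RF) q = algebraMap ℂ[X] RF q := by
  rw [← RatFunc.algebraMap_X, aeval_algebraMap_apply]; simp

lemma toR_toLaurent (q : ℂ[X]) : toR (toLaurent q) = algebraMap ℂ[X] RF q := by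
  rw [toR, evU_toLaurent]; exact aeval_X_RF q

lemma toR_inj : Function.Injective toR := by
  refine evU_inj _ (transcendental_iff.2 fun p hp => ?_)
  change aeval (RatFunc.X : RF) p = 0 at hp
  rw [aeval_X_RF] at hp
  exact (map_eq_zero_iff _ (RatFunc.algebraMap_injective ℂ)).1 hp

def Hm (D : ℕ) (W p q : ℂ[X]) : ℂ[X] := ∑ k ∈ Finset.range (D+1), C (W.coeff k) * p^k * q^(D-k)

lemma Hm_zero (D : ℕ) (W p q : ℂ[X]) (z : ℂ) (hq : q.eval z = 0) : (Hm D W p q).eval z = W.coeff D * p.eval z ^ D := by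
  rw [Hm, eval_finset_sum, Finset.sum_eq_single D]
  · simp
  · intro b hb hbD
    have : D - b ≠ 0 := by have := Finset.mem_range.1 hb; omega
    simp [hq, this]
  · simp

lemma Hm_alg {K : Type*} [Field K] [Algebra ℂ K] (D : ℕ) (W : ℂ[X]) (hW : W.natDegree ≤ D) (a b : K) (hb : b ≠ 0) :
    ∑ k ∈ Finset.range (D+1), algebraMap ℂ K (W.coeff k) * a^k * b^(D-k) = b ^ D * aeval (a / b) W := by
  rw [aeval_eq_sum_range' (Nat.lt_succ_of_le hW), Finset.mul_sum]
  refine Finset.sum_congr rfl fun k hk => ?_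
  have : k ≤ D := by have := Finset.mem_range.1 hk; omega
  obtain ⟨e, rfl⟩ := Nat.exists_eq_add_of_le this
  rw [Algebra.smul_def, div_pow, pow_add, Nat.add_sub_cancel_left]
  field_simp

lemma Hm_eval (D : ℕ) (W p q : ℂ[X]) (hW : W.natDegree ≤ D) (z : ℂ) (hq : q.eval z ≠ 0) :
    (Hm D W p q).eval z = q.eval z ^ D * W.eval (p.eval z / q.eval z) := by
  have := Hm_alg D W hW (p.eval z) (q.eval z) hq
  rw [coe_aeval_eq_eval] at this
  rw [← this, Hm, eval_finset_sum]
  simp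

lemma Hm_RF (D : ℕ) (W p q : ℂ[X]) (hW : W.natDegree ≤ D) (hq : q ≠ 0) :
    algebraMap ℂ[X] RF (Hm D W p q) = algebraMap ℂ[X] RF q ^ D * aeval (algebraMap ℂ[X] RF p / algebraMap ℂ[X] RF q) W := by
  rw [← Hm_alg D W hW _ _ ((map_ne_zero_iff _ (RatFunc.algebraMap_injective ℂ)).2 hq), Hm, map_sum]
  refine Finset.sum_congr rfl fun k _ => ?_
  simp only [map_mul, map_pow]
  congr 2

lemma Hm_coeff (D : ℕ) (W p q : ℂ[X]) (d : ℕ) (hp : p.natDegree ≤ d) (hqd : q.natDegree ≤ d) :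
    (Hm D W p q).natDegree ≤ D * d ∧ (Hm D W p q).coeff (D * d) = ∑ k ∈ Finset.range (D+1), W.coeff k * p.coeff d ^k * q.coeff d^(D-k) := by
  have key : ∀ k ∈ Finset.range (D+1), (p^k * q^(D-k)).natDegree ≤ D * d ∧ (p^k * q^(D-k)).coeff (D*d) = p.coeff d ^k * q.coeff d^(D-k) := by
    intro k hk
    have : k ≤ D := by have := Finset.mem_range.1 hk; omega
    have e : D * d = k * d + (D - k) * d := by rw [← add_mul]; congr 1; omega
    rw [e]
    have h1 := natDegree_pow_le_of_le k hp
    have h2 := natDegree_pow_le_of_le (D-k) hqd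
    exact ⟨natDegree_mul_le_of_le h1 h2, by
      rw [coeff_mul_add_eq_of_natDegree_le h1 h2, coeff_pow_of_natDegree_le hp, coeff_pow_of_natDegree_le hqd]⟩
  constructor
  · refine natDegree_sum_le_of_forall_le _ _ fun k hk => ?_
    rw [mul_assoc]
    exact (natDegree_C_mul_le _ _).trans (key k hk).1
  · rw [Hm, finset_sum_coeff]
    refine Finset.sum_congr rfl fun k hk => ?_
    rw [mul_assoc, coeff_C_mul, (key k hk).2, mul_assoc]

lemma only_root_zero {q : ℂ[X]} (hq : q ≠ 0) (h : ∀ z, z ≠ 0 → q.eval z ≠ 0) : ∃ κ : ℂ, κ ≠ 0 ∧ ∃ m : ℕ, q = C κ * X ^ m := by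
  obtain ⟨r, hr, hnd⟩ := Polynomial.exists_eq_pow_rootMultiplicity_mul_and_not_dvd q hq 0
  have hd : r.degree ≤ 0 := by
    by_contra hlt
    obtain ⟨z, hz⟩ := IsAlgClosed.exists_root r (by intro h0; rw [h0] at hlt; exact hlt le_rfl)
    by_cases hz0 : z = 0
    · subst hz0; exact hnd (dvd_iff_isRoot.2 hz)
    · exact h z hz0 (by rw [hr, eval_mul, hz.eq_zero, mul_zero])
  rw [eq_C_of_degree_le_zero hd] at hr
  refine ⟨r.coeff 0, ?_, _, by rw [map_zero, sub_zero, mul_comm] at hr; exact hr⟩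
  intro h0; rw [h0] at hr; simp at hr; exact hq hr

lemma key_form {h : RF} {x : RF} (hx : x ∈ IntermediateField.adjoin ℂ {h}) :
    ∃ U W : ℂ[X], IsCoprime U W ∧ aeval h W ≠ 0 ∧ x * aeval h W = aeval h U := by
  obtain ⟨r, s, rfl⟩ := (IntermediateField.mem_adjoin_simple_iff ℂ x).1 hx
  by_cases hs : aeval h s = 0
  · exact ⟨0, 1, isCoprime_one_right, by simp, by simp [hs]⟩
  · have hs0 : s ≠ 0 := by rintro rfl; simp at hs
    obtain ⟨r', hr⟩ := EuclideanDomain.gcd_dvd_left r s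
    obtain ⟨s', hs'⟩ := EuclideanDomain.gcd_dvd_right r s
    have hg : EuclideanDomain.gcd r s ≠ 0 := by intro h; rw [h, zero_mul] at hs'; exact hs0 hs'
    have hc : IsCoprime r' s' := by
      have := EuclideanDomain.gcd_eq_gcd_ab r s
      refine ⟨EuclideanDomain.gcdA r s, EuclideanDomain.gcdB r s, mul_left_cancel₀ hg ?_⟩
      linear_combination -this - hr * EuclideanDomain.gcdA r s - hs' * EuclideanDomain.gcdB r s
    have e1 := congrArg (aeval h) hr
    have e2 := congrArg (aeval h) hs'
    rw [map_mul] at e1 e2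
    have hs1 : aeval h s' ≠ 0 := by intro h0; rw [h0, mul_zero] at e2; exact hs e2
    refine ⟨r', s', hc, hs1, ?_⟩
    have hg1 : aeval h (EuclideanDomain.gcd r s) ≠ 0 := by intro h0; rw [h0, zero_mul] at e2; exact hs e2
    rw [e1, e2]; field_simp
end
end FileB7

section FileB8
open MeasureTheory Set Filter Topology
noncomputable section
open Polynomial

lemma luroth_norm (L : IntermediateField ℂ RF) (hL : L ≠ ⊥) : ∃ p q : ℂ[X], IsCoprime p q ∧ q ≠ 0 ∧ q.eval 0 = 0 ∧
    L = IntermediateField.adjoin ℂ {algebraMap ℂ[X] RF p / algebraMap ℂ[X] RF q} := by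
  have hgen := RatFunc.Luroth.eq_adjoin_generator (E := L)
  have hnc : ∀ c, RatFunc.Luroth.generator L ≠ RatFunc.C c := fun c hc => RatFunc.Luroth.generator_ne_C hL ⟨c, hc⟩
  set h := RatFunc.Luroth.generator L
  have hnd := RatFunc.num_div_denom h
  have hd0 := RatFunc.denom_ne_zero h
  have hcop := RatFunc.isCoprime_num_denom h
  by_cases h0 : h.denom.eval 0 = 0
  · exact ⟨_, _, hcop, hd0, h0, by rw [hnd]; exact hgen⟩
  set c := h.num.eval 0 / h.denom.eval 0 with hc
  have hD0 : algebraMap ℂ[X] RF h.denom ≠ 0 := (map_ne_zero_iff _ (RatFunc.algebraMap_injective ℂ)).2 hd0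
  have hCc : algebraMap ℂ[X] RF (C c) = algebraMap ℂ RF c := rfl
  have hsub : h - algebraMap ℂ RF c = algebraMap ℂ[X] RF (h.num - C c * h.denom) / algebraMap ℂ[X] RF h.denom := by
    conv_lhs => rw [← hnd]
    rw [map_sub, map_mul, hCc]; field_simp
  have hne : h - algebraMap ℂ RF c ≠ 0 := fun h1 => hnc c (sub_eq_zero.1 h1)
  have hq0 : h.num - C c * h.denom ≠ 0 := by
    intro h1; rw [h1] at hsub; simp at hsub; exact hne hsub
  refine ⟨h.denom, h.num - C c * h.denom, ?_, hq0, ?_, ?_⟩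
  · obtain ⟨a, b, hab⟩ := hcop
    exact ⟨b + a * C c, a, by linear_combination hab⟩
  · rw [eval_sub, eval_mul, eval_C, hc, div_mul_cancel₀ _ h0, sub_self]
  · have e : algebraMap ℂ[X] RF h.denom / algebraMap ℂ[X] RF (h.num - C c * h.denom) = (h - algebraMap ℂ RF c)⁻¹ := by
      rw [hsub, inv_div]
    rw [e]
    conv_lhs => rw [hgen]
    apply le_antisymm
    · rw [IntermediateField.adjoin_simple_le_iff]
      have h1 := IntermediateField.mem_adjoin_simple_self ℂ ((h - algebraMap ℂ RF c)⁻¹)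
      have h2 := add_mem (inv_mem h1) (algebraMap_mem (IntermediateField.adjoin ℂ {(h - algebraMap ℂ RF c)⁻¹}) c)
      rwa [inv_inv, sub_add_cancel] at h2
    · rw [IntermediateField.adjoin_simple_le_iff]
      exact inv_mem (sub_mem (IntermediateField.mem_adjoin_simple_self ℂ h) (algebraMap_mem _ c))

/-- bundled consequences of `f = U(h)/W(h)` -/
lemma form_poly {p q : ℂ[X]} (hq : q ≠ 0) {f : LL} {N : ℕ} {F : ℂ[X]} (hF : toLaurent F = f * LaurentPolynomial.T N)
    {U W : ℂ[X]} (hUW : toR f * aeval (algebraMap ℂ[X] RF p / algebraMap ℂ[X] RF q) W = aeval (algebraMap ℂ[X] RF p / algebraMap ℂ[X] RF q) U)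
    {D : ℕ} (hU : U.natDegree ≤ D) (hW : W.natDegree ≤ D) :
    F * Hm D W p q = X ^ N * Hm D U p q := by
  apply RatFunc.algebraMap_injective ℂ
  rw [map_mul, map_mul, Hm_RF D W p q hW hq, Hm_RF D U p q hU hq, ← hUW, ← toR_toLaurent F, hF, map_mul, ← toR_toLaurent (X ^ N), toLaurent_X_pow]
  ring

lemma luroth_dich {n : ℕ} (f : Fin n → LL) (i0 i1 : Fin n) {N0 N1 : ℕ} {F0 F1 : ℂ[X]} (hN0 : N0 ≠ 0)
    (hF0 : toLaurent F0 = f i0 * LaurentPolynomial.T N0) (hF00 : F0.eval 0 ≠ 0)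
    (hF1 : toLaurent F1 = f i1 * LaurentPolynomial.T N1) (hN1 : N1 < F1.natDegree) :
    (∃ h1 : LL, ∀ i, ∃ U : ℂ[X], f i = aeval h1 U) ∨ 
    ∃ m : ℕ, m ≠ 0 ∧ (∃ P Q : MvPolynomial (Fin n) ℂ, MvPolynomial.aeval f Q ≠ 0 ∧ MvPolynomial.aeval f P = MvPolynomial.aeval f Q * LaurentPolynomial.T (m:ℤ)) ∧
      ∀ i, ∃ U W : ℂ[X], aeval (LaurentPolynomial.T (-(m:ℤ)) : LL) W ≠ 0 ∧ f i * aeval (LaurentPolynomial.T (-(m:ℤ)) : LL) W = aeval (LaurentPolynomial.T (-(m:ℤ)) : LL) U := by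
  set L : IntermediateField ℂ RF := IntermediateField.adjoin ℂ (range fun i => toR (f i)) with hLdef
  have hfL : ∀ i, toR (f i) ∈ L := fun i => IntermediateField.subset_adjoin _ _ ⟨i, rfl⟩
  have hL : L ≠ ⊥ := by
    intro hb
    have h1 := hfL i0
    rw [hb, IntermediateField.mem_bot] at h1
    obtain ⟨c, hc⟩ := h1
    have h2 : f i0 = algebraMap ℂ LL c := toR_inj (by rw [← hc, AlgHom.commutes])
    have h3 : F0 = C c * X ^ N0 := by
      apply toLaurent_injective
      rw [hF0, h2, map_mul, toLaurent_C, toLaurent_X_pow]; rfl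
    rw [h3] at hF00; simp [hN0] at hF00
  obtain ⟨p, q, hcop, hq0, hq00, hLe⟩ := luroth_norm L hL
  set h := algebraMap ℂ[X] RF p / algebraMap ℂ[X] RF q with hh
  have hcz : ∀ z, q.eval z = 0 → p.eval z ≠ 0 := by
    intro z hz hp
    obtain ⟨a, b, hab⟩ := hcop
    have := congrArg (eval z) hab
    simp [hz, hp] at this
  have form : ∀ i, ∃ U W : ℂ[X], IsCoprime U W ∧ aeval h W ≠ 0 ∧ toR (f i) * aeval h W = aeval h U := fun i => by
    apply key_form; rw [← hLe]; exact hfL i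
  -- no root of W at finite nonzero points
  have noroot : ∀ (i) (U W : ℂ[X]), IsCoprime U W → toR (f i) * aeval h W = aeval h U → ∀ z, z ≠ 0 → q.eval z ≠ 0 →
      W.eval (p.eval z / q.eval z) ≠ 0 := by
    intro i U W hc hUW z hz hqz hWz
    obtain ⟨N, F, hF⟩ := (f i).exists_T_pow
    have := congrArg (eval z) (form_poly hq0 hF hUW (le_max_left U.natDegree W.natDegree) (le_max_right _ _))
    rw [eval_mul, eval_mul, Hm_eval _ _ _ _ (le_max_right _ _) z hqz, Hm_eval _ _ _ _ (le_max_left _ _) z hqz, hWz, mul_zero, mul_zero] at this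
    have hU : U.eval (p.eval z / q.eval z) ≠ 0 := by
      intro hU
      obtain ⟨a, b, hab⟩ := hc
      have := congrArg (eval (p.eval z / q.eval z)) hab
      simp [hU, hWz] at this
    have h2 : (X ^ N : ℂ[X]).eval z ≠ 0 := by simp [hz]
    exact mul_ne_zero h2 (mul_ne_zero (pow_ne_zero _ hqz) hU) this.symm
  -- q is a monomial
  have hqz : ∀ z, z ≠ 0 → q.eval z ≠ 0 := by
    obtain ⟨U, W, hc, hWne, hUW⟩ := form i0
    have hW0 : W ≠ 0 := by rintro rfl; simp at hWne
    have hp := form_poly hq0 hF0 hUW (le_max_left U.natDegree W.natDegree) (le_max_right _ _)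
    set D := max U.natDegree W.natDegree
    have h1 := congrArg (eval 0) hp
    rw [eval_mul, eval_mul, Hm_zero _ _ _ _ 0 hq00] at h1
    simp only [eval_pow, eval_X, ne_eq, hN0, not_false_eq_true, zero_pow, zero_mul] at h1
    have hWD : W.coeff D = 0 := by
      have := pow_ne_zero D (hcz 0 hq00)
      rcases mul_eq_zero.1 h1 with h | h
      · exact absurd h hF00
      · exact (mul_eq_zero.1 h).resolve_right this
    have hUD : U.coeff D ≠ 0 := by
      have hlt : W.natDegree ≠ D := by rintro h; rw [← h] at hWD; exact hW0 (leadingCoeff_eq_zero.1 hWD)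
      have : D = U.natDegree := by have : D = max U.natDegree W.natDegree := rfl; omega
      rw [this]
      intro h; rw [coeff_natDegree, leadingCoeff_eq_zero] at h
      rw [h] at this; simp at this; omega
    intro z hz hqz
    have h2 := congrArg (eval z) hp
    rw [eval_mul, eval_mul, Hm_zero _ _ _ _ z hqz, Hm_zero _ _ _ _ z hqz, hWD, zero_mul, mul_zero] at h2
    have h3 : (X ^ N0 : ℂ[X]).eval z ≠ 0 := by simp [hz]
    exact mul_ne_zero h3 (mul_ne_zero hUD (pow_ne_zero _ (hcz z hqz))) h2.symm
  obtain ⟨κ, hκ, m, hqm⟩ := only_root_zero hq0 hqz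
  have hm : m ≠ 0 := by rintro rfl; rw [hqm] at hq00; simp [hκ] at hq00
  have hqdeg : q.natDegree = m := by rw [hqm, natDegree_C_mul_X_pow _ _ hκ]
  have hqL : algebraMap ℂ[X] RF q = toR (κ • LaurentPolynomial.T (m:ℤ)) := by
    rw [← toR_toLaurent, hqm, map_mul, toLaurent_C, toLaurent_X_pow, LL_smul]
  have hTT : (LaurentPolynomial.T (m:ℤ) : LL) * LaurentPolynomial.T (-(m:ℤ)) = 1 := by
    rw [← LaurentPolynomial.T_add]; simp
  have hqinv : (algebraMap ℂ[X] RF q)⁻¹ = toR (κ⁻¹ • LaurentPolynomial.T (-(m:ℤ))) := by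
    rw [hqL]
    refine inv_eq_of_mul_eq_one_right ?_
    rw [← map_mul, smul_mul_smul_comm, hTT, mul_inv_cancel₀ hκ, one_smul, map_one]
  by_cases hpm : p.natDegree ≤ m
  · right
    refine ⟨m, hm, ?_⟩
    set c := p.coeff m / q.coeff m with hc
    have hqm0 : q.coeff m ≠ 0 := by rw [hqm]; simpa using hκ
    have hconst : ∃ κ' : ℂ, κ' ≠ 0 ∧ p - C c * q = C κ' := by
      have h0 : (p - C c * q).eval 0 ≠ 0 := by simpa [hq00] using hcz 0 hq00
      have hne : p - C c * q ≠ 0 := by intro h; rw [h] at h0; simp at h0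
      have hz : ∀ z, z ≠ 0 → (p - C c * q).eval z ≠ 0 := by
        obtain ⟨U, W, hcW, hWne, hUW⟩ := form i1
        have hp := form_poly hq0 hF1 hUW (le_max_left U.natDegree W.natDegree) (le_max_right _ _)
        set D := max U.natDegree W.natDegree with hD
        have h1 := congrArg (fun P => P.coeff (F1.natDegree + D * m)) hp
        obtain ⟨hd1, hd2⟩ := Hm_coeff D W p q m hpm hqdeg.le
        obtain ⟨hd3, -⟩ := Hm_coeff D U p q m hpm hqdeg.le
        simp only [coeff_mul_add_eq_of_natDegree_le le_rfl hd1] at h1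
        rw [coeff_eq_zero_of_natDegree_lt (p := X ^ N1 * Hm D U p q) 
          (lt_of_le_of_lt (natDegree_mul_le_of_le (natDegree_X_pow_le N1) hd3) (by omega)), hd2] at h1
        have h2 := Hm_alg D W (le_max_right _ _) (p.coeff m) (q.coeff m) hqm0
        simp only [Algebra.algebraMap_self, RingHom.id_apply] at h2
        rw [h2, coeff_natDegree, coe_aeval_eq_eval] at h1
        have hF1n : F1.leadingCoeff ≠ 0 := by rw [leadingCoeff_ne_zero]; rintro rfl; simp at hN1
        have hWc : W.eval c = 0 := by
          rcases mul_eq_zero.1 h1 with h | h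
          · exact absurd h hF1n
          · exact (mul_eq_zero.1 h).resolve_left (pow_ne_zero _ hqm0)
        intro z hz he
        have := noroot i1 U W hcW hUW z hz (hqz z hz)
        rw [eval_sub, eval_mul, eval_C, sub_eq_zero] at he
        rw [he, mul_div_cancel_right₀ _ (hqz z hz)] at this
        exact this hWc
      obtain ⟨κ', hκ', m', hm'⟩ := only_root_zero hne hz
      have : m' = 0 := by
        by_contra hm0; rw [hm'] at h0; simp [hm0] at h0
      subst this
      exact ⟨κ', hκ', by rw [hm']; simp⟩
    obtain ⟨κ', hκ', hpc⟩ := hconst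
    have hh2 : h = toR (algebraMap ℂ LL c + (κ' * κ⁻¹) • LaurentPolynomial.T (-(m:ℤ))) := by
      have : p = C c * q + C κ' := by rw [← hpc]; ring
      have hq1 : algebraMap ℂ[X] RF q ≠ 0 := (map_ne_zero_iff _ (RatFunc.algebraMap_injective ℂ)).2 hq0
      rw [hh, this, map_add, map_mul, add_div, mul_div_cancel_right₀ _ hq1, map_add, AlgHom.commutes, div_eq_mul_inv, hqinv, mul_smul, map_smul toR κ', Algebra.smul_def κ' (toR _)]
      rfl
    constructor
    · have hmem : toR (LaurentPolynomial.T (m:ℤ)) ∈ L := by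
        have h1 : toR (LaurentPolynomial.T (m:ℤ)) = (algebraMap ℂ RF (κ * κ'⁻¹) * (h - algebraMap ℂ RF c))⁻¹ := by
          symm
          rw [hh2, map_add, AlgHom.commutes, add_sub_cancel_left, ← Algebra.smul_def, ← map_smul, smul_smul]
          refine inv_eq_of_mul_eq_one_right ?_
          rw [show κ * κ'⁻¹ * (κ' * κ⁻¹) = 1 by field_simp, one_smul, ← map_mul, mul_comm, hTT, map_one]
        rw [h1]
        refine inv_mem (mul_mem (algebraMap_mem _ _) (sub_mem ?_ (algebraMap_mem _ _)))
        rw [hLe]; exact IntermediateField.mem_adjoin_simple_self ℂ h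
      obtain ⟨P, Q, hPQ⟩ := (IntermediateField.mem_adjoin_range_iff ℂ _ _).1 hmem
      have ha : ∀ P : MvPolynomial (Fin n) ℂ, MvPolynomial.aeval (fun i => toR (f i)) P = toR (MvPolynomial.aeval f P) := fun P =>
        (MvPolynomial.comp_aeval_apply (f := f) toR P).symm
      rw [ha, ha] at hPQ
      have hQ : toR (MvPolynomial.aeval f Q) ≠ 0 := by
        intro h0
        rw [h0, div_zero, map_eq_zero_iff _ toR_inj] at hPQ
        exact (LaurentPolynomial.isUnit_T _).ne_zero hPQ
      refine ⟨P, Q, fun h0 => hQ (by rw [h0, map_zero]), toR_inj ?_⟩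
      rw [map_mul, hPQ]; field_simp
    · intro i
      obtain ⟨U, W, hcW, hWne, hUW⟩ := form i
      have hs : ∀ W : ℂ[X], aeval h W = toR (aeval (LaurentPolynomial.T (-(m:ℤ)) : LL) (W.comp (C c + C (κ' * κ⁻¹) * X))) := by
        intro W
        rw [hh2, aeval_algHom_apply, aeval_comp]
        congr 2
        simp [Algebra.smul_def]
      rw [hs, hs, ← map_mul] at hUW
      rw [hs] at hWne
      exact ⟨_, _, fun h0 => hWne (by rw [h0, map_zero]), toR_inj hUW⟩
  · left
    refine ⟨toLaurent p * (κ⁻¹ • LaurentPolynomial.T (-(m:ℤ))), fun i => ?_⟩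
    obtain ⟨U, W, hcW, hWne, hUW⟩ := form i
    have hW0 : W ≠ 0 := by rintro rfl; simp at hWne
    have hWd : W.degree ≤ 0 := by
      by_contra hlt
      obtain ⟨c, hc⟩ := IsAlgClosed.exists_root W (by intro h0; rw [h0] at hlt; exact hlt le_rfl)
      have hdeg : (p - C c * q).natDegree = p.natDegree := by
        apply natDegree_sub_eq_left_of_natDegree_lt
        have := natDegree_C_mul_le c q
        omega
      obtain ⟨z, hz⟩ := IsAlgClosed.exists_root (p - C c * q) (by
        intro h0
        have : (p - C c * q).natDegree = 0 := natDegree_eq_of_degree_eq_some h0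
        omega)
      have hz1 : p.eval z = c * q.eval z := by
        have := hz.eq_zero
        rwa [eval_sub, eval_mul, eval_C, sub_eq_zero] at this
      have hqz1 : q.eval z ≠ 0 := by intro h0; rw [h0, mul_zero] at hz1; exact hcz z h0 hz1
      have hz0 : z ≠ 0 := by rintro rfl; exact hqz1 hq00
      have := noroot i U W hcW hUW z hz0 hqz1
      rw [hz1, mul_div_cancel_right₀ _ hqz1] at this
      exact this hc.eq_zero
    rw [eq_C_of_degree_le_zero hWd] at hUW hWne
    set w := W.coeff 0
    have hw : w ≠ 0 := by rintro h0; rw [h0] at hWne; simp at hWne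
    refine ⟨C w⁻¹ * U, toR_inj ?_⟩
    rw [← aeval_algHom_apply, map_mul toR, toR_toLaurent, ← hqinv, ← div_eq_mul_inv, map_mul, ← hh, ← hUW, aeval_C, aeval_C]
    rw [mul_left_comm, ← map_mul, inv_mul_cancel₀ hw, map_one, mul_one]
end
end FileB8

section FileB9
open MeasureTheory Set Filter Topology
noncomputable section
open Polynomial

def uT (m : ℤ) : LLˣ := ⟨LaurentPolynomial.T m, LaurentPolynomial.T (-m), by rw [← LaurentPolynomial.T_add]; simp, by rw [← LaurentPolynomial.T_add]; simp⟩

lemma T_zpow (m j : ℤ) : ((uT m ^ j : LLˣ) : LL) = LaurentPolynomial.T (m * j) := by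
  cases j with
  | ofNat k =>
    rw [Int.ofNat_eq_natCast, zpow_natCast, Units.val_pow_eq_pow_val]
    change (LaurentPolynomial.T m : LL) ^ k = _
    rw [LaurentPolynomial.T_pow, mul_comm]
  | negSucc k =>
    rw [zpow_negSucc, ← inv_pow, Units.val_pow_eq_pow_val]
    change (LaurentPolynomial.T (-m) : LL) ^ (k+1) = _
    rw [LaurentPolynomial.T_pow]
    congr 1
    rw [Int.negSucc_eq]; push_cast; ring

def pw (m : ℤ) : LL →ₐ[ℂ] LL := evU (uT m)
lemma pw_T (m j : ℤ) : pw m (LaurentPolynomial.T j) = LaurentPolynomial.T (m * j) := by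
  rw [pw, evU_T, T_zpow]

lemma LL_ind {M : LL → Prop} (x : LL) (ha : ∀ a b, M a → M b → M (a + b)) (hm : ∀ (j : ℤ) (c : ℂ), M (c • LaurentPolynomial.T j)) : M x := by
  refine LaurentPolynomial.induction_on' x ha fun j c => ?_
  rw [LL_smul]; exact hm j c

def proj (m : ℤ) (hm : m ≠ 0) : LL →ₗ[ℂ] LL :=
  (AddMonoidAlgebra.coeffLinearEquiv ℂ).symm.toLinearMap ∘ₗ Finsupp.lcomapDomain (fun j : ℤ => m * j) (mul_right_injective₀ hm) ∘ₗ
    (AddMonoidAlgebra.coeffLinearEquiv ℂ).toLinearMap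

lemma proj_coeff (m : ℤ) (hm : m ≠ 0) (x : LL) (j : ℤ) : (proj m hm x).coeff j = x.coeff (m * j) := rfl

lemma proj_T (m : ℤ) (hm : m ≠ 0) (j k : ℤ) : proj m hm (LaurentPolynomial.T (j + m * k)) = proj m hm (LaurentPolynomial.T j) * LaurentPolynomial.T k := by
  by_cases h : ∃ t, j = m * t
  · obtain ⟨t, rfl⟩ := h
    have key : ∀ t, proj m hm (LaurentPolynomial.T (m * t)) = LaurentPolynomial.T t := fun t => by
      refine LaurentPolynomial.ext fun a => ?_
      rw [proj_coeff, LaurentPolynomial.T_apply, LaurentPolynomial.T_apply]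
      simp only [mul_right_inj' hm]
    rw [← mul_add, key, key, LaurentPolynomial.T_add]
  · have key : ∀ k, proj m hm (LaurentPolynomial.T (j + m * k)) = 0 := fun k => by
      refine LaurentPolynomial.ext fun a => ?_
      rw [proj_coeff, LaurentPolynomial.T_apply, if_neg]
      · rfl
      · intro h1; exact h ⟨a - k, by linear_combination h1⟩
    have := key 0
    rw [mul_zero, add_zero] at this
    rw [key, this, zero_mul]

lemma proj_mul (m : ℤ) (hm : m ≠ 0) (x y : LL) : proj m hm (x * pw m y) = proj m hm x * y := by
  induction y using LL_ind with
  | ha a b ha hb => rw [map_add, mul_add, map_add, ha, hb, mul_add]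
  | hm k c =>
    rw [map_smul, pw_T, mul_smul_comm, map_smul, mul_smul_comm]
    congr 1
    induction x using LL_ind with
    | ha a b ha hb => rw [map_add, add_mul, map_add, ha, hb, add_mul]
    | hm j d => rw [smul_mul_assoc, ← LaurentPolynomial.T_add, map_smul, proj_T, map_smul, smul_mul_assoc]

lemma pw_inj (m : ℤ) (hm : m ≠ 0) : Function.Injective (pw m) := by
  intro x y h
  have h1 := proj_mul m hm 1 x
  have h2 := proj_mul m hm 1 y
  rw [h, h2] at h1
  have : proj m hm 1 = 1 := by
    have := proj_T m hm 0 0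
    refine LaurentPolynomial.ext fun a => ?_
    rw [proj_coeff, ← LaurentPolynomial.T_zero, LaurentPolynomial.T_apply, LaurentPolynomial.T_apply]
    simp [eq_comm, hm]
  rw [this, one_mul, one_mul] at h1; exact h1.symm

lemma mem_pw (m : ℤ) (hm : m ≠ 0) {f U W : LL} (hW : pw m W ≠ 0) (h : f * pw m W = pw m U) : ∃ b, f = pw m b := by
  refine ⟨proj m hm f, ?_⟩
  have h1 := proj_mul m hm f W
  have h2 := proj_mul m hm 1 U
  have : proj m hm 1 = 1 := by
    refine LaurentPolynomial.ext fun a => ?_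
    rw [proj_coeff, ← LaurentPolynomial.T_zero, LaurentPolynomial.T_apply, LaurentPolynomial.T_apply]
    simp [eq_comm, hm]
  rw [one_mul, this, one_mul, ← h, h1] at h2
  refine mul_right_cancel₀ hW ?_
  rw [h, ← h2, map_mul]

structure NA {n : ℕ} (f : Fin n → LL) (m : ℤ) (b : Fin n → LL) (c0 : MvPolynomial (Fin n) ℂ) : Prop where
  hm : m ≠ 0
  hb : ∀ i, f i = pw m (b i)
  hc : MvPolynomial.aeval b c0 ≠ 0
  hP : ∀ j : ℤ, ∃ P : MvPolynomial (Fin n) ℂ, MvPolynomial.aeval b P = MvPolynomial.aeval b c0 * LaurentPolynomial.T j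
  nc : ∃ i, ∀ c, f i ≠ algebraMap ℂ LL c

lemma integral_of {A : Subalgebra ℂ LL} {s t : LL} (hs : s ∈ A) {F : ℂ[X]} {N : ℕ} (hN : N < F.natDegree)
    (h : aeval t F = s * t ^ N) : IsIntegral A t := by
  have hF : F ≠ 0 := by rintro rfl; simp at hN
  have hl : F.leadingCoeff ≠ 0 := leadingCoeff_ne_zero.2 hF
  refine ⟨(F * C F.leadingCoeff⁻¹).map (algebraMap ℂ A) - C (⟨s, hs⟩ * algebraMap ℂ A F.leadingCoeff⁻¹) * X ^ N, ?_, ?_⟩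
  · refine Monic.sub_of_left ((monic_mul_leadingCoeff_inv hF).map _) ?_
    refine lt_of_le_of_lt (degree_C_mul_X_pow_le _ _) ?_
    rw [degree_map, degree_mul, degree_C (inv_ne_zero hl), add_zero, degree_eq_natDegree hF]
    exact_mod_cast hN
  · rw [eval₂_sub, eval₂_mul, eval₂_C, eval₂_X_pow, eval₂_map, eval₂_mul, eval₂_C]
    change aeval t F * algebraMap ℂ LL F.leadingCoeff⁻¹ - s * algebraMap ℂ LL F.leadingCoeff⁻¹ * t ^ N = 0
    rw [h]; ring

lemma almost {A : Subalgebra ℂ LL} {t q : LL} (ht : IsIntegral A t) (hq : q ∈ A) (hq0 : q ≠ 0) (hqt : q * t ∈ A) :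
    ∃ r ∈ A, r ≠ 0 ∧ ∀ j : ℕ, r * t ^ j ∈ A := by
  obtain ⟨r, hr, h⟩ := ht.isAlmostIntegral_of_exists_smul_mem_range ⟨⟨q, hq⟩, mem_nonZeroDivisors_of_ne_zero 
    (fun h => hq0 (congrArg Subtype.val h)), ⟨⟨_, hqt⟩, rfl⟩⟩
  refine ⟨r, r.2, fun h0 => nonZeroDivisors.ne_zero hr (Subtype.ext h0), fun j => ?_⟩
  obtain ⟨y, hy⟩ := h j
  have : r.1 * t ^ j = y.1 := hy.symm
  rw [this]; exact y.2

lemma neg_or (g : LL) : (∃ F : ℂ[X], g = toLaurent F) ∨ ∃ (N : ℕ) (F : ℂ[X]), N ≠ 0 ∧ F.eval 0 ≠ 0 ∧ toLaurent F = g * LaurentPolynomial.T N := by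
  classical
  have hex := g.exists_T_pow
  obtain ⟨F, hF⟩ := Nat.find_spec hex
  by_cases h0 : Nat.find hex = 0
  · left; refine ⟨F, ?_⟩; rw [hF, h0]; simp
  · right
    refine ⟨_, F, h0, fun hF0 => ?_, hF⟩
    obtain ⟨F', rfl⟩ := X_dvd_iff.2 (by rwa [← coeff_zero_eq_eval_zero] at hF0)
    obtain ⟨N, hN⟩ := Nat.exists_eq_succ_of_ne_zero h0
    refine Nat.find_min hex (m := N) (by omega) ⟨F', ?_⟩
    rw [hN] at hF
    refine mul_left_cancel₀ (LaurentPolynomial.isUnit_T (R := ℂ) 1).ne_zero ?_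
    rw [map_mul, toLaurent_X] at hF
    rw [hF, mul_left_comm, ← LaurentPolynomial.T_add]; push_cast; ring_nf

lemma pos_or (g : LL) : (∃ F : ℂ[X], g = aeval (LaurentPolynomial.T (-1) : LL) F) ∨ ∃ (N : ℕ) (F : ℂ[X]), N < F.natDegree ∧ toLaurent F = g * LaurentPolynomial.T N := by
  obtain ⟨N, F, hF⟩ := g.exists_T_pow
  by_cases h : N < F.natDegree
  · exact Or.inr ⟨N, F, h, hF⟩
  left
  refine ⟨∑ k ∈ Finset.range (N+1), C (F.coeff k) * X ^ (N - k), ?_⟩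
  refine mul_right_cancel₀ (LaurentPolynomial.isUnit_T (R := ℂ) N).ne_zero ?_
  rw [← hF, F.as_sum_range' (N+1) (by omega), map_sum, map_sum, Finset.sum_mul]
  rw [← F.as_sum_range' (N+1) (by omega)]
  refine Finset.sum_congr rfl fun k hk => ?_
  have : k ≤ N := by have := Finset.mem_range.1 hk; omega
  rw [← C_mul_X_pow_eq_monomial, map_mul, map_mul, toLaurent_C, toLaurent_X_pow, aeval_C, map_pow, aeval_X, LaurentPolynomial.T_pow, mul_assoc,
    ← LaurentPolynomial.T_add]
  congr 2
  push_cast [this]; ring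

lemma J_mem_h {n : ℕ} {T : ℝ} (h1 : LL) (U : Fin n → ℂ[X]) {J : List (Fin n) → ℂ → ℂ} 
    (hJ : IsJ (fun i => (lE T (aeval h1 (U i)) : ℂ → ℂ)) J) (l : List (Fin n)) : ∃ V : ℂ[X], J l = (lE T (aeval h1 V) : ℂ → ℂ) := by
  induction l with
  | nil => exact ⟨1, by rw [hJ.nil, map_one, map_one]; rfl⟩
  | cons i l ih =>
    obtain ⟨H, hH⟩ := ih
    obtain ⟨V, hV⟩ : ∃ V : ℂ[X], derivative V = derivative (U i) * H := by
      generalize derivative (U i) * H = p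
      induction p using Polynomial.induction_on' with
      | add p q hp hq => 
        obtain ⟨a, ha⟩ := hp; obtain ⟨b, hb⟩ := hq
        exact ⟨a + b, by rw [map_add, ha, hb]⟩
      | monomial m a =>
        refine ⟨monomial (m+1) (a / (m+1)), ?_⟩
        have : (m + 1 : ℂ) ≠ 0 := by exact_mod_cast m.succ_ne_zero
        rw [derivative_monomial]
        congr 1; push_cast; field_simp
    have hd : ∀ V, dE (lE T (aeval h1 V)) = lE T (aeval h1 (derivative V)) * dE (lE T h1) := fun V => by
      rw [← aeval_algHom_apply (lE T) h1 V, ← aeval_algHom_apply (lE T) h1 (derivative V), Derivation.map_aeval, smul_eq_mul]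
    obtain ⟨c, hc⟩ := dE_eq_zero (f := Ent.mk (J (i :: l)) (hJ.hd _) - lE T (aeval h1 V)) (by
      rw [map_sub, hd, hV, map_mul, map_mul, sub_eq_zero]
      rw [mul_right_comm, ← hd]
      refine Ent.ext' (fun x => ?_)
      change deriv (J (i :: l)) x = deriv (lE T (aeval h1 (U i))) x * (lE T (aeval h1 H) : ℂ → ℂ) x
      rw [hJ.der, hH])
    refine ⟨V + algebraMap ℂ _ c, ?_⟩
    rw [map_add, map_add, AlgHom.commutes, AlgHom.commutes, ← hc]; simp [fn_mk]

lemma transc_LL {T : ℝ} (hT : 0 < T) {f : LL} (hf : ∀ c, f ≠ algebraMap ℂ LL c) : Transcendental ℂ f := by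
  intro ha
  refine transc_of_der' dE (f := lE T f) ?_ (ha.algHom (lE T))
  intro h0
  obtain ⟨c, hc⟩ := dE_eq_zero h0
  exact hf c (lE_inj hT (by rw [hc, AlgHom.commutes]))

theorem trig_dich {n : ℕ} {T : ℝ} (hT : 0 < T) (f : Fin n → LL) (hnc : ∃ i, ∀ c, f i ≠ algebraMap ℂ LL c) :
    Alg (fun i => (lE T (f i) : ℂ → ℂ)) ∨ ∃ m b c0, NA f m b c0 := by
  have alg : (∃ h1 : LL, ∀ i, ∃ U : ℂ[X], f i = aeval h1 U) → Alg (fun i => (lE T (f i) : ℂ → ℂ)) := by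
    rintro ⟨h1, h⟩ 
    choose U hU using h
    intro J hJ l
    simp only [hU] at hJ
    obtain ⟨V, hV⟩ := J_mem_h h1 U hJ l
    rw [hV]
    refine algOver_of (lE T) (lE_inj hT) f _ ?_
    obtain ⟨i, hi⟩ := hnc
    obtain ⟨Q, hQ0, hQ⟩ := exists_Q (alg_one (transc_LL hT hi) (aeval h1 V))
    exact of_Q (transc_LL hT hi) _ (Algebra.subset_adjoin (mem_range_self i)) hQ0 hQ
  by_cases h0 : ∀ i, ∃ F : ℂ[X], f i = toLaurent F
  · refine Or.inl (alg ⟨LaurentPolynomial.T 1, fun i => ?_⟩)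
    obtain ⟨F, hF⟩ := h0 i
    exact ⟨F, by rw [hF]; simpa [toLaurentAlg_apply] using (aeval_algHom_apply toLaurentAlg (X : ℂ[X]) F).symm⟩
  by_cases h1 : ∀ i, ∃ F : ℂ[X], f i = aeval (LaurentPolynomial.T (-1) : LL) F
  · exact Or.inl (alg ⟨_, h1⟩)
  push Not at h0 h1
  obtain ⟨i0, hi0⟩ := h0
  obtain ⟨i1, hi1⟩ := h1
  obtain ⟨N0, F0, hN0, hF00, hF0⟩ := (neg_or (f i0)).resolve_left (fun ⟨F, h⟩ => hi0 F h)
  obtain ⟨N1, F1, hN1, hF1⟩ := (pos_or (f i1)).resolve_left (fun ⟨F, h⟩ => hi1 F h)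
  rcases luroth_dich f i0 i1 hN0 hF0 hF00 hF1 hN1 with h | ⟨m, hm, ⟨P, Q, hQ, hPQ⟩, hUW⟩
  · exact Or.inl (alg h)
  right
  have hm' : (m : ℤ) ≠ 0 := by exact_mod_cast hm
  have hb : ∀ i, ∃ b, f i = pw m b := by
    intro i
    obtain ⟨U, W, hW, h⟩ := hUW i
    have e : ∀ U : ℂ[X], aeval (LaurentPolynomial.T (-(m:ℤ)) : LL) U = pw m (aeval (LaurentPolynomial.T (-1) : LL) U) := fun U => by
      rw [← aeval_algHom_apply, pw_T]; simp
    rw [e] at hW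
    rw [e, e] at h
    exact mem_pw m hm' hW h
  choose b hb using hb
  have hbf : ∀ P : MvPolynomial (Fin n) ℂ, MvPolynomial.aeval f P = pw m (MvPolynomial.aeval b P) := fun P => by
    rw [MvPolynomial.comp_aeval_apply]; congr 2; funext i; exact hb i
  set A := (MvPolynomial.aeval (R := ℂ) f).range with hA
  have hfA : ∀ i, f i ∈ A := fun i => ⟨MvPolynomial.X i, by simp⟩
  have int1 : IsIntegral A (LaurentPolynomial.T 1 : LL) := by
    refine integral_of (hfA i1) hN1 ?_
    rw [LaurentPolynomial.T_pow, mul_one, ← hF1]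
    simpa [toLaurentAlg_apply] using aeval_algHom_apply toLaurentAlg (X : ℂ[X]) F1
  have int2 : IsIntegral A (LaurentPolynomial.T (-1) : LL) := by
    have hr : F0.reverse.natDegree = F0.natDegree := by
      rw [reverse_natDegree, natTrailingDegree_eq_zero_of_constantCoeff_ne_zero (by simpa [coeff_zero_eq_eval_zero] using hF00)]; simp
    have hF0r : F0.reverse ≠ 0 := by rw [Ne, reverse_eq_zero]; rintro rfl; simp at hF00
    refine integral_of (F := X ^ N0 * F0.reverse) (N := F0.natDegree) (hfA i0) ?_ ?_
    · rw [natDegree_mul (by simp) hF0r, hr, natDegree_X_pow]; omega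
    · have h3 : aeval (LaurentPolynomial.T (-1) : LL) F0.reverse = LaurentPolynomial.invert (toLaurent F0.reverse) := by
        have : toLaurent F0.reverse = aeval (LaurentPolynomial.T 1 : LL) F0.reverse := by
          simpa [toLaurentAlg_apply] using (aeval_algHom_apply toLaurentAlg (X : ℂ[X]) F0.reverse).symm
        rw [this, ← aeval_algHom_apply]; simp
      rw [map_mul, h3, LaurentPolynomial.toLaurent_reverse, map_mul, LaurentPolynomial.involutive_invert, hF0, LaurentPolynomial.invert_T, map_pow, aeval_X,
        LaurentPolynomial.T_pow, LaurentPolynomial.T_pow]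
      have : (LaurentPolynomial.T ((N0:ℤ) * -1) : LL) * LaurentPolynomial.T N0 = 1 := by
        rw [← LaurentPolynomial.T_add]; simp
      have h5 : (LaurentPolynomial.T ((F0.natDegree:ℤ) * -1) : LL) = LaurentPolynomial.T (-(F0.natDegree:ℤ)) := by simp
      rw [h5]
      linear_combination (f i0 * LaurentPolynomial.T (-(F0.natDegree:ℤ))) * this
  have hmm : (LaurentPolynomial.T (m:ℤ) : LL) * LaurentPolynomial.T (-(m:ℤ)) = 1 := by
    rw [← LaurentPolynomial.T_add]; simp
  obtain ⟨r, hrA, hr0, hr⟩ := almost (A := A) (t := LaurentPolynomial.T (m:ℤ)) (q := MvPolynomial.aeval f Q) (by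
    have := int1.pow m
    rwa [LaurentPolynomial.T_pow, mul_one] at this) ⟨Q, rfl⟩ hQ ⟨P, hPQ⟩
  obtain ⟨r', hrA', hr0', hr'⟩ := almost (A := A) (t := LaurentPolynomial.T (-(m:ℤ))) (q := MvPolynomial.aeval f P) (by
    have := int2.pow m
    rwa [LaurentPolynomial.T_pow, mul_neg_one] at this) ⟨P, rfl⟩ (by 
      rw [hPQ]; exact mul_ne_zero hQ (LaurentPolynomial.isUnit_T _).ne_zero) ⟨Q, by rw [hPQ]; change MvPolynomial.aeval f Q = _; rw [mul_assoc, hmm, mul_one]⟩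
  obtain ⟨c0, hc0⟩ := mul_mem hrA hrA'
  change MvPolynomial.aeval f c0 = _ at hc0
  refine ⟨m, b, c0, hm', hb, ?_, ?_, hnc⟩
  · intro h; rw [hbf, h, map_zero] at hc0
    exact mul_ne_zero hr0 hr0' hc0.symm
  · intro j
    have : r * r' * LaurentPolynomial.T ((m:ℤ) * j) ∈ A := by
      cases j with
      | ofNat k =>
        have h3 := mul_mem (hr k) hrA'
        rw [LaurentPolynomial.T_pow] at h3
        convert! h3 using 1
        rw [Int.ofNat_eq_natCast, mul_comm (m:ℤ)]; ring
      | negSucc k =>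
        have h3 := mul_mem (hr' (k+1)) hrA
        rw [LaurentPolynomial.T_pow] at h3
        convert! h3 using 1
        rw [Int.negSucc_eq, show (m:ℤ) * (-((k:ℤ)+1)) = ((k+1:ℕ):ℤ) * -(m:ℤ) by push_cast; ring]; ring
    obtain ⟨P', hP'⟩ := this
    change MvPolynomial.aeval f P' = _ at hP'
    refine ⟨P', pw_inj m hm' ?_⟩
    rw [map_mul, ← hbf, ← hbf, pw_T, hP', hc0]
end
end FileB9

section FileB10
open MeasureTheory Set Filter Topology
noncomputable section
open Polynomial

local notation "𝐓" => (LaurentPolynomial.T : ℤ → LL)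

def ct : LL →ₗ[ℂ] ℂ := Finsupp.lapply 0 ∘ₗ (AddMonoidAlgebra.coeffLinearEquiv ℂ).toLinearMap
lemma ct_T (j : ℤ) : ct (𝐓 j) = if j = 0 then 1 else 0 := LaurentPolynomial.T_apply _ _

def thL : LL →ₗ[ℂ] LL := Finsupp.lsum ℂ (fun j : ℤ => LinearMap.toSpanSingleton ℂ LL ((j:ℂ) • 𝐓 j)) ∘ₗ (AddMonoidAlgebra.coeffLinearEquiv ℂ).toLinearMap
lemma thL_T (j : ℤ) : thL (𝐓 j) = (j:ℂ) • 𝐓 j := by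
  have : (AddMonoidAlgebra.coeffLinearEquiv ℂ) (𝐓 j) = Finsupp.single j (1:ℂ) := rfl
  simp only [thL, LinearMap.comp_apply, LinearEquiv.coe_coe, this, Finsupp.lsum_single]
  simp

def us (κ : ℂˣ) (s : ℤ) : LLˣ := Units.map (algebraMap ℂ LL).toMonoidHom κ * uT s
lemma us_zpow (κ : ℂˣ) (s j : ℤ) : ((us κ s ^ j : LLˣ) : LL) = ((κ ^ j : ℂˣ) : ℂ) • 𝐓 (s * j) := by
  rw [us, mul_zpow, ← map_zpow, Units.val_mul, T_zpow, Algebra.smul_def]; rfl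

lemma us_one (s : ℤ) : us 1 s = uT s := by rw [us, map_one, one_mul]

lemma th_us (κ : ℂˣ) (s : ℤ) (x : LL) : thL (evU (us κ s) x) = (s:ℂ) • evU (us κ s) (thL x) := by
  induction x using LL_ind with
  | ha a b ha hb => simp [ha, hb]
  | hm j c => simp only [map_smul, evU_T, us_zpow, thL_T, smul_smul]; push_cast; congr 1; ring

lemma ct_us (κ : ℂˣ) {s : ℤ} (hs : s ≠ 0) (x : LL) : ct (evU (us κ s) x) = ct x := by
  induction x using LL_ind with
  | ha a b ha hb => simp [ha, hb]
  | hm j c => 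
    simp only [map_smul, evU_T, us_zpow, ct_T, mul_eq_zero, hs, false_or]
    by_cases h : j = 0 <;> simp [h]

lemma key2 (x : LL) (j : ℤ) : ct (x * 𝐓 (-j)) = x.coeff j := by
  induction x using LL_ind with
  | ha a b ha hb => simp [add_mul, ha, hb]
  | hm k c => 
    simp only [map_smul, smul_mul_assoc, ← LaurentPolynomial.T_add, ct_T, smul_eq_mul, AddMonoidAlgebra.coeff_smul, Finsupp.smul_apply]
    rw [LaurentPolynomial.T_apply]
    congr 1
    simp only [add_neg_eq_zero, eq_comm]

lemma fn_exE (c x : ℂ) : (exE c).fn x = Complex.exp (c * x) := rfl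

lemma th_const {x : LL} (h : thL x = 0) : ∃ c, x = algebraMap ℂ LL c := by
  have key : ∀ (x : LL) (j : ℤ), ct (thL x * 𝐓 (-j)) = j * ct (x * 𝐓 (-j)) := fun x j => by
    induction x using LL_ind with
    | ha a b ha hb => simp [add_mul, ha, hb, mul_add]
    | hm k c => 
      simp only [map_smul, thL_T, smul_mul_assoc, ← LaurentPolynomial.T_add, ct_T, smul_eq_mul]
      by_cases h : k = j
      · simp [h]; ring
      · rw [if_neg (by omega)]; simp
  refine ⟨ct x, LaurentPolynomial.ext fun j => ?_⟩
  have h1 := key x j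
  rw [h, zero_mul, map_zero, key2] at h1
  have h2 : (algebraMap ℂ LL (ct x)) = ct x • 𝐓 0 := by rw [LaurentPolynomial.T_zero, Algebra.algebraMap_eq_smul_one]
  rw [h2, AddMonoidAlgebra.coeff_smul, Finsupp.smul_apply, LaurentPolynomial.T_apply]
  by_cases hj : j = 0
  · subst hj; rw [if_pos rfl, smul_eq_mul, mul_one]; rfl
  · rw [if_neg (Ne.symm hj), smul_zero]
    exact (mul_eq_zero.1 h1.symm).resolve_left (by exact_mod_cast hj)

lemma ct_all {x : LL} (h : ∀ j, ct (x * 𝐓 j) = 0) : x = 0 := by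
  refine LaurentPolynomial.ext fun j => ?_
  rw [← key2, h]; rfl

def mo {n : ℕ} (f : Fin n → LL) (P : MvPolynomial (Fin n) ℂ) (i : Fin n) : ℂ := ct (MvPolynomial.aeval f P * thL (f i))

lemma dE_lE (T : ℝ) (x : LL) : dE (lE T x) = om T • lE T (thL x) := by
  induction x using LL_ind with
  | ha a b ha hb => simp [ha, hb]
  | hm j c => simp only [map_smul, Derivation.map_smul, lE_T, dE_exE, thL_T, smul_smul]; congr 1; ring

lemma int_lE {T : ℝ} (hT : 0 < T) (x : LL) : ∫ t in (0:ℝ)..T, (lE T x : ℂ → ℂ) t = T * ct x := by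
  have hc : ∀ x, IntervalIntegrable (fun t : ℝ => (lE T x : ℂ → ℂ) t) volume 0 T := fun x =>
    ((entD (lE T x)).continuous.comp Complex.continuous_ofReal).intervalIntegrable _ _
  induction x using LL_ind with
  | ha a b ha hb => 
    simp only [map_add, fn_add]
    rw [intervalIntegral.integral_add (hc a) (hc b), ha, hb, mul_add]
  | hm j c =>
    simp only [map_smul, fn_smul, lE_T, ct_T, smul_eq_mul]
    rw [intervalIntegral.integral_const_mul]
    change c * ∫ t in (0:ℝ)..T, Complex.exp (j * om T * t) = _
    by_cases hj : j = 0
    · subst hj; simp [mul_comm]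
    · rw [integral_exp_mul_complex (mul_ne_zero (by exact_mod_cast hj) (om_ne hT)), mul_assoc, om_T hT, if_neg hj]
      simp [Complex.exp_int_mul_two_pi_mul_I]

lemma fn_aeval {n : ℕ} (f : Fin n → Ent) (P : MvPolynomial (Fin n) ℂ) (x : ℂ) :
    (MvPolynomial.aeval f P).fn x = MvPolynomial.eval (fun i => (f i).fn x) P := by
  have := MvPolynomial.comp_aeval_apply f (evE x) P
  rw [evE_apply] at this
  rw [this, MvPolynomial.aeval_eq_eval]; rfl

lemma mo_eq {n : ℕ} {T : ℝ} (hT : 0 < T) (f : Fin n → LL) (P : MvPolynomial (Fin n) ℂ) (i : Fin n) :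
    ∫ x in (0:ℝ)..T, MvPolynomial.eval (fun i => (lE T (f i)).fn x) P * deriv (lE T (f i)).fn x = T * om T * mo f P i := by
  have : ∀ x : ℂ, MvPolynomial.eval (fun i => (lE T (f i)).fn x) P * deriv (lE T (f i)).fn x = om T * (lE T (MvPolynomial.aeval f P * thL (f i))).fn x := fun x => by
    rw [← fn_aeval (fun i => lE T (f i)), ← dE_apply, dE_lE, fn_smul, map_mul, fn_mul, MvPolynomial.comp_aeval_apply]; ring
  simp only [this]
  rw [intervalIntegral.integral_const_mul, int_lE hT, mo]; ring

variable {n : ℕ}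

lemma aeval_evU {A : Type*} [CommRing A] [Algebra ℂ A] (u : Aˣ) (b : Fin n → LL) (P : MvPolynomial (Fin n) ℂ) : 
    MvPolynomial.aeval (fun i => evU u (b i)) P = evU u (MvPolynomial.aeval b P) := by rw [MvPolynomial.comp_aeval_apply]

lemma mo_us (κ : ℂˣ) {s : ℤ} (hs : s ≠ 0) (b : Fin n → LL) (P : MvPolynomial (Fin n) ℂ) (i : Fin n) :
    mo (fun i => evU (us κ s) (b i)) P i = s * mo b P i := by
  rw [mo, aeval_evU, th_us, mul_smul_comm, ← map_mul, map_smul, ct_us κ hs]; rfl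

lemma NA.eq {f : Fin n → LL} {m b c0} (h : NA f m b c0) : f = fun i => evU (us 1 m) (b i) := by
  funext i; rw [h.hb, us_one]; rfl

lemma NA.crit {f : Fin n → LL} {m b c0} (h : NA f m b c0) (G : MvPolynomial (Fin n) ℂ) (hG : ∀ P i, mo f (G * P) i = 0) : 
    MvPolynomial.aeval b G = 0 := by
  have h1 : ∀ P i, mo b (G * P) i = 0 := fun P i => by
    have := hG P i
    rw [h.eq, mo_us 1 h.hm] at this
    exact (mul_eq_zero.1 this).resolve_left (by exact_mod_cast h.hm)
  obtain ⟨i, hi⟩ := h.nc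
  have h2 : MvPolynomial.aeval b G * MvPolynomial.aeval b c0 * thL (b i) = 0 := by
    refine ct_all fun j => ?_
    obtain ⟨P, hP⟩ := h.hP j
    have := h1 P i
    rw [mo, map_mul (MvPolynomial.aeval b), hP] at this
    rwa [show MvPolynomial.aeval b G * MvPolynomial.aeval b c0 * thL (b i) * 𝐓 j = MvPolynomial.aeval b G * (MvPolynomial.aeval b c0 * 𝐓 j) * thL (b i) by ring]
  rcases mul_eq_zero.1 h2 with h2 | h2
  · exact (mul_eq_zero.1 h2).resolve_right h.hc
  · obtain ⟨c, hc⟩ := th_const h2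
    exact absurd (by rw [h.hb, hc, AlgHom.commutes]) (hi c)

lemma NA.mo_ne {f : Fin n → LL} {m b c0} (h : NA f m b c0) : ∃ P i, mo f P i ≠ 0 := by
  by_contra! h0
  have := h.crit 1 (fun P i => h0 _ _)
  rw [map_one] at this
  exact one_ne_zero this

lemma NA.zero_iff {f g : Fin n → LL} {m b c0 m' b' c0'} (h : NA f m b c0) (h' : NA g m' b' c0') (hm : ∀ P i, mo f P i = mo g P i)
    (G : MvPolynomial (Fin n) ℂ) (hG : MvPolynomial.aeval b G = 0) : MvPolynomial.aeval g G = 0 := by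
  have := h'.crit G (fun P i => by rw [← hm, mo, map_mul (MvPolynomial.aeval f), h.eq, aeval_evU, hG, map_zero, zero_mul, zero_mul, map_zero])
  rw [h'.eq, aeval_evU, this, map_zero]

instance : IsNoetherianRing LL := IsLocalization.isNoetherianRing (Submonoid.powers (X : ℂ[X])) _ inferInstance
instance : IsIntegrallyClosed LL := isIntegrallyClosed_of_isLocalization _ (Submonoid.powers (X : ℂ[X])) (by
  rintro x ⟨k, rfl⟩; exact mem_nonZeroDivisors_of_ne_zero (pow_ne_zero _ X_ne_zero)) 

lemma dvd_of_seq {c a : LL} (hc : c ≠ 0) (p : ℕ → LL) (h0 : p 0 = c) (hp : ∀ j, c * p (j+1) = p j * a) : ∃ v, a = c * v := by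
  have hc' : algebraMap LL (FractionRing LL) c ≠ 0 := by simpa using hc
  have h1 : IsAlmostIntegral LL (algebraMap LL (FractionRing LL) a / algebraMap LL _ c) := by
    refine ⟨c, mem_nonZeroDivisors_of_ne_zero hc, fun j => ⟨p j, ?_⟩⟩
    rw [Algebra.smul_def]
    induction j with
    | zero => rw [h0]; simp
    | succ j ih => 
      rw [pow_succ, ← mul_assoc, ← ih, mul_div_assoc', ← map_mul, ← hp, map_mul]; field_simp
  obtain ⟨v, hv⟩ := IsIntegrallyClosed.isIntegral_iff.1 (isAlmostIntegral_iff_isIntegral.1 h1)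
  refine ⟨v, IsFractionRing.injective LL (FractionRing LL) ?_⟩
  rw [map_mul, hv]; field_simp

lemma unit_form (u : LLˣ) : ∃ κ s, u = us κ s := by
  obtain ⟨N, F, hF⟩ := (u : LL).exists_T_pow
  obtain ⟨M, G, hG⟩ := ((u⁻¹ : LLˣ) : LL).exists_T_pow
  have hFG : F * G = X ^ (N + M) := toLaurent_injective (by
    rw [map_mul, hF, hG, toLaurent_X_pow, mul_mul_mul_comm, ← LaurentPolynomial.T_add, Units.mul_inv, one_mul]; push_cast; rfl)
  obtain ⟨κ, hκ, s, hs⟩ := only_root_zero (q := F) (by rintro rfl; simp at hFG; exact absurd hFG.symm (by simp)) (fun z hz h => by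
    have := congrArg (eval z) hFG
    rw [eval_mul, h, zero_mul, eval_pow, eval_X] at this
    exact pow_ne_zero _ hz this.symm)
  refine ⟨Units.mk0 κ hκ, s - N, Units.ext ?_⟩
  have h1 := us_zpow (Units.mk0 κ hκ) (s - N) 1
  rw [zpow_one, zpow_one, mul_one] at h1
  rw [h1]
  refine mul_right_cancel₀ (LaurentPolynomial.isUnit_T (R := ℂ) N).ne_zero ?_
  rw [← hF, hs, smul_mul_assoc, ← LaurentPolynomial.T_add, map_mul, toLaurent_C, toLaurent_X_pow, LL_smul]; simp

theorem NA.shift {T : ℝ} (hT : 0 < T) {f g : Fin n → LL} {m b c0 m' b' c0'} (h : NA f m b c0) (h' : NA g m' b' c0') (hm : ∀ P i, mo f P i = mo g P i) :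
    ∃ x0 : ℂ, ∀ i x, (lE T (g i)).fn x = (lE T (f i)).fn (x + x0) := by
  have Z := h.zero_iff h' hm
  have Z' : ∀ G H : MvPolynomial (Fin n) ℂ, MvPolynomial.aeval b G = MvPolynomial.aeval b H → MvPolynomial.aeval g G = MvPolynomial.aeval g H := fun G H e => by
    rw [← sub_eq_zero, ← map_sub]; exact Z _ (by rw [map_sub, e, sub_self])
  choose P hP using h.hP
  set c := MvPolynomial.aeval g c0 with hcdef
  have hc : c ≠ 0 := fun e => h.hc (by
    refine h.crit c0 (fun P i => ?_)
    rw [hm, mo, map_mul (MvPolynomial.aeval g), ← hcdef, e, zero_mul, zero_mul, map_zero])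
  have p0 : MvPolynomial.aeval g (P 0) = c := Z' _ _ (by rw [hP, LaurentPolynomial.T_zero, mul_one])
  have pa : ∀ j k, c * MvPolynomial.aeval g (P (j + k)) = MvPolynomial.aeval g (P j) * MvPolynomial.aeval g (P k) := fun j k => by
    rw [hcdef, ← map_mul, ← map_mul]
    refine Z' _ _ ?_
    rw [map_mul, map_mul, hP, hP, hP, LaurentPolynomial.T_add]; ring
  obtain ⟨v, hv⟩ := dvd_of_seq hc (fun j : ℕ => MvPolynomial.aeval g (P j)) (by simpa using p0) (a := MvPolynomial.aeval g (P 1)) (fun j => pa j 1)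
  obtain ⟨w, hw⟩ := dvd_of_seq hc (fun j : ℕ => MvPolynomial.aeval g (P (-j))) (by simpa using p0) (a := MvPolynomial.aeval g (P (-1))) (fun j => by
    rw [← pa, Nat.cast_succ, neg_add])
  have hvw : v * w = 1 := by
    have := pa 1 (-1)
    rw [add_neg_cancel, p0, hv, hw] at this
    refine mul_left_cancel₀ (mul_ne_zero hc hc) ?_
    linear_combination -this
  let u : LLˣ := ⟨v, w, hvw, by rw [mul_comm, hvw]⟩
  have pj : ∀ j : ℤ, MvPolynomial.aeval g (P j) = c * ((u ^ j : LLˣ) : LL) := by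
    have st : ∀ j : ℤ, MvPolynomial.aeval g (P (j + 1)) = MvPolynomial.aeval g (P j) * v := fun j => by
      refine mul_left_cancel₀ hc ?_
      rw [pa, hv]; ring
    intro j
    induction j using Int.induction_on with
    | zero => rw [p0]; simp
    | succ k ih => rw [st, ih, zpow_add_one, Units.val_mul, mul_assoc]
    | pred k ih =>
      have := st (-(k:ℤ) - 1)
      rw [sub_add_cancel, ih] at this
      rw [zpow_sub_one, Units.val_mul, ← mul_assoc, this, mul_assoc]
      change _ = _ * (v * w)
      rw [hvw, mul_one]
  have ex : ∀ x : LL, ∃ Q : MvPolynomial (Fin n) ℂ, MvPolynomial.aeval b Q = MvPolynomial.aeval b c0 * x ∧ MvPolynomial.aeval g Q = c * evU u x := fun x => by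
    induction x using LL_ind with
    | ha x y hx hy => 
      obtain ⟨Q, h1, h2⟩ := hx; obtain ⟨R, h3, h4⟩ := hy
      exact ⟨Q + R, by simp only [map_add, h1, h3, mul_add], by simp only [map_add, h2, h4, mul_add]⟩
    | hm j a => exact ⟨a • P j, by rw [map_smul, hP, mul_smul_comm], by rw [map_smul, pj, map_smul, evU_T, mul_smul_comm]⟩
  have hg : g = fun i => evU u (b i) := by
    funext i
    obtain ⟨Q, h1, h2⟩ := ex (b i)
    refine mul_left_cancel₀ hc ?_
    rw [← h2, Z' Q (c0 * MvPolynomial.X i) (by rw [h1, map_mul, MvPolynomial.aeval_X]), map_mul, MvPolynomial.aeval_X]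
  obtain ⟨κ, s, hu⟩ := unit_form u
  rw [hu] at hg
  have hs : s ≠ 0 := by
    rintro rfl
    obtain ⟨P, i, hPi⟩ := h'.mo_ne
    refine hPi ?_
    rw [hg, mo, th_us]; simp
  obtain ⟨P1, i1, hPi⟩ := h.mo_ne
  have h1 := hm P1 i1
  rw [hg, mo_us κ hs] at h1
  rw [h.eq, mo_us 1 h.hm] at h1 hPi
  have hms : m = s := by exact_mod_cast mul_right_cancel₀ (right_ne_zero_of_mul hPi) h1
  have h0 : (m : ℂ) * om T ≠ 0 := mul_ne_zero (by exact_mod_cast h.hm) (om_ne hT)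
  refine ⟨Complex.log κ / (m * om T), fun i x => ?_⟩
  rw [hg, h.eq]
  beta_reduce
  generalize b i = y
  induction y using LL_ind with
  | ha a b ha hb => simp only [map_add, fn_add, ha, hb]
  | hm j a =>
    simp only [map_smul, fn_smul, evU_T, us_zpow, lE_T, ← hms, one_zpow, Units.val_one, one_mul, fn_exE]
    refine congrArg (a * ·) ?_
    rw [mul_add, Complex.exp_add, mul_comm]
    refine congrArg₂ _ rfl ?_
    rw [show ((m * j : ℤ) : ℂ) * om T * (Complex.log κ / (m * om T)) = j * Complex.log κ by push_cast; rw [mul_div_assoc', div_eq_iff h0]; ring,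
      Complex.exp_int_mul, Complex.exp_log κ.ne_zero, Units.val_zpow_eq_zpow_val]
end
end FileB10

section FileB11
open MeasureTheory Set Filter Topology
noncomputable section
open Polynomial
variable {n : ℕ}

def mu (T : ℝ) (f : Fin n → ℂ → ℂ) (P : MvPolynomial (Fin n) ℂ) (i : Fin n) : ℂ :=
  ∫ x in (0:ℝ)..T, MvPolynomial.eval (fun i => f i x) P * deriv (f i) x

def pth (T : ℝ) (F : Fin n → LL[X]) : Fin n → ℂ → ℂ := fun i => (PT T (F i)).fn

lemma pth_d (T : ℝ) (F : Fin n → LL[X]) (i : Fin n) : Differentiable ℂ (pth T F i) := entD _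

lemma eq_of_deriv {f g : ℂ → ℂ} (hf : Differentiable ℂ f) (hg : Differentiable ℂ g) (h : ∀ x, deriv f x = deriv g x) (h0 : f 0 = g 0) : f = g := by
  have := is_const_of_deriv_eq_zero (hf.sub hg) (fun x => by rw [deriv_sub (hf x) (hg x), h, sub_self])
  funext x
  have := this x 0
  simp only [Pi.sub_apply, h0, sub_self] at this
  exact sub_eq_zero.1 this

section
variable {f : Fin n → ℂ → ℂ} {J : List (Fin n) → ℂ → ℂ} (hf : ∀ i, Differentiable ℂ (f i)) (hJ : IsJ f J) (h0 : ∀ i, f i 0 = 0)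
include hJ

lemma J_prim (j : Fin n) {h : ℂ → ℂ} (hh : h ∈ Submodule.span ℂ (range J)) : ∃ k ∈ Submodule.span ℂ (J '' {l | l ≠ []}), 
    Differentiable ℂ k ∧ (∀ x, deriv k x = deriv (f j) x * h x) ∧ k 0 = 0 := by
  induction hh using Submodule.span_induction with
  | mem h hh => 
    obtain ⟨l, rfl⟩ := hh
    exact ⟨J (j :: l), Submodule.subset_span ⟨_, by simp, rfl⟩, hJ.hd _, hJ.der j l, hJ.zero j l⟩
  | zero => exact ⟨0, zero_mem _, differentiable_const _, fun x => by simp, rfl⟩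
  | add a b _ _ ha hb =>
    obtain ⟨k, h1, h2, h3, h4⟩ := ha
    obtain ⟨k', h1', h2', h3', h4'⟩ := hb
    exact ⟨k + k', add_mem h1 h1', h2.add h2', fun x => by rw [deriv_add (h2 x) (h2' x), h3, h3', Pi.add_apply, mul_add], by simp [h4, h4']⟩
  | smul c a _ ha =>
    obtain ⟨k, h1, h2, h3, h4⟩ := ha
    exact ⟨c • k, Submodule.smul_mem _ _ h1, h2.const_smul c, fun x => by rw [deriv_const_smul _ (h2 x), h3]; simp; ring, by simp [h4]⟩

include hf h0
lemma f_mul_mem (i : Fin n) {h : ℂ → ℂ} (hh : h ∈ Submodule.span ℂ (range J)) : f i * h ∈ Submodule.span ℂ (range J) := by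
  have hs : Submodule.span ℂ (J '' {l | l ≠ []}) ≤ Submodule.span ℂ (range J) := Submodule.span_mono (image_subset_range _ _)
  induction hh using Submodule.span_induction with
  | zero => rw [mul_zero]; exact zero_mem _
  | add a b _ _ ha hb => rw [mul_add]; exact add_mem ha hb
  | smul c a _ ha => rw [mul_smul_comm]; exact Submodule.smul_mem _ _ ha
  | mem h hh => 
    obtain ⟨l, rfl⟩ := hh
    induction l with
    | nil => 
      refine Submodule.subset_span ⟨[i], eq_of_deriv (hJ.hd _) ((hf i).mul (hJ.hd _)) (fun x => ?_) ?_⟩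
      · rw [hJ.der, deriv_mul (hf i x) (hJ.hd _ x), hJ.nil]; simp
      · rw [hJ.zero]; simp [h0]
    | cons j l ih =>
      obtain ⟨k, h1, h2, h3, h4⟩ := J_prim hJ j ih
      have : f i * J (j :: l) = J (i :: j :: l) + k := by
        refine eq_of_deriv ((hf i).mul (hJ.hd _)) ((hJ.hd _).add h2) (fun x => ?_) ?_
        · rw [deriv_mul (hf i x) (hJ.hd _ x), deriv_add (hJ.hd _ x) (h2 x), h3, hJ.der, hJ.der, Pi.mul_apply]; ring
        · simp [h0, h4, hJ.zero]
      rw [this]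
      exact add_mem (Submodule.subset_span ⟨_, rfl⟩) (hs h1)

lemma P_mem (P : MvPolynomial (Fin n) ℂ) : (fun x => MvPolynomial.eval (fun i => f i x) P) ∈ Submodule.span ℂ (range J) := by
  induction P using MvPolynomial.induction_on with
  | C a => 
    have : (fun x => MvPolynomial.eval (fun i => f i x) (MvPolynomial.C a)) = a • J [] := by funext x; simp [hJ.nil]
    rw [this]; exact Submodule.smul_mem _ _ (Submodule.subset_span ⟨_, rfl⟩)
  | add p q hp hq => simp only [map_add]; exact add_mem hp hq
  | mul_X p i hp => 
    have := f_mul_mem hf hJ h0 i hp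
    convert! this using 1
    funext x; simp [mul_comm]

lemma mu_of_univ {T : ℝ} (hu : ∀ l, l ≠ [] → J l T = 0) (P : MvPolynomial (Fin n) ℂ) (i : Fin n) : mu T f P i = 0 := by
  obtain ⟨k, h1, h2, h3, h4⟩ := J_prim hJ i (P_mem hf hJ h0 P)
  have hk : ∀ x : ℝ, HasDerivAt (fun x : ℝ => k x) (MvPolynomial.eval (fun i => f i x) P * deriv (f i) x) x := fun x => by
    have := (h2 x).hasDerivAt.comp_ofReal
    rwa [h3, mul_comm] at this
  rw [mu, intervalIntegral.integral_eq_sub_of_hasDerivAt (fun x _ => hk x), Complex.ofReal_zero, h4, sub_zero]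
  · have : Submodule.span ℂ (J '' {l | l ≠ []}) ≤ LinearMap.ker (LinearMap.proj (R := ℂ) (φ := fun _ : ℂ => ℂ) (T:ℂ)) :=
      Submodule.span_le.2 (by rintro _ ⟨l, hl, rfl⟩; exact hu l hl)
    exact this h1
  · refine Continuous.intervalIntegrable ?_ _ _
    exact ((diff_evalMv hf P).continuous.comp Complex.continuous_ofReal).mul 
      ((((hf i).contDiff (n := 1)).continuous_deriv le_rfl).comp Complex.continuous_ofReal)

omit hf h0 in
lemma J_of_const {T : ℂ} (hc : ∀ i x y, f i x = f i y) (l : List (Fin n)) (hl : l ≠ []) : J l T = 0 := by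
  cases l with
  | nil => exact absurd rfl hl
  | cons i l =>
    rw [← hJ.zero i l]
    refine is_const_of_deriv_eq_zero (hJ.hd _) (fun x => ?_) _ _
    rw [hJ.der, (funext fun x => hc i x 0 : f i = fun _ => f i 0), deriv_const, zero_mul]
end

lemma dich {T : ℝ} (hT : 0 < T) (F : Fin n → LL[X]) (hnc : ∃ i x y, pth T F i x ≠ pth T F i y) :
    Alg (pth T F) ∨ ∃ f m b c0, NA f m b c0 ∧ F = fun i => C (f i) := by
  by_cases h1 : ∃ i j, br (pE T (F i)) (pE T (F j)) ≠ 0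
  · obtain ⟨i, j, h⟩ := h1
    exact Or.inl (alg_caseI hT F i j h)
  push Not at h1
  by_cases h2 : ∃ i, px (pE T (F i)) ≠ 0
  · obtain ⟨i, hi⟩ := h2
    refine Or.inl (alg_caseIIa (fun i => pE T (F i)) h1 i hi ?_)
    have ht : Transcendental ℂ (F i) := fun ha => transc_of_der' px hi (ha.algHom (pE T))
    exact fun ha => ht ((isAlgebraic_algHom_iff (PT T) (PT_inj hT)).1 ha)
  push Not at h2
  have h3 : ∀ i, ∃ f : LL, F i = C f := fun i => by
    have h4 := h2 i
    rw [px_apply] at h4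
    have := natDegree_eq_zero_of_derivative_eq_zero h4
    rw [show (pE T (F i)) = (F i).map (lE T).toRingHom from rfl, natDegree_map_eq_of_injective (lE_inj hT)] at this
    exact ⟨_, eq_C_of_natDegree_eq_zero this⟩
  choose f hf using h3
  obtain ⟨i, x, y, hi⟩ := hnc
  have hp : pth T F = fun i => (lE T (f i)).fn := by funext i; rw [pth, hf, PT_C]
  rcases trig_dich hT f ⟨i, fun c hc => hi (by simp only [hp, hc, AlgHom.commutes, fn_alg])⟩ with h | ⟨m, b, c0, h⟩
  · left; rwa [hp]
  · exact Or.inr ⟨f, m, b, c0, h, funext hf⟩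

lemma pth_C (T : ℝ) (f : Fin n → LL) : pth T (fun i => C (f i)) = fun i => (lE T (f i)).fn := by funext i; rw [pth, PT_C]

lemma NA.mu_ne {T : ℝ} (hT : 0 < T) {f : Fin n → LL} {m b c0} (h : NA f m b c0) : ∃ P i, mu T (pth T fun i => C (f i)) P i ≠ 0 := by
  obtain ⟨P, i, hi⟩ := h.mo_ne
  refine ⟨P, i, ?_⟩
  rw [mu, pth_C, mo_eq hT]
  exact mul_ne_zero (mul_ne_zero (by exact_mod_cast hT.ne') (om_ne hT)) hi

lemma univ_of_rel {T : ℝ} (hT : 0 < T) {F : Fin n → LL[X]} {J} (hJ : IsJ (pth T F) J) (hm : ∀ P i, mu T (pth T F) P i = 0) 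
    (hr : (∃ i x y, pth T F i x ≠ pth T F i y) → PRel (pth T F) (pth T F) 0 T) (l : List (Fin n)) (hl : l ≠ []) : J l T = 0 := by
  by_cases hnc : ∃ i x y, pth T F i x ≠ pth T F i y
  · obtain ⟨i, l', rfl⟩ := List.exists_cons_of_ne_nil hl
    rcases dich hT F hnc with h | ⟨f, m, b, c0, h, rfl⟩
    · exact caseB (pth_d T F) h (hr hnc) hJ i l'
    · obtain ⟨P, i, hi⟩ := h.mu_ne hT; exact absurd (hm P i) hi
  · push Not at hnc; exact J_of_const hJ hnc l hl

lemma univ_of_zero {T : ℝ} (hT : 0 < T) {F : Fin n → LL[X]} {J} (hJ : IsJ (pth T F) J) (hm : ∀ P i, mu T (pth T F) P i = 0) 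
    (l : List (Fin n)) (hl : l ≠ []) : J l T = 0 := by
  refine univ_of_rel hT hJ hm (fun hnc => ?_) l hl
  obtain ⟨e, t, h1, h2⟩ := moments_rel hT (fun _ : Unit => pth T F) (fun _ => 1) (fun _ => pth_d T F) (fun _ => hnc) (fun P i => by 
    simpa [mu] using hm P i) () one_ne_zero false
  cases t
  · simp [sgn] at h2
  · simpa [endp] using h1

theorem Dprime {T : ℝ} (hT : 0 < T) {F G : Fin n → LL[X]} (hF : ∀ i, pth T F i 0 = 0) (hG : ∀ i, pth T G i 0 = 0)
    (hm : ∀ P i, mu T (pth T F) P i = mu T (pth T G) P i) {J K} (hJ : IsJ (pth T F) J) (hK : IsJ (pth T G) K) :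
    (PRel (pth T F) (pth T G) 0 0 ∧ ∀ l, J l T = K l T) ∨ ((∀ l, l ≠ [] → J l T = 0) ∧ ∀ l, l ≠ [] → K l T = 0) ∨ 
    ∃ c, (∀ i x, pth T G i x = pth T F i (x + c)) ∧ ∀ i x, pth T F i (x + T) = pth T F i x := by
  have z : (∀ P i, mu T (pth T F) P i = 0) → (∀ l, l ≠ [] → J l T = 0) ∧ ∀ l, l ≠ [] → K l T = 0 := fun h =>
    ⟨univ_of_zero hT hJ h, univ_of_zero hT hK (fun P i => by rw [← hm, h])⟩
  by_cases hfc : ∃ i x y, pth T F i x ≠ pth T F i y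
  swap
  · push Not at hfc
    exact Or.inr (Or.inl (z (mu_of_univ (pth_d T F) hJ hF (J_of_const hJ hfc))))
  by_cases hgc : ∃ i x y, pth T G i x ≠ pth T G i y
  swap
  · push Not at hgc
    exact Or.inr (Or.inl (z (fun P i => by rw [hm]; exact mu_of_univ (pth_d T G) hK hG (J_of_const hK hgc) P i)))
  have R := moments_rel hT (fun e : Bool => pth T (cond e F G)) (fun e => cond e 1 (-1)) (fun e => pth_d T _) (by rintro (_|_) <;> assumption)
    (fun P i => by simpa [mu, sub_eq_zero, ← sub_eq_add_neg] using hm P i)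
  have R' : ∀ F G : Fin n → LL[X], (∀ t, PRel (pth T F) (pth T F) (endp T t) (endp T !t) ∨ PRel (pth T F) (pth T G) (endp T t) (endp T t)) →
      PRel (pth T F) (pth T F) 0 T ∨ (PRel (pth T F) (pth T G) 0 0 ∧ PRel (pth T F) (pth T G) T T) := fun F G h => by
    have h0 := h false
    have h1 := h true
    simp only [endp, Bool.not_false, Bool.not_true, if_true, Bool.false_eq_true, if_false] at h0 h1
    rcases h0 with h0 | h0
    · exact Or.inl h0
    · rcases h1 with h1 | h1
      · exact Or.inl h1.symm
      · exact Or.inr ⟨h0, h1⟩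
  have A : ∀ {F G : Fin n → LL[X]} {J K}, IsJ (pth T F) J → IsJ (pth T G) K → (∀ i, pth T F i 0 = 0) →
      (∀ P i, mu T (pth T F) P i = mu T (pth T G) P i) → Alg (pth T F) → 
      (∀ t, PRel (pth T F) (pth T F) (endp T t) (endp T !t) ∨ PRel (pth T F) (pth T G) (endp T t) (endp T t)) → 
      (PRel (pth T F) (pth T G) 0 0 ∧ ∀ l, J l T = K l T) ∨ ∀ P i, mu T (pth T F) P i = 0 := by
    intro F G J K hJ hK hF hm hA h
    rcases R' F G h with h | ⟨h, h'⟩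
    · right
      refine mu_of_univ (pth_d T F) hJ hF (fun l hl => ?_)
      obtain ⟨i, l', rfl⟩ := List.exists_cons_of_ne_nil hl
      exact caseB (pth_d T F) hA h hJ i l'
    · exact Or.inl ⟨h, caseA (pth_d T F) (pth_d T G) hA h h' hJ hK⟩
  rcases dich hT F hfc with hA | ⟨f, m, b, c0, h, rfl⟩
  · rcases A hJ hK hF hm hA (fun t => by
      obtain ⟨e, t', h1, h2⟩ := R true (by simp) t
      cases e <;> cases t <;> cases t' <;> simp [sgn] at h2 <;> simp_all) with h | h
    · exact Or.inl h
    · exact Or.inr (Or.inl (z h))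
  rcases dich hT G hgc with hA | ⟨g, m', b', c0', h', rfl⟩
  · rcases A hK hJ hG (fun P i => (hm P i).symm) hA (fun t => by
      obtain ⟨e, t', h1, h2⟩ := R false (by simp) t
      cases e <;> cases t <;> cases t' <;> simp [sgn] at h2 <;> simp_all) with h | h
    · exact Or.inl ⟨h.1.symm, fun l => (h.2 l).symm⟩
    · exact Or.inr (Or.inl (z (fun P i => by rw [hm, h])))
  obtain ⟨c, hc⟩ := h.shift hT h' (fun P i => by
    have := hm P i
    rw [mu, mu, pth_C, pth_C, mo_eq hT, mo_eq hT] at this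
    exact mul_left_cancel₀ (mul_ne_zero (by exact_mod_cast hT.ne') (om_ne hT)) this)
  refine Or.inr (Or.inr ⟨c, ?_, ?_⟩)
  · rw [pth_C, pth_C]; exact hc
  · rw [pth_C]; exact fun i x => lE_per hT _ _
end
end FileB11

section FileC1
open MeasureTheory Set Filter Topology
noncomputable section
variable {n : ℕ}

def Pm (n : ℕ) : ℕ → (List (Fin n) →₀ ℂ)
  | 0 => Finsupp.single [] 1
  | m + 1 => -∑ i : Fin n, if i.1 ≤ m then ((m - i.1 : ℕ) + 1 : ℂ) • Finsupp.mapDomain (List.cons i) (Pm n (m - i.1)) else 0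
decreasing_by omega

def JE {f : Fin n → ℂ → ℂ} {J : List (Fin n) → ℂ → ℂ} (hJ : IsJ f J) (l : List (Fin n)) : Ent := Ent.mk (J l) (hJ.hd l)

def pp {f : Fin n → ℂ → ℂ} {J : List (Fin n) → ℂ → ℂ} (hJ : IsJ f J) (m : ℕ) : Ent := Finsupp.linearCombination ℂ (JE hJ) (Pm n m)

lemma pp_val {f : Fin n → ℂ → ℂ} {J : List (Fin n) → ℂ → ℂ} (hJ : IsJ f J) (m : ℕ) (x : ℂ) : 
    (pp hJ m).fn x = (Pm n m).sum fun l c => c * J l x := by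
  rw [← evE_apply, pp, Finsupp.linearCombination_apply, map_finsuppSum]
  simp only [map_smul]; rfl

section
variable {f : Fin n → Ent} {J : List (Fin n) → ℂ → ℂ} (hJ : IsJ (fun i => (f i).fn) J)

lemma dE_JE (i : Fin n) (P : List (Fin n) →₀ ℂ) : 
    dE (Finsupp.linearCombination ℂ (JE hJ) (P.mapDomain (List.cons i))) = dE (f i) * Finsupp.linearCombination ℂ (JE hJ) P := by
  rw [Finsupp.linearCombination_mapDomain, Finsupp.linearCombination_apply, Finsupp.linearCombination_apply, Finsupp.sum, Finsupp.sum, map_sum, Finset.mul_sum]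
  refine Finset.sum_congr rfl fun l _ => ?_
  rw [Derivation.map_smul, mul_smul_comm]
  congr 1
  exact Ent.ext' fun x => hJ.der i l x

lemma pp_zero : pp hJ 0 = 1 := by
  rw [pp, Pm, Finsupp.linearCombination_single, one_smul]
  exact Ent.ext' fun x => congrFun hJ.nil x

lemma pp_succ (m : ℕ) : dE (pp hJ (m+1)) = -∑ i : Fin n, if i.1 ≤ m then ((m - i.1 : ℕ) + 1 : ℂ) • (dE (f i) * pp hJ (m - i.1)) else 0 := by
  rw [pp, Pm, map_neg, map_neg, map_sum, map_sum]
  congr 1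
  refine Finset.sum_congr rfl fun i _ => ?_
  split_ifs
  · rw [map_smul, Derivation.map_smul, dE_JE]; rfl
  · simp

lemma pp_at0 (m : ℕ) : (pp hJ (m+1)).fn 0 = 0 := by
  rw [← evE_apply, pp, Pm, map_neg, map_neg, map_sum, map_sum, neg_eq_zero]
  refine Finset.sum_eq_zero fun i _ => ?_
  split_ifs
  · rw [map_smul, map_smul, Finsupp.linearCombination_mapDomain, Finsupp.linearCombination_apply, map_finsuppSum, Finsupp.sum, Finset.sum_eq_zero, smul_zero]
    intro l _
    rw [map_smul]
    exact (congrArg _ (hJ.zero i l)).trans (smul_zero _)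
  · simp
end

open PowerSeries

def D1 (F : Ent⟦X⟧) : Ent⟦X⟧ := PowerSeries.mk fun m => dE (coeff m F)
def dd (f : Fin n → Ent) (F : Ent⟦X⟧) : Ent⟦X⟧ := D1 F + (∑ i : Fin n, X ^ (i.1+2) * C (dE (f i))) * PowerSeries.derivative Ent F

lemma dd_add (f : Fin n → Ent) (F G : Ent⟦X⟧) : dd f (F + G) = dd f F + dd f G := by
  have : D1 (F + G) = D1 F + D1 G := by ext m; simp [D1]
  rw [dd, dd, dd, this, map_add]; ring

lemma dd_mul (f : Fin n → Ent) (F G : Ent⟦X⟧) : dd f (F * G) = dd f F * G + F * dd f G := by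
  have : D1 (F * G) = D1 F * G + F * D1 G := by
    ext m
    rw [D1, coeff_mk, map_add, coeff_mul, coeff_mul, coeff_mul, map_sum, ← Finset.sum_add_distrib]
    refine Finset.sum_congr rfl fun x _ => ?_
    rw [Derivation.leibniz, D1, D1, coeff_mk, coeff_mk]; simp only [smul_eq_mul]; ring
  rw [dd, dd, dd, this, Derivation.leibniz]; simp only [smul_eq_mul]; ring

lemma dd_const (f : Fin n → Ent) (c : ℂ) : dd f (C (algebraMap ℂ Ent c)) = 0 := by
  have : D1 (C (algebraMap ℂ Ent c)) = 0 := by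
    ext m; rw [D1, coeff_mk, coeff_C]; split_ifs <;> simp
  rw [dd, this]; simp

lemma coeff_dd (f : Fin n → Ent) (F : Ent⟦X⟧) (k : ℕ) : coeff k (dd f F) = dE (coeff k F) + ∑ i : Fin n, if i.1 + 2 ≤ k then 
    dE (f i) * (coeff (k - (i.1 + 2) + 1) F * ((k - (i.1+2) : ℕ) + 1)) else 0 := by
  rw [dd, map_add, D1, coeff_mk, Finset.sum_mul, map_sum]
  congr 1
  refine Finset.sum_congr rfl fun i _ => ?_
  rw [mul_assoc, coeff_X_pow_mul']
  split_ifs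
  · rw [coeff_C_mul, coeff_derivative]
  · rfl

lemma dd_lead {f : Fin n → Ent} {F : Ent⟦X⟧} (h : dd f F = 0) (r : ℕ) (hr : ∀ j < r, coeff j F = 0) : ∃ c : ℂ, coeff r F = algebraMap ℂ Ent c := by
  refine dE_eq_zero ?_
  have := coeff_dd f F r
  rw [h, map_zero, Finset.sum_eq_zero, add_zero] at this
  · exact this.symm
  · intro i _
    split_ifs
    · rw [hr _ (by omega), zero_mul, mul_zero]
    · rfl

def psi {f : Fin n → ℂ → ℂ} {J : List (Fin n) → ℂ → ℂ} (hJ : IsJ f J) : Ent⟦X⟧ := X * PowerSeries.mk (pp hJ)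

lemma dd_psi {f : Fin n → Ent} {J : List (Fin n) → ℂ → ℂ} (hJ : IsJ (fun i => (f i).fn) J) : dd f (psi hJ) = 0 := by
  ext k
  rw [coeff_dd, map_zero]
  rcases k with _ | _ | k
  · simp [psi]
  · rw [psi, zero_add, coeff_succ_X_mul, coeff_mk, pp_zero, Finset.sum_eq_zero (fun i _ => if_neg (by omega))]; simp
  · simp only [psi, coeff_succ_X_mul, coeff_mk]
    rw [pp_succ, neg_add_eq_zero]
    refine Finset.sum_congr rfl fun i _ => ?_
    rw [show k + 1 + 1 - (i.1 + 2) = k - i.1 by omega]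
    simp only [show i.1 + 2 ≤ k + 1 + 1 ↔ i.1 ≤ k by omega]
    split_ifs
    · rw [Algebra.smul_def]; simp; ring
    · rfl

def sh (c : ℂ) : Ent →+* Ent where
  toFun f := Ent.mk (fun x => f.fn (x + c)) ((entD f).comp (differentiable_id.add_const c))
  map_one' := rfl
  map_mul' _ _ := rfl
  map_zero' := rfl
  map_add' _ _ := rfl

lemma sh_dE (c : ℂ) (f : Ent) : dE (sh c f) = sh c (dE f) := Ent.ext' fun x => deriv_comp_add_const (f := f.fn) c x

lemma dd_sh (c : ℂ) (f : Fin n → Ent) (F : Ent⟦X⟧) : dd (fun i => sh c (f i)) (PowerSeries.map (sh c) F) = PowerSeries.map (sh c) (dd f F) := by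
  ext k
  rw [coeff_dd, coeff_map, coeff_map, coeff_dd, map_add, sh_dE, map_sum]
  congr 1
  refine Finset.sum_congr rfl fun i _ => ?_
  split_ifs
  · simp [sh_dE]
  · simp

lemma dd_zero {f : Fin n → Ent} {F : Ent⟦X⟧} (h : dd f F = 0) (h0 : ∀ k, (coeff k F).fn 0 = 0) : F = 0 := by
  ext k
  induction k using Nat.strong_induction_on with
  | _ k ih =>
    obtain ⟨c, hc⟩ := dd_lead h k ih
    have := h0 k
    rw [hc, fn_alg] at this
    rw [hc, this, map_zero, map_zero]

lemma dd_pow {f : Fin n → Ent} {Q : Ent⟦X⟧} (hQ : dd f Q = 0) (r : ℕ) : dd f (Q ^ r) = 0 := by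
  induction r with
  | zero => simpa using dd_const f 1
  | succ r ih => rw [pow_succ, dd_mul, ih, hQ]; simp

lemma dd_per {f : Fin n → Ent} {Q : Ent⟦X⟧} (hQ : dd f Q = 0) (h0 : coeff 0 Q = 0) (h1 : coeff 1 Q = 1) {T : ℂ} (hT : PowerSeries.map (sh T) Q = Q)
    (k r : ℕ) : ∀ F : Ent⟦X⟧, dd f F = 0 → (∀ j < r, coeff j F = 0) → ∀ j < r + k, sh T (coeff j F) = coeff j F := by
  induction k generalizing r with
  | zero => intro F _ hr j hj; rw [hr j (by omega), map_zero]
  | succ k ih =>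
    intro F hF hr j hj
    obtain ⟨c, hc⟩ := dd_lead hF r hr
    have hp := dd_pow hQ r
    have hr2 : ∀ j < r + 1, coeff j (Q ^ r) = if j = r then 1 else 0 := by
      obtain ⟨Q', rfl⟩ := (PowerSeries.X_dvd_iff (φ := Q)).2 (by rwa [← coeff_zero_eq_constantCoeff_apply])
      rw [← zero_add 1, coeff_succ_X_mul] at h1
      intro j hj
      rw [mul_pow, coeff_X_pow_mul']
      split_ifs with h2 h3 h3
      · subst h3; rw [Nat.sub_self, coeff_zero_eq_constantCoeff_apply, map_pow, ← coeff_zero_eq_constantCoeff_apply, h1, one_pow]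
      · omega
      · omega
      · rfl
    have h3 := ih (r+1) (F + C (algebraMap ℂ Ent (-c)) * Q ^ r) (by rw [dd_add, dd_mul, dd_const, hp, hF]; simp) (by
      intro j hj
      rw [map_add, coeff_C_mul, hr2 j hj]
      split_ifs with h
      · rw [h, hc]; simp
      · rw [hr j (by omega)]; simp) j (by omega)
    rw [map_add, map_add, coeff_C_mul, map_mul, ← coeff_map, ← coeff_map, map_pow, hT] at h3
    exact add_right_cancel h3

lemma shift_center {f : Fin n → Ent} {J K : List (Fin n) → ℂ → ℂ} (c T : ℂ) (hJ : IsJ (fun i => (f i).fn) J) (hK : IsJ (fun i => (sh c (f i)).fn) K)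
    (hp : ∀ i, sh T (f i) = f i) (h : ∀ m, (pp hJ (m+1)).fn T = 0) (m : ℕ) : (pp hK (m+1)).fn T = 0 := by
  have hψ : PowerSeries.map (sh T) (psi hJ) = psi hJ := by
    have h1 := dd_sh T f (psi hJ)
    simp only [hp] at h1
    rw [dd_psi, map_zero] at h1
    have h2 := dd_zero (F := PowerSeries.map (sh T) (psi hJ) + C (algebraMap ℂ Ent (-1)) * psi hJ) (f := f)
      (by rw [dd_add, dd_mul, dd_const, h1, dd_psi]; simp) (by
        intro k
        rw [map_add, coeff_map, coeff_C_mul, fn_add, fn_mul, fn_alg]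
        change (coeff k (psi hJ)).fn (0 + T) + _ = _
        rw [zero_add]
        rcases k with _ | _ | k
        · simp [psi, fn_zero]
        · rw [psi, coeff_succ_X_mul, coeff_mk, pp_zero]; simp [fn_one]
        · rw [psi, coeff_succ_X_mul, coeff_mk, h, pp_at0]; simp)
    simpa [add_neg_eq_zero] using h2
  have h1 := dd_per (Q := PowerSeries.map (sh c) (psi hJ)) (by rw [dd_sh, dd_psi, map_zero]) (by simp [psi])
    (by rw [psi, coeff_map, ← zero_add 1, coeff_succ_X_mul, coeff_mk, pp_zero, map_one]) (T := T) (by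
      nth_rw 2 [← hψ]
      ext1 k
      simp only [coeff_map]
      refine Ent.ext' fun x => ?_
      change (coeff k (psi hJ)).fn (x + T + c) = (coeff k (psi hJ)).fn (x + c + T)
      rw [add_right_comm]) (m+3) 0 (psi hK) (dd_psi hK) (by simp) (m+2) (by omega)
  rw [psi, coeff_succ_X_mul, coeff_mk] at h1
  have h2 := fn_congr h1 0
  change (pp hK (m+1)).fn (0 + T) = _ at h2
  rwa [zero_add, pp_at0] at h2

lemma center_imp {T : ℝ} (hT : 0 < T) {F G : Fin n → Polynomial LL} (hF : ∀ i, pth T F i 0 = 0) (hG : ∀ i, pth T G i 0 = 0)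
    (hm : ∀ P i, mu T (pth T F) P i = mu T (pth T G) P i) {J K} (hJ : IsJ (pth T F) J) (hK : IsJ (pth T G) K)
    (h : ∀ m, (pp hJ (m+1)).fn T = 0) (m : ℕ) : (pp hK (m+1)).fn T = 0 := by
  rcases Dprime hT hF hG hm hJ hK with h1 | h1 | ⟨c, h1, h2⟩
  · rw [← h m, pp_val, pp_val]; simp only [h1.2]
  · rw [← h m, pp_val, pp_val]
    refine Finset.sum_congr rfl fun l _ => ?_
    dsimp only
    by_cases hl : l = []
    · rw [hl, hJ.nil, hK.nil]
    · rw [h1.1 l hl, h1.2 l hl]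
  · have e : pth T G = fun i => (sh c (PT T (F i))).fn := funext fun i => funext fun x => h1 i x
    have hK' : IsJ (fun i => (sh c (PT T (F i))).fn) K := e ▸ hK
    have := shift_center (f := fun i => PT T (F i)) c T hJ hK' (fun i => Ent.ext' fun x => h2 i x) h m
    rwa [pp_val] at this ⊢
end
end FileC1

section FileC2
open MeasureTheory Set Filter Topology
noncomputable section
variable {n : ℕ}

lemma pow_lip {x y : ℂ} (hx : ‖x‖ ≤ 1) (hy : ‖y‖ ≤ 1) (j : ℕ) : ‖x ^ j - y ^ j‖ ≤ j * ‖x - y‖ := by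
  induction j with
  | zero => simp
  | succ j ih =>
    have : x ^ (j+1) - y ^ (j+1) = x * (x ^ j - y ^ j) + (x - y) * y ^ j := by ring
    rw [this]
    refine (norm_add_le _ _).trans ?_
    rw [norm_mul, norm_mul, norm_pow]
    have h1 : ‖y‖ ^ j ≤ 1 := pow_le_one₀ (norm_nonneg _) hy
    push_cast
    nlinarith [norm_nonneg (x - y), norm_nonneg (x ^ j - y ^ j), norm_nonneg x]

section
variable {T A ρ : ℝ} (hT : 0 < T) {b : Fin n → ℝ → ℂ} (hb : ∀ i, Continuous (b i)) (hA0 : 0 ≤ A) (hA : ∀ i, ∀ x ∈ Icc 0 T, ‖b i x‖ ≤ A)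
  (h0 : 0 < ρ) (h1 : ρ ≤ 1) (h2 : 2 * T * (n * A) * ρ < 1)

def rhs (b : Fin n → ℝ → ℂ) (s : ℝ) (v : ℂ) : ℂ := ∑ i, b i s * v ^ (i.1 + 2)

include hA0 hA h0 h1 in
lemma rhs_le {s : ℝ} (hs : s ∈ Icc 0 T) {v : ℂ} (hv : ‖v‖ ≤ ρ) : ‖rhs b s v‖ ≤ n * A * ρ ^ 2 := by
  refine (norm_sum_le _ _).trans ?_
  rw [show (n : ℝ) * A * ρ ^ 2 = ∑ _i : Fin n, A * ρ ^ 2 by simp; ring]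
  refine Finset.sum_le_sum fun i _ => ?_
  rw [norm_mul, norm_pow]
  refine mul_le_mul (hA i s hs) ((pow_le_pow_left₀ (norm_nonneg _) hv _).trans (pow_le_pow_of_le_one h0.le h1 (by omega))) (by positivity) hA0

include hb in
lemma sol_cont {y : ℝ} (hy : 0 ≤ y) {v : ℝ → ℂ} (hv : ∀ x ∈ Icc 0 y, v x = v 0 + ∫ s in (0:ℝ)..x, rhs b s (v s))
    (hi : IntervalIntegrable (fun s => rhs b s (v s)) volume 0 y) : ContinuousOn v (Icc 0 y) ∧ 
      ∀ x ∈ Ico 0 y, HasDerivWithinAt v (rhs b x (v x)) (Ici x) x := by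
  have hc : ContinuousOn v (Icc 0 y) := by
    have := intervalIntegral.continuousOn_primitive_interval' hi left_mem_uIcc
    rw [uIcc_of_le hy] at this
    exact (continuousOn_const.add this).congr hv
  refine ⟨hc, fun x hx => ?_⟩
  have hr : ContinuousOn (fun s => rhs b s (v s)) (Icc 0 y) := by
    unfold rhs
    exact continuousOn_finset_sum _ fun i _ => (hb i).continuousOn.mul (hc.pow _)
  set g : ℝ → ℂ := IccExtend hy ((Icc 0 y).restrict fun s => rhs b s (v s)) with hg
  have hgc : Continuous g := (continuousOn_iff_continuous_restrict.1 hr).Icc_extend'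
  have hge : ∀ s ∈ Icc 0 y, g s = rhs b s (v s) := fun s hs => by rw [hg, IccExtend_of_mem _ _ hs]; rfl
  have hd := ((hgc.integral_hasStrictDerivAt 0 x).hasDerivAt.const_add (v 0)).hasDerivWithinAt (s := Ici x)
  rw [hge x ⟨hx.1, hx.2.le⟩] at hd
  have e : ∀ u ∈ Icc 0 y, v u = v 0 + ∫ s in (0:ℝ)..u, g s := by
    intro u hu
    rw [hv u hu]; congr 1
    refine intervalIntegral.integral_congr fun s hs => (hge s ?_).symm
    rw [uIcc_of_le hu.1] at hs
    exact ⟨hs.1, hs.2.trans hu.2⟩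
  refine hd.congr_of_eventuallyEq ?_ (e x ⟨hx.1, hx.2.le⟩)
  filter_upwards [Icc_mem_nhdsGE hx.2] with u hu
  exact e u ⟨hx.1.trans hu.1, hu.2⟩

include hT hb hA0 hA h0 h1 h2 in
lemma sol_bd {y : ℝ} (hy : 0 ≤ y) (hyT : y ≤ T) {v : ℝ → ℂ} (hv : ContinuousOn v (Icc 0 y)) 
    (hd : ∀ x ∈ Ico 0 y, HasDerivWithinAt v (rhs b x (v x)) (Ici x) x) (hv0 : ‖v 0‖ ≤ ρ / 2) : ∀ x ∈ Icc 0 y, ‖v x‖ ≤ ρ := by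
  have key := image_norm_le_of_norm_deriv_right_lt_deriv_boundary hv hd (B := fun x => ρ/2 + x * (ρ / (2*T))) (B' := fun _ => ρ / (2*T)) (by simpa using hv0)
    (fun x => by simpa using ((hasDerivAt_id x).mul_const (ρ / (2*T))).const_add (ρ/2)) ?_
  · intro x hx
    refine (key hx).trans ?_
    have : x * (ρ / (2*T)) ≤ T * (ρ / (2*T)) := by gcongr; exact hx.2.trans hyT
    have e : T * (ρ / (2*T)) = ρ / 2 := by field_simp
    linarith
  · intro x hx hn
    have hxT : x ≤ T := hx.2.le.trans hyT
    have : x * (ρ / (2*T)) ≤ T * (ρ / (2*T)) := by gcongr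
    have e : T * (ρ / (2*T)) = ρ / 2 := by field_simp
    refine (rhs_le hA0 hA h0 h1 ⟨hx.1, hxT⟩ (hn.trans_le (by linarith))).trans_lt ?_
    rw [lt_div_iff₀ (by positivity)]
    nlinarith

include hT hb hA0 hA h0 h1 h2 in
lemma sol_good {v : ℝ → ℂ} (hv : ∀ x ∈ Icc 0 T, v x = v 0 + ∫ s in (0:ℝ)..x, rhs b s (v s)) (hv0 : ‖v 0‖ ≤ ρ / 2) :
    ContinuousOn v (Icc 0 T) ∧ (∀ x ∈ Ico 0 T, HasDerivWithinAt v (rhs b x (v x)) (Ici x) x) ∧ ∀ x ∈ Icc 0 T, ‖v x‖ ≤ ρ := by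
  suffices hi : IntervalIntegrable (fun s => rhs b s (v s)) volume 0 T by
    have := sol_cont hb hT.le hv hi
    exact ⟨this.1, this.2, sol_bd hT hb hA0 hA h0 h1 h2 hT.le le_rfl this.1 this.2 hv0⟩
  set h : ℝ → ℂ := fun s => rhs b s (v s) with hh
  set G : Set ℝ := {x | x ∈ Icc 0 T ∧ IntervalIntegrable h volume 0 x} with hG
  have hG0 : (0:ℝ) ∈ G := ⟨⟨le_rfl, hT.le⟩, by simp⟩
  have hGb : BddAbove G := ⟨T, fun x hx => hx.1.2⟩
  have hgood : ∀ y ∈ G, ContinuousOn v (Icc 0 y) ∧ ∀ x ∈ Icc 0 y, ‖v x‖ ≤ ρ := by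
    intro y hy
    have := sol_cont hb hy.1.1 (fun x hx => hv x ⟨hx.1, hx.2.trans hy.1.2⟩) hy.2
    exact ⟨this.1, sol_bd hT hb hA0 hA h0 h1 h2 hy.1.1 hy.1.2 this.1 this.2 hv0⟩
  set c := sSup G with hc
  have hc0 : 0 ≤ c := le_csSup hGb hG0
  have hcT : c ≤ T := csSup_le ⟨0, hG0⟩ fun x hx => hx.1.2
  have hlt : ∀ x, x < c → ∃ y ∈ G, x < y := fun x hx => exists_lt_of_lt_csSup ⟨0, hG0⟩ hx
  have i1 : IntervalIntegrable h volume 0 c := by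
    rw [intervalIntegrable_iff_integrableOn_Ioo_of_le hc0]
    refine ⟨?_, .restrict_of_bounded (C := n * A * ρ ^ 2) (by simp) ?_⟩
    · refine ContinuousOn.aestronglyMeasurable ?_ (measurableSet_Ioo (a := (0:ℝ)) (b := c))
      have : ContinuousOn v (Ioo 0 c) := by
        intro x hx
        obtain ⟨y, hy, hxy⟩ := hlt x hx.2
        exact (((hgood y hy).1 x ⟨hx.1.le, hxy.le⟩).continuousAt (Icc_mem_nhds hx.1 hxy)).continuousWithinAt
      simp only [hh, rhs]
      exact continuousOn_finset_sum _ fun i _ => (hb i).continuousOn.mul (this.pow _)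
    · refine (ae_restrict_iff' (measurableSet_Ioo (a := (0:ℝ)) (b := c))).2 (ae_of_all _ fun x hx => ?_)
      obtain ⟨y, hy, hxy⟩ := hlt x hx.2
      exact rhs_le hA0 hA h0 h1 ⟨hx.1.le, hx.2.le.trans hcT⟩ ((hgood y hy).2 x ⟨hx.1.le, hxy.le⟩)
  have i2 : IntervalIntegrable h volume c T := by
    have hcont : IntervalIntegrable (fun s => rhs b s (v 0)) volume c T := by
      refine Continuous.intervalIntegrable ?_ _ _
      unfold rhs
      exact continuous_finset_sum _ fun i _ => (hb i).mul continuous_const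
    refine hcont.congr ?_
    intro s hs
    rw [uIoc_of_le hcT] at hs
    have hs2 : s ∈ Icc 0 T := ⟨hc0.trans hs.1.le, hs.2⟩
    have : v s = v 0 := by
      rw [hv s hs2, intervalIntegral.integral_undef, add_zero]
      intro hint
      exact absurd (le_csSup hGb (⟨hs2, hint⟩ : s ∈ G)) (not_le.2 hs.1)
    simp only [hh, this]
  exact i1.trans i2

include hT hb hA0 hA h0 h1 h2 in
lemma sol_ex {v0 : ℂ} (hv0 : ‖v0‖ ≤ ρ / 2) : ∃ v : ℝ → ℂ, v 0 = v0 ∧ ∀ x ∈ Icc 0 T, v x = v 0 + ∫ s in (0:ℝ)..x, rhs b s (v s) := by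
  have key : IsPicardLindelof (rhs b) (tmin := 0) (tmax := T) ⟨0, le_rfl, hT.le⟩ (0:ℂ) ⟨ρ, h0.le⟩ ⟨ρ/2, by positivity⟩ ⟨n * A * ρ ^ 2, by positivity⟩
      ⟨∑ i : Fin n, A * ((i.1 + 2 : ℕ):ℝ), by positivity⟩ := by
    refine ⟨fun t ht => ?_, fun x hx => ?_, fun t ht x hx => ?_, ?_⟩
    · refine LipschitzOnWith.of_dist_le_mul fun x hx y hy => ?_
      rw [mem_closedBall_zero_iff] at hx hy
      rw [dist_eq_norm, dist_eq_norm, rhs, rhs, ← Finset.sum_sub_distrib]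
      refine (norm_sum_le _ _).trans ?_
      change _ ≤ (∑ i : Fin n, A * ((i.1 + 2 : ℕ):ℝ)) * _
      rw [Finset.sum_mul]
      refine Finset.sum_le_sum fun i _ => ?_
      rw [← mul_sub, norm_mul, mul_assoc]
      exact mul_le_mul (hA i t ht) (pow_lip (hx.trans h1) (hy.trans h1) _) (norm_nonneg _) hA0
    · unfold rhs
      exact (continuous_finset_sum _ fun i _ => (hb i).mul continuous_const).continuousOn
    · rw [mem_closedBall_zero_iff] at hx
      exact rhs_le hA0 hA h0 h1 ht hx
    · change n * A * ρ ^ 2 * max (T - 0) (0 - 0) ≤ ρ - ρ / 2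
      rw [sub_zero, sub_zero, max_eq_left hT.le]
      nlinarith
  obtain ⟨v, hv1, hv2⟩ := key.exists_eq_forall_mem_Icc_hasDerivWithinAt (x := v0) (by rw [mem_closedBall_zero_iff]; exact hv0)
  refine ⟨v, hv1, fun x hx => ?_⟩
  have hc : ContinuousOn v (Icc 0 T) := fun x hx => (hv2 x hx).continuousWithinAt
  have hr : ContinuousOn (fun s => rhs b s (v s)) (Icc 0 T) := by
    unfold rhs
    exact continuousOn_finset_sum _ fun i _ => (hb i).continuousOn.mul (hc.pow _)
  have hs : Icc 0 x ⊆ Icc 0 T := Icc_subset_Icc le_rfl hx.2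
  rw [intervalIntegral.integral_eq_sub_of_hasDerivAt_of_le hx.1 (hc.mono hs) (fun u hu => (hv2 u ⟨hu.1.le, hu.2.le.trans hx.2⟩).hasDerivAt (Icc_mem_nhds hu.1 (hu.2.trans_le hx.2)))]
  · ring
  · refine ContinuousOn.intervalIntegrable ?_
    rw [uIcc_of_le hx.1]; exact hr.mono hs
end
end
end FileC2

section FileC3
open MeasureTheory Set Filter Topology
noncomputable section
variable {n : ℕ}
variable {T A ρ : ℝ} (hT : 0 < T) {b : Fin n → ℝ → ℂ} (hb : ∀ i, Continuous (b i)) (hA0 : 0 ≤ A) (hA : ∀ i, ∀ x ∈ Icc 0 T, ‖b i x‖ ≤ A)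
  {p : ℕ → ℝ → ℂ} (p0 : ∀ x, p 0 x = 1) (pz : ∀ m, p (m+1) 0 = 0) 
  (pd : ∀ m x, HasDerivAt (p (m+1)) (-∑ i : Fin n, if i.1 ≤ m then ((m - i.1 : ℕ) + 1 : ℂ) * (b i x * p (m - i.1) x) else 0) x)
  (h0 : 0 < ρ) (h1 : ρ ≤ 1) (h2 : 2 * T * (n * A) * ρ < 1)

include hA0 hA p0 pz pd in
lemma p_bd (m : ℕ) : ∀ x ∈ Icc 0 T, ‖p m x‖ ≤ Real.exp (n * A * m * x) := by
  induction m using Nat.strong_induction_on with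
  | _ m ih =>
  rcases m with _ | m
  · intro x _; simp [p0]
  intro x hx
  refine image_norm_le_of_norm_deriv_right_le_deriv_boundary (a := 0) (b := T) (B := fun x => Real.exp (n * A * (m+1 : ℕ) * x))
    (B' := fun x => Real.exp (n * A * (m+1 : ℕ) * x) * (n * A * (m+1 : ℕ)))
    (fun x _ => (pd m x).continuousAt.continuousWithinAt) (fun x _ => (pd m x).hasDerivWithinAt) (by simp [pz]) 
    (fun x => by simpa using ((hasDerivAt_id x).const_mul ((n:ℝ) * A * (m+1 : ℕ))).exp) ?_ hx
  intro x hx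
  rw [norm_neg]
  refine (norm_sum_le _ _).trans ?_
  rw [show Real.exp (n * A * (m+1 : ℕ) * x) * (n * A * (m+1 : ℕ)) = ∑ _i : Fin n, (m+1 : ℕ) * (A * Real.exp (n * A * (m+1 : ℕ) * x)) by simp; ring]
  refine Finset.sum_le_sum fun i _ => ?_
  split_ifs with hi
  · rw [norm_mul, norm_mul]
    have e : ‖((m - i.1 : ℕ) + 1 : ℂ)‖ ≤ ((m+1 : ℕ) : ℝ) := by
      rw [show ((m - i.1 : ℕ) + 1 : ℂ) = ((m - i.1 + 1 : ℕ) : ℂ) by push_cast; rfl, Complex.norm_natCast]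
      exact_mod_cast (by omega)
    have e2 : ‖p (m - i.1) x‖ ≤ Real.exp (n * A * (m+1 : ℕ) * x) := by
      refine (ih (m - i.1) (by omega) x ⟨hx.1, hx.2.le⟩).trans ?_
      rw [Real.exp_le_exp]
      have : ((m - i.1 : ℕ) : ℝ) ≤ ((m + 1 : ℕ) : ℝ) := by exact_mod_cast (by omega)
      have := hx.1
      gcongr
    gcongr
    exact hA i x ⟨hx.1, hx.2.le⟩
  · rw [norm_zero]; positivity

lemma sum_shift {E : Type*} [AddCommGroup E] (g : ℕ → E) (M i : ℕ) : 
    ∑ s ∈ Finset.range (M+1), g s - ∑ m ∈ Finset.range M, (if i ≤ m then g (m - i) else 0) = ∑ s ∈ Finset.Ico (M - i) (M+1), g s := by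
  have : ∀ M, ∑ m ∈ Finset.range M, (if i ≤ m then g (m - i) else 0) = ∑ s ∈ Finset.range (M - i), g s := by
    intro M
    induction M with
    | zero => simp
    | succ M ih =>
      rw [Finset.sum_range_succ, ih]
      split_ifs with h
      · rw [show M + 1 - i = (M - i) + 1 by omega, Finset.sum_range_succ]
      · rw [add_zero, show M + 1 - i = M - i by omega]
  rw [this, Finset.sum_Ico_eq_sub _ (by omega)]

include hT hA0 hA p0 pz pd h0 h1 in
lemma psi_bd {v : ℝ → ℂ} (hv : ContinuousOn v (Icc 0 T)) (hd : ∀ x ∈ Ico 0 T, HasDerivWithinAt v (rhs b x (v x)) (Ici x) x)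
    (hρ : ∀ x ∈ Icc 0 T, ‖v x‖ ≤ ρ) (M : ℕ) : 
    ‖∑ m ∈ Finset.range (M+1), p m T * v T ^ (m+1) - v 0‖ ≤ n * ((M+1) * ((M+1) * (A * (Real.exp (n * A * T) ^ M * ρ ^ (M+2))))) * T := by
  have pc : ∀ m, Continuous (p m) := by
    intro m
    rcases m with _ | m
    · rw [show p 0 = fun _ => 1 from funext p0]; exact continuous_const
    · exact continuous_iff_continuousAt.2 fun x => (pd m x).continuousAt
  set Ψ : ℝ → ℂ := fun x => ∑ m ∈ Finset.range (M+1), p m x * v x ^ (m+1) with hΨ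
  have hΨ0 : Ψ 0 = v 0 := by
    simp only [hΨ]
    rw [Finset.sum_range_succ', Finset.sum_eq_zero (fun m _ => by rw [pz, zero_mul]), p0]; simp
  have key := norm_image_sub_le_of_norm_deriv_right_le_segment (f := Ψ) (a := 0) (b := T) 
    (f' := fun x => ∑ i : Fin n, ∑ s ∈ Finset.Ico (M - i.1) (M+1), (s + 1 : ℂ) * (b i x * p s x) * v x ^ (s + i.1 + 2)) 
    (C := n * ((M+1) * ((M+1) * (A * (Real.exp (n * A * T) ^ M * ρ ^ (M+2)))))) ?_ ?_ ?_ T ⟨hT.le, le_rfl⟩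
  · rwa [hΨ0, sub_zero] at key
  · exact continuousOn_finset_sum _ fun m _ => (pc m).continuousOn.mul (hv.pow _)
  · intro x hx
    have h3 : ∀ m, HasDerivWithinAt (fun x => p (m+1) x * v x ^ (m+2)) ((-∑ i : Fin n, if i.1 ≤ m then ((m - i.1 : ℕ) + 1 : ℂ) * (b i x * p (m - i.1) x) else 0) * v x ^ (m+2) +
      p (m+1) x * (((m+2 : ℕ) : ℂ) * v x ^ (m+1) * rhs b x (v x))) (Ici x) x := 
      fun m => (pd m x).hasDerivWithinAt.mul ((hd x hx).pow (m+2))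
    have h4 : HasDerivWithinAt (fun x => p 0 x * v x ^ (0+1)) (rhs b x (v x)) (Ici x) x := by simpa [p0] using hd x hx
    have h5 := (HasDerivWithinAt.fun_sum (u := Finset.range M) fun m _ => h3 m).add h4
    have e : Ψ = (fun x => ∑ m ∈ Finset.range M, p (m+1) x * v x ^ (m+2)) + fun x => p 0 x * v x ^ (0+1) := by
      funext x; simp only [hΨ]; rw [Finset.sum_range_succ']; rfl
    rw [e]
    convert h5 using 1
    simp only [← sum_shift]
    rw [Finset.sum_sub_distrib, Finset.sum_add_distrib]
    have e1 : ∑ i : Fin n, ∑ s ∈ Finset.range (M+1), (s + 1 : ℂ) * (b i x * p s x) * v x ^ (s + i.1 + 2) = 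
      ∑ m ∈ Finset.range M, p (m+1) x * (((m+2 : ℕ) : ℂ) * v x ^ (m+1) * rhs b x (v x)) + rhs b x (v x) := by
      rw [Finset.sum_comm, Finset.sum_range_succ']
      congr 1
      · refine Finset.sum_congr rfl fun m _ => ?_
        rw [rhs, Finset.mul_sum, Finset.mul_sum]
        refine Finset.sum_congr rfl fun i _ => ?_
        push_cast; ring
      · rw [rhs]
        refine Finset.sum_congr rfl fun i _ => ?_
        rw [p0]; push_cast; ring
    rw [e1, Finset.sum_comm, sub_eq_add_neg, ← Finset.sum_neg_distrib, add_comm, ← add_assoc]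
    congr 2
    refine Finset.sum_congr rfl fun m _ => ?_
    rw [neg_mul, Finset.sum_mul]
    congr 1
    refine Finset.sum_congr rfl fun i _ => ?_
    split_ifs with hi
    · rw [show m - i.1 + i.1 + 2 = m + 2 by omega]
    · rw [zero_mul]
  · intro x hx
    have hx' : x ∈ Icc 0 T := ⟨hx.1, hx.2.le⟩
    refine (norm_sum_le _ _).trans ?_
    rw [show (n:ℝ) * ((M+1) * ((M+1) * (A * (Real.exp (n * A * T) ^ M * ρ ^ (M+2))))) = ∑ _i : Fin n, (M+1) * ((M+1) * (A * (Real.exp (n * A * T) ^ M * ρ ^ (M+2)))) by simp]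
    refine Finset.sum_le_sum fun i _ => ?_
    have hc : ((Finset.Ico (M - i.1) (M+1)).card : ℝ) ≤ M + 1 := by rw [Nat.card_Ico]; exact_mod_cast (by omega)
    refine (norm_sum_le_of_le (n := fun _ => (M+1) * (A * (Real.exp (n * A * T) ^ M * ρ ^ (M+2)))) _ fun s hs => ?_).trans ?_
    · rw [Finset.mem_Ico] at hs
      rw [norm_mul, norm_mul, norm_mul, norm_pow]
      have e : ‖(s + 1 : ℂ)‖ ≤ M + 1 := by
        rw [show (s + 1 : ℂ) = ((s + 1 : ℕ) : ℂ) by push_cast; rfl, Complex.norm_natCast]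
        exact_mod_cast (by omega)
      have e2 : ‖p s x‖ ≤ Real.exp (n * A * T) ^ M := by
        refine (p_bd hA0 hA p0 pz pd s x hx').trans ?_
        rw [← Real.exp_nat_mul, Real.exp_le_exp]
        have : (s:ℝ) ≤ M := by exact_mod_cast (by omega)
        calc (n:ℝ) * A * s * x ≤ n * A * M * T := by
              have := hx'.1; have := hx'.2; gcongr
          _ = _ := by ring
      have e3 : ‖v x‖ ^ (s + i.1 + 2) ≤ ρ ^ (M + 2) := (pow_le_pow_left₀ (norm_nonneg _) (hρ x hx') _).trans (pow_le_pow_of_le_one h0.le h1 (by omega))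
      calc _ ≤ ((M:ℝ) + 1) * (A * Real.exp (n * A * T) ^ M) * ρ ^ (M+2) := by
            gcongr; exact hA i x hx'
        _ = _ := by ring
    · rw [Finset.sum_const, nsmul_eq_mul]
      gcongr

include hT hb hA0 hA p0 pz pd in
theorem center_iff' : DeterminesCenter T b ↔ ∀ m, p (m+1) T = 0 := by
  set B := (n:ℝ) * A with hB
  have hB0 : 0 ≤ B := by positivity
  set C := Real.exp (n * A * T) with hC
  have hC1 : 1 ≤ C := Real.one_le_exp (by positivity)
  have hC0 : 0 < C := by positivity
  obtain ⟨r, hr0, hr1, hr2, hr3⟩ : ∃ r : ℝ, 0 < r ∧ r ≤ 1 ∧ (∀ ρ, 0 < ρ → ρ ≤ r → 2 * T * B * ρ < 1) ∧ C * r < 1 := by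
    have hp : 0 < 2 * T * B + 2 * C := by positivity
    refine ⟨1 / (2 * T * B + 2 * C), by positivity, ?_, ?_, ?_⟩
    · rw [div_le_one hp]; nlinarith [mul_nonneg hT.le hB0]
    · intro ρ _ hρ
      rw [le_div_iff₀ hp] at hρ
      nlinarith
    · rw [mul_one_div, div_lt_one hp]; nlinarith [mul_nonneg hT.le hB0]
  constructor
  · rintro ⟨ε, hε, H⟩ m
    induction m using Nat.strong_induction_on with
    | _ m ih =>
    set K : ℝ := n * (((m + 1 : ℕ) + 1) * (((m + 1 : ℕ) + 1) * (A * C ^ (m+1)))) * T * 2 ^ (m+3) with hK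
    have key : ∀ t : ℝ, 0 < t → t < ε → 2 * t ≤ r → ‖p (m+1) T‖ ≤ K * t := by
      intro t ht htε htr
      obtain ⟨v, hv0, hv⟩ := sol_ex hT hb hA0 hA (ρ := 2 * t) (by positivity) (htr.trans hr1) (hr2 _ (by positivity) htr) (v0 := t) (by simp [abs_of_pos ht])
      have hn : ‖v 0‖ = t := by rw [hv0]; simp [abs_of_pos ht]
      obtain ⟨c1, c2, c3⟩ := sol_good hT hb hA0 hA (ρ := 2 * t) (by positivity) (htr.trans hr1) (hr2 _ (by positivity) htr) hv (by rw [hn]; linarith)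
      have h5 := psi_bd hT hA0 hA p0 pz pd (by positivity) (htr.trans hr1) c1 c2 c3 (m+1)
      have h6 : v T = v 0 := H v hv (by rw [hn]; exact htε)
      rw [Finset.sum_range_succ, Finset.sum_range_succ', Finset.sum_eq_zero (fun j hj => by rw [ih j (Finset.mem_range.1 hj), zero_mul]), p0, h6] at h5
      simp only [zero_add, one_mul, pow_one, add_sub_cancel_left, norm_mul, norm_pow, hn] at h5
      rw [← mul_le_mul_iff_left₀ (show 0 < t ^ (m+1+1) by positivity)]
      refine h5.trans (le_of_eq ?_)
      rw [hK, mul_pow]; push_cast; ring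
    have h7 : Tendsto (fun t : ℝ => K * t) (𝓝[>] 0) (𝓝 0) := by
      have : Tendsto (fun t : ℝ => K * t) (𝓝 0) (𝓝 (K * 0)) := (continuous_const.mul continuous_id).tendsto 0
      rw [mul_zero] at this
      exact this.mono_left nhdsWithin_le_nhds
    have h8 : ‖p (m+1) T‖ ≤ 0 := by
      refine ge_of_tendsto h7 ?_
      filter_upwards [Ioo_mem_nhdsGT hε, Ioo_mem_nhdsGT (show 0 < r / 2 by positivity)] with t h1 h2
      exact key t h1.1 h1.2 (by linarith [h2.2])
    simpa using h8
  · intro H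
    refine ⟨r / 2, by positivity, fun v hv hv0 => ?_⟩
    obtain ⟨c1, c2, c3⟩ := sol_good hT hb hA0 hA hr0 hr1 (hr2 r hr0 le_rfl) hv hv0.le
    have h5 : ∀ M : ℕ, ‖v T - v 0‖ ≤ n * A * r ^ 2 * T * (((M:ℝ) + 1) ^ 2 * (C * r) ^ M) := by
      intro M
      have h5 := psi_bd hT hA0 hA p0 pz pd hr0 hr1 c1 c2 c3 M
      rw [Finset.sum_range_succ', Finset.sum_eq_zero (fun j hj => by rw [H j, zero_mul]), p0] at h5
      simp only [zero_add, one_mul, pow_one] at h5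
      refine h5.trans (le_of_eq ?_)
      rw [mul_pow]; ring
    have h6 : Tendsto (fun M : ℕ => n * A * r ^ 2 * T * (((M:ℝ) + 1) ^ 2 * (C * r) ^ M)) atTop (𝓝 0) := by
      have hlt : |C * r| < 1 := by rw [abs_of_nonneg (by positivity)]; exact hr3
      have h2 := tendsto_pow_const_mul_const_pow_of_abs_lt_one 2 hlt
      have h1 := tendsto_pow_const_mul_const_pow_of_abs_lt_one 1 hlt
      have h0 := tendsto_pow_const_mul_const_pow_of_abs_lt_one 0 hlt
      have := ((h2.add (h1.const_mul 2)).add h0).const_mul (n * A * r ^ 2 * T)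
      simp only [mul_zero, add_zero] at this
      refine this.congr fun M => ?_
      ring
    have := ge_of_tendsto' h6 h5
    rw [← sub_eq_zero]; simpa using this
end
end FileC3

section FileC4
open MeasureTheory Set Filter Topology
noncomputable section
variable {n : ℕ} {T : ℝ} (hT : 0 < T) {a : Fin n → ℝ → ℂ} {f : Fin n → Ent} {J : List (Fin n) → ℂ → ℂ} 
  (ha : ∀ i, ∀ x ∈ Icc (0:ℝ) T, a i x = (dE (f i)).fn x) (hJ : IsJ (fun i => (f i).fn) J)

lemma Ent.hd (g : Ent) (x : ℝ) : HasDerivAt (fun y : ℝ => g.fn y) ((dE g).fn x) x :=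
  ((entD g) (x:ℂ)).hasDerivAt.comp_ofReal

lemma Ent.cont (g : Ent) : Continuous (fun y : ℝ => g.fn y) := (entD g).continuous.comp Complex.continuous_ofReal

lemma Ent.int (g : Ent) (x : ℝ) : ∫ s in (0:ℝ)..x, (dE g).fn s = g.fn x - g.fn 0 := by
  rw [intervalIntegral.integral_eq_sub_of_hasDerivAt (fun y _ => g.hd y) ((dE g).cont.intervalIntegrable _ _)]; simp

include hT ha in
lemma center_iff : DeterminesCenter T a ↔ ∀ m, (pp hJ (m+1)).fn T = 0 := by
  have e : DeterminesCenter T a ↔ DeterminesCenter T (fun i (x:ℝ) => (dE (f i)).fn x) := by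
    unfold DeterminesCenter
    refine exists_congr fun ε => and_congr_right fun _ => forall_congr' fun v => imp_congr_left (forall₂_congr fun x hx => ?_)
    rw [intervalIntegral.integral_congr (g := fun s => ∑ i, (dE (f i)).fn s * v s ^ ((i : ℕ) + 2))]
    intro s hs
    rw [uIcc_of_le hx.1] at hs
    exact Finset.sum_congr rfl fun i _ => by rw [ha i s ⟨hs.1, hs.2.trans hx.2⟩]
  rw [e]
  obtain ⟨A, hA⟩ : ∃ A, ∀ i, ∀ x ∈ Icc 0 T, ‖(dE (f i)).fn x‖ ≤ A := by
    have : ∀ i, ∃ A, ∀ x ∈ Icc 0 T, ‖(dE (f i)).fn x‖ ≤ A := fun i => isCompact_Icc.exists_bound_of_continuousOn (dE (f i)).cont.continuousOn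
    choose A hA using this
    refine ⟨∑ i, |A i|, fun i x hx => (hA i x hx).trans ((le_abs_self _).trans (Finset.single_le_sum (f := fun i => |A i|) (fun _ _ => abs_nonneg _) (Finset.mem_univ i)))⟩
  refine center_iff' (p := fun m x => (pp hJ m).fn x) hT (fun i => (dE (f i)).cont) (abs_nonneg A) (fun i x hx => (hA i x hx).trans (le_abs_self A)) (fun x => ?_) (fun m => by simpa using pp_at0 hJ m) (fun m x => ?_)
  · rw [pp_zero]; rfl
  · have := (pp hJ (m+1)).hd x
    rw [pp_succ] at this
    convert this using 1
    rw [← evE_apply, map_neg, map_sum]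
    congr 1
    refine Finset.sum_congr rfl fun i _ => ?_
    split_ifs
    · rw [map_smul, map_mul]; rfl
    · simp

include ha hJ in
lemma simplex_eq (l : List (Fin n)) : ∀ x ∈ Icc (0:ℝ) T, simplexInt (l.map a) x = J l x := by
  induction l with
  | nil => intro x _; rw [hJ.nil]; rfl
  | cons i l ih =>
    intro x hx
    have h1 := (JE hJ (i :: l)).int x
    rw [show (JE hJ (i :: l)).fn 0 = 0 from hJ.zero i l, sub_zero] at h1
    rw [List.map_cons, simplexInt]
    refine Eq.trans (intervalIntegral.integral_congr fun s hs => ?_) h1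
    rw [uIcc_of_le hx.1] at hs
    have hs' : s ∈ Icc (0:ℝ) T := ⟨hs.1, hs.2.trans hx.2⟩
    change a i s * _ = _
    rw [ih s hs', ha i s hs']
    exact (hJ.der i l s).symm

include hT ha hJ in
lemma iter_eq (l : List (Fin n)) : iterInt T a l = J l.reverse T := by
  rw [iterInt, ← List.map_reverse, simplex_eq ha hJ _ T ⟨hT.le, le_rfl⟩]

include hT ha in
lemma moment_eq (h0 : ∀ i, (f i).fn 0 = 0) (ps : List (Fin n × ℕ)) (i : Fin n) : 
    moment T a ps i = mu T (fun i => (f i).fn) (ps.map fun q => MvPolynomial.X q.1 ^ q.2).prod i := by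
  have hp : ∀ i, ∀ x ∈ Icc (0:ℝ) T, primitive (a i) x = (f i).fn x := by
    intro i x hx
    have h1 := (f i).int x
    rw [h0 i, sub_zero] at h1
    rw [primitive, ← h1]
    refine intervalIntegral.integral_congr fun s hs => ?_
    rw [uIcc_of_le hx.1] at hs
    exact ha i s ⟨hs.1, hs.2.trans hx.2⟩
  rw [moment, mu]
  refine intervalIntegral.integral_congr fun s hs => ?_
  rw [uIcc_of_le hT.le] at hs
  rw [ha i s hs, map_list_prod, List.map_map]
  congr 2
  refine List.map_congr_left fun q _ => ?_
  simp [hp _ s hs]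

end
end FileC4

section FileD1
open MeasureTheory Set Filter Topology
noncomputable section

section
variable {R' S : Type*} [CommRing R'] [Algebra ℂ R'] [CommRing S] [Algebra ℂ S] [Algebra.FiniteType ℂ S]

lemma pt_of_max (M : Ideal S) [M.IsMaximal] : ∃ φ : S →ₐ[ℂ] ℂ, ∀ x ∈ M, φ x = 0 := by
  letI := Ideal.Quotient.field M
  have : Module.Finite ℂ (S ⧸ M) := finite_of_finite_type_of_isJacobsonRing ℂ (S ⧸ M)
  have hb := IsAlgClosed.algebraMap_bijective_of_isIntegral (k := ℂ) (K := S ⧸ M)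
  let e : ℂ ≃ₐ[ℂ] (S ⧸ M) := AlgEquiv.ofBijective (Algebra.ofId ℂ (S ⧸ M)) hb
  refine ⟨(e.symm : (S ⧸ M) →ₐ[ℂ] ℂ).comp (Ideal.Quotient.mkₐ ℂ M), fun x hx => ?_⟩
  have : Ideal.Quotient.mkₐ ℂ M x = 0 := Ideal.Quotient.eq_zero_iff_mem.2 hx
  rw [AlgHom.comp_apply, this, map_zero]

lemma pt_lift (ρ : R' →ₐ[ℂ] S) (hρ : ρ.toRingHom.IsIntegral) (ψ : R' →ₐ[ℂ] ℂ) (hk : ∀ x, ρ x = 0 → ψ x = 0) : 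
    ∃ φ : S →ₐ[ℂ] ℂ, ∀ x, φ (ρ x) = ψ x := by
  letI := ρ.toRingHom.toAlgebra
  haveI : Algebra.IsIntegral R' S := ⟨hρ⟩
  have hs : Function.Surjective ψ := fun c => ⟨algebraMap ℂ R' c, ψ.commutes c⟩
  haveI : (RingHom.ker ψ).IsMaximal := RingHom.ker_isMaximal_of_surjective ψ hs
  obtain ⟨Q, -, hQ, hQc⟩ := Ideal.exists_ideal_over_prime_of_isIntegral (RingHom.ker ψ) (⊥ : Ideal S) (fun x hx => hk x hx)
  haveI : Q.IsMaximal := Ideal.isMaximal_of_isIntegral_of_isMaximal_comap (R := R') Q (by rw [hQc]; infer_instance)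
  obtain ⟨φ, hφ⟩ := pt_of_max Q
  refine ⟨φ, fun x => ?_⟩
  have h1 : x - algebraMap ℂ R' (ψ x) ∈ RingHom.ker ψ := by
    rw [RingHom.mem_ker, map_sub, AlgHom.commutes]; simp
  rw [← hQc] at h1
  have h2 := hφ _ (Ideal.mem_comap.1 h1)
  change φ (ρ _) = 0 at h2
  rw [map_sub, map_sub, AlgHom.commutes, AlgHom.commutes, sub_eq_zero] at h2
  exact h2
end

lemma root_near {q : Polynomial ℂ} (hq : q.Monic) {z : ℂ} {δ : ℝ} (hδ : 0 < δ) (h : ‖q.eval z‖ < δ ^ q.natDegree) : ∃ r, q.IsRoot r ∧ ‖z - r‖ < δ := by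
  by_contra! hc
  have hs := IsAlgClosed.splits q
  have e := hs.eval_eq_prod_roots z
  rw [hq.leadingCoeff, one_mul] at e
  have h3 : ∀ s : Multiset ℂ, (∀ r ∈ s, δ ≤ ‖z - r‖) → δ ^ s.card ≤ ‖(s.map (z - ·)).prod‖ := by
    intro s
    induction s using Multiset.induction_on with
    | empty => simp
    | cons r s ih =>
      intro h
      rw [Multiset.card_cons, Multiset.map_cons, Multiset.prod_cons, norm_mul, pow_succ, mul_comm]
      exact mul_le_mul (h r (Multiset.mem_cons_self r s)) (ih fun x hx => h x (Multiset.mem_cons_of_mem hx)) (by positivity) (norm_nonneg _)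
  have h4 := h3 q.roots (fun r hr => hc r (Polynomial.isRoot_of_mem_roots hr))
  rw [← e, ← hs.natDegree_eq_card_roots] at h4
  linarith

lemma root_bd {q : Polynomial ℂ} (hq : q.Monic) {r : ℂ} (hr : q.IsRoot r) : ‖r‖ ≤ 1 + ∑ i ∈ Finset.range q.natDegree, ‖q.coeff i‖ := by
  set d := q.natDegree
  have hS : 0 ≤ ∑ i ∈ Finset.range d, ‖q.coeff i‖ := by positivity
  by_contra! h
  have h1 : 1 < ‖r‖ := by linarith
  have e : r ^ d = -∑ i ∈ Finset.range d, q.coeff i * r ^ i := by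
    have := hr
    rw [Polynomial.IsRoot, Polynomial.eval_eq_sum_range, Finset.sum_range_succ, hq.coeff_natDegree, one_mul] at this
    exact eq_neg_of_add_eq_zero_right this
  have hd : d ≠ 0 := by
    intro hd
    rw [hd] at e; simp at e
  obtain ⟨d', hd'⟩ := Nat.exists_eq_succ_of_ne_zero hd
  have h2 : ‖r‖ ^ d ≤ (∑ i ∈ Finset.range d, ‖q.coeff i‖) * ‖r‖ ^ d' := by
    rw [← norm_pow, e, norm_neg, Finset.sum_mul]
    refine (norm_sum_le _ _).trans (Finset.sum_le_sum fun i hi => ?_)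
    rw [norm_mul, norm_pow]
    have := Finset.mem_range.1 hi
    gcongr
    · exact h1.le
    · omega
  rw [hd', pow_succ, mul_comm] at h2
  have := le_of_mul_le_mul_right h2 (by positivity)
  rw [hd'] at h hS
  linarith

lemma dense_ne {d : ℕ} {h : MvPolynomial (Fin d) ℂ} (hh : h ≠ 0) (t : Fin d → ℂ) : ∃ s : ℕ → Fin d → ℂ, (∀ j, MvPolynomial.eval (s j) h ≠ 0) ∧ Tendsto s atTop (𝓝 t) := by
  obtain ⟨u, hu⟩ : ∃ u, MvPolynomial.eval u h ≠ 0 := by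
    by_contra! hc
    exact hh (MvPolynomial.funext fun x => by rw [hc x, map_zero])
  let g : Polynomial ℂ := MvPolynomial.aeval (fun i => Polynomial.C (t i) + Polynomial.X * Polynomial.C (u i - t i)) h
  have hg : ∀ x, g.eval x = MvPolynomial.eval (fun i => t i + x * (u i - t i)) h := by
    intro x
    have := MvPolynomial.map_aeval (fun i => Polynomial.C (t i) + Polynomial.X * Polynomial.C (u i - t i)) (Polynomial.evalRingHom x) h
    rw [Polynomial.coe_evalRingHom] at this
    rw [this, MvPolynomial.coe_eval₂Hom, MvPolynomial.eval₂_eq', MvPolynomial.eval_eq']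
    simp
  have hg0 : g ≠ 0 := by
    intro h0
    have := hg 1
    rw [h0] at this
    simp at this
    exact hu this.symm
  have hfin : {x | g.eval x = 0}.Finite := by
    refine (g.roots.toFinset.finite_toSet).subset fun x hx => ?_
    simpa [hg0] using hx
  have hev : ∀ᶠ x in 𝓝[≠] (0:ℂ), g.eval x ≠ 0 := by
    have h1 := (hfin.subset (diff_subset (t := {0}))).isClosed.isOpen_compl.mem_nhds (x := (0:ℂ)) (by simp)
    filter_upwards [mem_nhdsWithin_of_mem_nhds h1, self_mem_nhdsWithin] with x h1 h2 h3
    exact h1 ⟨h3, h2⟩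
  obtain ⟨s, hs⟩ := exists_seq_tendsto (𝓝[≠] (0:ℂ))
  obtain ⟨N, hN⟩ := eventually_atTop.1 (hs.eventually hev)
  refine ⟨fun j i => t i + s (j + N) * (u i - t i), fun j => ?_, ?_⟩
  · rw [← hg]; exact hN _ (by omega)
  · rw [tendsto_pi_nhds]
    intro i
    have h1 := ((tendsto_add_atTop_iff_nat N).2 (hs.mono_right nhdsWithin_le_nhds)).mul_const (u i - t i)
    simpa using h1.const_add (t i)
end
end FileD1

section FileD2
open MeasureTheory Set Filter Topology
noncomputable section

theorem near_pt {B : Type*} [CommRing B] [IsDomain B] [Algebra ℂ B] [Algebra.FiniteType ℂ B] (φ0 : B →ₐ[ℂ] ℂ) {f : B} (hf : f ≠ 0)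
    {ι : Type*} [Finite ι] (x : ι → B) {ε : ℝ} (hε : 0 < ε) : ∃ φ : B →ₐ[ℂ] ℂ, φ f ≠ 0 ∧ ∀ i, ‖φ (x i) - φ0 (x i)‖ < ε := by
  by_contra! hc
  obtain ⟨d, g, hinj, hint⟩ := exists_integral_inj_algHom_of_fg ℂ B
  letI : Algebra (MvPolynomial (Fin d) ℂ) B := g.toRingHom.toAlgebra
  haveI : IsScalarTower ℂ (MvPolynomial (Fin d) ℂ) B := IsScalarTower.of_algebraMap_eq' g.comp_algebraMap.symm
  haveI : Algebra.IsIntegral (MvPolynomial (Fin d) ℂ) B := ⟨hint⟩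
  haveI : FaithfulSMul (MvPolynomial (Fin d) ℂ) B := (faithfulSMul_iff_algebraMap_injective _ _).2 hinj
  haveI : Algebra.FiniteType (MvPolynomial (Fin d) ℂ) B := Algebra.FiniteType.of_restrictScalars_finiteType ℂ _ _
  haveI : Module.Finite (MvPolynomial (Fin d) ℂ) B := Algebra.IsIntegral.finite
  have hg : ∀ a, algebraMap (MvPolynomial (Fin d) ℂ) B a = g a := fun a => rfl
  have c0 : ∀ b : B, ∃ y, g ((minpoly (MvPolynomial (Fin d) ℂ) b).coeff 0) = b * y := by
    intro b
    set p := minpoly (MvPolynomial (Fin d) ℂ) b with hp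
    refine ⟨-Polynomial.aeval b p.divX, ?_⟩
    have h1 := minpoly.aeval (MvPolynomial (Fin d) ℂ) b
    rw [← hp, ← Polynomial.X_mul_divX_add p, map_add, map_mul, Polynomial.aeval_X, Polynomial.aeval_C, hg] at h1
    linear_combination h1
  set t : Fin d → ℂ := fun i => φ0 (g (MvPolynomial.X i)) with ht
  have htA : ∀ a, φ0 (g a) = MvPolynomial.eval t a := by
    intro a
    have : φ0.comp g = MvPolynomial.aeval t := MvPolynomial.algHom_ext fun i => by simp [ht]
    have := congrArg (fun F => F a) this
    simpa [MvPolynomial.aeval_eq_eval] using this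
  obtain ⟨y0, hy0⟩ := c0 f
  have hh : (minpoly (MvPolynomial (Fin d) ℂ) f).coeff 0 ≠ 0 := by
    intro h0
    set p := minpoly (MvPolynomial (Fin d) ℂ) f with hp
    have e1 := Polynomial.divX_mul_X_add p
    have h1 := minpoly.aeval (MvPolynomial (Fin d) ℂ) f
    rw [h0, map_zero, add_zero] at e1
    rw [← hp, ← e1, map_mul, Polynomial.aeval_X] at h1
    obtain ⟨u, hu⟩ := minpoly.isIntegrallyClosed_dvd (Algebra.IsIntegral.isIntegral f) ((mul_eq_zero.1 h1).resolve_right hf)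
    rw [← hp] at hu
    have hm : p.Monic := minpoly.monic (Algebra.IsIntegral.isIntegral f)
    have e2 : p * (u * Polynomial.X) = p * 1 := by rw [← mul_assoc, ← hu, e1, mul_one]
    have e3 := congrArg (fun q => Polynomial.coeff q 0) (mul_left_cancel₀ hm.ne_zero e2)
    simp at e3
  obtain ⟨s, hs1, hs2⟩ := dense_ne hh t
  have evc : ∀ a : MvPolynomial (Fin d) ℂ, Tendsto (fun j => MvPolynomial.eval (s j) a) atTop (𝓝 (MvPolynomial.eval t a)) := fun a => 
    ((MvPolynomial.continuous_eval a).tendsto t).comp hs2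
  have mon : ∀ b : B, (minpoly (MvPolynomial (Fin d) ℂ) b).Monic := fun b => minpoly.monic (Algebra.IsIntegral.isIntegral b)
  have key : ∀ θ, φ0 θ = 0 → ∃ φ : B →ₐ[ℂ] ℂ, (∀ a, φ (g a) = φ0 (g a)) ∧ φ θ = 0 ∧ ∃ i, ε ≤ ‖φ (x i) - φ0 (x i)‖ := by
    intro θ hθ
    set p := minpoly (MvPolynomial (Fin d) ℂ) θ with hp
    have h1 : ∀ m : ℕ, ∃ j ≥ m, ∃ r : ℂ, (p.map (MvPolynomial.eval (s j))).IsRoot r ∧ ‖r‖ < 1 / ((m:ℝ) + 1) := by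
      intro m
      have h2 := (evc (p.coeff 0)).norm
      obtain ⟨y, hy⟩ := c0 θ
      rw [← htA, hy, map_mul, hθ, zero_mul, norm_zero] at h2
      have hpos : 0 < (1 / ((m:ℝ) + 1)) ^ p.natDegree := by positivity
      obtain ⟨j, hj, hjm⟩ := ((h2.eventually_lt_const hpos).and (eventually_ge_atTop m)).exists
      have hnd := (mon θ).natDegree_map (MvPolynomial.eval (s j))
      obtain ⟨r, hr, hr2⟩ := root_near ((mon θ).map (MvPolynomial.eval (s j))) (z := 0) (δ := 1 / ((m:ℝ) + 1)) (by positivity)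
        (by rwa [hnd, ← Polynomial.coeff_zero_eq_eval_zero, Polynomial.coeff_map])
      exact ⟨j, hjm, r, hr, by simpa using hr2⟩
    choose j hj r hr hr2 using h1
    have hjt : Tendsto j atTop atTop := tendsto_atTop_mono hj tendsto_id
    have h3 : ∀ m, ∃ φ : B →ₐ[ℂ] ℂ, (∀ a, φ (g a) = MvPolynomial.eval (s (j m)) a) ∧ φ θ = r m := by
      intro m
      obtain ⟨φ, hφ⟩ := pt_lift ((Polynomial.aeval θ : Polynomial (MvPolynomial (Fin d) ℂ) →ₐ[MvPolynomial (Fin d) ℂ] B).restrictScalars ℂ)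
        (RingHom.IsIntegral.tower_top Polynomial.C _ (by
          convert hint using 1
          ext a
          · simp [hg]
          · simp [hg]))
        (Polynomial.eval₂AlgHom (MvPolynomial.aeval (s (j m))) (r m) fun _ => Commute.all _ _) (by
          intro q hq
          have := minpoly.isIntegrallyClosed_dvd (Algebra.IsIntegral.isIntegral θ) hq
          obtain ⟨u, hu⟩ := this
          rw [hu, map_mul]
          convert zero_mul _
          have := hr m
          rw [Polynomial.IsRoot, Polynomial.eval_map] at this
          exact this)
      refine ⟨φ, fun a => ?_, ?_⟩
      · have := hφ (Polynomial.C a)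
        simpa [hg, MvPolynomial.aeval_eq_eval] using this
      · have := hφ Polynomial.X
        simpa using this
    choose φ hφ1 hφ2 using h3
    have hle : (hyperfilter ℕ : Filter ℕ) ≤ atTop := Nat.hyperfilter_le_atTop
    have evj : ∀ a : MvPolynomial (Fin d) ℂ, Tendsto (fun m => φ m (g a)) (hyperfilter ℕ) (𝓝 (MvPolynomial.eval t a)) := by
      intro a
      simp only [hφ1]
      exact ((evc a).comp hjt).mono_left hle
    have h4 : ∀ b : B, ∃ y, Tendsto (fun m => φ m b) (hyperfilter ℕ) (𝓝 y) := by
      intro b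
      set q := minpoly (MvPolynomial (Fin d) ℂ) b with hq
      have h5 : ∀ m, ‖φ m b‖ ≤ 1 + ∑ i ∈ Finset.range q.natDegree, ‖φ m (g (q.coeff i))‖ := by
        intro m
        have h6 := root_bd ((mon b).map ((φ m : B →+* ℂ).comp (g : MvPolynomial (Fin d) ℂ →+* B))) (r := φ m b) (by
          rw [Polynomial.IsRoot, Polynomial.eval_map]
          refine (Polynomial.hom_eval₂ _ _ (φ m : B →+* ℂ) b).symm.trans ?_
          have := minpoly.aeval (MvPolynomial (Fin d) ℂ) b
          rw [Polynomial.aeval_def] at this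
          change φ m (Polynomial.eval₂ (algebraMap (MvPolynomial (Fin d) ℂ) B) b (minpoly (MvPolynomial (Fin d) ℂ) b)) = 0
          rw [this, map_zero])
        rw [(mon b).natDegree_map] at h6
        simp only [Polynomial.coeff_map] at h6
        exact h6
      have h7 : Tendsto (fun m => 1 + ∑ i ∈ Finset.range q.natDegree, ‖φ m (g (q.coeff i))‖) (hyperfilter ℕ) (𝓝 (1 + ∑ i ∈ Finset.range q.natDegree, ‖MvPolynomial.eval t (q.coeff i)‖)) :=
        tendsto_const_nhds.add (tendsto_finset_sum _ fun i _ => (evj (q.coeff i)).norm)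
      have h8 := h7.eventually_lt_const (lt_add_one _)
      obtain ⟨y, -, hy⟩ := (isCompact_closedBall (0:ℂ) (1 + ∑ i ∈ Finset.range q.natDegree, ‖MvPolynomial.eval t (q.coeff i)‖ + 1)).ultrafilter_le_nhds' 
        ((hyperfilter ℕ).map fun m => φ m b) (by
          rw [Ultrafilter.mem_map, ← Ultrafilter.mem_coe]
          filter_upwards [h8] with m hm
          rw [mem_preimage, mem_closedBall_zero_iff]
          exact (h5 m).trans hm.le)
      exact ⟨y, hy⟩
    choose Φ hΦ using h4
    let Φ' : B →ₐ[ℂ] ℂ := AlgHom.mk' { toFun := Φ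
                                       map_one' := tendsto_nhds_unique (hΦ 1) (by simp only [map_one]; exact tendsto_const_nhds)
                                       map_zero' := tendsto_nhds_unique (hΦ 0) (by simp only [map_zero]; exact tendsto_const_nhds)
                                       map_add' := fun a b => tendsto_nhds_unique (hΦ _) (by simp only [map_add]; exact (hΦ a).add (hΦ b))
                                       map_mul' := fun a b => tendsto_nhds_unique (hΦ _) (by simp only [map_mul]; exact (hΦ a).mul (hΦ b)) }
      (fun c b => tendsto_nhds_unique (hΦ _) (by simp only [map_smul]; exact (hΦ b).const_smul c))
    refine ⟨Φ', fun a => ?_, ?_, ?_⟩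
    · rw [htA]; exact tendsto_nhds_unique (hΦ _) (evj a)
    · refine tendsto_nhds_unique (hΦ θ) ?_
      simp only [hφ2]
      refine (squeeze_zero_norm (fun m => (hr2 m).le) ?_).mono_left hle
      exact tendsto_one_div_add_atTop_nhds_zero_nat
    · by_contra! hcl
      have h9 : ∀ᶠ m in (hyperfilter ℕ : Filter ℕ), ∀ i, ‖φ m (x i) - φ0 (x i)‖ < ε := by
        rw [eventually_all]
        intro i
        exact ((hΦ (x i)).sub_const (φ0 (x i))).norm.eventually_lt_const (hcl i)
      obtain ⟨m, hm⟩ := h9.exists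
      obtain ⟨i, hi⟩ := hc (φ m) (by
        intro h0
        apply hs1 (j m)
        rw [← hφ1, hy0, map_mul, h0, zero_mul])
      linarith [hm i]
  classical
  set P0 : Ideal (MvPolynomial (Fin d) ℂ) := RingHom.ker (φ0.comp g) with hP0
  haveI : P0.IsPrime := RingHom.ker_isPrime _
  have hfin : (P0.primesOver B).Finite := Algebra.QuasiFinite.finite_primesOver P0
  set Z := hfin.toFinset.filter (fun Q => ∃ φ : B →ₐ[ℂ] ℂ, (∃ i, ε ≤ ‖φ (x i) - φ0 (x i)‖) ∧ Q = RingHom.ker φ) with hZ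
  have hsub : (RingHom.ker φ0 : Set B) ⊆ ⋃ Q ∈ (↑Z : Set (Ideal B)), (id Q : Ideal B) := by
    intro θ hθ
    obtain ⟨φ, h1, h2, h3⟩ := key θ hθ
    refine mem_biUnion (x := RingHom.ker φ) ?_ h2
    rw [hZ, Finset.coe_filter]
    refine ⟨?_, φ, h3, rfl⟩
    rw [Finite.mem_toFinset]
    refine ⟨RingHom.ker_isPrime _, ⟨?_⟩⟩
    ext a
    rw [Ideal.mem_comap, RingHom.mem_ker, RingHom.mem_ker, hg, h1]; rfl
  rw [Ideal.subset_union_prime ⊥ ⊥ (by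
    intro Q hQ _ _
    rw [hZ, Finset.mem_filter] at hQ
    obtain ⟨-, φ, -, rfl⟩ := hQ
    exact RingHom.ker_isPrime _)] at hsub
  obtain ⟨Q, hQ, hle⟩ := hsub
  rw [hZ, Finset.mem_filter] at hQ
  obtain ⟨-, φ, ⟨i, hi⟩, rfl⟩ := hQ
  have : x i - algebraMap ℂ B (φ0 (x i)) ∈ RingHom.ker φ := hle (by rw [RingHom.mem_ker, map_sub, AlgHom.commutes]; simp)
  rw [RingHom.mem_ker, map_sub, AlgHom.commutes] at this
  rw [show φ (x i) - φ0 (x i) = 0 from this, norm_zero] at hi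
  linarith
end
end FileD2

section FileD3
open MeasureTheory Set Filter Topology
noncomputable section

theorem gen_lift {B L : Type*} [CommRing B] [IsDomain B] [Algebra ℂ B] [Algebra.FiniteType ℂ B] [CommRing L] [IsDomain L] [Algebra ℂ L] [Algebra.FiniteType ℂ L]
    (ρ : B →ₐ[ℂ] L) (hρ : Function.Injective ρ) : ∃ f : B, f ≠ 0 ∧ ∀ φ : B →ₐ[ℂ] ℂ, φ f ≠ 0 → ∃ Φ : L →ₐ[ℂ] ℂ, ∀ b, Φ (ρ b) = φ b := by
  have hft : ρ.toRingHom.FiniteType := AlgHom.FiniteType.of_comp_finiteType (f := Algebra.ofId ℂ B) (g := ρ) (by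
    have : ρ.comp (Algebra.ofId ℂ B) = Algebra.ofId ℂ L := Subsingleton.elim _ _
    rw [this]
    exact RingHom.finiteType_algebraMap.2 inferInstance)
  haveI : IsNoetherianRing B := Algebra.FiniteType.isNoetherianRing ℂ B
  have hfp := (RingHom.FinitePresentation.of_finiteType).1 hft
  obtain ⟨S, hS⟩ := PrimeSpectrum.exists_constructibleSetData_iff.2 (PrimeSpectrum.isConstructible_range_comap hfp)
  have hb : (⟨⊥, Ideal.isPrime_bot⟩ : PrimeSpectrum B) ∈ S.toSet := by
    rw [hS]
    refine ⟨⟨⊥, Ideal.isPrime_bot⟩, ?_⟩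
    ext x
    change ρ x = 0 ↔ x = 0
    exact map_eq_zero_iff ρ hρ
  rw [PrimeSpectrum.ConstructibleSetData.toSet, mem_iUnion₂] at hb
  obtain ⟨C, hC, h1, h2⟩ := hb
  have hg : ∀ i, C.g i = 0 := fun i => h1 ⟨i, rfl⟩
  refine ⟨C.f, fun h => h2 (by simp [h]), fun φ hφ => ?_⟩
  have hs : Function.Surjective φ := fun c => ⟨algebraMap ℂ B c, φ.commutes c⟩
  haveI hM : (RingHom.ker φ).IsMaximal := RingHom.ker_isMaximal_of_surjective φ hs
  have hm : (⟨RingHom.ker φ, hM.isPrime⟩ : PrimeSpectrum B) ∈ range (PrimeSpectrum.comap ρ.toRingHom) := by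
    rw [← hS, PrimeSpectrum.ConstructibleSetData.toSet, mem_iUnion₂]
    refine ⟨C, hC, ?_, fun h => hφ (h rfl)⟩
    rintro _ ⟨i, rfl⟩
    rw [hg]; exact Submodule.zero_mem _
  obtain ⟨q, hq⟩ := hm
  have hq' : ∀ b, ρ b ∈ q.asIdeal ↔ φ b = 0 := fun b => by
    have := congrArg (fun p => b ∈ p.asIdeal) hq
    exact iff_of_eq this
  obtain ⟨M, hMm, hMq⟩ := q.asIdeal.exists_le_maximal q.2.ne_top
  obtain ⟨Φ, hΦ⟩ := pt_of_max M
  refine ⟨Φ, fun b => ?_⟩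
  have h1 := hΦ _ (hMq ((hq' (b - algebraMap ℂ B (φ b))).2 (by simp)))
  rw [map_sub, map_sub, AlgHom.commutes, AlgHom.commutes, sub_eq_zero] at h1
  exact h1

theorem int_aux {S L ι : Type*} [Finite ι] [CommRing S] [Algebra ℂ S] [CommRing L] [IsDomain L] [Algebra ℂ L] [Algebra.FiniteType ℂ L]
    (e : S →ₐ[ℂ] L) (hei : Function.Injective e) (m : ι → S) (x : S) (y : L) (hy : y * e x = 1)
    (hp : ∀ C : ℝ, ∃ D : ℝ, ∀ Φ : S →ₐ[ℂ] ℂ, (∀ j, ‖Φ (m j)‖ ≤ C) → ‖Φ x‖ ≤ D) :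
    ∃ q : Polynomial (MvPolynomial ι ℂ), q.Monic ∧ q.eval₂ (MvPolynomial.aeval m : MvPolynomial ι ℂ →ₐ[ℂ] S).toRingHom x = 0 := by
  set θ : MvPolynomial ι ℂ →ₐ[ℂ] L := e.comp (MvPolynomial.aeval m) with hθ
  set Θ : Polynomial (MvPolynomial ι ℂ) →ₐ[ℂ] L := Polynomial.eval₂AlgHom θ y fun _ => Commute.all _ _ with hΘ
  have hΘX : Θ Polynomial.X = y := Polynomial.eval₂_X _ _
  have hΘC : ∀ a, Θ (Polynomial.C a) = θ a := fun a => Polynomial.eval₂_C _ _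
  haveI : Algebra.FiniteType ℂ (Polynomial (MvPolynomial ι ℂ)) := Algebra.FiniteType.trans (S := MvPolynomial ι ℂ) inferInstance inferInstance
  haveI : Algebra.FiniteType ℂ Θ.range := Algebra.FiniteType.of_surjective Θ.rangeRestrict Θ.rangeRestrict_surjective
  set r := Θ.rangeRestrict with hr
  have hrv : ∀ a, (r a : L) = Θ a := fun a => rfl
  obtain ⟨f, hf, hlift⟩ := gen_lift Θ.range.val Subtype.val_injective
  by_cases hyu : IsUnit (r Polynomial.X)
  · obtain ⟨b, hb⟩ := hyu.exists_right_inv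
    obtain ⟨b, rfl⟩ := Θ.rangeRestrict_surjective b
    have h1 := congrArg Subtype.val hb
    change Θ Polynomial.X * Θ b = 1 at h1
    rw [← map_mul] at h1
    set g : Polynomial (MvPolynomial ι ℂ) := 1 - Polynomial.X * b
    have hg0 : g.coeff 0 = 1 := by simp [g]
    have hg : Θ g = 0 := by rw [map_sub, h1, map_one, sub_self]
    refine ⟨g.reverse, ?_, ?_⟩
    · rw [Polynomial.Monic, Polynomial.reverse_leadingCoeff, Polynomial.trailingCoeff, 
        Polynomial.natTrailingDegree_eq_zero_of_constantCoeff_ne_zero (by simp [hg0]), hg0]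
    · letI : Invertible y := ⟨e x, by rw [mul_comm, hy], hy⟩
      have h2 := (Polynomial.eval₂_reverse_eq_zero_iff θ.toRingHom y g).2 hg
      have h3 := Polynomial.hom_eval₂ g.reverse (MvPolynomial.aeval m : MvPolynomial ι ℂ →ₐ[ℂ] S).toRingHom e.toRingHom x
      exact (map_eq_zero_iff e hei).1 (h3.trans h2)
  · exfalso
    obtain ⟨M, hM, hMy⟩ := exists_max_ideal_of_mem_nonunits hyu
    obtain ⟨φ0, hφ0⟩ := pt_of_max M
    have h0 := hφ0 _ hMy
    set μ : ι → Θ.range := fun j => r (Polynomial.C (MvPolynomial.X j)) with hμ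
    set Y := r Polynomial.X with hY
    have hY0 : Y ≠ 0 := fun h => by
      have := congrArg Subtype.val h
      change Θ Polynomial.X = 0 at this
      rw [← hΘX, this, zero_mul] at hy
      exact zero_ne_one hy
    haveI := Fintype.ofFinite ι
    obtain ⟨D, hD⟩ := hp (∑ j, ‖φ0 (μ j)‖ + 1)
    obtain ⟨φ, h1, h2⟩ := near_pt φ0 (mul_ne_zero hf hY0) (fun o : Option ι => o.elim Y μ) (ε := 1 / (|D| + 1)) (by positivity)
    rw [map_mul] at h1
    obtain ⟨Φ, hΦ⟩ := hlift φ (left_ne_zero_of_mul h1)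
    have h3 := hD (Φ.comp e) (fun j => by
      have e1 : Φ (e (m j)) = φ (μ j) := by
        rw [← hΦ]
        change _ = Φ (Θ _)
        rw [hΘC]; simp [hθ]
      have h4 := h2 (some j)
      simp only [Option.elim] at h4
      have h5 : 1 / (|D| + 1) ≤ 1 := by rw [div_le_one (by positivity)]; linarith [abs_nonneg D]
      have h6 : ‖φ0 (μ j)‖ ≤ ∑ j, ‖φ0 (μ j)‖ := Finset.single_le_sum (f := fun j => ‖φ0 (μ j)‖) (fun _ _ => norm_nonneg _) (Finset.mem_univ j)
      have h7 := norm_sub_norm_le (φ (μ j)) (φ0 (μ j))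
      rw [AlgHom.comp_apply, e1]; linarith)
    have h4 := h2 none
    simp only [Option.elim] at h4
    rw [h0, sub_zero] at h4
    have h5 : φ Y * Φ (e x) = 1 := by
      rw [← hΦ]
      change Φ (Θ _) * _ = 1
      rw [hΘX, ← map_mul, hy, map_one]
    have h6 := congrArg norm h5
    rw [norm_mul, norm_one] at h6
    have h7 : ‖Φ (e x)‖ ≤ |D| := h3.trans (le_abs_self D)
    have h8 : ‖φ Y‖ * ‖Φ (e x)‖ ≤ 1 / (|D| + 1) * |D| := by gcongr
    have h9 : 1 / (|D| + 1) * |D| < 1 := by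
      rw [one_div, inv_mul_lt_one₀ (by positivity)]; linarith
    linarith

theorem int_loc {S ι : Type*} [Finite ι] [CommRing S] [IsDomain S] [Algebra ℂ S] [Algebra.FiniteType ℂ S] (m : ι → S) (x : S)
    (hp : ∀ C : ℝ, ∃ D : ℝ, ∀ Φ : S →ₐ[ℂ] ℂ, (∀ j, ‖Φ (m j)‖ ≤ C) → ‖Φ x‖ ≤ D) :
    ∃ q : Polynomial (MvPolynomial ι ℂ), q.Monic ∧ q.eval₂ (MvPolynomial.aeval m : MvPolynomial ι ℂ →ₐ[ℂ] S).toRingHom x = 0 := by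
  by_cases hx : x = 0
  · exact ⟨Polynomial.X, Polynomial.monic_X, by rw [Polynomial.eval₂_X, hx]⟩
  haveI : Algebra.FiniteType S (Localization.Away x) := IsLocalization.finiteType_of_monoid_fg (Submonoid.powers x) _
  haveI : Algebra.FiniteType ℂ (Localization.Away x) := Algebra.FiniteType.trans (S := S) inferInstance inferInstance
  have hle : Submonoid.powers x ≤ nonZeroDivisors S := powers_le_nonZeroDivisors_of_noZeroDivisors hx
  haveI : IsDomain (Localization.Away x) := IsLocalization.isDomain_localization hle
  obtain ⟨y, hy⟩ := (IsLocalization.Away.algebraMap_isUnit (S := Localization.Away x) x).exists_left_inv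
  exact int_aux (IsScalarTower.toAlgHom ℂ S (Localization.Away x)) (IsLocalization.injective (Localization.Away x) hle) m x y hy hp

theorem int_dom {σ ι : Type*} [Finite σ] [Finite ι] (P : Ideal (MvPolynomial σ ℂ)) [P.IsPrime] (m : ι → MvPolynomial σ ℂ) (x : MvPolynomial σ ℂ)
    (hp : ∀ C : ℝ, ∃ D : ℝ, ∀ w : σ → ℂ, (∀ p ∈ P, MvPolynomial.eval w p = 0) → (∀ j, ‖MvPolynomial.eval w (m j)‖ ≤ C) → ‖MvPolynomial.eval w x‖ ≤ D) :
    ∃ q : Polynomial (MvPolynomial ι ℂ), q.Monic ∧ q.eval₂ (MvPolynomial.aeval m : MvPolynomial ι ℂ →ₐ[ℂ] MvPolynomial σ ℂ).toRingHom x ∈ P := by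
  set π : MvPolynomial σ ℂ →ₐ[ℂ] MvPolynomial σ ℂ ⧸ P := Ideal.Quotient.mkₐ ℂ P with hπ
  obtain ⟨q, hq, h⟩ := int_loc (fun j => π (m j)) (π x) (by
    intro C
    obtain ⟨D, hD⟩ := hp C
    refine ⟨D, fun Φ hΦ => ?_⟩
    set w : σ → ℂ := fun i => Φ (π (MvPolynomial.X i)) with hw
    have hwe : ∀ p, MvPolynomial.eval w p = Φ (π p) := by
      intro p
      have : Φ.comp π = MvPolynomial.aeval w := MvPolynomial.algHom_ext fun i => by simp [hw]
      have := congrArg (fun F => F p) this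
      simpa [MvPolynomial.aeval_eq_eval] using this.symm
    rw [← hwe]
    refine hD w (fun p hp => ?_) fun j => by rw [hwe]; exact hΦ j
    rw [hwe, show π p = 0 from Ideal.Quotient.eq_zero_iff_mem.2 hp, map_zero])
  refine ⟨q, hq, Ideal.Quotient.eq_zero_iff_mem.1 ?_⟩
  have h3 := Polynomial.hom_eval₂ q (MvPolynomial.aeval m : MvPolynomial ι ℂ →ₐ[ℂ] MvPolynomial σ ℂ).toRingHom π.toRingHom x
  refine h3.trans (Eq.trans ?_ h)
  congr 1
  have : π.comp (MvPolynomial.aeval m) = MvPolynomial.aeval fun j => π (m j) := MvPolynomial.algHom_ext fun i => by simp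
  exact congrArg AlgHom.toRingHom this
end
end FileD3

section FileD4
open MeasureTheory Set Filter Topology
noncomputable section

section
variable {σ ι : Type*} [Fintype σ] (m : ι → MvPolynomial σ ℂ) (d : ι → ℕ)
  (hom : ∀ j (c : ℂ) w, MvPolynomial.eval (c • w) (m j) = c ^ d j * MvPolynomial.eval w (m j))
  (V : Set (σ → ℂ)) (S : Set (MvPolynomial σ ℂ)) (hV : ∀ w, w ∈ V ↔ ∀ q ∈ S, MvPolynomial.eval w q = 0)
  (hinf : ∀ w : ℕ → (σ → ℂ), (∀ j, w j ∈ V) → Tendsto (fun j => ‖w j‖) atTop atTop →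
      ∀ v : σ → ℂ, Tendsto (fun j => (‖w j‖)⁻¹ • w j) atTop (𝓝 v) → ∃ j, 0 < d j ∧ MvPolynomial.eval v (m j) ≠ 0)

include hom hinf in
lemma bd_V (C : ℝ) : ∃ D : ℝ, ∀ w ∈ V, (∀ j, 0 < d j → ‖MvPolynomial.eval w (m j)‖ ≤ C) → ‖w‖ ≤ D := by
  by_contra! hc
  choose w hw hC hn using fun N : ℕ => hc N
  have ht : Tendsto (fun j => ‖w j‖) atTop atTop := tendsto_atTop_mono (fun j => (hn j).le) tendsto_natCast_atTop_atTop
  have hb : ∀ j, (‖w j‖)⁻¹ • w j ∈ Metric.closedBall (0 : σ → ℂ) 1 := fun j => by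
    rw [mem_closedBall_zero_iff, norm_smul, norm_inv, norm_norm]
    exact inv_mul_le_one
  obtain ⟨v, -, φ, hφ, hv⟩ := (isCompact_closedBall (0 : σ → ℂ) 1).tendsto_subseq hb
  have ht' := ht.comp hφ.tendsto_atTop
  obtain ⟨j, hj, hne⟩ := hinf (w ∘ φ) (fun j => hw _) ht' v hv
  apply hne
  have h1 := ((MvPolynomial.continuous_eval (m j)).tendsto v).comp hv
  refine tendsto_nhds_unique h1 ?_
  have h2 : Tendsto (fun t => (‖w (φ t)‖⁻¹) ^ d j * C) atTop (𝓝 0) := by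
    have := ((tendsto_inv_atTop_zero.comp ht').pow (d j)).mul_const C
    simpa [hj.ne'] using this
  refine squeeze_zero_norm (fun t => ?_) h2
  have e : (‖w (φ t)‖⁻¹ • w (φ t)) = ((‖w (φ t)‖⁻¹ : ℝ) : ℂ) • w (φ t) := by ext i; simp
  simp only [Function.comp_apply]
  rw [e, hom, norm_mul, norm_pow, Complex.norm_real, norm_inv, norm_norm]
  gcongr
  exact hC _ j hj

include hom hinf hV in
lemma int_V [Finite ι] (hd : ∀ j, 0 < d j) (x : MvPolynomial σ ℂ) : ∃ q : Polynomial (MvPolynomial ι ℂ), q.Monic ∧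
    q.eval₂ (MvPolynomial.aeval m : MvPolynomial ι ℂ →ₐ[ℂ] MvPolynomial σ ℂ).toRingHom x ∈ MvPolynomial.vanishingIdeal ℂ V := by
  set I := MvPolynomial.vanishingIdeal ℂ V with hI
  have hrad : I.radical = I := by
    refine Ideal.IsRadical.radical fun p ⟨k, hk⟩ w hw => ?_
    have := hk w hw
    rw [map_pow] at this
    exact eq_zero_of_pow_eq_zero this
  have hfin : I.minimalPrimes.Finite := I.finite_minimalPrimes_of_isNoetherianRing _
  have hx : ∀ P : I.minimalPrimes, ∃ q : Polynomial (MvPolynomial ι ℂ), q.Monic ∧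
    q.eval₂ (MvPolynomial.aeval m : MvPolynomial ι ℂ →ₐ[ℂ] MvPolynomial σ ℂ).toRingHom x ∈ P.1 := by
    rintro ⟨P, hP⟩
    haveI := hP.1.1
    refine int_dom P m x fun C => ?_
    obtain ⟨D, hD⟩ := bd_V m d hom V hinf C
    obtain ⟨D', hD'⟩ := (isCompact_closedBall (0 : σ → ℂ) D).exists_bound_of_continuousOn (MvPolynomial.continuous_eval x).continuousOn
    refine ⟨D', fun w hw hm => hD' w ?_⟩
    rw [mem_closedBall_zero_iff]
    refine hD w ((hV w).2 fun q hq => hw q (hP.1.2 fun v hv => ?_)) fun j _ => hm j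
    rw [MvPolynomial.aeval_eq_eval]
    exact (hV v).1 hv q hq
  choose q hq hqx using hx
  haveI := hfin.fintype
  refine ⟨∏ P, q P, Polynomial.monic_prod_of_monic _ _ fun P _ => hq P, ?_⟩
  refine hrad.le ?_
  refine (Ideal.sInf_minimalPrimes (I := I)).le ?_
  rw [Ideal.mem_sInf]
  intro P hP
  rw [Polynomial.eval₂_finset_prod]
  exact Ideal.mem_of_dvd _ (Finset.dvd_prod_of_mem _ (Finset.mem_univ ⟨P, hP⟩)) (hqx ⟨P, hP⟩)

include hom hinf hV in
theorem AG (C : Set (σ → ℂ)) (Q : Set (MvPolynomial σ ℂ)) (hC : ∀ w, w ∈ C ↔ ∀ q ∈ Q, MvPolynomial.eval w q = 0)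
    (hsat : ∀ w ∈ V, ∀ c ∈ V, c ∈ C → (∀ j, MvPolynomial.eval w (m j) = MvPolynomial.eval c (m j)) → w ∈ C) :
    ∃ s : Finset (MvPolynomial ι ℂ), ∀ w ∈ V, w ∈ C ↔ ∀ a ∈ s, MvPolynomial.eval (fun j => MvPolynomial.eval w (m j)) a = 0 := by
  classical
  have hev : ∀ (w : σ → ℂ) a, MvPolynomial.eval w (MvPolynomial.aeval m a) = MvPolynomial.eval (fun j => MvPolynomial.eval w (m j)) a := by
    intro w a
    have : (MvPolynomial.aeval w : MvPolynomial σ ℂ →ₐ[ℂ] ℂ).comp (MvPolynomial.aeval m) = MvPolynomial.aeval (fun j => MvPolynomial.eval w (m j)) :=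
      MvPolynomial.algHom_ext fun i => by simp [MvPolynomial.aeval_eq_eval]
    have := congrArg (fun F => F a) this
    simpa [MvPolynomial.aeval_eq_eval] using this
  obtain ⟨t, ht1, ht2⟩ := (Submodule.fg_span_iff_fg_span_finset_subset (R := MvPolynomial σ ℂ) (m '' {j | 0 < d j})).1 (IsNoetherian.noetherian _)
  have ht1' : ∀ p : t, ∃ j, 0 < d j ∧ m j = p := fun p => ht1 p.2
  choose J hJ1 hJ2 using ht1'
  have hspan : ∀ v : σ → ℂ, (∀ p ∈ t, MvPolynomial.eval v p = 0) → ∀ j, 0 < d j → MvPolynomial.eval v (m j) = 0 := by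
    intro v hv j hj
    have h1 : m j ∈ Ideal.span (t : Set (MvPolynomial σ ℂ)) := by
      change m j ∈ Submodule.span _ _
      rw [← ht2]; exact Submodule.subset_span ⟨j, hj, rfl⟩
    have h2 : Ideal.span (t : Set (MvPolynomial σ ℂ)) ≤ RingHom.ker (MvPolynomial.eval v) := Ideal.span_le.2 hv
    exact h2 h1
  set 𝔠 := MvPolynomial.vanishingIdeal ℂ (V ∩ C) with h𝔠
  set π : MvPolynomial σ ℂ →ₐ[ℂ] MvPolynomial σ ℂ ⧸ 𝔠 := Ideal.Quotient.mkₐ ℂ 𝔠 with hπ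
  have hπ0 : ∀ p, π p = 0 ↔ p ∈ 𝔠 := fun p => Ideal.Quotient.eq_zero_iff_mem
  set ρ : MvPolynomial ι ℂ →ₐ[ℂ] MvPolynomial σ ℂ ⧸ 𝔠 := π.comp (MvPolynomial.aeval m) with hρ
  have hint : ρ.toRingHom.IsIntegral := by
    have key := fun x => int_V (fun p : t => m (J p)) (fun p => d (J p)) (fun p => hom (J p)) V S hV (fun w h1 h2 v h3 => by
      by_contra! hc
      obtain ⟨j, hj, hne⟩ := hinf w h1 h2 v h3
      refine hne (hspan v (fun p hp => ?_) j hj)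
      have := hc ⟨p, hp⟩ (hJ1 _)
      rwa [hJ2] at this) (fun p => hJ1 p) x
    refine RingHom.IsIntegral.tower_top (MvPolynomial.rename (fun p : t => J p) : MvPolynomial t ℂ →ₐ[ℂ] MvPolynomial ι ℂ).toRingHom _ ?_
    intro x
    obtain ⟨x, rfl⟩ := Ideal.Quotient.mk_surjective x
    obtain ⟨q, hq, h⟩ := key x
    refine ⟨q, hq, ?_⟩
    have h3 := Polynomial.hom_eval₂ q (MvPolynomial.aeval fun p : t => m (J p) : MvPolynomial t ℂ →ₐ[ℂ] MvPolynomial σ ℂ).toRingHom π.toRingHom x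
    have h4 : (ρ.comp (MvPolynomial.rename (fun p : t => J p))) = π.comp (MvPolynomial.aeval fun p : t => m (J p)) := 
      MvPolynomial.algHom_ext fun i => by simp [hρ]
    have h5 : ρ.toRingHom.comp (MvPolynomial.rename (fun p : t => J p) : MvPolynomial t ℂ →ₐ[ℂ] MvPolynomial ι ℂ).toRingHom = π.toRingHom.comp (MvPolynomial.aeval fun p : t => m (J p) : MvPolynomial t ℂ →ₐ[ℂ] MvPolynomial σ ℂ).toRingHom := 
      congrArg AlgHom.toRingHom h4
    rw [h5]
    refine h3.symm.trans ?_
    exact (hπ0 _).2 fun w hw => h w hw.1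
  obtain ⟨s, hs1, hs2⟩ := (Submodule.fg_span_iff_fg_span_finset_subset (R := MvPolynomial σ ℂ) ((MvPolynomial.aeval m : MvPolynomial ι ℂ →ₐ[ℂ] MvPolynomial σ ℂ) '' {a | ρ a = 0})).1 (IsNoetherian.noetherian _)
  have hs1' : ∀ p ∈ s, ∃ a, ρ a = 0 ∧ MvPolynomial.aeval m a = p := fun p hp => hs1 hp
  choose! L hL1 hL2 using hs1'
  refine ⟨s.image L, fun w hw => ⟨fun hwC a ha => ?_, fun h => ?_⟩⟩
  · obtain ⟨p, hp, rfl⟩ := Finset.mem_image.1 ha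
    rw [← hev, ← MvPolynomial.aeval_eq_eval]
    exact (hπ0 _).1 (hL1 p hp) w ⟨hw, hwC⟩
  · obtain ⟨φ, hφ⟩ := pt_lift ρ hint (MvPolynomial.aeval (fun j => MvPolynomial.eval w (m j))) (by
      intro a ha
      rw [MvPolynomial.aeval_eq_eval]
      change MvPolynomial.eval _ a = 0
      rw [← hev]
      have h1 : MvPolynomial.aeval m a ∈ Ideal.span (s : Set (MvPolynomial σ ℂ)) := by
        change _ ∈ Submodule.span _ _
        rw [← hs2]; exact Submodule.subset_span ⟨a, ha, rfl⟩
      have h2 : Ideal.span (s : Set (MvPolynomial σ ℂ)) ≤ RingHom.ker (MvPolynomial.eval w) := Ideal.span_le.2 fun p hp => by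
        have := h (L p) (Finset.mem_image_of_mem L hp)
        rwa [← hev, hL2 p hp] at this
      exact h2 h1)
    set c : σ → ℂ := fun i => φ (π (MvPolynomial.X i)) with hc
    have hwe : ∀ p, MvPolynomial.eval c p = φ (π p) := by
      intro p
      have : φ.comp π = MvPolynomial.aeval c := MvPolynomial.algHom_ext fun i => by simp [hc]
      have := congrArg (fun F => F p) this
      simpa [MvPolynomial.aeval_eq_eval] using this.symm
    refine hsat w hw c ((hV c).2 fun q hq => ?_) ((hC c).2 fun q hq => ?_) fun j => ?_
    · rw [hwe, (hπ0 q).2 fun v hv => ?_, map_zero]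
      rw [MvPolynomial.aeval_eq_eval]; exact (hV v).1 hv.1 q hq
    · rw [hwe, (hπ0 q).2 fun v hv => ?_, map_zero]
      rw [MvPolynomial.aeval_eq_eval]; exact (hC v).1 hv.2 q hq
    · have := hφ (MvPolynomial.X j)
      rw [hwe]
      simpa [hρ] using this.symm

end

lemma pack {ι : Type*} [Nonempty ι] (s : Finset (MvPolynomial ι ℂ)) : ∃ N : ℕ, 1 ≤ N ∧ ∃ (e : Fin N → ι) (p : Fin N → MvPolynomial (Fin N) ℂ),
    ∀ z : ι → ℂ, (∀ a ∈ s, MvPolynomial.eval z a = 0) ↔ ∀ j, MvPolynomial.eval (z ∘ e) (p j) = 0 := by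
  classical
  set v : Finset ι := s.biUnion MvPolynomial.vars with hv
  obtain ⟨i0⟩ := ‹Nonempty ι›
  set N := v.card + s.card + 1 with hN
  set e : Fin N → ι := fun j => if h : j.1 < v.card then v.equivFin.symm ⟨j, h⟩ else i0 with he
  set g : Fin N → MvPolynomial ι ℂ := fun j => if h : j.1 < s.card then s.equivFin.symm ⟨j, h⟩ else 0 with hg
  set f : v → Fin N := fun i => ⟨v.equivFin i, by omega⟩ with hf
  have hef : e ∘ f = Subtype.val := by funext i; simp [he, hf]
  have hgs : ∀ j, ∃ p : MvPolynomial (Fin N) ℂ, MvPolynomial.rename e p = g j := by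
    intro j
    have h0 : ((g j).vars : Set ι) ⊆ range (Subtype.val : v → ι) := by
      intro i hi
      rw [Subtype.range_coe]
      simp only [hg] at hi
      split_ifs at hi with h
      · exact Finset.mem_coe.2 (Finset.mem_biUnion.2 ⟨_, (s.equivFin.symm ⟨j, h⟩).2, hi⟩)
      · simp at hi
    obtain ⟨q, hq⟩ := MvPolynomial.exists_rename_eq_of_vars_subset_range _ _ Subtype.val_injective h0
    exact ⟨MvPolynomial.rename f q, by rw [MvPolynomial.rename_rename, hef, hq]⟩
  choose p hp using hgs
  refine ⟨N, by omega, e, p, fun z => ?_⟩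
  have hz : ∀ j, MvPolynomial.eval (z ∘ e) (p j) = MvPolynomial.eval z (g j) := fun j => by
    rw [← hp, MvPolynomial.eval_rename]
  simp only [hz]
  refine ⟨fun h j => ?_, fun h a ha => ?_⟩
  · simp only [hg]
    split_ifs with hj
    · exact h _ (s.equivFin.symm ⟨j, hj⟩).2
    · simp
  · have := h ⟨s.equivFin ⟨a, ha⟩, by omega⟩
    simpa [hg] using this
end
end FileD4

section FileE1
open MeasureTheory Set Filter Topology
noncomputable section
open Polynomial

section HFsec
variable {n : ℕ} {σ : Type*}

def HF (σ : Type*) : Submodule ℂ ((σ → ℂ) → Ent) :=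
  Submodule.span ℂ {Φ | ∃ (c : MvPolynomial σ ℂ) (h : Ent), Φ = fun w => MvPolynomial.eval w c • h}

lemma HF.gen (c : MvPolynomial σ ℂ) (h : Ent) : (fun w => MvPolynomial.eval w c • h) ∈ HF σ := Submodule.subset_span ⟨c, h, rfl⟩

lemma HF.const (h : Ent) : (fun _ => h) ∈ HF σ := by
  have := HF.gen (σ := σ) 1 h
  simpa using this

lemma HF.mul {Φ Ψ : (σ → ℂ) → Ent} (h1 : Φ ∈ HF σ) (h2 : Ψ ∈ HF σ) : (fun w => Φ w * Ψ w) ∈ HF σ := by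
  induction h1 using Submodule.span_induction with
  | mem x hx =>
    obtain ⟨c, h, rfl⟩ := hx
    induction h2 using Submodule.span_induction with
    | mem y hy =>
      obtain ⟨c', h', rfl⟩ := hy
      convert HF.gen (c * c') (h * h') using 1
      funext w
      rw [map_mul, smul_mul_smul_comm]
    | zero => convert (HF σ).zero_mem using 1; funext w; simp
    | add y z _ _ hy hz => convert (HF σ).add_mem hy hz using 1; funext w; simp [mul_add]
    | smul a y _ hy => convert (HF σ).smul_mem a hy using 1; funext w; simp
  | zero => convert (HF σ).zero_mem using 1; funext w; simp
  | add y z _ _ hy hz => convert (HF σ).add_mem hy hz using 1; funext w; simp [add_mul]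
  | smul a y _ hy => convert (HF σ).smul_mem a hy using 1; funext w; simp

lemma HF.lin {Φ : (σ → ℂ) → Ent} (h1 : Φ ∈ HF σ) (L : Ent →ₗ[ℂ] Ent) : (fun w => L (Φ w)) ∈ HF σ := by
  induction h1 using Submodule.span_induction with
  | mem x hx =>
    obtain ⟨c, h, rfl⟩ := hx
    simpa using HF.gen c (L h)
  | zero => convert (HF σ).zero_mem using 1; funext w; simp
  | add y z _ _ hy hz => convert (HF σ).add_mem hy hz using 1; funext w; simp
  | smul a y _ hy => convert (HF σ).smul_mem a hy using 1; funext w; simp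

lemma HF.prim {Φ : (σ → ℂ) → Ent} (h1 : Φ ∈ HF σ) : ∃ Ψ ∈ HF σ, ∀ w, dE (Ψ w) = Φ w ∧ (Ψ w).fn 0 = 0 := by
  induction h1 using Submodule.span_induction with
  | mem x hx =>
    obtain ⟨c, h, rfl⟩ := hx
    obtain ⟨g, hg, hg0⟩ := dE_surj h 0 0
    exact ⟨_, HF.gen c g, fun w => ⟨by rw [Derivation.map_smul, hg], by rw [fn_smul, hg0, mul_zero]⟩⟩
  | zero => exact ⟨0, (HF σ).zero_mem, fun w => ⟨by simp, by simp [fn_zero]⟩⟩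
  | add y z _ _ hy hz =>
    obtain ⟨a, ha, ha'⟩ := hy
    obtain ⟨b, hb, hb'⟩ := hz
    exact ⟨a + b, (HF σ).add_mem ha hb, fun w => ⟨by simp [ha', hb'], by simp [fn_add, ha', hb']⟩⟩
  | smul c y _ hy => 
    obtain ⟨a, ha, ha'⟩ := hy
    exact ⟨c • a, (HF σ).smul_mem c ha, fun w => ⟨by simp [ha'], by simp [fn_smul, ha']⟩⟩

lemma HF.ev {Φ : (σ → ℂ) → Ent} (h1 : Φ ∈ HF σ) (x : ℂ) : ∃ p : MvPolynomial σ ℂ, ∀ w, (Φ w).fn x = MvPolynomial.eval w p := by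
  induction h1 using Submodule.span_induction with
  | mem y hx =>
    obtain ⟨c, h, rfl⟩ := hx
    exact ⟨c * MvPolynomial.C (h.fn x), fun w => by simp [fn_smul]⟩
  | zero => exact ⟨0, fun w => by simp [fn_zero]⟩
  | add y z _ _ hy hz =>
    obtain ⟨a, ha⟩ := hy
    obtain ⟨b, hb⟩ := hz
    exact ⟨a + b, fun w => by simp [fn_add, ha, hb]⟩
  | smul c y _ hy => 
    obtain ⟨a, ha⟩ := hy
    exact ⟨MvPolynomial.C c * a, fun w => by simp [fn_smul, ha]⟩

lemma HF.J {f : (σ → ℂ) → Fin n → Ent} (hf : ∀ i, (fun w => f w i) ∈ HF σ) {J : (σ → ℂ) → List (Fin n) → ℂ → ℂ}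
    (hJ : ∀ w, IsJ (fun i => (f w i).fn) (J w)) (l : List (Fin n)) : (fun w => JE (hJ w) l) ∈ HF σ := by
  have hfn : ∀ w l x, (JE (hJ w) l).fn x = J w l x := fun w l x => rfl
  induction l with
  | nil =>
    have := HF.const (σ := σ) 1
    convert this using 2 with w
    apply Ent.ext'
    intro x
    rw [hfn, (hJ w).nil, fn_one]
  | cons i l ih =>
    obtain ⟨Ψ, h1, h2⟩ := HF.prim (HF.mul (HF.lin (hf i) (dE : Ent →ₗ[ℂ] Ent)) ih)
    convert h1 using 1
    funext w
    have h3 : dE (JE (hJ w) (i :: l) - Ψ w) = 0 := by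
      rw [map_sub, (h2 w).1, sub_eq_zero]
      apply Ent.ext'
      intro x
      rw [dE_apply, fn_mul, hfn]
      change deriv (J w (i :: l)) x = _
      rw [(hJ w).der]
      congr 1
    obtain ⟨c, hc⟩ := dE_eq_zero h3
    have h4 := congrArg (fun g => g.fn 0) hc
    simp only [fn_sub, fn_alg, (h2 w).2, hfn, (hJ w).zero, sub_zero] at h4
    rw [← h4, map_zero, sub_eq_zero] at hc
    exact hc

lemma HF.pp {f : (σ → ℂ) → Fin n → Ent} (hf : ∀ i, (fun w => f w i) ∈ HF σ) {J : (σ → ℂ) → List (Fin n) → ℂ → ℂ}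
    (hJ : ∀ w, IsJ (fun i => (f w i).fn) (J w)) (m : ℕ) (x : ℂ) : ∃ p : MvPolynomial σ ℂ, ∀ w, (_root_.pp (hJ w) m).fn x = MvPolynomial.eval w p := by
  choose p hp using fun l => HF.ev (HF.J hf hJ l) x
  refine ⟨(Pm n m).sum fun l c => MvPolynomial.C c * p l, fun w => ?_⟩
  rw [pp_val, Finsupp.sum, Finsupp.sum, map_sum]
  refine Finset.sum_congr rfl fun l _ => ?_
  rw [map_mul, MvPolynomial.eval_C, ← hp]; rfl

lemma aeval_fn (f : Fin n → Ent) (P : MvPolynomial (Fin n) ℂ) (x : ℂ) : (MvPolynomial.aeval f P).fn x = MvPolynomial.eval (fun i => (f i).fn x) P := by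
  have : (evE x).comp (MvPolynomial.aeval f) = MvPolynomial.aeval (fun i => (f i).fn x) :=
    MvPolynomial.algHom_ext fun i => by simp [evE_apply]
  have := congrArg (fun F => F P) this
  simpa [MvPolynomial.aeval_eq_eval, evE_apply] using this

lemma mu_ent (T : ℝ) (f : Fin n → Ent) (P : MvPolynomial (Fin n) ℂ) (i : Fin n) :
    mu T (fun i => (f i).fn) P i = ∫ x in (0:ℝ)..T, (MvPolynomial.aeval f P * dE (f i)).fn x := by
  unfold mu
  refine intervalIntegral.integral_congr fun x _ => ?_
  simp only [fn_mul, aeval_fn, dE_apply]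

lemma HF.mu {f : (σ → ℂ) → Fin n → Ent} (hf : ∀ i, (fun w => f w i) ∈ HF σ) (T : ℝ) (P : MvPolynomial (Fin n) ℂ) (i : Fin n) :
    ∃ p : MvPolynomial σ ℂ, ∀ w, _root_.mu T (fun i => (f w i).fn) P i = MvPolynomial.eval w p := by
  have h1 : (fun w => MvPolynomial.aeval (f w) P) ∈ HF σ := by
    induction P using MvPolynomial.induction_on with
    | C a => simpa using HF.const (algebraMap ℂ Ent a)
    | add p q hp hq => convert (HF σ).add_mem hp hq using 1; funext w; simp
    | mul_X p j hp => simpa using HF.mul hp (hf j)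
  obtain ⟨Ψ, h2, h3⟩ := HF.prim (HF.mul h1 (HF.lin (hf i) (dE : Ent →ₗ[ℂ] Ent)))
  obtain ⟨p, hp⟩ := HF.ev h2 T
  refine ⟨p, fun w => ?_⟩
  rw [mu_ent, ← hp]
  have := Ent.int (Ψ w) T
  rw [(h3 w).1, (h3 w).2, sub_zero] at this
  exact this

def mon (ps : List (Fin n × ℕ)) : MvPolynomial (Fin n) ℂ := (ps.map fun q => MvPolynomial.X q.1 ^ q.2).prod

lemma mu_ext {T : ℝ} {f g : Fin n → Ent} (h : ∀ ps : List (Fin n × ℕ), (∀ q ∈ ps, 0 < q.2) → ∀ i, mu T (fun i => (f i).fn) (mon ps) i = mu T (fun i => (g i).fn) (mon ps) i)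
    (P : MvPolynomial (Fin n) ℂ) (i : Fin n) : mu T (fun i => (f i).fn) P i = mu T (fun i => (g i).fn) P i := by
  simp only [mu_ent] at h ⊢
  have hi : ∀ e : Ent, IntervalIntegrable (fun x : ℝ => e.fn x) volume 0 T := fun e => e.cont.intervalIntegrable 0 T
  induction P using MvPolynomial.induction_on' with
  | monomial s a =>
    have h1 : MvPolynomial.monomial s a = a • mon (s.support.toList.map fun i => (i, s i)) := by
      rw [MvPolynomial.monomial_eq, MvPolynomial.smul_eq_C_mul, mon, List.map_map, Finsupp.prod]
      congr 1
      exact (Finset.prod_map_toList _ _).symm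
    have h2 := h (s.support.toList.map fun i => (i, s i)) (by
      intro q hq
      obtain ⟨j, hj, rfl⟩ := List.mem_map.1 hq
      exact Nat.pos_of_ne_zero (Finsupp.mem_support_iff.1 (Finset.mem_toList.1 hj))) i
    simp only [h1, map_smul, smul_mul_assoc, fn_smul, intervalIntegral.integral_const_mul]
    rw [h2]
  | add p q hp hq =>
    simp only [map_add, add_mul, fn_add]
    rw [intervalIntegral.integral_add (hi _) (hi _), intervalIntegral.integral_add (hi _) (hi _), hp, hq]

lemma moment_scale {T : ℝ} (a : Fin n → ℝ → ℂ) (d : Fin n → ℕ) (c : ℂ) (ps : List (Fin n × ℕ)) (i : Fin n) :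
    moment T (fun i x => c ^ d i * a i x) ps i = c ^ ((ps.map fun q => d q.1 * q.2).sum + d i) * moment T a ps i := by
  unfold moment
  rw [← intervalIntegral.integral_const_mul]
  congr 1
  funext s
  have : (ps.map fun q => primitive (fun x => c ^ d q.1 * a q.1 x) s ^ q.2).prod = c ^ (ps.map fun q => d q.1 * q.2).sum * (ps.map fun q => primitive (a q.1) s ^ q.2).prod := by
    induction ps with
    | nil => simp
    | cons q ps ih =>
      simp only [List.map_cons, List.prod_cons, List.sum_cons]
      rw [ih, primitive, intervalIntegral.integral_const_mul]
      change _ = _ * (_ * _)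
      rw [primitive]
      ring
  rw [this]; ring
end HFsec
end
end FileE1

section FileE2
open MeasureTheory Set Filter Topology
noncomputable section
open Polynomial

section Fam
variable {n : ℕ}

abbrev Idx (n : ℕ) := {ps : List (Fin n × ℕ) // ∀ q ∈ ps, 0 < q.2} × Fin n

def MM (T : ℝ) (F : Fin n → LL[X]) (j : Idx n) : ℂ := mu T (pth T F) (mon j.1.1) j.2

def dgr (d : Fin n → ℕ) (j : Idx n) : ℕ := (j.1.1.map fun q => d q.1 * q.2).sum + d j.2

def AA (T : ℝ) (F : Fin n → LL[X]) : Fin n → ℝ → ℂ := fun i x => (dE (PT T (F i))).fn x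

def Uni (T : ℝ) (F : Fin n → LL[X]) : Prop := ∀ l : List (Fin n), l ≠ [] → iterInt T (AA T F) l = 0

lemma uni_iff {T : ℝ} (hT : 0 < T) {F : Fin n → LL[X]} {J} (hJ : IsJ (pth T F) J) : Uni T F ↔ ∀ l : List (Fin n), l ≠ [] → J l T = 0 := by
  have h := iter_eq hT (a := AA T F) (f := fun i => PT T (F i)) (fun i x _ => rfl) hJ
  constructor
  · intro hu l hl
    have := hu l.reverse (by simpa using hl)
    rwa [h, List.reverse_reverse] at this
  · intro hu l hl
    rw [h]
    exact hu _ (by simpa using hl)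

lemma MM_scale {T : ℝ} (hT : 0 < T) {F G : Fin n → LL[X]} (hF : ∀ i, pth T F i 0 = 0) (d : Fin n → ℕ) (c : ℂ)
    (h : ∀ i, G i = c ^ d i • F i) (j : Idx n) : MM T G j = c ^ dgr d j * MM T F j := by
  have h1 := moment_eq hT (a := AA T F) (f := fun i => PT T (F i)) (fun i x _ => rfl) hF j.1.1 j.2
  have h2 := moment_eq hT (a := AA T G) (f := fun i => PT T (G i)) (fun i x _ => rfl) (fun i => by
    rw [h, map_smul, fn_smul]
    exact mul_eq_zero_of_right _ (hF i)) j.1.1 j.2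
  have h3 : AA T G = fun i x => c ^ d i * AA T F i x := by
    funext i x
    simp only [AA]
    rw [h, map_smul, Derivation.map_smul, fn_smul]
  rw [h3, moment_scale, h1] at h2
  exact h2.symm

lemma agree_mu {T : ℝ} {F G : Fin n → LL[X]} (h : ∀ j, MM T F j = MM T G j) (P : MvPolynomial (Fin n) ℂ) (i : Fin n) :
    mu T (pth T F) P i = mu T (pth T G) P i :=
  mu_ext (f := fun i => PT T (F i)) (g := fun i => PT T (G i)) (fun ps hps i => h (⟨ps, hps⟩, i)) P i

lemma degA {T : ℝ} (hT : 0 < T) {F G : Fin n → LL[X]} (hG : ∀ i, pth T G i 0 = 0) (h : ∀ j, MM T F j = MM T G j)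
    (hu : Uni T G) : Uni T F := by
  obtain ⟨J, hJ⟩ := exists_J (pth_d T F)
  obtain ⟨K, hK⟩ := exists_J (pth_d T G)
  rw [uni_iff hT hK] at hu
  rw [uni_iff hT hJ]
  exact univ_of_zero hT hJ fun P i => by rw [agree_mu h, mu_of_univ (pth_d T G) hK hG hu]

lemma degB {T : ℝ} (hT : 0 < T) {F G : Fin n → LL[X]} (hF : ∀ i, pth T F i 0 = 0) (hG : ∀ i, pth T G i 0 = 0) (h : ∀ j, MM T F j = MM T G j)
    (hu : ¬ Uni T G) (i : Fin n) (hi : G i = 0) : F i = 0 := by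
  obtain ⟨J, hJ⟩ := exists_J (pth_d T F)
  obtain ⟨K, hK⟩ := exists_J (pth_d T G)
  rw [uni_iff hT hK] at hu
  have hg : ∀ x, pth T G i x = 0 := fun x => by rw [pth, hi, map_zero, fn_zero]
  have key : ∀ x, pth T F i x = 0 := by
    rcases Dprime hT hF hG (agree_mu h) hJ hK with ⟨⟨R, α, β, h1, h2, h3⟩, _⟩ | ⟨_, h2⟩ | ⟨c, h1, _⟩
    · exact h1.ident (pth_d T F i) fun ξ hξ => by rw [h3 ξ hξ, hg]
    · exact absurd h2 hu
    · intro x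
      have := h1 i (x - c)
      rw [hg, sub_add_cancel] at this
      exact this.symm
  apply PT_inj hT
  rw [map_zero]
  exact Ent.ext' fun x => by rw [fn_zero]; exact key x

variable {σ τ : Type*} [Fintype σ] [Fintype τ]

def FF (q : Fin n → τ → MvPolynomial σ ℂ) (e : τ → LL[X]) (w : σ → ℂ) (i : Fin n) : LL[X] := ∑ t, MvPolynomial.eval w (q i t) • e t

lemma FF_zero {T : ℝ} (q : Fin n → τ → MvPolynomial σ ℂ) {e : τ → LL[X]} (he : ∀ t, (PT T (e t)).fn 0 = 0) (w : σ → ℂ) (i : Fin n) :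
    pth T (FF q e w) i 0 = 0 := by
  rw [pth, FF, map_sum, ← evE_apply, map_sum]
  refine Finset.sum_eq_zero fun t _ => ?_
  rw [map_smul, evE_apply, fn_smul, he, mul_zero]

lemma FF_HF (T : ℝ) (q : Fin n → τ → MvPolynomial σ ℂ) (e : τ → LL[X]) (i : Fin n) : (fun w => PT T (FF q e w i)) ∈ HF σ := by
  have : (fun w => PT T (FF q e w i)) = ∑ t, fun w => MvPolynomial.eval w (q i t) • PT T (e t) := by
    funext w
    simp [FF]
  rw [this]
  exact Submodule.sum_mem _ fun t _ => HF.gen _ _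

lemma FF_scale {q : Fin n → τ → MvPolynomial σ ℂ} {d : Fin n → ℕ}
    (hq : ∀ i t c w, MvPolynomial.eval (c • w) (q i t) = c ^ d i * MvPolynomial.eval w (q i t)) (e : τ → LL[X]) (c : ℂ) (w : σ → ℂ) (i : Fin n) :
    FF q e (c • w) i = c ^ d i • FF q e w i := by
  simp only [FF, hq, Finset.smul_sum, smul_smul]

theorem fam {T : ℝ} (hT : 0 < T) (q : Fin n → τ → MvPolynomial σ ℂ) {e : τ → LL[X]} (he : ∀ t, (PT T (e t)).fn 0 = 0) {d : Fin n → ℕ}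
    (hq : ∀ i t c w, MvPolynomial.eval (c • w) (q i t) = c ^ d i * MvPolynomial.eval w (q i t))
    (V : Set (σ → ℂ)) (S : Set (MvPolynomial σ ℂ)) (hV : ∀ w, w ∈ V ↔ ∀ q ∈ S, MvPolynomial.eval w q = 0)
    (hinf : ∀ w : ℕ → σ → ℂ, (∀ j, w j ∈ V) → Tendsto (fun j => ‖w j‖) atTop atTop → ∀ v, Tendsto (fun j => ‖w j‖⁻¹ • w j) atTop (𝓝 v) →
      ∃ j : Idx n, 0 < dgr d j ∧ MM T (FF q e v) j ≠ 0) :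
    ∃ s : Finset (MvPolynomial (Idx n) ℂ), ∀ w ∈ V, DeterminesCenter T (AA T (FF q e w)) ↔ ∀ a ∈ s, MvPolynomial.eval (MM T (FF q e w)) a = 0 := by
  choose m hm using fun j : Idx n => HF.mu (f := fun w i => PT T (FF q e w i)) (FF_HF T q e) T (mon j.1.1) j.2
  replace hm : ∀ j w, MM T (FF q e w) j = MvPolynomial.eval w (m j) := hm
  choose J hJ using fun w => exists_J (pth_d T (FF q e w))
  choose p hp using fun k : ℕ => HF.pp (f := fun w i => PT T (FF q e w i)) (FF_HF T q e) hJ (k + 1) T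
  have hcen : ∀ w, DeterminesCenter T (AA T (FF q e w)) ↔ ∀ k, (pp (hJ w) (k + 1)).fn T = 0 := fun w =>
    center_iff hT (f := fun i => PT T (FF q e w i)) (fun i x _ => rfl) (hJ w)
  obtain ⟨s, hs⟩ := AG m (dgr d) (fun j c w => by
      rw [← hm, ← hm]
      exact MM_scale hT (FF_zero q he w) d c (FF_scale hq e c w) j) V S hV
    (fun w h1 h2 v h3 => by
      obtain ⟨j, h4, h5⟩ := hinf w h1 h2 v h3
      exact ⟨j, h4, by rwa [← hm]⟩)
    {w | DeterminesCenter T (AA T (FF q e w))} (Set.range p) (fun w => by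
      rw [mem_setOf_eq, hcen]
      constructor
      · rintro h _ ⟨k, rfl⟩
        rw [← hp]; exact h k
      · intro h k
        have := h _ ⟨k, rfl⟩
        rw [← hp] at this; exact this)
    (fun w _ c _ hc h => by
      rw [mem_setOf_eq, hcen] at hc ⊢
      exact center_imp hT (FF_zero q he c) (FF_zero q he w) (agree_mu fun j => by rw [hm, hm, h]) (hJ c) (hJ w) hc)
  refine ⟨s, fun w hw => ?_⟩
  have : MM T (FF q e w) = fun j => MvPolynomial.eval w (m j) := funext fun j => hm j w
  rw [this]
  exact hs w hw

lemma agree0 {T : ℝ} (hT : 0 < T) {q : Fin n → τ → MvPolynomial σ ℂ} {e : τ → LL[X]} (he : ∀ t, (PT T (e t)).fn 0 = 0) {d : Fin n → ℕ}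
    (hq : ∀ i t c w, MvPolynomial.eval (c • w) (q i t) = c ^ d i * MvPolynomial.eval w (q i t)) {v : σ → ℂ}
    (h : ¬ ∃ j : Idx n, 0 < dgr d j ∧ MM T (FF q e v) j ≠ 0) (j : Idx n) : MM T (FF q e v) j = MM T (FF q e 0) j := by
  push Not at h
  have h1 := MM_scale hT (FF_zero q he v) d 0 (FF_scale hq e 0 v) j
  rw [zero_smul] at h1
  rw [h1]
  rcases Nat.eq_zero_or_pos (dgr d j) with h0 | h0
  · rw [h0, pow_zero, one_mul]
  · rw [h j h0, mul_zero]

theorem fam2 {T : ℝ} (hT : 0 < T) (q : Fin n → τ → MvPolynomial σ ℂ) {e : τ → LL[X]} (he : ∀ t, (PT T (e t)).fn 0 = 0)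
    (hli : LinearIndependent ℂ e) {d : Fin n → ℕ}
    (hq : ∀ i t c w, MvPolynomial.eval (c • w) (q i t) = c ^ d i * MvPolynomial.eval w (q i t))
    (V : Set (σ → ℂ)) (S : Set (MvPolynomial σ ℂ)) (hV : ∀ w, w ∈ V ↔ ∀ q ∈ S, MvPolynomial.eval w q = 0)
    (hinf : ∀ w : ℕ → σ → ℂ, (∀ j, w j ∈ V) → Tendsto (fun j => ‖w j‖) atTop atTop → ∀ v, Tendsto (fun j => ‖w j‖⁻¹ • w j) atTop (𝓝 v) →
      ¬ Uni T (FF q e v)) :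
    ∃ s : Finset (MvPolynomial (Idx n) ℂ), ∀ w ∈ V, DeterminesCenter T (AA T (FF q e w)) ↔ ∀ a ∈ s, MvPolynomial.eval (MM T (FF q e w)) a = 0 := by
  by_cases hU : Uni T (FF q e 0)
  · refine fam hT q he hq V S hV fun w h1 h2 v h3 => ?_
    by_contra hc
    exact hinf w h1 h2 v h3 (degA hT (FF_zero q he 0) (agree0 hT he hq hc) hU)
  · let q' : Fin n → τ → MvPolynomial ({i : Fin n // 0 < d i} × τ) ℂ := fun i t =>
      if h : 0 < d i then MvPolynomial.X (⟨i, h⟩, t) else MvPolynomial.C (MvPolynomial.eval 0 (q i t))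
    let d' : Fin n → ℕ := fun i => if 0 < d i then 1 else 0
    let u : (σ → ℂ) → ({i : Fin n // 0 < d i} × τ) → ℂ := fun w p => MvPolynomial.eval w (q p.1.1 p.2)
    have hq' : ∀ i t c w, MvPolynomial.eval (c • w) (q' i t) = c ^ d' i * MvPolynomial.eval w (q' i t) := by
      intro i t c w
      by_cases h : 0 < d i <;> simp [q', d', h]
    have hu : ∀ w, FF q' e (u w) = FF q e w := by
      intro w
      funext i
      refine Finset.sum_congr rfl fun t _ => ?_
      congr 1
      by_cases h : 0 < d i
      · simp [q', u, h]
      · have := hq i t 0 w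
        rw [zero_smul, Nat.eq_zero_of_not_pos h, pow_zero, one_mul] at this
        simp only [q', h, dif_neg, not_false_eq_true, MvPolynomial.eval_C, this]
    have hpos : ∀ i (h : 0 < d i) v, FF q' e v i = ∑ t, v (⟨i, h⟩, t) • e t := by
      intro i h v
      refine Finset.sum_congr rfl fun t _ => ?_
      simp [q', h]
    have h00 : FF q' e 0 = FF q e 0 := by
      rw [← hu]
      funext i
      by_cases h : 0 < d i
      · rw [hpos i h, hpos i h]
        refine Finset.sum_congr rfl fun t _ => ?_
        have := hq i t 0 0
        rw [zero_smul, zero_pow h.ne', zero_mul] at this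
        simp [u, this]
      · refine Finset.sum_congr rfl fun t _ => ?_
        simp [q', h]
    obtain ⟨s, hs⟩ := fam hT q' he hq' univ ∅ (by simp) (fun w _ h2 v h3 => by
      by_contra hc
      have hag := agree0 hT he hq' hc
      have hz : ∀ i, 0 < d i → FF q' e v i = 0 := fun i hi =>
        degB hT (FF_zero q' he v) (FF_zero q' he 0) hag (by rwa [h00]) i (by rw [hpos i hi]; simp)
      have hv : v = 0 := by
        funext p
        obtain ⟨⟨i, hi⟩, t⟩ := p
        have := hz i hi
        rw [hpos i hi] at this
        exact Fintype.linearIndependent_iff.1 hli _ this t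
      have hn : Tendsto (fun j => ‖‖w j‖⁻¹ • w j‖) atTop (𝓝 1) := by
        refine tendsto_const_nhds.congr' ?_
        filter_upwards [h2.eventually_gt_atTop 0] with j hj
        rw [norm_smul, norm_inv, norm_norm, inv_mul_cancel₀ hj.ne']
      have := tendsto_nhds_unique hn h3.norm
      rw [hv, norm_zero] at this
      exact one_ne_zero this)
    refine ⟨s, fun w _ => ?_⟩
    have := hs (u w) (mem_univ _)
    rwa [hu] at this
end Fam
end
end FileE2

section E3a
open Polynomial

lemma adm_lift {T : ℝ} (hT : 0 < T) {c : ℝ → ℂ} (h : Admissible T c) : ∃ E : LL[X], (PT T E).fn 0 = 0 ∧ ∀ x ∈ Icc (0:ℝ) T, c x = (dE (PT T E)).fn x := by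
  have h1 : ∃ F : LL[X], ∀ x ∈ Icc (0:ℝ) T, c x = (PT T F).fn x := by
    rcases h with ⟨p, hp⟩ | ⟨s, b, hs⟩
    · refine ⟨aeval X p, fun x hx => ?_⟩
      rw [hp x hx, ← aeval_algHom_apply, PT_X, ← evE_apply, ← aeval_algHom_apply, evE_apply]
      rw [coe_aeval_eq_eval]
      rfl
    · refine ⟨∑ j ∈ s, b j • C (LaurentPolynomial.T j), fun x hx => ?_⟩
      rw [hs x hx, map_sum, ← evE_apply, map_sum]
      refine Finset.sum_congr rfl fun j _ => ?_
      rw [map_smul, PT_C, lE_T, evE_apply, fn_smul]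
      congr 1
      change _ = Complex.exp _
      congr 1
      rw [om]
      ring
  obtain ⟨F, hF⟩ := h1
  obtain ⟨G, hG⟩ := PT_prim hT F
  refine ⟨G - algebraMap ℂ _ ((PT T G).fn 0), ?_, fun x hx => ?_⟩
  · rw [map_sub, AlgHom.commutes, fn_sub, fn_alg, sub_self]
  · rw [map_sub, AlgHom.commutes, map_sub, Derivation.map_algebraMap, sub_zero, hG, hF x hx]

lemma hom_part {k : ℕ} {s : Finset (Fin k →₀ ℕ)} {b : (Fin k →₀ ℕ) → ℂ} {D : ℕ} {a : (Fin k → ℂ) → ℂ}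
    (h : ∀ w, a w = ∑ β ∈ s, b β * ∏ t, w t ^ β t) (hh : ∀ (l : ℂ) w, a (l • w) = l ^ D * a w) (w : Fin k → ℂ) :
    a w = ∑ β ∈ s with ∑ t, β t = D, b β * ∏ t, w t ^ β t := by
  have h1 : (∑ β ∈ s, C (b β * ∏ t, w t ^ β t) * X ^ (∑ t, β t) : ℂ[X]) = C (a w) * X ^ D := by
    refine Polynomial.funext fun l => ?_
    have := hh l w
    rw [h (l • w)] at this
    simp only [eval_finset_sum, eval_mul, eval_C, eval_pow, eval_X]
    rw [mul_comm (a w), ← this]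
    refine Finset.sum_congr rfl fun β _ => ?_
    simp only [Pi.smul_apply, smul_eq_mul, mul_pow, Finset.prod_mul_distrib, Finset.prod_pow_eq_pow_sum]
    ring
  have h2 := congrArg (fun p => coeff p D) h1
  simp only [finset_sum_coeff, coeff_C_mul_X_pow, if_true] at h2
  rw [← h2, Finset.sum_filter]
  refine Finset.sum_congr rfl fun β _ => ?_
  simp only [eq_comm]

lemma fin_basis {X : Type*} [AddCommGroup X] [Module ℂ X] {R : Set X} (hR : R.Finite) :
    ∃ (N : ℕ) (e : Fin N → X), LinearIndependent ℂ e ∧ (∀ t, e t ∈ Submodule.span ℂ R) ∧ ∀ x ∈ R, ∃ r : Fin N → ℂ, x = ∑ t, r t • e t := by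
  haveI : FiniteDimensional ℂ (Submodule.span ℂ R) := FiniteDimensional.span_of_finite ℂ hR
  let b := Module.finBasis ℂ (Submodule.span ℂ R)
  refine ⟨_, fun t => (b t : X), b.linearIndependent.map' (Submodule.subtype _) (Submodule.ker_subtype _), fun t => (b t).2, fun x hx => ?_⟩
  refine ⟨b.repr ⟨x, Submodule.subset_span hx⟩, ?_⟩
  have := congrArg (Submodule.subtype _) (b.sum_repr ⟨x, Submodule.subset_span hx⟩)
  rw [map_sum] at this
  exact this.symm

lemma build {T : ℝ} (hT : 0 < T) {n k : ℕ} (a : Fin n → (Fin k → ℂ) → ℝ → ℂ)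
    (hrep : ∀ i, ∃ (s : Finset (Fin k →₀ ℕ)) (c : (Fin k →₀ ℕ) → ℝ → ℂ),
      (∀ β ∈ s, Admissible T (c β)) ∧
      ∀ (w : Fin k → ℂ), ∀ x ∈ Icc (0:ℝ) T,
        a i w x = ∑ β ∈ s, c β x * ∏ t, w t ^ β t)
    (hhom : ∀ i, ∃ dd : ℕ, ∀ (lam : ℂ) (w : Fin k → ℂ), ∀ x ∈ Icc (0:ℝ) T,
      a i (lam • w) x = lam ^ dd * a i w x) :
    ∃ (N : ℕ) (q : Fin n → Fin N → MvPolynomial (Fin k) ℂ) (e : Fin N → LL[X]) (d : Fin n → ℕ), (∀ t, (PT T (e t)).fn 0 = 0) ∧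
      LinearIndependent ℂ e ∧ (∀ i t c w, MvPolynomial.eval (c • w) (q i t) = c ^ d i * MvPolynomial.eval w (q i t)) ∧
      ∀ i w, ∀ x ∈ Icc (0:ℝ) T, a i w x = (dE (PT T (FF q e w i))).fn x := by
  choose s c hadm hrep using hrep
  choose D hD using hhom
  have hE : ∀ i β, ∃ E : LL[X], (PT T E).fn 0 = 0 ∧ (β ∈ s i → ∀ x ∈ Icc (0:ℝ) T, c i β x = (dE (PT T E)).fn x) := by
    intro i β
    by_cases h : β ∈ s i
    · obtain ⟨E, h1, h2⟩ := adm_lift hT (hadm i β h)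
      exact ⟨E, h1, fun _ => h2⟩
    · exact ⟨0, by rw [map_zero, fn_zero], fun h' => absurd h' h⟩
  choose E hE0 hEc using hE
  let R : Set LL[X] := ⋃ i, E i '' (s i : Set (Fin k →₀ ℕ))
  have hR : R.Finite := Set.finite_iUnion fun i => (s i).finite_toSet.image _
  obtain ⟨N, e, hli, hspan, hb⟩ := fin_basis hR
  have hr : ∀ i β, ∃ r : Fin N → ℂ, β ∈ s i → E i β = ∑ t, r t • e t := by
    intro i β
    by_cases h : β ∈ s i
    · obtain ⟨r, hr⟩ := hb (E i β) (Set.mem_iUnion.2 ⟨i, β, h, rfl⟩)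
      exact ⟨r, fun _ => hr⟩
    · exact ⟨0, fun h' => absurd h' h⟩
  choose r hr using hr
  have hmon : ∀ (w : Fin k → ℂ) (β : Fin k →₀ ℕ) (z : ℂ), MvPolynomial.eval w (MvPolynomial.monomial β z) = z * ∏ t, w t ^ β t := by
    intro w β z
    rw [MvPolynomial.eval_monomial, Finsupp.prod_fintype _ _ (by simp)]
  refine ⟨_, fun i t => ∑ β ∈ s i with ∑ t, β t = D i, MvPolynomial.monomial β (r i β t), e, D, ?_, ?_, ?_, ?_⟩
  · have hW : Submodule.span ℂ R ≤ LinearMap.ker ((evE 0).toLinearMap ∘ₗ (PT T).toLinearMap) := by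
      refine Submodule.span_le.2 ?_
      rintro _ h
      obtain ⟨i, β, _, rfl⟩ := Set.mem_iUnion.1 h
      exact (evE_apply _ _).trans (hE0 i β)
    intro t
    exact (evE_apply _ _).symm.trans (hW (hspan t))
  · exact hli
  · intro i t l w
    simp only [map_sum, hmon, Finset.mul_sum]
    refine Finset.sum_congr rfl fun β hβ => ?_
    rw [← (Finset.mem_filter.1 hβ).2]
    simp only [Pi.smul_apply, smul_eq_mul, mul_pow, Finset.prod_mul_distrib, Finset.prod_pow_eq_pow_sum]
    ring
  · intro i w x hx
    have h1 := hom_part (a := fun w => a i w x) (fun w => hrep i w x hx) (fun l w => hD i l w x hx) w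
    have h2 : FF (fun i t => ∑ β ∈ s i with ∑ t, β t = D i, MvPolynomial.monomial β (r i β t)) e w i =
        ∑ β ∈ s i with ∑ t, β t = D i, (∏ t, w t ^ β t) • E i β := by
      simp only [FF, map_sum, hmon, Finset.sum_smul]
      rw [Finset.sum_comm]
      refine Finset.sum_congr rfl fun β hβ => ?_
      rw [hr i β (Finset.mem_filter.1 hβ).1, Finset.smul_sum]
      refine Finset.sum_congr rfl fun t _ => ?_
      rw [smul_smul, mul_comm]
    rw [h1, h2, map_sum, map_sum, ← evE_apply, map_sum]
    refine Finset.sum_congr rfl fun β hβ => ?_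
    rw [map_smul, Derivation.map_smul, evE_apply, fn_smul, hEc i β (Finset.mem_filter.1 hβ).1 x hx, mul_comm]
end E3a

/-- **Theorem 3.**  Suppose the coefficients `a_i(w,x)` are homogeneous polynomials in
`w ∈ ℂ^k` whose coefficients are admissible functions of `x`.  Let `V ⊆ ℂ^k` be an
algebraic subvariety (the common zero set of a family of polynomials) such that
`V ∩ 𝒰_A = ∅` and no limit direction of `V` at infinity lies in `𝒰_A`.  Then the
center set intersected with `V` is cut out on `V` by finitely many polynomials in
finitely many moments. -/
theorem center_set_on_subvariety_cut_out_by_polynomials_in_moments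
    (T : ℝ) (hT : 0 < T) (n k : ℕ) (hn : 1 ≤ n) (hk : 1 ≤ k)
    (a : Fin n → (Fin k → ℂ) → ℝ → ℂ)
    -- each `a i` is a finite sum of monomials in `w` with admissible coefficients in `x`
    (hrep : ∀ i, ∃ (s : Finset (Fin k →₀ ℕ)) (c : (Fin k →₀ ℕ) → ℝ → ℂ),
      (∀ β ∈ s, Admissible T (c β)) ∧
      ∀ (w : Fin k → ℂ), ∀ x ∈ Icc (0:ℝ) T,
        a i w x = ∑ β ∈ s, c β x * ∏ t, w t ^ β t)
    -- each `a i (·, x)` is homogeneous of some degree `d_i`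
    (hhom : ∀ i, ∃ dd : ℕ, ∀ (lam : ℂ) (w : Fin k → ℂ), ∀ x ∈ Icc (0:ℝ) T,
      a i (lam • w) x = lam ^ dd * a i w x)
    -- the universal center set
    (U : Set (Fin k → ℂ))
    (hU : U = {w : Fin k → ℂ | ∀ l : List (Fin n), l ≠ [] →
      iterInt T (fun i => a i w) l = 0})
    -- `V` is the common zero set of a family of polynomials
    (V : Set (Fin k → ℂ)) (S : Set (MvPolynomial (Fin k) ℂ))
    (hV : V = {w : Fin k → ℂ | ∀ q ∈ S, MvPolynomial.eval w q = 0})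
    (hdisj : V ∩ U = ∅)
    -- no limit direction of `V` at infinity lies in `𝒰_A`
    (hdir : ∀ w : ℕ → (Fin k → ℂ), (∀ j, w j ∈ V) →
      Tendsto (fun j => ‖w j‖) atTop atTop →
      ∀ v : Fin k → ℂ, Tendsto (fun j => (‖w j‖)⁻¹ • w j) atTop (𝓝 v) → v ∉ U) :
    ∃ N : ℕ, 1 ≤ N ∧
      ∃ (ps : Fin N → List (Fin n × ℕ)) (idx : Fin N → Fin n)
        (p : Fin N → MvPolynomial (Fin N) ℂ),
        (∀ j, ∀ q ∈ ps j, 0 < q.2) ∧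
        {w : Fin k → ℂ | DeterminesCenter T (fun i => a i w)} ∩ V =
          {w ∈ V | ∀ j, MvPolynomial.eval
            (fun t => moment T (fun i => a i w) (ps t) (idx t)) (p j) = 0} := by
  obtain ⟨M, q, e, d, he, hli, hq, ha⟩ := build hT a hrep hhom
  have hav : ∀ w, ∀ i, ∀ x ∈ Icc (0:ℝ) T, a i w x = (dE (PT T (FF q e w i))).fn x := fun w i x hx => ha i w x hx
  have hUv : ∀ v, Uni T (FF q e v) → v ∈ U := by
    intro v hv
    obtain ⟨J, hJ⟩ := exists_J (pth_d T (FF q e v))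
    rw [uni_iff hT hJ] at hv
    rw [hU]
    intro l hl
    rw [iter_eq hT (f := fun i => PT T (FF q e v i)) (hav v) hJ]
    exact hv _ (by simpa using hl)
  obtain ⟨s, hs⟩ := fam2 hT q he hli hq V S (fun w => by rw [hV]; rfl) fun w h1 h2 v h3 h4 => hdir w h1 h2 v h3 (hUv v h4)
  haveI : Nonempty (Idx n) := ⟨(⟨[], by simp⟩, ⟨0, hn⟩)⟩
  obtain ⟨N, hN, ix, p, hp⟩ := pack s
  refine ⟨N, hN, fun t => (ix t).1.1, fun t => (ix t).2, p, fun j => (ix j).1.2, ?_⟩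
  have hcen : ∀ w, DeterminesCenter T (fun i => a i w) ↔ DeterminesCenter T (AA T (FF q e w)) := by
    intro w
    obtain ⟨J, hJ⟩ := exists_J (pth_d T (FF q e w))
    rw [center_iff hT (f := fun i => PT T (FF q e w i)) (hav w) hJ,
      center_iff hT (a := AA T (FF q e w)) (f := fun i => PT T (FF q e w i)) (fun i x _ => rfl) hJ]
  have hmo : ∀ w, (fun t => moment T (fun i => a i w) (ix t).1.1 (ix t).2) = MM T (FF q e w) ∘ ix := fun w =>
    funext fun t => moment_eq hT (f := fun i => PT T (FF q e w i)) (hav w) (FF_zero q he w) _ _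
  ext w
  simp only [mem_inter_iff, mem_setOf_eq, hmo]
  rw [← hp, hcen, and_comm]
  exact and_congr_right fun hw => hs w hw

end
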